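/- Let s ∈ (1,2), b = 3−2s, and let v* be the R. Yang biharmonic-type extension of v ∈ Ḣ^s(ℝ^n). For any ε ∈ (0,1) and any Φ ∈ C_c^∞(ℝ^{n+1}) one has the interpolation inequality ∫_{ℝ^{n+1}_+} y^b |∇̄v*|² Φ² dx dy ≤ ε ∫_{ℝ^{n+1}_+} y^b |Δ̄_b v*|² Φ² dx dy + (C/ε) ∫_{ℝ^{n+1}_+} y^b |v*|² (Φ² + |∇̄Φ|²) dx dy, where Δ̄_b v* = Δ̄v* + (b/y)∂_y v* and C depends only on n and s. -/

import Mathlib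

open MeasureTheory Metric Filter Set
open scoped Topology

noncomputable section

/-- The weighted operator `Δ̄_b V = Δ̄ V + (b/y) ∂_y V` (with `b = 3-2s`) on the upper half
space `ℝⁿ × (0,∞)`, written via iterated directional derivatives. -/
def lapb (n : ℕ) (s : ℝ) (V : EuclideanSpace ℝ (Fin n) × ℝ → ℝ)
    (p : EuclideanSpace ℝ (Fin n) × ℝ) : ℝ :=
  (∑ i, fderiv ℝ (fun q => fderiv ℝ V q (EuclideanSpace.single i 1, 0)) p
      (EuclideanSpace.single i 1, 0))
    + fderiv ℝ (fun q => fderiv ℝ V q (0, 1)) p ((0 : EuclideanSpace ℝ (Fin n)), 1)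
    + ((3 - 2 * s) / p.2) * fderiv ℝ V p ((0 : EuclideanSpace ℝ (Fin n)), 1)

/-- Minimising `½ a(v,v) + ℓ(v)` over a convex cone: a minimising sequence is Cauchy, and the
limit `μ` of the first variations is nonnegative on the cone and asymptotically annihilates the
minimising sequence. -/
theorem exists_minimizing_sequence {V : Type*} [AddCommGroup V] [Module ℝ V]
    (a : V →ₗ[ℝ] V →ₗ[ℝ] ℝ) (ha_symm : ∀ u v, a u v = a v u) (ha_nonneg : ∀ v, 0 ≤ a v v)
    (l : V →ₗ[ℝ] ℝ) (C : ℝ) (hl : ∀ v, |l v| ≤ C * √(a v v))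
    (K : Set V) (hK0 : (0 : V) ∈ K) (hKadd : ∀ u ∈ K, ∀ v ∈ K, u + v ∈ K)
    (hKsmul : ∀ t : ℝ, 0 ≤ t → ∀ v ∈ K, t • v ∈ K) :
    ∃ (ψ : ℕ → V) (μ : V →ₗ[ℝ] ℝ) (ε : ℕ → ℝ), Tendsto ε atTop (𝓝 0) ∧ (∀ k, 0 ≤ ε k) ∧
      (∀ k, ψ k ∈ K) ∧ (∀ k v, |μ v - (a (ψ k) v + l v)| ≤ ε k * √(a v v)) ∧
      (∀ v ∈ K, 0 ≤ μ v) ∧ Tendsto (fun k => μ (ψ k)) atTop (𝓝 0) ∧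
      (∀ k j, k ≤ j → √(a (ψ j - ψ k) (ψ j - ψ k)) ≤ ε k) ∧
      (∀ k, a (ψ k) (ψ k) ≤ 4 * C ^ 2 + 4) := by
  have hcs : ∀ u v, |a u v| ≤ √(a u u) * √(a v v) := by
    intro u v
    have h : ∀ t : ℝ, 0 ≤ a v v * (t * t) + (2 * a u v) * t + a u u := by
      intro t
      have := ha_nonneg (u + t • v)
      simp only [map_add, map_smul, LinearMap.add_apply, LinearMap.smul_apply, smul_eq_mul,
        ha_symm v u] at this
      linarith
    have hd := discrim_le_zero h
    rw [discrim] at hd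
    rw [← Real.sqrt_mul (ha_nonneg u)]
    apply Real.abs_le_sqrt
    nlinarith
  set J : V → ℝ := fun v => a v v / 2 + l v with hJ
  have hJb : ∀ v, -(C ^ 2 / 2) ≤ J v := by
    intro v
    have h1 := hl v
    have h2 := Real.sq_sqrt (ha_nonneg v)
    have h3 := (abs_le.1 h1).1
    simp only [hJ]
    nlinarith [sq_nonneg (√(a v v) - C)]
  have hbdd : BddBelow (J '' K) := ⟨-(C ^ 2 / 2), by rintro _ ⟨v, _, rfl⟩; exact hJb v⟩
  set I := sInf (J '' K) with hI
  have hne : (J '' K).Nonempty := ⟨_, 0, hK0, rfl⟩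
  have hIle : ∀ v ∈ K, I ≤ J v := fun v hv => csInf_le hbdd ⟨v, hv, rfl⟩
  have hI0 : I ≤ 0 := by simpa [hJ] using hIle 0 hK0
  set δ : ℕ → ℝ := fun k => 1 / ((k : ℝ) + 1) with hδ
  have hδpos : ∀ k, 0 < δ k := fun k => Nat.one_div_pos_of_nat
  have hδ1 : ∀ k, δ k ≤ 1 := by
    intro k; simp only [hδ]; rw [div_le_one (by positivity)]; linarith [k.cast_nonneg (α := ℝ)]
  have hδt : Tendsto δ atTop (𝓝 0) := tendsto_one_div_add_atTop_nhds_zero_nat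
  have hδanti : ∀ k j, k ≤ j → δ j ≤ δ k := fun k j h => Nat.one_div_le_one_div h
  have hex : ∀ k, ∃ v ∈ K, J v < I + δ k := by
    intro k
    obtain ⟨_, ⟨v, hv, rfl⟩, h⟩ := exists_lt_of_csInf_lt hne (lt_add_of_pos_right I (hδpos k))
    exact ⟨v, hv, h⟩
  choose ψ hψK hψ using hex
  have hpar : ∀ u v, a (u - v) (u - v) = 4 * (J u + J v) - 8 * J ((1 / 2 : ℝ) • (u + v)) := by
    intro u v
    simp only [hJ, map_add, map_sub, map_smul, LinearMap.add_apply, LinearMap.sub_apply,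
      LinearMap.smul_apply, smul_eq_mul, ha_symm v u]
    ring
  have hcau : ∀ k j, k ≤ j → a (ψ j - ψ k) (ψ j - ψ k) ≤ 8 * δ k := by
    intro k j hkj
    rw [hpar]
    have h1 := hIle _ (hKsmul (1 / 2) (by norm_num) _ (hKadd _ (hψK j) _ (hψK k)))
    linarith [hψ k, hψ j, hδanti k j hkj]
  set ε : ℕ → ℝ := fun k => √(8 * δ k) with hε
  have hεt : Tendsto ε atTop (𝓝 0) := by
    have : Tendsto (fun k => √(8 * δ k)) atTop (𝓝 (√(8 * 0))) :=
      (Real.continuous_sqrt.tendsto _).comp (hδt.const_mul 8)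
    rwa [mul_zero, Real.sqrt_zero] at this
  have hcauε : ∀ k j, k ≤ j → √(a (ψ j - ψ k) (ψ j - ψ k)) ≤ ε k := fun k j h =>
    Real.sqrt_le_sqrt (hcau k j h)
  have hdiff : ∀ v k j, k ≤ j → |a (ψ j) v - a (ψ k) v| ≤ ε k * √(a v v) := by
    intro v k j h
    have h1 := hcs (ψ j - ψ k) v
    simp only [map_sub, LinearMap.sub_apply] at h1
    refine h1.trans ?_
    have := hcauε k j h
    simp only [map_sub, LinearMap.sub_apply] at this
    gcongr
  have hconv : ∀ v, ∃ L, Tendsto (fun k => a (ψ k) v) atTop (𝓝 L) := by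
    intro v
    apply cauchySeq_tendsto_of_complete
    rw [Metric.cauchySeq_iff']
    intro e he
    have : Tendsto (fun k => ε k * √(a v v)) atTop (𝓝 0) := by simpa using hεt.mul_const (√(a v v))
    obtain ⟨N, hN⟩ := (this.eventually (gt_mem_nhds he)).exists
    exact ⟨N, fun j hj => by rw [Real.dist_eq]; exact (hdiff v N j hj).trans_lt hN⟩
  choose L hL using hconv
  have hLadd : ∀ u v, L (u + v) = L u + L v := fun u v =>
    tendsto_nhds_unique (hL (u + v)) (by simpa using (hL u).add (hL v))
  have hLsmul : ∀ (t : ℝ) v, L (t • v) = t * L v := fun t v =>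
    tendsto_nhds_unique (hL (t • v)) (by simpa using (hL v).const_mul t)
  let Lm : V →ₗ[ℝ] ℝ :=
    { toFun := L, map_add' := hLadd, map_smul' := fun t v => by simpa using hLsmul t v }
  have hLerr : ∀ k v, |L v - a (ψ k) v| ≤ ε k * √(a v v) := by
    intro k v
    have h1 : Tendsto (fun j => |a (ψ j) v - a (ψ k) v|) atTop (𝓝 |L v - a (ψ k) v|) :=
      ((hL v).sub_const _).abs
    exact le_of_tendsto h1 (eventually_atTop.2 ⟨k, fun j hj => hdiff v k j hj⟩)
  have hab : ∀ k, a (ψ k) (ψ k) ≤ 4 * C ^ 2 + 4 := by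
    intro k
    have h1 := hl (ψ k)
    have h2 := Real.sq_sqrt (ha_nonneg (ψ k))
    have h3 := (abs_le.1 h1).1
    have h4 := hψ k
    simp only [hJ] at h4
    nlinarith [sq_nonneg (√(a (ψ k) (ψ k)) - 2 * C), hδ1 k]
  have hpert : ∀ k v (t : ℝ), ψ k + t • v ∈ K →
      -δ k ≤ t * (a (ψ k) v + l v) + t ^ 2 / 2 * a v v := by
    intro k v t h
    have h1 := hIle _ h
    have h2 := hψ k
    simp only [hJ, map_add, map_smul, LinearMap.add_apply, LinearMap.smul_apply, smul_eq_mul,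
      ha_symm v (ψ k)] at h1 h2
    linarith
  refine ⟨ψ, Lm + l, ε, hεt, fun k => Real.sqrt_nonneg _, hψK, ?_, ?_, ?_, hcauε, hab⟩
  · intro k v
    have := hLerr k v
    simp only [LinearMap.add_apply]
    change |L v + l v - (a (ψ k) v + l v)| ≤ _
    rwa [add_sub_add_right_eq_sub]
  · intro v hv
    change 0 ≤ L v + l v
    have h1 : ∀ t : ℝ, 0 < t → 0 ≤ (L v + l v) + t / 2 * a v v := by
      intro t ht
      have h2 : Tendsto (fun k => t * (a (ψ k) v + l v) + t ^ 2 / 2 * a v v + δ k) atTop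
          (𝓝 (t * (L v + l v) + t ^ 2 / 2 * a v v + 0)) :=
        ((((hL v).add_const _).const_mul t).add_const _).add hδt
      have h3 : (0 : ℝ) ≤ t * (L v + l v) + t ^ 2 / 2 * a v v + 0 := ge_of_tendsto' h2 (fun k => by
        have := hpert k v t (hKadd _ (hψK k) _ (hKsmul t ht.le _ hv))
        linarith)
      have h4 : 0 ≤ t * ((L v + l v) + t / 2 * a v v) := by nlinarith
      exact nonneg_of_mul_nonneg_right h4 ht
    have h2 : Tendsto (fun t : ℝ => (L v + l v) + t / 2 * a v v) (𝓝[>] 0)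
        (𝓝 ((L v + l v) + 0 / 2 * a v v)) := by
      apply Tendsto.mono_left _ nhdsWithin_le_nhds
      exact Continuous.tendsto (by fun_prop) 0
    have h3 := ge_of_tendsto h2 (by filter_upwards [self_mem_nhdsWithin] with t ht using h1 t ht)
    simpa using h3
  · have key : ∀ k, |a (ψ k) (ψ k) + l (ψ k)| ≤ √(δ k) * (1 + (2 * C ^ 2 + 2)) := by
      intro k
      set t := √(δ k) with ht
      have htpos : 0 < t := Real.sqrt_pos.2 (hδpos k)
      have ht1 : t ≤ 1 := Real.sqrt_le_one.2 (hδ1 k)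
      have htt : t ^ 2 = δ k := Real.sq_sqrt (hδpos k).le
      have h1 := hpert k (ψ k) t (hKadd _ (hψK k) _ (hKsmul t htpos.le _ (hψK k)))
      have h2 := hpert k (ψ k) (-t) (by
        have : ψ k + (-t) • ψ k = (1 - t) • ψ k := by module
        rw [this]; exact hKsmul _ (by linarith) _ (hψK k))
      have h3 := hab k
      have h4 : t ^ 2 / 2 * a (ψ k) (ψ k) ≤ t ^ 2 * (2 * C ^ 2 + 2) := by
        nlinarith [sq_nonneg t]
      rw [abs_le]
      constructor
      · have : 0 ≤ t * (a (ψ k) (ψ k) + l (ψ k) + t * (1 + (2 * C ^ 2 + 2))) := by nlinarith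
        have := nonneg_of_mul_nonneg_right this htpos
        linarith
      · have : 0 ≤ t * (-(a (ψ k) (ψ k) + l (ψ k)) + t * (1 + (2 * C ^ 2 + 2))) := by
          have e : (-t) ^ 2 = t ^ 2 := by ring
          rw [e] at h2
          nlinarith
        have := nonneg_of_mul_nonneg_right this htpos
        linarith
    have hb : ∀ k, |(Lm + l) (ψ k)| ≤
        ε k * √(4 * C ^ 2 + 4) + √(δ k) * (1 + (2 * C ^ 2 + 2)) := by
      intro k
      have e1 := hLerr k (ψ k)
      have e2 := key k
      have e3 : ε k * √(a (ψ k) (ψ k)) ≤ ε k * √(4 * C ^ 2 + 4) :=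
        mul_le_mul_of_nonneg_left (Real.sqrt_le_sqrt (hab k)) (Real.sqrt_nonneg _)
      have e4 : (Lm + l) (ψ k) = (L (ψ k) - a (ψ k) (ψ k)) + (a (ψ k) (ψ k) + l (ψ k)) := by
        change L (ψ k) + l (ψ k) = _
        ring
      rw [e4]
      exact (abs_add_le _ _).trans (by linarith)
    apply squeeze_zero_norm hb
    have h1 : Tendsto (fun k => √(δ k)) atTop (𝓝 (√0)) :=
      (Real.continuous_sqrt.tendsto _).comp hδt
    have h2 := (hεt.mul_const (√(4 * C ^ 2 + 4))).add (h1.mul_const (1 + (2 * C ^ 2 + 2)))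
    simpa using h2

/-- Cauchy–Schwarz for square integrable real functions. -/
theorem abs_integral_mul_le_sqrt {α : Type*} [MeasurableSpace α] {μ : Measure α} {f g : α → ℝ}
    (hf : MemLp f 2 μ) (hg : MemLp g 2 μ) :
    |∫ x, f x * g x ∂μ| ≤ √(∫ x, f x ^ 2 ∂μ) * √(∫ x, g x ^ 2 ∂μ) := by
  have hfg : Integrable (fun x => f x * g x) μ := hf.integrable_mul hg
  have h : ∀ t : ℝ, 0 ≤ (∫ x, g x ^ 2 ∂μ) * (t * t) + (2 * ∫ x, f x * g x ∂μ) * t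
      + ∫ x, f x ^ 2 ∂μ := by
    intro t
    have h0 : 0 ≤ ∫ x, (f x + t * g x) ^ 2 ∂μ := integral_nonneg fun x => sq_nonneg _
    have e : (fun x => (f x + t * g x) ^ 2)
        = fun x => (g x ^ 2 * (t * t) + (f x * g x) * (2 * t)) + f x ^ 2 := by
      funext x; ring
    have i1 : Integrable (fun x => g x ^ 2 * (t * t) + (f x * g x) * (2 * t)) μ :=
      (hg.integrable_sq.mul_const _).add (hfg.mul_const _)
    rw [e, integral_add i1 hf.integrable_sq,
      integral_add (hg.integrable_sq.mul_const _) (hfg.mul_const _), integral_mul_const,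
      integral_mul_const] at h0
    linarith
  have hd := discrim_le_zero h
  rw [discrim] at hd
  rw [← Real.sqrt_mul (integral_nonneg fun x => sq_nonneg _)]
  apply Real.abs_le_sqrt
  nlinarith

namespace WeightedHalfSpace

open scoped ContDiff Manifold

section

/-- Points `(x, y)` of `ℝⁿ × ℝ`. -/
abbrev Pt (n : ℕ) := EuclideanSpace ℝ (Fin n) × ℝ

/-- The open upper half space. -/
def upper (n : ℕ) : Set (Pt n) := {p | 0 < p.2}

/-- The measure `y^b dy` on `(0,∞)`. -/
def nu (b : ℝ) : Measure ℝ :=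
  (volume.restrict (Ioi 0)).withDensity fun y => ENNReal.ofReal (y ^ b)

/-- The measure `y^b dx dy` on the upper half space. -/
def wt (n : ℕ) (b : ℝ) : Measure (Pt n) :=
  (volume : Measure (EuclideanSpace ℝ (Fin n))).prod (nu b)

/-- Coordinate directions; `none` is the vertical one. -/
def dir {n : ℕ} : Option (Fin n) → Pt n
  | none => (0, 1)
  | some i => (EuclideanSpace.single i 1, 0)

/-- Directional derivative along a coordinate direction. -/
def pd {n : ℕ} (j : Option (Fin n)) (f : Pt n → ℝ) (p : Pt n) : ℝ := fderiv ℝ f p (dir j)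

/-- The pointwise product of gradients. -/
def gd {n : ℕ} (f g : Pt n → ℝ) (p : Pt n) : ℝ := ∑ j, pd j f p * pd j g p

/-- `Δ f + (b / y) ∂_y f`. -/
def lap {n : ℕ} (b : ℝ) (f : Pt n → ℝ) (p : Pt n) : ℝ :=
  (∑ j, pd j (pd j f) p) + b / p.2 * pd none f p

variable {n : ℕ} {b : ℝ}

theorem isOpen_upper : IsOpen (upper n) := isOpen_lt continuous_const continuous_snd

theorem measurableSet_upper : MeasurableSet (upper n) := isOpen_upper.measurableSet

theorem measurable_rpow_density : Measurable fun y : ℝ => ENNReal.ofReal (y ^ b) := by fun_prop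

instance : SFinite (nu b) := by unfold nu; infer_instance

theorem wt_eq : wt n b =
    ((volume : Measure (Pt n)).restrict (upper n)).withDensity
      fun p => ENNReal.ofReal (p.2 ^ b) := by
  unfold wt nu
  rw [prod_withDensity_right measurable_rpow_density]
  congr 1
  rw [← Measure.restrict_univ (μ := (volume : Measure (EuclideanSpace ℝ (Fin n)))),
    Measure.prod_restrict]
  congr 1
  ext p; simp [upper]

theorem ae_wt_of_forall {P : Pt n → Prop} (h : ∀ p, 0 < p.2 → P p) : ∀ᵐ p ∂wt n b, P p := by
  rw [wt_eq]
  apply (withDensity_absolutelyContinuous _ _).ae_le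
  filter_upwards [ae_restrict_mem measurableSet_upper] with p hp using h p hp

theorem ae_nu_of_forall {P : ℝ → Prop} (h : ∀ y, 0 < y → P y) : ∀ᵐ y ∂nu b, P y := by
  unfold nu
  apply (withDensity_absolutelyContinuous _ _).ae_le
  filter_upwards [ae_restrict_mem measurableSet_Ioi] with p hp using h p hp

theorem integrable_wt_iff {F : Pt n → ℝ} :
    Integrable F (wt n b) ↔ IntegrableOn (fun p => p.2 ^ b * F p) (upper n) := by
  rw [wt_eq, integrable_withDensity_iff_integrable_smul' (by fun_prop) (by simp)]
  apply integrable_congr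
  filter_upwards [ae_restrict_mem measurableSet_upper] with p hp
  have : (0 : ℝ) ≤ p.2 ^ b := Real.rpow_nonneg (le_of_lt hp) _
  simp [ENNReal.toReal_ofReal this]

theorem integral_wt (F : Pt n → ℝ) :
    ∫ p, F p ∂wt n b = ∫ p in upper n, p.2 ^ b * F p := by
  rw [wt_eq, integral_withDensity_eq_integral_toReal_smul (by fun_prop) (by simp)]
  apply integral_congr_ae
  filter_upwards [ae_restrict_mem measurableSet_upper] with p hp
  have : (0 : ℝ) ≤ p.2 ^ b := Real.rpow_nonneg (le_of_lt hp) _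
  simp [ENNReal.toReal_ofReal this]

theorem integral_nu (F : ℝ → ℝ) :
    ∫ y, F y ∂nu b = ∫ y in Ioi 0, y ^ b * F y := by
  rw [nu, integral_withDensity_eq_integral_toReal_smul (by fun_prop) (by simp)]
  apply integral_congr_ae
  filter_upwards [ae_restrict_mem measurableSet_Ioi] with y hy
  have : (0 : ℝ) ≤ y ^ b := Real.rpow_nonneg (le_of_lt hy) _
  simp [ENNReal.toReal_ofReal this]

theorem integrable_nu_iff {F : ℝ → ℝ} :
    Integrable F (nu b) ↔ IntegrableOn (fun y => y ^ b * F y) (Ioi 0) := by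
  rw [nu, integrable_withDensity_iff_integrable_smul' (by fun_prop) (by simp)]
  apply integrable_congr
  filter_upwards [ae_restrict_mem measurableSet_Ioi] with y hy
  have : (0 : ℝ) ≤ y ^ b := Real.rpow_nonneg (le_of_lt hy) _
  simp [ENNReal.toReal_ofReal this]

theorem integral_prod_nu {F : Pt n → ℝ} (hF : Integrable F (wt n b)) :
    ∫ p, F p ∂wt n b = ∫ x, ∫ y, F (x, y) ∂nu b := integral_prod F hF

theorem nu_Iic_lt_top (hb : -1 < b) (r : ℝ) : nu b (Iic r) < ⊤ := by
  rw [nu, withDensity_apply _ measurableSet_Iic, Measure.restrict_restrict measurableSet_Iic]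
  have h : IntegrableOn (fun y : ℝ => y ^ b) (Ioc 0 (max r 0)) := by
    have := intervalIntegral.intervalIntegrable_rpow' (a := 0) (b := max r 0) hb
    rwa [intervalIntegrable_iff_integrableOn_Ioc_of_le (le_max_right _ _)] at this
  refine lt_of_le_of_lt (lintegral_mono_set (t := Ioc 0 (max r 0)) ?_) h.lintegral_lt_top
  rintro y ⟨h1, h2⟩
  exact ⟨h2, le_max_of_le_left h1⟩

theorem wt_box_lt_top (hb : -1 < b) (r : ℝ) :
    wt n b (closedBall 0 r ×ˢ Iic r) < ⊤ := by
  rw [wt, Measure.prod_prod]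
  exact ENNReal.mul_lt_top measure_closedBall_lt_top (nu_Iic_lt_top hb r)

/-- Functions vanishing outside a box `|x| ≤ r, y ≤ r`. -/
def BddSupp (f : Pt n → ℝ) : Prop := ∃ r : ℝ, ∀ x y, r < ‖x‖ ∨ r < y → f (x, y) = 0

/-- Continuous bounded functions on the upper half space with bounded support. -/
structure BC (f : Pt n → ℝ) : Prop where
  cont : ContinuousOn f (upper n)
  bdd : ∃ C, ∀ p, 0 < p.2 → |f p| ≤ C
  supp : BddSupp f

theorem aesm_of_continuousOn {f : Pt n → ℝ} (hf : ContinuousOn f (upper n)) :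
    AEStronglyMeasurable f (wt n b) := by
  rw [wt_eq]
  exact (hf.aestronglyMeasurable measurableSet_upper).mono_ac
    (withDensity_absolutelyContinuous _ _)

theorem BddSupp.exists_pos {f : Pt n → ℝ} (hf : BddSupp f) :
    ∃ r : ℝ, 1 ≤ r ∧ ∀ x y, r < ‖x‖ ∨ r < y → f (x, y) = 0 := by
  obtain ⟨r, hr⟩ := hf
  exact ⟨max r 1, le_max_right _ _, fun x y h => hr x y
    (h.imp (fun h => (le_max_left _ _).trans_lt h) (fun h => (le_max_left _ _).trans_lt h))⟩

theorem BddSupp.mul_right {f g : Pt n → ℝ} (hf : BddSupp f) : BddSupp (fun p => f p * g p) := by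
  obtain ⟨r, hr⟩ := hf
  exact ⟨r, fun x y h => by simp [hr x y h]⟩

theorem BddSupp.mul_left {f g : Pt n → ℝ} (hf : BddSupp f) : BddSupp (fun p => g p * f p) := by
  obtain ⟨r, hr⟩ := hf
  exact ⟨r, fun x y h => by simp [hr x y h]⟩

theorem BddSupp.add {f g : Pt n → ℝ} (hf : BddSupp f) (hg : BddSupp g) :
    BddSupp (fun p => f p + g p) := by
  obtain ⟨r, hr⟩ := hf
  obtain ⟨s, hs⟩ := hg
  refine ⟨max r s, fun x y h => ?_⟩
  simp only []
  rw [hr x y, hs x y, add_zero]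
  · exact h.imp (fun h => (le_max_right _ _).trans_lt h) (fun h => (le_max_right _ _).trans_lt h)
  · exact h.imp (fun h => (le_max_left _ _).trans_lt h) (fun h => (le_max_left _ _).trans_lt h)

theorem BddSupp.pd {f : Pt n → ℝ} (hf : BddSupp f) (j : Option (Fin n)) : BddSupp (pd j f) := by
  obtain ⟨r, hr⟩ := hf
  refine ⟨r, fun x y h => ?_⟩
  have hopen : IsOpen {q : Pt n | r < ‖q.1‖ ∨ r < q.2} :=
    (isOpen_lt continuous_const continuous_fst.norm).union
      (isOpen_lt continuous_const continuous_snd)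
  have : f =ᶠ[𝓝 (x, y)] fun _ => 0 := by
    filter_upwards [hopen.mem_nhds (show (x, y) ∈ {q : Pt n | r < ‖q.1‖ ∨ r < q.2} from h)]
      with q hq using hr q.1 q.2 hq
  simp [WeightedHalfSpace.pd, this.fderiv_eq]

theorem integrable_of_bdd (hb : -1 < b) {f : Pt n → ℝ}
    (hm : AEStronglyMeasurable f (wt n b)) {C : ℝ} (hC : ∀ p, 0 < p.2 → |f p| ≤ C)
    (hs : BddSupp f) : Integrable f (wt n b) := by
  obtain ⟨r, hr⟩ := hs
  have h1 : IntegrableOn f (closedBall 0 r ×ˢ Iic r) (wt n b) := by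
    apply Measure.integrableOn_of_bounded (M := C) (wt_box_lt_top hb r).ne hm
    exact ae_restrict_of_ae (ae_wt_of_forall hC)
  rw [integrableOn_iff_integrable_of_support_subset] at h1
  · exact h1
  · intro p hp
    by_contra hcon
    apply hp
    apply hr
    by_contra! h
    exact hcon ⟨by simpa using h.1, h.2⟩

theorem BC.integrable (hb : -1 < b) {f : Pt n → ℝ} (hf : BC f) : Integrable f (wt n b) := by
  obtain ⟨C, hC⟩ := hf.bdd
  exact integrable_of_bdd hb (aesm_of_continuousOn hf.cont) hC hf.supp

theorem BC.mul_bdd {f g : Pt n → ℝ} (hf : BC f) (hg : ContinuousOn g (upper n))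
    {C : ℝ} (hC : ∀ p, 0 < p.2 → |g p| ≤ C) : BC (fun p => f p * g p) := by
  obtain ⟨D, hD⟩ := hf.bdd
  refine ⟨hf.cont.mul hg, ⟨D * C, fun p hp => ?_⟩, hf.supp.mul_right⟩
  rw [abs_mul]
  exact mul_le_mul (hD p hp) (hC p hp) (abs_nonneg _) ((abs_nonneg _).trans (hD p hp))

theorem BC.mul {f g : Pt n → ℝ} (hf : BC f) (hg : BC g) : BC (fun p => f p * g p) := by
  obtain ⟨C, hC⟩ := hg.bdd
  exact hf.mul_bdd hg.cont hC

theorem BC.add {f g : Pt n → ℝ} (hf : BC f) (hg : BC g) : BC (fun p => f p + g p) := by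
  obtain ⟨C, hC⟩ := hf.bdd
  obtain ⟨D, hD⟩ := hg.bdd
  exact ⟨hf.cont.add hg.cont, ⟨C + D, fun p hp =>
    (abs_add_le _ _).trans (add_le_add (hC p hp) (hD p hp))⟩, hf.supp.add hg.supp⟩

theorem BC.const_mul {f : Pt n → ℝ} (hf : BC f) (c : ℝ) : BC (fun p => c * f p) := by
  have := hf.mul_bdd (g := fun _ => c) continuousOn_const (C := |c|) fun _ _ => le_rfl
  simpa only [mul_comm] using this

theorem BC.zero : BC (fun _ : Pt n => (0 : ℝ)) :=
  ⟨continuousOn_const, ⟨0, by simp⟩, ⟨0, by simp⟩⟩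

theorem BC.sum {ι : Type*} (s : Finset ι) {f : ι → Pt n → ℝ} (hf : ∀ i ∈ s, BC (f i)) :
    BC (fun p => ∑ i ∈ s, f i p) := by
  classical
  induction s using Finset.induction_on with
  | empty => simpa using BC.zero
  | insert a s ha ih =>
    simp only [Finset.sum_insert ha]
    exact (hf a (Finset.mem_insert_self _ _)).add
      (ih fun i hi => hf i (Finset.mem_insert_of_mem hi))

theorem BC.congr {f g : Pt n → ℝ} (hf : BC f) (h : ∀ p, 0 < p.2 → g p = f p)
    (hg : BddSupp g) : BC g := by
  obtain ⟨C, hC⟩ := hf.bdd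
  exact ⟨hf.cont.congr h, ⟨C, fun p hp => by rw [h p hp]; exact hC p hp⟩, hg⟩

theorem BC.memLp (hb : -1 < b) {f : Pt n → ℝ} (hf : BC f) : MemLp f 2 (wt n b) := by
  rw [memLp_two_iff_integrable_sq (aesm_of_continuousOn hf.cont)]
  simpa only [sq] using (hf.mul hf).integrable hb

/-- Translation in the horizontal variable. -/
def shift (v : EuclideanSpace ℝ (Fin n)) (f : Pt n → ℝ) (p : Pt n) : ℝ := f (p.1 + v, p.2)

theorem measurePreserving_shift (v : EuclideanSpace ℝ (Fin n)) :
    MeasurePreserving (fun p : Pt n => (p.1 + v, p.2)) (wt n b) (wt n b) :=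
  (measurePreserving_add_right volume v).prod (MeasurePreserving.id _)

theorem integral_shift (v : EuclideanSpace ℝ (Fin n)) (f : Pt n → ℝ) :
    ∫ p, shift v f p ∂wt n b = ∫ p, f p ∂wt n b := by
  have e : MeasurableEmbedding (fun p : Pt n => (p.1 + v, p.2)) :=
    ((Homeomorph.addRight v).prodCongr (Homeomorph.refl ℝ)).measurableEmbedding
  exact (measurePreserving_shift v).integral_comp e f

theorem pd_shift (v : EuclideanSpace ℝ (Fin n)) (f : Pt n → ℝ) (j : Option (Fin n)) :
    pd j (shift v f) = shift v (pd j f) := by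
  funext p
  have : shift v f = fun q => f (q + (v, 0)) := by
    funext q; simp only [shift]; congr 1; ext <;> simp
  rw [pd, this, fderiv_comp_add_right]
  simp only [shift, pd]
  congr 2
  ext <;> simp

end

section

variable {n : ℕ} {b : ℝ}

/-- Smooth on the open upper half space. -/
def SmoothUp (f : Pt n → ℝ) : Prop := ContDiffOn ℝ ∞ f (upper n)

theorem upper_mem_nhds {p : Pt n} (hp : 0 < p.2) : upper n ∈ 𝓝 p := isOpen_upper.mem_nhds hp

theorem SmoothUp.contDiffAt {f : Pt n → ℝ} (hf : SmoothUp f) {p : Pt n} (hp : 0 < p.2) :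
    ContDiffAt ℝ ∞ f p := ContDiffOn.contDiffAt hf (upper_mem_nhds hp)

theorem SmoothUp.differentiableAt {f : Pt n → ℝ} (hf : SmoothUp f) {p : Pt n} (hp : 0 < p.2) :
    DifferentiableAt ℝ f p := (hf.contDiffAt hp).differentiableAt (by simp)

theorem SmoothUp.pd {f : Pt n → ℝ} (hf : SmoothUp f) (j : Option (Fin n)) :
    SmoothUp (pd j f) :=
  (ContDiffOn.fderiv_of_isOpen hf isOpen_upper (m := ∞) (by simp)).clm_apply contDiffOn_const

theorem SmoothUp.mul {f g : Pt n → ℝ} (hf : SmoothUp f) (hg : SmoothUp g) :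
    SmoothUp (fun p => f p * g p) := ContDiffOn.mul hf hg

theorem SmoothUp.sub {f g : Pt n → ℝ} (hf : SmoothUp f) (hg : SmoothUp g) :
    SmoothUp (fun p => f p - g p) := ContDiffOn.sub hf hg

theorem SmoothUp.continuousOn {f : Pt n → ℝ} (hf : SmoothUp f) : ContinuousOn f (upper n) :=
  ContDiffOn.continuousOn hf

theorem ContDiff.smoothUp {f : Pt n → ℝ} (hf : ContDiff ℝ ∞ f) : SmoothUp f := hf.contDiffOn

theorem pd_mul {f g : Pt n → ℝ} {p : Pt n} (hf : DifferentiableAt ℝ f p)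
    (hg : DifferentiableAt ℝ g p) (j : Option (Fin n)) :
    pd j (fun q => f q * g q) p = f p * pd j g p + pd j f p * g p := by
  simp only [pd]
  rw [fderiv_fun_mul hf hg]
  simp [mul_comm]

theorem pd_add {f g : Pt n → ℝ} {p : Pt n} (hf : DifferentiableAt ℝ f p)
    (hg : DifferentiableAt ℝ g p) (j : Option (Fin n)) :
    pd j (fun q => f q + g q) p = pd j f p + pd j g p := by
  simp only [pd]
  rw [fderiv_fun_add hf hg]
  simp

theorem pd_sub {f g : Pt n → ℝ} {p : Pt n} (hf : DifferentiableAt ℝ f p)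
    (hg : DifferentiableAt ℝ g p) (j : Option (Fin n)) :
    pd j (fun q => f q - g q) p = pd j f p - pd j g p := by
  simp only [pd]
  rw [fderiv_fun_sub hf hg]
  simp

theorem pd_const_mul {f : Pt n → ℝ} {p : Pt n} (hf : DifferentiableAt ℝ f p) (c : ℝ)
    (j : Option (Fin n)) : pd j (fun q => c * f q) p = c * pd j f p := by
  simp only [pd]
  rw [fderiv_const_mul hf]
  simp

theorem pd_comp {f : Pt n → ℝ} {p : Pt n} {g : ℝ → ℝ} (hg : DifferentiableAt ℝ g (f p))
    (hf : DifferentiableAt ℝ f p) (j : Option (Fin n)) :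
    pd j (fun q => g (f q)) p = deriv g (f p) * pd j f p := by
  have h : HasFDerivAt (fun q => g (f q)) (deriv g (f p) • fderiv ℝ f p) p :=
    hg.hasDerivAt.comp_hasFDerivAt p hf.hasFDerivAt
  simp only [pd]
  rw [h.fderiv]
  simp

theorem hasDerivAt_vert {f : Pt n → ℝ} {x : EuclideanSpace ℝ (Fin n)} {y : ℝ}
    (hf : DifferentiableAt ℝ f (x, y)) :
    HasDerivAt (fun t => f (x, t)) (pd none f (x, y)) y := by
  have h : HasDerivAt (fun t : ℝ => ((x, t) : Pt n)) (0, 1) y :=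
    (hasDerivAt_const y x).prodMk (hasDerivAt_id y)
  exact hf.hasFDerivAt.comp_hasDerivAt y h

theorem hasFDerivAt_horiz {f : Pt n → ℝ} {x : EuclideanSpace ℝ (Fin n)} {y : ℝ}
    (hf : DifferentiableAt ℝ f (x, y)) :
    HasFDerivAt (fun z => f (z, y))
      ((fderiv ℝ f (x, y)).comp (ContinuousLinearMap.inl ℝ _ ℝ)) x :=
  hf.hasFDerivAt.comp x (hasFDerivAt_prodMk_left x y)

theorem hasLineDerivAt_horiz {f : Pt n → ℝ} {x : EuclideanSpace ℝ (Fin n)} {y : ℝ}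
    (hf : DifferentiableAt ℝ f (x, y)) (i : Fin n) :
    HasLineDerivAt ℝ (fun z => f (z, y)) (pd (some i) f (x, y)) x
      (EuclideanSpace.single i 1) :=
  (hasFDerivAt_horiz hf).hasLineDerivAt _

/-- A function of the height alone. -/
theorem pd_none_height {g : ℝ → ℝ} {p : Pt n} (hg : DifferentiableAt ℝ g p.2) :
    pd none (fun q : Pt n => g q.2) p = deriv g p.2 := by
  have := hasDerivAt_vert (f := fun q : Pt n => g q.2) (x := p.1) (y := p.2)
    (hg.comp p differentiableAt_snd)
  exact this.deriv.symm

theorem pd_some_height (g : ℝ → ℝ) (i : Fin n) (p : Pt n) :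
    pd (some i) (fun q : Pt n => g q.2) p = 0 := by
  by_cases h : DifferentiableAt ℝ (fun q : Pt n => g q.2) p
  · have h1 := hasLineDerivAt_horiz (x := p.1) (y := p.2) h i
    have h2 : HasLineDerivAt ℝ (fun _ : EuclideanSpace ℝ (Fin n) => g p.2) 0 p.1
      (EuclideanSpace.single i 1) := by
      simpa using (hasFDerivAt_const (𝕜 := ℝ) (g p.2) p.1).hasLineDerivAt
        (EuclideanSpace.single i 1)
    exact h1.lineDeriv.symm.trans h2.lineDeriv
  · simp [pd, fderiv_zero_of_not_differentiableAt h]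

/-- The integral of a horizontal derivative vanishes. -/
theorem integral_pd_some {G : Pt n → ℝ} (i : Fin n)
    (hG : ∀ p : Pt n, 0 < p.2 → DifferentiableAt ℝ G p) (h1 : Integrable G (wt n b))
    (h2 : Integrable (pd (some i) G) (wt n b)) : ∫ p, pd (some i) G p ∂wt n b = 0 := by
  rw [wt, integral_prod_symm _ h2]
  apply integral_eq_zero_of_ae
  have a1 : ∀ᵐ y ∂nu b, Integrable (fun x => G (x, y)) := Integrable.prod_left_ae h1
  have a2 : ∀ᵐ y ∂nu b, Integrable (fun x => pd (some i) G (x, y)) :=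
    Integrable.prod_left_ae h2
  filter_upwards [a1, a2, ae_nu_of_forall (b := b) (P := fun y => 0 < y) fun y hy => hy]
    with y hy1 hy2 hy
  have := integral_bilinear_hasLineDerivAt_right_eq_neg_left_of_integrable
    (μ := (volume : Measure (EuclideanSpace ℝ (Fin n))))
    (f := fun _ => (1 : ℝ)) (f' := fun _ => 0) (g := fun x => G (x, y))
    (g' := fun x => pd (some i) G (x, y)) (v := EuclideanSpace.single i 1)
    (B := ContinuousLinearMap.mul ℝ ℝ) (by simp) (by simpa using hy2) (by simpa using hy1)
    (fun x _ => by
      simpa using (hasFDerivAt_const (𝕜 := ℝ) (1 : ℝ) x).hasLineDerivAt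
        (EuclideanSpace.single i 1))
    (fun x _ => hasLineDerivAt_horiz (hG (x, y) hy) i)
  simpa using this

/-- The vertical divergence integrates to zero in the absence of boundary flux. -/
theorem integral_vert {H : Pt n → ℝ}
    (hH : ∀ p : Pt n, 0 < p.2 → DifferentiableAt ℝ H p)
    (hi : Integrable (fun p => pd none H p + b / p.2 * H p) (wt n b)) (hs : BddSupp H)
    (h0 : ∀ x, Tendsto (fun y => y ^ b * H (x, y)) (𝓝[>] 0) (𝓝 0)) :
    ∫ p, (pd none H p + b / p.2 * H p) ∂wt n b = 0 := by
  rw [integral_prod_nu hi]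
  apply integral_eq_zero_of_ae
  have a1 : ∀ᵐ x, Integrable (fun y => pd none H (x, y) + b / y * H (x, y)) (nu b) :=
    Integrable.prod_right_ae hi
  filter_upwards [a1] with x hx
  rw [integral_nu]
  rw [integrable_nu_iff] at hx
  set g : ℝ → ℝ := Function.update (fun y => y ^ b * H (x, y)) 0 0 with hg
  obtain ⟨r, hr⟩ := hs
  have hd : ∀ y ∈ Ioi (0 : ℝ), HasDerivAt g
      (y ^ b * (pd none H (x, y) + b / y * H (x, y))) y := by
    intro y hy
    have hy' : (0 : ℝ) < y := hy
    have h1 : HasDerivAt (fun y => y ^ b * H (x, y))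
        (y ^ b * (pd none H (x, y) + b / y * H (x, y))) y := by
      have h3 : HasDerivAt (fun y => y ^ b * H (x, y))
          (b * y ^ (b - 1) * H (x, y) + y ^ b * pd none H (x, y)) y :=
        (Real.hasDerivAt_rpow_const (x := y) (p := b) (Or.inl hy'.ne')).mul
          (hasDerivAt_vert (hH (x, y) hy))
      refine h3.congr_deriv ?_
      rw [Real.rpow_sub_one hy'.ne']
      field_simp
      ring
    apply h1.congr_of_eventuallyEq
    filter_upwards [isOpen_ne.mem_nhds hy'.ne'] with z hz
    exact Function.update_of_ne hz _ _
  have := integral_Ioi_of_hasDerivAt_of_tendsto (f := g) (a := 0) (m := 0) (by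
      rw [hg, ContinuousWithinAt, Function.update_self]
      have : Ici (0 : ℝ) = insert 0 (Ioi 0) := by simp
      rw [this, nhdsWithin_insert, tendsto_sup]
      constructor
      · rw [tendsto_pure_left]; intro s hs; simpa using mem_of_mem_nhds hs
      · refine (h0 x).congr' ?_
        filter_upwards [self_mem_nhdsWithin] with z hz
        rw [Function.update_of_ne (mem_Ioi.1 hz).ne']) hd hx (by
      refine tendsto_const_nhds.congr' ?_
      filter_upwards [eventually_gt_atTop (max r 0)] with z hz
      rw [hg, Function.update_of_ne (ne_of_gt ((le_max_right _ _).trans_lt hz)),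
        hr x z (Or.inr ((le_max_left _ _).trans_lt hz)), mul_zero])
  rw [this]
  simp [hg]

theorem BC.of_vanish {f : Pt n → ℝ} (hf : ContinuousOn f (upper n)) (hs : BddSupp f)
    {r : ℝ} (hr : 0 < r) (hv : ∀ x y, 0 < y → y < r → f (x, y) = 0) : BC f := by
  refine ⟨hf, ?_, hs⟩
  obtain ⟨R, hR⟩ := hs
  have hK : IsCompact ((closedBall (0 : EuclideanSpace ℝ (Fin n)) R) ×ˢ (Icc r R)) :=
    (isCompact_closedBall _ _).prod isCompact_Icc
  obtain ⟨C, hC⟩ := hK.exists_bound_of_continuousOn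
    (hf.mono (fun p hp => lt_of_lt_of_le hr hp.2.1))
  refine ⟨max C 0, fun p hp => ?_⟩
  by_cases h : p ∈ ((closedBall (0 : EuclideanSpace ℝ (Fin n)) R) ×ˢ (Icc r R))
  · exact (hC p h).trans (le_max_left _ _)
  · have : f p = 0 := by
      by_cases h2 : p.2 < r
      · exact hv p.1 p.2 hp h2
      · apply hR
        by_contra! h3
        exact h ⟨by simpa using h3.1, not_lt.1 h2, h3.2⟩
    rw [this]; simp

/-- Green's formula without boundary flux. -/
theorem green (hb : -1 < b) {u φ : Pt n → ℝ} (hu : SmoothUp u) (hφ : SmoothUp φ)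
    (h0 : ∀ j, BC (fun p => φ p * pd j u p)) (h1 : ∀ j, BC (fun p => pd j φ p * pd j u p))
    (h2 : ∀ j, BC (fun p => φ p * pd j (pd j u) p)) {r : ℝ} (hr : 0 < r)
    (hv : ∀ x y, 0 < y → y < r → φ (x, y) * pd none u (x, y) = 0) :
    ∫ p, gd u φ p ∂wt n b = - ∫ p, φ p * lap b u p ∂wt n b := by
  have hd : ∀ j p, 0 < p.2 → pd j (fun q => φ q * pd j u q) p
      = φ p * pd j (pd j u) p + pd j φ p * pd j u p := fun j p hp =>
    pd_mul (hφ.differentiableAt hp) ((hu.pd j).differentiableAt hp) j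
  have hB : ∀ j, BC (pd j fun q => φ q * pd j u q) := fun j =>
    ((h2 j).add (h1 j)).congr (hd j) ((h0 j).supp.pd j)
  have hdiff : ∀ j (p : Pt n), 0 < p.2 → DifferentiableAt ℝ (fun q => φ q * pd j u q) p :=
    fun j p hp => (hφ.differentiableAt hp).mul ((hu.pd j).differentiableAt hp)
  have hsome : ∀ i : Fin n, ∫ p, pd (some i) (fun q => φ q * pd (some i) u q) p ∂wt n b = 0 :=
    fun i => integral_pd_some i (hdiff _) ((h0 _).integrable hb) ((hB _).integrable hb)
  have hB2 : BC (fun p => b / p.2 * (φ p * pd none u p)) := by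
    apply BC.of_vanish (r := r) _ (h0 none).supp.mul_left hr
    · intro x y hy hy2; simp [hv x y hy hy2]
    · refine ContinuousOn.mul ?_ (h0 none).cont
      exact continuousOn_const.div continuousOn_snd fun p hp => ne_of_gt hp
  have hnone := integral_vert (b := b) (H := fun q => φ q * pd none u q) (hdiff none)
    (((hB none).add hB2).integrable hb) (h0 none).supp (fun x => by
      refine tendsto_const_nhds.congr' ?_
      filter_upwards [Ioo_mem_nhdsGT hr] with y hy
      simp [hv x y hy.1 hy.2])
  have hfin : ∫ p, ((pd none (fun q => φ q * pd none u q) p + b / p.2 * (φ p * pd none u p))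
      + ∑ i : Fin n, pd (some i) (fun q => φ q * pd (some i) u q) p) ∂wt n b = 0 := by
    rw [integral_add (((hB none).add hB2).integrable hb)
      ((BC.sum _ fun i _ => hB (some i)).integrable hb),
      integral_finsetSum _ fun i _ => (hB (some i)).integrable hb, hnone]
    simp [hsome]
  have hgd : BC (gd u φ) := by
    have := BC.sum Finset.univ (f := fun j p => pd j φ p * pd j u p) fun j _ => h1 j
    have e : gd u φ = fun p => ∑ j, pd j φ p * pd j u p := by
      funext p; exact Finset.sum_congr rfl fun j _ => mul_comm _ _
    rw [e]; exact this
  have hlap : BC (fun p => φ p * lap b u p) := by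
    have := (BC.sum Finset.univ (f := fun j p => φ p * pd j (pd j u) p) fun j _ => h2 j).add hB2
    refine this.congr (fun p _ => ?_) ?_
    · rw [lap, mul_add, Finset.mul_sum]; ring
    · have h3 : (fun p => φ p * lap b u p) = fun p => (∑ j, φ p * pd j (pd j u) p)
          + b / p.2 * (φ p * pd none u p) := by
        funext p; rw [lap, mul_add, Finset.mul_sum]; ring
      rw [h3]; exact this.supp
  rw [eq_neg_iff_add_eq_zero, ← integral_add (hgd.integrable hb) (hlap.integrable hb), ← hfin]
  apply integral_congr_ae
  filter_upwards [ae_wt_of_forall (b := b) (P := fun p : Pt n => 0 < p.2) fun p hp => hp]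
    with p hp
  simp only [gd, lap, Fintype.sum_option, hd _ p hp, Finset.sum_add_distrib, mul_add,
    Finset.mul_sum]
  have : ∀ i : Fin n, pd (some i) u p * pd (some i) φ p = pd (some i) φ p * pd (some i) u p :=
    fun i => mul_comm _ _
  simp only [this]
  ring

end

section

variable {n : ℕ} {b : ℝ}

/-- Smooth functions with bounded support that do not depend on the height near the boundary. -/
structure NN (f : Pt n → ℝ) : Prop where
  smooth : ContDiff ℝ ∞ f
  supp : BddSupp f
  flat : ∃ r : ℝ, 0 < r ∧ ∀ x y, y ≤ r → f (x, y) = f (x, 0)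

theorem NN.smoothUp {f : Pt n → ℝ} (hf : NN f) : SmoothUp f := hf.smooth.contDiffOn

theorem NN.differentiableAt {f : Pt n → ℝ} (hf : NN f) (p : Pt n) : DifferentiableAt ℝ f p :=
  hf.smooth.differentiable (by simp) p

theorem NN.continuous {f : Pt n → ℝ} (hf : NN f) : Continuous f := hf.smooth.continuous

theorem NN.flat' {f : Pt n → ℝ} (hf : NN f) :
    ∃ r : ℝ, 0 < r ∧ ∀ x y z, y ≤ r → z ≤ r → f (x, y) = f (x, z) := by
  obtain ⟨r, hr, h⟩ := hf.flat
  exact ⟨r, hr, fun x y z hy hz => (h x y hy).trans (h x z hz).symm⟩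

theorem NN.zero : NN (fun _ : Pt n => (0 : ℝ)) :=
  ⟨contDiff_const, ⟨0, by simp⟩, ⟨1, one_pos, by simp⟩⟩

/-- Combine two functions of the class. -/
theorem NN.comp₂ {f g : Pt n → ℝ} (hf : NN f) (hg : NN g) {β : ℝ × ℝ → ℝ} (hβ : ContDiff ℝ ∞ β)
    (h0 : β (0, 0) = 0) : NN (fun p => β (f p, g p)) := by
  obtain ⟨r, hr, h⟩ := hf.flat
  obtain ⟨s, hs, k⟩ := hg.flat
  obtain ⟨R, hR⟩ := hf.supp
  obtain ⟨S, hS⟩ := hg.supp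
  refine ⟨hβ.comp (hf.smooth.prodMk hg.smooth), ⟨max R S, fun x y hxy => ?_⟩,
    ⟨min r s, lt_min hr hs, fun x y hy => ?_⟩⟩
  · change β (f (x, y), g (x, y)) = 0
    rw [hR x y, hS x y, h0]
    · exact hxy.imp (fun h => (le_max_right _ _).trans_lt h)
        (fun h => (le_max_right _ _).trans_lt h)
    · exact hxy.imp (fun h => (le_max_left _ _).trans_lt h)
        (fun h => (le_max_left _ _).trans_lt h)
  · rw [h x y (hy.trans (min_le_left _ _)), k x y (hy.trans (min_le_right _ _))]

theorem NN.add {f g : Pt n → ℝ} (hf : NN f) (hg : NN g) : NN (fun p => f p + g p) :=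
  hf.comp₂ hg (β := fun q => q.1 + q.2) (by fun_prop) (by simp)

theorem NN.sub {f g : Pt n → ℝ} (hf : NN f) (hg : NN g) : NN (fun p => f p - g p) :=
  hf.comp₂ hg (β := fun q => q.1 - q.2) (by fun_prop) (by simp)

theorem NN.mul {f g : Pt n → ℝ} (hf : NN f) (hg : NN g) : NN (fun p => f p * g p) :=
  hf.comp₂ hg (β := fun q => q.1 * q.2) (by fun_prop) (by simp)

theorem NN.const_mul {f : Pt n → ℝ} (hf : NN f) (c : ℝ) : NN (fun p => c * f p) :=
  hf.comp₂ hf (β := fun q => c * q.1) (by fun_prop) (by simp)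

theorem NN.comp {f : Pt n → ℝ} (hf : NN f) {β : ℝ → ℝ} (hβ : ContDiff ℝ ∞ β)
    (h0 : β 0 = 0) : NN (fun p => β (f p)) :=
  hf.comp₂ hf (β := fun q => β q.1) (by fun_prop) (by simpa)

/-- Multiply by a function of the height which is constant near the boundary. -/
theorem NN.mul_height {f : Pt n → ℝ} (hf : NN f) {g : ℝ → ℝ} (hg : ContDiff ℝ ∞ g) {r : ℝ}
    (hr : 0 < r) (hgr : ∀ y, y ≤ r → g y = g 0) : NN (fun p => g p.2 * f p) := by
  obtain ⟨s, hs, k⟩ := hf.flat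
  refine ⟨(hg.comp contDiff_snd).mul hf.smooth, hf.supp.mul_left, ⟨min r s, lt_min hr hs,
    fun x y hy => ?_⟩⟩
  simp only []
  rw [hgr y (hy.trans (min_le_left _ _)), k x y (hy.trans (min_le_right _ _))]

/-- Multiply by a function of the horizontal variable. -/
theorem NN.mul_horiz {f : Pt n → ℝ} (hf : NN f) {g : EuclideanSpace ℝ (Fin n) → ℝ}
    (hg : ContDiff ℝ ∞ g) : NN (fun p => g p.1 * f p) := by
  obtain ⟨s, hs, k⟩ := hf.flat
  refine ⟨(hg.comp contDiff_fst).mul hf.smooth, hf.supp.mul_left, ⟨s, hs,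
    fun x y hy => ?_⟩⟩
  simp only []
  rw [k x y hy]

theorem NN.shift {f : Pt n → ℝ} (hf : NN f) (v : EuclideanSpace ℝ (Fin n)) : NN (shift v f) := by
  obtain ⟨s, hs, k⟩ := hf.flat
  obtain ⟨R, hR⟩ := hf.supp
  refine ⟨hf.smooth.comp (by fun_prop), ⟨max (R + ‖v‖) R, fun x y hxy => ?_⟩,
    ⟨s, hs, fun x y hy => k _ _ hy⟩⟩
  apply hR
  rcases hxy with h | h
  · left
    have h1 := (le_max_left (R + ‖v‖) R).trans_lt h
    have h2 : ‖x‖ ≤ ‖x + v‖ + ‖v‖ := by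
      calc ‖x‖ = ‖(x + v) - v‖ := by simp
        _ ≤ _ := norm_sub_le _ _
    change R < ‖x + v‖
    linarith
  · right; exact (le_max_right _ _).trans_lt h

theorem pd_none_eq_zero {f : Pt n → ℝ} {r : ℝ} (hd : Differentiable ℝ f)
    (h : ∀ x y, y ≤ r → f (x, y) = f (x, 0)) (x : EuclideanSpace ℝ (Fin n)) (y : ℝ)
    (hy : y < r) : pd none f (x, y) = 0 := by
  have h1 := hasDerivAt_vert (hd (x, y))
  have h2 : HasDerivAt (fun t => f (x, t)) 0 y := by
    apply (hasDerivAt_const y (f (x, 0))).congr_of_eventuallyEq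
    filter_upwards [gt_mem_nhds hy] with t ht using h x t ht.le
  exact h1.unique h2

theorem NN.pd_none_flat {f : Pt n → ℝ} (hf : NN f) :
    ∃ r : ℝ, 0 < r ∧ ∀ x y, y < r → pd none f (x, y) = 0 := by
  obtain ⟨r, hr, h⟩ := hf.flat
  exact ⟨r, hr, pd_none_eq_zero (hf.smooth.differentiable (by simp)) h⟩

theorem NN.pd {f : Pt n → ℝ} (hf : NN f) (j : Option (Fin n)) : NN (pd j f) := by
  refine ⟨(hf.smooth.fderiv_right (m := ∞) (by simp)).clm_apply contDiff_const,
    hf.supp.pd j, ?_⟩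
  obtain ⟨r, hr, h⟩ := hf.flat
  refine ⟨r / 2, by linarith, fun x y hy => ?_⟩
  have e : f =ᶠ[𝓝 (x, 0)] fun q => f (q + (0, y)) := by
    have : {q : Pt n | q.2 < r / 2} ∈ 𝓝 ((x, 0) : Pt n) :=
      (isOpen_lt continuous_snd continuous_const).mem_nhds (by simp; linarith)
    filter_upwards [this] with q hq
    have hq' : q.2 < r / 2 := hq
    have : q + (0, y) = (q.1, q.2 + y) := by ext <;> simp
    rw [this, h q.1 (q.2 + y) (by linarith), ← h q.1 q.2 (by linarith)]
  simp only [WeightedHalfSpace.pd]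
  rw [e.fderiv_eq, fderiv_comp_add_right]
  simp

theorem NN.bc {f : Pt n → ℝ} (hf : NN f) : BC f := by
  obtain ⟨r, hr, h⟩ := hf.flat
  refine ⟨hf.continuous.continuousOn, ?_, hf.supp⟩
  obtain ⟨R, hR⟩ := hf.supp
  obtain ⟨C, hC⟩ := ((isCompact_closedBall (0 : EuclideanSpace ℝ (Fin n)) R).prod
    (isCompact_Icc (a := (0 : ℝ)) (b := R))).exists_bound_of_continuousOn hf.continuous.continuousOn
  refine ⟨max C 0, fun p hp => ?_⟩
  by_cases hm : p ∈ ((closedBall (0 : EuclideanSpace ℝ (Fin n)) R) ×ˢ (Icc 0 R))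
  · exact (hC p hm).trans (le_max_left _ _)
  · have : f p = 0 := by
      apply hR
      by_contra! h3
      exact hm ⟨by simpa using h3.1, hp.le, h3.2⟩
    rw [this]; simp

theorem NN.bdd {f : Pt n → ℝ} (hf : NN f) : ∃ C, ∀ p, |f p| ≤ C := by
  obtain ⟨r, hr, h⟩ := hf.flat'
  obtain ⟨C, hC⟩ := hf.bc.bdd
  refine ⟨C, fun p => ?_⟩
  rcases lt_or_ge 0 p.2 with h0 | h0
  · exact hC p h0
  · have : f p = f (p.1, r) := h p.1 p.2 r (h0.trans hr.le) le_rfl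
    rw [this]; exact hC _ hr

theorem NN.memLp (hb : -1 < b) {f : Pt n → ℝ} (hf : NN f) : MemLp f 2 (wt n b) := hf.bc.memLp hb

theorem NN.gd_bc {f g : Pt n → ℝ} (hf : NN f) (hg : NN g) : BC (gd f g) :=
  BC.sum Finset.univ fun j _ => ((hf.pd j).bc.mul (hg.pd j).bc)

/-- The class `NN` as a subspace. -/
def NNs (n : ℕ) : Submodule ℝ (Pt n → ℝ) where
  carrier := {f | NN f}
  add_mem' := fun hf hg => NN.add hf hg
  zero_mem' := NN.zero
  smul_mem' := fun c _ hf => NN.const_mul hf c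

/-- The energy form `∫ ∇f·∇g + λ f g`. -/
def form (n : ℕ) (b lam : ℝ) (f g : Pt n → ℝ) : ℝ := ∫ p, (gd f g p + lam * (f p * g p)) ∂wt n b

theorem form_int (hb : -1 < b) (lam : ℝ) {f g : Pt n → ℝ} (hf : NN f) (hg : NN g) :
    Integrable (fun p => gd f g p + lam * (f p * g p)) (wt n b) :=
  (((hf.gd_bc hg).add ((hf.bc.mul hg.bc).const_mul lam))).integrable hb

theorem gd_comm (f g : Pt n → ℝ) : gd f g = gd g f := by
  funext p; exact Finset.sum_congr rfl fun j _ => mul_comm _ _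

theorem form_comm (lam : ℝ) (f g : Pt n → ℝ) : form n b lam f g = form n b lam g f := by
  simp only [form, gd_comm f g, mul_comm (f _)]

theorem gd_add_left {f g h : Pt n → ℝ} {p : Pt n} (hf : DifferentiableAt ℝ f p)
    (hg : DifferentiableAt ℝ g p) :
    gd (fun q => f q + g q) h p = gd f h p + gd g h p := by
  simp only [gd, pd_add hf hg, add_mul, Finset.sum_add_distrib]

theorem gd_sub_left {f g h : Pt n → ℝ} {p : Pt n} (hf : DifferentiableAt ℝ f p)
    (hg : DifferentiableAt ℝ g p) :
    gd (fun q => f q - g q) h p = gd f h p - gd g h p := by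
  simp only [gd, pd_sub hf hg, sub_mul, Finset.sum_sub_distrib]

theorem gd_const_mul_left {f h : Pt n → ℝ} {p : Pt n} (hf : DifferentiableAt ℝ f p) (c : ℝ) :
    gd (fun q => c * f q) h p = c * gd f h p := by
  simp only [gd, pd_const_mul hf, mul_assoc, Finset.mul_sum]

theorem gd_add_right {f g h : Pt n → ℝ} {p : Pt n} (hf : DifferentiableAt ℝ f p)
    (hg : DifferentiableAt ℝ g p) :
    gd h (fun q => f q + g q) p = gd h f p + gd h g p := by
  rw [gd_comm, gd_add_left hf hg, gd_comm f, gd_comm g]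

theorem gd_sub_right {f g h : Pt n → ℝ} {p : Pt n} (hf : DifferentiableAt ℝ f p)
    (hg : DifferentiableAt ℝ g p) :
    gd h (fun q => f q - g q) p = gd h f p - gd h g p := by
  rw [gd_comm, gd_sub_left hf hg, gd_comm f, gd_comm g]

theorem gd_const_mul_right {f h : Pt n → ℝ} {p : Pt n} (hf : DifferentiableAt ℝ f p) (c : ℝ) :
    gd h (fun q => c * f q) p = c * gd h f p := by
  rw [gd_comm, gd_const_mul_left hf, gd_comm]

theorem form_add_left (hb : -1 < b) (lam : ℝ) {f g h : Pt n → ℝ} (hf : NN f) (hg : NN g)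
    (hh : NN h) : form n b lam (fun p => f p + g p) h = form n b lam f h + form n b lam g h := by
  rw [form, form, form, ← integral_add (form_int hb lam hf hh) (form_int hb lam hg hh)]
  congr 1; funext p
  rw [gd_add_left (hf.differentiableAt p) (hg.differentiableAt p)]; ring

theorem form_const_mul_left (lam c : ℝ) {f h : Pt n → ℝ} (hf : NN f) :
    form n b lam (fun p => c * f p) h = c * form n b lam f h := by
  rw [form, form, ← integral_const_mul]
  congr 1; funext p
  rw [gd_const_mul_left (hf.differentiableAt p)]; ring

theorem form_sub_left (hb : -1 < b) (lam : ℝ) {f g h : Pt n → ℝ} (hf : NN f) (hg : NN g)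
    (hh : NN h) : form n b lam (fun p => f p - g p) h = form n b lam f h - form n b lam g h := by
  rw [form, form, form, ← integral_sub (form_int hb lam hf hh) (form_int hb lam hg hh)]
  congr 1; funext p
  rw [gd_sub_left (hf.differentiableAt p) (hg.differentiableAt p)]; ring

theorem gd_self_nonneg (f : Pt n → ℝ) (p : Pt n) : 0 ≤ gd f f p :=
  Finset.sum_nonneg fun _ _ => mul_self_nonneg _

theorem form_self_nonneg {lam : ℝ} (hl : 0 ≤ lam) (f : Pt n → ℝ) : 0 ≤ form n b lam f f :=
  integral_nonneg fun p => add_nonneg (gd_self_nonneg f p) (mul_nonneg hl (mul_self_nonneg _))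

/-- The energy form as a bilinear map. -/
def formL (n : ℕ) (hb : -1 < b) (lam : ℝ) : NNs n →ₗ[ℝ] NNs n →ₗ[ℝ] ℝ :=
  LinearMap.mk₂ ℝ (fun f g => form n b lam f.1 g.1)
    (fun f g h => form_add_left hb lam f.2 g.2 h.2)
    (fun c f h => form_const_mul_left lam c f.2)
    (fun h f g => by
      rw [form_comm, form_comm lam h.1, form_comm lam h.1]
      exact form_add_left hb lam f.2 g.2 h.2)
    (fun c h f => by
      rw [form_comm, form_comm lam h.1]
      exact form_const_mul_left lam c f.2)

/-- The energy norm. -/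
def en (n : ℕ) (b lam : ℝ) (f : Pt n → ℝ) : ℝ := √(form n b lam f f)

/-- The `L²` norm. -/
def l2 (n : ℕ) (b : ℝ) (f : Pt n → ℝ) : ℝ := √(∫ p, f p ^ 2 ∂wt n b)

theorem l2_nonneg (f : Pt n → ℝ) : 0 ≤ l2 n b f := Real.sqrt_nonneg _

theorem l2_sq (f : Pt n → ℝ) : l2 n b f ^ 2 = ∫ p, f p ^ 2 ∂wt n b :=
  Real.sq_sqrt (integral_nonneg fun _ => sq_nonneg _)

theorem en_nonneg (lam : ℝ) (f : Pt n → ℝ) : 0 ≤ en n b lam f := Real.sqrt_nonneg _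

theorem en_sq {lam : ℝ} (hl : 0 ≤ lam) (f : Pt n → ℝ) : en n b lam f ^ 2 = form n b lam f f :=
  Real.sq_sqrt (form_self_nonneg hl f)

theorem abs_integral_mul_le {f g : Pt n → ℝ} (hf : MemLp f 2 (wt n b)) (hg : MemLp g 2 (wt n b)) :
    |∫ p, f p * g p ∂wt n b| ≤ l2 n b f * l2 n b g := abs_integral_mul_le_sqrt hf hg

theorem l2_add_le {f g : Pt n → ℝ} (hf : MemLp f 2 (wt n b)) (hg : MemLp g 2 (wt n b)) :
    l2 n b (fun p => f p + g p) ≤ l2 n b f + l2 n b g := by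
  apply Real.sqrt_le_iff.2 ⟨add_nonneg (l2_nonneg _) (l2_nonneg _), ?_⟩
  have e : ∫ p, (f p + g p) ^ 2 ∂wt n b
      = l2 n b f ^ 2 + l2 n b g ^ 2 + 2 * ∫ p, f p * g p ∂wt n b := by
    have i1 : Integrable (fun p => f p ^ 2 + g p ^ 2) (wt n b) :=
      hf.integrable_sq.add hg.integrable_sq
    have i2 : Integrable (fun p => 2 * (f p * g p)) (wt n b) :=
      (hf.integrable_mul hg).const_mul 2
    rw [l2_sq, l2_sq, ← integral_add hf.integrable_sq hg.integrable_sq, ← integral_const_mul,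
      ← integral_add i1 i2]
    congr 1; funext p; ring
  rw [e]
  have := (le_abs_self _).trans (abs_integral_mul_le hf hg)
  nlinarith

theorem l2_const_mul (f : Pt n → ℝ) (c : ℝ) : l2 n b (fun p => c * f p) = |c| * l2 n b f := by
  simp only [l2, mul_pow]
  rw [integral_const_mul, Real.sqrt_mul (sq_nonneg c), Real.sqrt_sq_eq_abs]

theorem l2_mono {f g : Pt n → ℝ} (hg : MemLp g 2 (wt n b))
    (h : ∀ p, 0 < p.2 → |f p| ≤ |g p|) : l2 n b f ≤ l2 n b g := by
  apply Real.sqrt_le_sqrt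
  refine integral_mono_of_nonneg (Eventually.of_forall fun _ => sq_nonneg _) hg.integrable_sq ?_
  exact ae_wt_of_forall fun p hp => sq_le_sq.2 (h p hp)

theorem form_eq (hb : -1 < b) (lam : ℝ) {f g : Pt n → ℝ} (hf : NN f) (hg : NN g) :
    form n b lam f g = ∑ j, ∫ p, pd j f p * pd j g p ∂wt n b + lam * ∫ p, f p * g p ∂wt n b := by
  rw [form, integral_add ((hf.gd_bc hg).integrable hb)
    (((hf.bc.mul hg.bc).const_mul lam).integrable hb), integral_const_mul]
  congr 1
  exact integral_finsetSum _ fun j _ => ((hf.pd j).bc.mul (hg.pd j).bc).integrable hb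

theorem form_self_eq (hb : -1 < b) (lam : ℝ) {f : Pt n → ℝ} (hf : NN f) :
    form n b lam f f = ∑ j, l2 n b (pd j f) ^ 2 + lam * l2 n b f ^ 2 := by
  rw [form_eq hb lam hf hf]
  simp only [l2_sq, ← sq]

theorem l2_le_en (hb : -1 < b) {lam : ℝ} (hl : 1 ≤ lam) {f : Pt n → ℝ} (hf : NN f) :
    l2 n b f ≤ en n b lam f := by
  apply Real.le_sqrt_of_sq_le
  rw [form_self_eq hb lam hf]
  have : 0 ≤ ∑ j, l2 n b (pd j f) ^ 2 := Finset.sum_nonneg fun _ _ => sq_nonneg _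
  nlinarith [sq_nonneg (l2 n b f)]

theorem l2_pd_le_en (hb : -1 < b) {lam : ℝ} (hl : 0 ≤ lam) {f : Pt n → ℝ} (hf : NN f)
    (j : Option (Fin n)) : l2 n b (pd j f) ≤ en n b lam f := by
  apply Real.le_sqrt_of_sq_le
  rw [form_self_eq hb lam hf]
  have : l2 n b (pd j f) ^ 2 ≤ ∑ j, l2 n b (pd j f) ^ 2 :=
    Finset.single_le_sum (f := fun j => l2 n b (pd j f) ^ 2) (fun _ _ => sq_nonneg _)
      (Finset.mem_univ j)
  nlinarith [sq_nonneg (l2 n b f)]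

end

section

variable {n : ℕ} {b : ℝ}

/-- A smooth step, `0` below `s` and `1` above `2 s`. -/
def cut (s y : ℝ) : ℝ := Real.smoothTransition ((y - s) / s)

/-- The derivative of the smooth step. -/
def cutD (s y : ℝ) : ℝ := deriv (cut s) y

theorem contDiff_cut (s : ℝ) : ContDiff ℝ ∞ (cut s) :=
  Real.smoothTransition.contDiff.comp (by fun_prop)

theorem cut_nonneg (s y : ℝ) : 0 ≤ cut s y := Real.smoothTransition.nonneg _

theorem cut_le_one (s y : ℝ) : cut s y ≤ 1 := Real.smoothTransition.le_one _

theorem cut_eq_zero {s y : ℝ} (hs : 0 < s) (hy : y ≤ s) : cut s y = 0 :=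
  Real.smoothTransition.zero_of_nonpos (div_nonpos_of_nonpos_of_nonneg (by linarith) hs.le)

theorem cut_eq_one {s y : ℝ} (hs : 0 < s) (hy : 2 * s ≤ y) : cut s y = 1 :=
  Real.smoothTransition.one_of_one_le (by rw [le_div_iff₀ hs]; linarith)

theorem monotone_smoothTransition : Monotone Real.smoothTransition := by
  intro x y hxy
  have h1 := Real.smoothTransition.pos_denom x
  have h2 := Real.smoothTransition.pos_denom y
  rw [Real.smoothTransition, Real.smoothTransition, div_le_div_iff₀ h1 h2]
  have a : expNegInvGlue x ≤ expNegInvGlue y := expNegInvGlue.monotone hxy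
  have c : expNegInvGlue (1 - y) ≤ expNegInvGlue (1 - x) := expNegInvGlue.monotone (by linarith)
  have := mul_le_mul a c (expNegInvGlue.nonneg _) (expNegInvGlue.nonneg _)
  linarith

theorem monotone_cut {s : ℝ} (hs : 0 < s) : Monotone (cut s) := fun x y h =>
  monotone_smoothTransition (by gcongr)

theorem hasDerivAt_cut (s y : ℝ) : HasDerivAt (cut s) (cutD s y) y :=
  ((contDiff_cut s).differentiable (by simp) y).hasDerivAt

theorem contDiff_cutD (s : ℝ) : ContDiff ℝ ∞ (cutD s) := by
  have := (contDiff_infty_iff_deriv.1 (contDiff_cut s)).2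
  exact this

theorem cutD_nonneg {s : ℝ} (hs : 0 < s) (y : ℝ) : 0 ≤ cutD s y := (monotone_cut hs).deriv_nonneg

theorem cutD_eq_zero_left {s y : ℝ} (hs : 0 < s) (hy : y ≤ s) : cutD s y = 0 := by
  apply IsLocalMin.deriv_eq_zero
  exact Eventually.of_forall fun z => by
    simp only [cut_eq_zero hs hy]; exact cut_nonneg s z

theorem cutD_eq_zero_right {s y : ℝ} (hs : 0 < s) (hy : 2 * s ≤ y) : cutD s y = 0 := by
  apply IsLocalMax.deriv_eq_zero
  exact Eventually.of_forall fun z => by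
    simp only [cut_eq_one hs hy]; exact cut_le_one s z

theorem exists_deriv_smoothTransition_le :
    ∃ C : ℝ, 1 ≤ C ∧ ∀ t, |deriv Real.smoothTransition t| ≤ C := by
  have hc : Continuous (deriv Real.smoothTransition) :=
    (Real.smoothTransition.contDiff (n := 1)).continuous_deriv le_rfl
  obtain ⟨C, hC⟩ := (isCompact_Icc (a := (0 : ℝ)) (b := 1)).exists_bound_of_continuousOn
    hc.continuousOn
  refine ⟨max C 1, le_max_right _ _, fun t => ?_⟩
  by_cases h : t ∈ Icc (0 : ℝ) 1
  · exact (hC t h).trans (le_max_left _ _)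
  · have : deriv Real.smoothTransition t = 0 := by
      rw [mem_Icc, not_and_or, not_le, not_le] at h
      rcases h with h | h
      · apply IsLocalMin.deriv_eq_zero
        exact Eventually.of_forall fun z => by
          simp only [Real.smoothTransition.zero_of_nonpos h.le]
          exact Real.smoothTransition.nonneg z
      · apply IsLocalMax.deriv_eq_zero
        exact Eventually.of_forall fun z => by
          simp only [Real.smoothTransition.one_of_one_le h.le]
          exact Real.smoothTransition.le_one z
    rw [this]; simp

/-- A bound for the derivative of the standard smooth step. -/
def stepC : ℝ := exists_deriv_smoothTransition_le.choose

theorem one_le_stepC : 1 ≤ stepC := exists_deriv_smoothTransition_le.choose_spec.1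

theorem cutD_le {s : ℝ} (hs : 0 < s) (y : ℝ) : cutD s y ≤ stepC / s := by
  have h := exists_deriv_smoothTransition_le.choose_spec.2 ((y - s) / s)
  have h2 : HasDerivAt (fun y : ℝ => (y - s) / s) (1 / s) y :=
    ((hasDerivAt_id y).sub_const s).div_const s
  have h3 : HasDerivAt (cut s) (deriv Real.smoothTransition ((y - s) / s) * (1 / s)) y :=
    (((Real.smoothTransition.contDiff (n := 1)).differentiable (by simp) _).hasDerivAt).comp y h2
  rw [cutD, h3.deriv, mul_one_div]
  gcongr
  exact (le_abs_self _).trans h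

/-- A smooth approximation of the positive part. -/
def ppart (e t : ℝ) : ℝ := ∫ u in (0 : ℝ)..t, cut (e / 2) u

theorem hasDerivAt_ppart (e t : ℝ) : HasDerivAt (ppart e) (cut (e / 2) t) t :=
  (contDiff_cut _).continuous.integral_hasStrictDerivAt 0 t |>.hasDerivAt

theorem contDiff_ppart (e : ℝ) : ContDiff ℝ ∞ (ppart e) := by
  rw [contDiff_infty_iff_deriv]
  refine ⟨fun t => (hasDerivAt_ppart e t).differentiableAt, ?_⟩
  have : deriv (ppart e) = cut (e / 2) := funext fun t => (hasDerivAt_ppart e t).deriv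
  rw [this]; exact contDiff_cut _

theorem ppart_eq_zero {e t : ℝ} (he : 0 < e) (ht : t ≤ e / 2) : ppart e t = 0 := by
  apply intervalIntegral.integral_zero_ae
  refine Eventually.of_forall fun u hu => cut_eq_zero (half_pos he) ?_
  rw [uIoc, mem_Ioc] at hu
  exact hu.2.trans (max_le (half_pos he).le ht)

theorem monotone_ppart (e : ℝ) : Monotone (ppart e) :=
  monotone_of_deriv_nonneg (fun t => (hasDerivAt_ppart e t).differentiableAt) fun t => by
    rw [(hasDerivAt_ppart e t).deriv]; exact cut_nonneg _ _

theorem ppart_nonneg {e : ℝ} (he : 0 < e) (t : ℝ) : 0 ≤ ppart e t := by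
  rcases le_total t 0 with h | h
  · rw [ppart_eq_zero he (h.trans (half_pos he).le)]
  · have := monotone_ppart e h
    rwa [ppart_eq_zero he (half_pos he).le] at this

theorem ppart_le {e : ℝ} (he : 0 < e) (t : ℝ) : ppart e t ≤ max t 0 := by
  rcases le_total t 0 with h | h
  · rw [ppart_eq_zero he (h.trans (half_pos he).le)]; exact le_max_right _ _
  · have : Monotone fun t => t - ppart e t := by
      apply monotone_of_deriv_nonneg
        (fun t => ((hasDerivAt_id t).sub (hasDerivAt_ppart e t)).differentiableAt)
      intro t
      have := ((hasDerivAt_id t).sub (hasDerivAt_ppart e t)).deriv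
      rw [this]
      linarith [cut_le_one (e / 2) t]
    have := this h
    simp only [ppart_eq_zero he (half_pos he).le] at this
    rw [max_eq_left h]; linarith

theorem sub_le_ppart {e : ℝ} (he : 0 < e) (t : ℝ) : t - e ≤ ppart e t := by
  rcases le_total t e with h | h
  · linarith [ppart_nonneg he t]
  · have h2 : ppart e t - ppart e e = ∫ u in e..t, (1 : ℝ) := by
      rw [ppart, ppart, intervalIntegral.integral_interval_sub_left
        ((contDiff_cut _).continuous.intervalIntegrable _ _)
        ((contDiff_cut _).continuous.intervalIntegrable _ _)]
      apply intervalIntegral.integral_congr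
      intro u hu
      rw [uIcc_of_le h] at hu
      exact cut_eq_one (half_pos he) (by linarith [hu.1])
    have h3 := ppart_nonneg he e
    rw [intervalIntegral.integral_const] at h2
    simp at h2
    linarith

theorem NN.of_mul_height {f : Pt n → ℝ} (hf : SmoothUp f) (hs : BddSupp f) {κ : ℝ → ℝ}
    (hκ : ContDiff ℝ ∞ κ) {s : ℝ} (hs0 : 0 < s) (h0 : ∀ y, y ≤ s → κ y = 0) :
    NN (fun p => κ p.2 * f p) := by
  refine ⟨?_, hs.mul_left, s, hs0, fun x y hy => by simp [h0 y hy, h0 0 hs0.le]⟩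
  rw [contDiff_iff_contDiffAt]
  intro p
  rcases lt_or_ge 0 p.2 with hp | hp
  · exact (hκ.comp contDiff_snd).contDiffAt.mul (hf.contDiffAt hp)
  · have : (fun p : Pt n => κ p.2 * f p) =ᶠ[𝓝 p] fun _ => 0 := by
      filter_upwards [(isOpen_lt continuous_snd continuous_const).mem_nhds
        (show p ∈ {q : Pt n | q.2 < s} from lt_of_le_of_lt hp hs0)] with q hq
      rw [h0 q.2 (le_of_lt hq), zero_mul]
    exact contDiffAt_const.congr_of_eventuallyEq this

/-- The integral over the vertical ray above a point. -/
def tail (g : Pt n → ℝ) (p : Pt n) : ℝ := ∫ t in Ioi p.2, g (p.1, t)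

theorem NN.vert_integrable {g : Pt n → ℝ} (hg : NN g) (hz : ∀ x y, y ≤ 0 → g (x, y) = 0)
    (x : EuclideanSpace ℝ (Fin n)) : Integrable fun t => g (x, t) := by
  obtain ⟨R, hR⟩ := hg.supp
  apply Continuous.integrable_of_hasCompactSupport (hg.continuous.comp (by fun_prop))
  apply HasCompactSupport.intro (isCompact_Icc (a := (0 : ℝ)) (b := R))
  intro t ht
  rw [mem_Icc, not_and_or, not_le, not_le] at ht
  exact ht.elim (fun h => hz x t h.le) (fun h => hR x t (Or.inr h))

theorem contDiff_tail {g : Pt n → ℝ} (hg : NN g) (hz : ∀ x y, y ≤ 0 → g (x, y) = 0) :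
    ContDiff ℝ ∞ (tail g) := by
  obtain ⟨R, hR⟩ := hg.supp
  have h := contDiffOn_convolution_right_with_param (𝕜 := ℝ) (μ := (volume : Measure ℝ))
    (f := (Iio (0 : ℝ)).indicator fun _ => (1 : ℝ)) (n := ⊤) (ContinuousLinearMap.mul ℝ ℝ)
    (g := fun (x : EuclideanSpace ℝ (Fin n)) t => g (x, t)) (s := univ)
    (k := Icc 0 R) isOpen_univ isCompact_Icc (fun x t _ ht => by
      rw [mem_Icc, not_and_or, not_le, not_le] at ht
      exact ht.elim (fun h => hz x t h.le) (fun h => hR x t (Or.inr h)))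
    ((locallyIntegrable_const (1 : ℝ)).indicator measurableSet_Iio)
    (hg.smooth.contDiffOn)
  rw [univ_prod_univ, contDiffOn_univ] at h
  have e : tail g = fun q : Pt n => convolution ((Iio (0 : ℝ)).indicator fun _ => (1 : ℝ))
      (fun t => g (q.1, t)) (ContinuousLinearMap.mul ℝ ℝ) volume q.2 := ?_
  · rw [e]; exact h
  funext p
  rw [convolution_def, ← integral_sub_left_eq_self _ _ p.2, tail,
    ← integral_indicator measurableSet_Ioi]
  congr 1; funext t
  by_cases ht : p.2 < t <;> simp [indicator, ht]

theorem tail_eq {g : Pt n → ℝ} (hg : NN g) (hz : ∀ x y, y ≤ 0 → g (x, y) = 0)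
    (x : EuclideanSpace ℝ (Fin n)) (y : ℝ) :
    tail g (x, y) = tail g (x, 0) - ∫ t in (0 : ℝ)..y, g (x, t) := by
  have hi := hg.vert_integrable hz x
  have := intervalIntegral.integral_interval_add_Ioi (a := 0) (b := y) (f := fun t => g (x, t))
    hi.integrableOn hi.integrableOn
  simp only [tail]
  linarith

theorem NN.tail {g : Pt n → ℝ} (hg : NN g) {s : ℝ} (hs : 0 < s)
    (hz : ∀ x y, y ≤ s → g (x, y) = 0) : NN (tail g) := by
  have hz' : ∀ x y, y ≤ 0 → g (x, y) = 0 := fun x y hy => hz x y (hy.trans hs.le)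
  refine ⟨contDiff_tail hg hz', ?_, s, hs, fun x y hy => ?_⟩
  · obtain ⟨R, hR⟩ := hg.supp
    refine ⟨R, fun x y hxy => ?_⟩
    apply setIntegral_eq_zero_of_forall_eq_zero
    intro t ht
    exact hR x t (hxy.imp id fun h => h.trans ht)
  · rw [tail_eq hg hz', intervalIntegral.integral_zero_ae, sub_zero]
    refine Eventually.of_forall fun u hu => hz _ _ ?_
    rw [uIoc, mem_Ioc] at hu
    exact hu.2.trans (max_le hs.le hy)

theorem pd_none_tail {g : Pt n → ℝ} (hg : NN g) (hz : ∀ x y, y ≤ 0 → g (x, y) = 0) (p : Pt n) :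
    pd none (tail g) p = - g p := by
  have h1 := hasDerivAt_vert (x := p.1) (y := p.2)
    ((contDiff_tail hg hz).differentiable (by simp) p)
  have hc : Continuous fun t => g (p.1, t) := hg.continuous.comp (by fun_prop)
  have h2 : HasDerivAt (fun t => tail g (p.1, t)) (0 - g (p.1, p.2)) p.2 := by
    have e : (fun t => tail g (p.1, t)) = fun t => tail g (p.1, 0)
        - ∫ u in (0 : ℝ)..t, g (p.1, u) :=
      funext fun t => tail_eq hg hz p.1 t
    rw [e]
    exact (hasDerivAt_const _ _).sub (hc.integral_hasStrictDerivAt 0 p.2).hasDerivAt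
  have := h1.unique h2
  simpa using this

theorem pd_some_tail {g : Pt n → ℝ} (hg : NN g) (hz : ∀ x y, y ≤ 0 → g (x, y) = 0) (i : Fin n)
    (p : Pt n) : pd (some i) (tail g) p = tail (pd (some i) g) p := by
  have h1 : HasDerivAt (fun h : ℝ => tail g (p.1 + h • EuclideanSpace.single i 1, p.2))
      (pd (some i) (tail g) p) 0 := by
    have := hasLineDerivAt_horiz (x := p.1) (y := p.2)
      ((contDiff_tail hg hz).differentiable (by simp) p) i
    exact this
  obtain ⟨C, hC⟩ := (hg.pd (some i)).bdd
  obtain ⟨R, hR⟩ := (hg.pd (some i)).supp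
  have h2 := hasDerivAt_integral_of_dominated_loc_of_deriv_le (μ := volume.restrict (Ioi p.2))
    (F := fun (h : ℝ) t => g (p.1 + h • EuclideanSpace.single i 1, t)) (x₀ := 0)
    (F' := fun h t => pd (some i) g (p.1 + h • EuclideanSpace.single i 1, t))
    (s := univ) (bound := (Ioc p.2 R).indicator fun _ => C) univ_mem
    (Eventually.of_forall fun h => (hg.continuous.comp (by fun_prop)).aestronglyMeasurable)
    (by simp only [zero_smul, add_zero]; exact (hg.vert_integrable hz p.1).integrableOn)
    (((hg.pd _).continuous.comp (by fun_prop)).aestronglyMeasurable)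
    (by
      filter_upwards [ae_restrict_mem measurableSet_Ioi] with t ht h _
      by_cases h2 : t ∈ Ioc p.2 R
      · rw [indicator_of_mem h2]; exact hC _
      · rw [indicator_of_notMem h2, hR, norm_zero]
        right; by_contra! h3; exact h2 ⟨ht, h3⟩)
    ((integrable_indicator_iff measurableSet_Ioc).2
      ((integrableOn_const (by simp)).mono_measure Measure.restrict_le_self))
    (by
      refine Eventually.of_forall fun t h _ => ?_
      have h4 : HasDerivAt (fun h : ℝ => p.1 + h • EuclideanSpace.single i (1 : ℝ))
        (EuclideanSpace.single i 1) h := by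
        simpa using ((hasDerivAt_id h).smul_const (EuclideanSpace.single i (1 : ℝ))).const_add p.1
      exact (hg.differentiableAt
        (p.1 + h • EuclideanSpace.single i 1, t)).hasFDerivAt.comp_hasDerivAt
        h (h4.prodMk (hasDerivAt_const h t)))
  have := h1.unique h2.2
  simpa [tail] using this

end

section

variable {n : ℕ} {b : ℝ}

theorem nu_restrict_Iio (r : ℝ) : (nu b).restrict (Iio r) =
    (volume.restrict (Ioo 0 r)).withDensity fun y => ENNReal.ofReal (y ^ b) := by
  rw [nu, restrict_withDensity measurableSet_Iio, Measure.restrict_restrict measurableSet_Iio,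
    inter_comm, Ioi_inter_Iio]

theorem lintegral_Ioo_rpow (hb : -1 < b) {r : ℝ} (hr : 0 < r) :
    ∫⁻ y in Ioo 0 r, ENNReal.ofReal (y ^ b) = ENNReal.ofReal (r ^ (1 + b) / (1 + b)) := by
  have h := intervalIntegral.intervalIntegrable_rpow' (a := 0) (b := r) hb
  rw [intervalIntegrable_iff_integrableOn_Ioo_of_le hr.le] at h
  rw [← ofReal_integral_eq_lintegral_ofReal h]
  · rw [← integral_Ioc_eq_integral_Ioo, ← intervalIntegral.integral_of_le hr.le,
      integral_rpow (Or.inl hb), Real.zero_rpow (by linarith), sub_zero, add_comm b 1]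
  · filter_upwards [ae_restrict_mem measurableSet_Ioo] with y hy
    exact Real.rpow_nonneg hy.1.le _

theorem nu_Iio (hb : -1 < b) {r : ℝ} (hr : 0 < r) :
    nu b (Iio r) = ENNReal.ofReal (r ^ (1 + b) / (1 + b)) := by
  rw [← Measure.restrict_apply_univ, nu_restrict_Iio, withDensity_apply _ MeasurableSet.univ,
    Measure.restrict_univ, lintegral_Ioo_rpow hb hr]

theorem sq_lintegral_Ioo_le (hb1 : b < 1) {r : ℝ} (hr : 0 < r) {h : ℝ → ENNReal}
    (hm : AEMeasurable h (volume.restrict (Ioo 0 r))) :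
    (∫⁻ t in Ioo 0 r, h t) ^ 2 ≤
      (∫⁻ t in Iio r, h t ^ 2 ∂nu b) * ENNReal.ofReal (r ^ (1 - b) / (1 - b)) := by
  have e1 : ∫⁻ t in Ioo 0 r, h t = ∫⁻ t in Ioo 0 r,
      ((fun t => h t * ENNReal.ofReal (t ^ (b / 2))) *
        fun t => ENNReal.ofReal (t ^ (-b / 2))) t := by
    apply setLIntegral_congr_fun measurableSet_Ioo
    intro t ht
    have h0 : (0 : ℝ) ≤ t ^ (b / 2) := Real.rpow_nonneg ht.1.le _
    simp only [Pi.mul_apply]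
    rw [mul_assoc, ← ENNReal.ofReal_mul h0, ← Real.rpow_add ht.1]
    simp [neg_div]
  have e2 := ENNReal.lintegral_mul_le_Lp_mul_Lq (volume.restrict (Ioo 0 r))
    (p := 2) (q := 2) Real.HolderConjugate.two_two
    (f := fun t => h t * ENNReal.ofReal (t ^ (b / 2)))
    (g := fun t => ENNReal.ofReal (t ^ (-b / 2)))
    (hm.mul (by fun_prop)) (by fun_prop)
  rw [← e1] at e2
  have e3 : ∀ t ∈ Ioo 0 r, (h t * ENNReal.ofReal (t ^ (b / 2))) ^ (2 : ℝ)
      = ENNReal.ofReal (t ^ b) * h t ^ 2 := by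
    intro t ht
    have h0 : (0 : ℝ) ≤ t ^ (b / 2) := Real.rpow_nonneg ht.1.le _
    rw [ENNReal.rpow_two, mul_pow, mul_comm, ← ENNReal.ofReal_pow h0, ← Real.rpow_natCast,
      ← Real.rpow_mul ht.1.le]
    congr 3; push_cast; ring
  have e4 : ∀ t ∈ Ioo 0 r, (ENNReal.ofReal (t ^ (-b / 2))) ^ (2 : ℝ)
      = ENNReal.ofReal (t ^ (-b)) := by
    intro t ht
    have h0 : (0 : ℝ) ≤ t ^ (-b / 2) := Real.rpow_nonneg ht.1.le _
    rw [ENNReal.rpow_two, ← ENNReal.ofReal_pow h0, ← Real.rpow_natCast,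
      ← Real.rpow_mul ht.1.le]
    congr 2; push_cast; ring
  rw [setLIntegral_congr_fun measurableSet_Ioo e3, setLIntegral_congr_fun measurableSet_Ioo e4,
    lintegral_Ioo_rpow (by linarith) hr, ← sub_eq_add_neg] at e2
  have e5 : ∫⁻ t in Iio r, h t ^ 2 ∂nu b = ∫⁻ t in Ioo 0 r, ENNReal.ofReal (t ^ b) * h t ^ 2 := by
    rw [nu_restrict_Iio, lintegral_withDensity_eq_lintegral_mul₀ (by fun_prop) (hm.pow_const 2)]
    rfl
  rw [e5]
  calc _ ≤ _ := pow_le_pow_left' e2 2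
    _ = _ := by
      rw [mul_pow, ← ENNReal.rpow_two, ← ENNReal.rpow_two, ← ENNReal.rpow_mul,
        ← ENNReal.rpow_mul]
      norm_num

/-- The points below a given height. -/
def low (n : ℕ) (r : ℝ) : Set (Pt n) := {p | p.2 < r}

theorem measurableSet_low (r : ℝ) : MeasurableSet (low n r) :=
  (isOpen_lt continuous_snd continuous_const).measurableSet

theorem wt_restrict_low (r : ℝ) : (wt n b).restrict (low n r) =
    (volume : Measure (EuclideanSpace ℝ (Fin n))).prod ((nu b).restrict (Iio r)) := by
  have : low n r = univ ×ˢ Iio r := by ext p; simp [low]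
  rw [this, wt, ← Measure.prod_restrict, Measure.restrict_univ]

/-- The constant in the one-dimensional Hardy type inequality. -/
def hardyC (b : ℝ) : ℝ := 4 / ((1 + b) * (1 - b))

theorem hardyC_pos (hb : -1 < b) (hb1 : b < 1) : 0 < hardyC b :=
  div_pos (by norm_num) (mul_pos (by linarith) (by linarith))

theorem hardy (hb : -1 < b) (hb1 : b < 1) {s : ℝ} (hs : 0 < s) {F g : Pt n → ℝ}
    (hF : ContinuousOn F (upper n)) (hg : ContinuousOn g (upper n)) (hg2 : MemLp g 2 (wt n b))
    (h : ∀ x y, 0 < y → y < 2 * s → ‖F (x, y)‖ₑ ≤ ∫⁻ t in Ioo 0 (2 * s), ‖g (x, t)‖ₑ)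
    (h0 : ∀ x y, 2 * s ≤ y → F (x, y) = 0) :
    MemLp F 2 (wt n b) ∧
      ∫ p, F p ^ 2 ∂wt n b ≤ hardyC b * s ^ 2 * ∫ p in low n (2 * s), g p ^ 2 ∂wt n b := by
  have h2s : 0 < 2 * s := by linarith
  have hgx : ∀ x : EuclideanSpace ℝ (Fin n), AEMeasurable (fun t => ‖g (x, t)‖ₑ)
      (volume.restrict (Ioo 0 (2 * s))) := by
    intro x
    apply AEMeasurable.enorm
    apply ContinuousOn.aemeasurable _ measurableSet_Ioo
    exact hg.comp (by fun_prop) fun t ht => ht.1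
  have hgint : Integrable (fun p => g p ^ 2) ((wt n b).restrict (low n (2 * s))) :=
    hg2.integrable_sq.restrict
  have key : ∫⁻ p, ‖F p‖ₑ ^ 2 ∂wt n b ≤ ENNReal.ofReal (hardyC b * s ^ 2) *
      ∫⁻ p in low n (2 * s), ‖g p‖ₑ ^ 2 ∂wt n b := by
    calc ∫⁻ p, ‖F p‖ₑ ^ 2 ∂wt n b
        ≤ ∫⁻ x, ∫⁻ y, ‖F (x, y)‖ₑ ^ 2 ∂nu b := lintegral_prod_le _
      _ ≤ ∫⁻ x, ENNReal.ofReal (hardyC b * s ^ 2) *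
            ∫⁻ t in Iio (2 * s), ‖g (x, t)‖ₑ ^ 2 ∂nu b := by
          apply lintegral_mono
          intro x
          calc ∫⁻ y, ‖F (x, y)‖ₑ ^ 2 ∂nu b
              ≤ ∫⁻ y, (Iio (2 * s)).indicator
                  (fun _ => (∫⁻ t in Ioo 0 (2 * s), ‖g (x, t)‖ₑ) ^ 2) y ∂nu b := by
                apply lintegral_mono_ae
                refine ae_nu_of_forall fun y hy => ?_
                by_cases hy2 : y < 2 * s
                · rw [indicator_of_mem (show y ∈ Iio (2 * s) from hy2)]
                  exact pow_le_pow_left' (h x y hy hy2) 2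
                · rw [h0 x y (not_lt.1 hy2)]; simp
            _ = (∫⁻ t in Ioo 0 (2 * s), ‖g (x, t)‖ₑ) ^ 2 *
                  ENNReal.ofReal ((2 * s) ^ (1 + b) / (1 + b)) := by
                rw [lintegral_indicator measurableSet_Iio, lintegral_const,
                  Measure.restrict_apply_univ, nu_Iio hb h2s]
            _ ≤ ((∫⁻ t in Iio (2 * s), ‖g (x, t)‖ₑ ^ 2 ∂nu b) *
                  ENNReal.ofReal ((2 * s) ^ (1 - b) / (1 - b))) *
                  ENNReal.ofReal ((2 * s) ^ (1 + b) / (1 + b)) := by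
                gcongr
                exact sq_lintegral_Ioo_le hb1 h2s (hgx x)
            _ = _ := by
                rw [mul_assoc, ← ENNReal.ofReal_mul (div_nonneg (Real.rpow_nonneg h2s.le _)
                  (by linarith)), mul_comm]
                congr 2
                rw [div_mul_div_comm, ← Real.rpow_add h2s, hardyC]
                have : (2 * s) ^ (1 - b + (1 + b)) = 4 * s ^ 2 := by
                  rw [show 1 - b + (1 + b) = ((2 : ℕ) : ℝ) by push_cast; ring,
                    Real.rpow_natCast]; ring
                rw [this]; ring
      _ = _ := by
          rw [lintegral_const_mul'' _, wt_restrict_low, lintegral_prod]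
          · have := hgint.aestronglyMeasurable
            have h3 := (aesm_of_continuousOn (b := b) hg).restrict (s := low n (2 * s))
            rw [wt_restrict_low] at h3
            exact h3.enorm.pow_const 2
          · have h3 := (aesm_of_continuousOn (b := b) hg).restrict (s := low n (2 * s))
            rw [wt_restrict_low] at h3
            exact (h3.enorm.pow_const 2).lintegral_prod_right'
  have eF : ∀ p, ‖F p‖ₑ ^ 2 = ‖F p ^ 2‖ₑ := fun p => by rw [enorm_pow]
  have eg : ∀ p, ‖g p‖ₑ ^ 2 = ‖g p ^ 2‖ₑ := fun p => by rw [enorm_pow]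
  simp only [eF, eg] at key
  have hfin : ENNReal.ofReal (hardyC b * s ^ 2) *
      ∫⁻ p in low n (2 * s), ‖g p ^ 2‖ₑ ∂wt n b < ⊤ :=
    ENNReal.mul_lt_top ENNReal.ofReal_lt_top hgint.2
  have hFm : AEStronglyMeasurable (fun p => F p ^ 2) (wt n b) :=
    aesm_of_continuousOn (hF.pow 2)
  refine ⟨(memLp_two_iff_integrable_sq (aesm_of_continuousOn hF)).2
    ⟨hFm, key.trans_lt hfin⟩, ?_⟩
  have hc : 0 ≤ hardyC b * s ^ 2 := mul_nonneg (hardyC_pos hb hb1).le (sq_nonneg _)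
  have r1 : ∫ p, F p ^ 2 ∂wt n b = (∫⁻ p, ‖F p ^ 2‖ₑ ∂wt n b).toReal := by
    rw [integral_eq_lintegral_of_nonneg_ae (Eventually.of_forall fun _ => sq_nonneg _) hFm]
    congr 2; funext p; rw [Real.enorm_of_nonneg (sq_nonneg _)]
  have r2 : ∫ p in low n (2 * s), g p ^ 2 ∂wt n b
      = (∫⁻ p in low n (2 * s), ‖g p ^ 2‖ₑ ∂wt n b).toReal := by
    rw [integral_eq_lintegral_of_nonneg_ae (Eventually.of_forall fun _ => sq_nonneg _)
      hgint.aestronglyMeasurable]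
    congr 2; funext p; rw [Real.enorm_of_nonneg (sq_nonneg _)]
  rw [r1, r2, ← ENNReal.toReal_ofReal hc, ← ENNReal.toReal_mul]
  exact ENNReal.toReal_mono hfin.ne key

end

section

variable {n : ℕ} {b : ℝ}

/-- Vertical averaging: the mean of `f (x, max y t)` against the density `cutD s`. -/
def top (s : ℝ) (f : Pt n → ℝ) (p : Pt n) : ℝ :=
  cut s p.2 * f p + tail (fun q => cutD s q.2 * f q) p

theorem nn_cutD_mul {f : Pt n → ℝ} (hf : SmoothUp f) (hs : BddSupp f) {s : ℝ} (h0 : 0 < s) :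
    NN (fun q => cutD s q.2 * f q) :=
  NN.of_mul_height hf hs (contDiff_cutD s) h0 fun _ hy => cutD_eq_zero_left h0 hy

theorem NN.cut_mul {f : Pt n → ℝ} (hf : SmoothUp f) (hs : BddSupp f) {s : ℝ} (h0 : 0 < s) :
    NN (fun q => cut s q.2 * f q) :=
  NN.of_mul_height hf hs (contDiff_cut s) h0 fun _ hy => cut_eq_zero h0 hy

theorem NN.top {f : Pt n → ℝ} (hf : SmoothUp f) (hs : BddSupp f) {s : ℝ} (h0 : 0 < s) :
    NN (top s f) :=
  (NN.cut_mul hf hs h0).add <| (nn_cutD_mul hf hs h0).tail h0 fun x y hy => by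
    simp [cutD_eq_zero_left h0 hy]

theorem cutD_mul_zero {s : ℝ} (h0 : 0 < s) (f : Pt n → ℝ) :
    ∀ x y, y ≤ 0 → (fun q : Pt n => cutD s q.2 * f q) (x, y) = 0 := fun x y hy => by
  simp [cutD_eq_zero_left h0 (hy.trans h0.le)]

theorem differentiableAt_cut_snd (s : ℝ) (p : Pt n) :
    DifferentiableAt ℝ (fun q : Pt n => cut s q.2) p :=
  (((contDiff_cut s).comp contDiff_snd).differentiable (by simp)) p

theorem differentiableAt_cutD_snd (s : ℝ) (p : Pt n) :
    DifferentiableAt ℝ (fun q : Pt n => cutD s q.2) p :=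
  (((contDiff_cutD s).comp contDiff_snd).differentiable (by simp)) p

theorem pd_none_cut (s : ℝ) (p : Pt n) : pd none (fun q : Pt n => cut s q.2) p = cutD s p.2 := by
  rw [pd_none_height (hasDerivAt_cut s p.2).differentiableAt, (hasDerivAt_cut s p.2).deriv]

theorem pd_none_top {f : Pt n → ℝ} (hf : SmoothUp f) (hs : BddSupp f) {s : ℝ} (h0 : 0 < s)
    {p : Pt n} (hp : 0 < p.2) : pd none (top s f) p = cut s p.2 * pd none f p := by
  have hg := nn_cutD_mul hf hs h0
  have ht : NN (tail fun q : Pt n => cutD s q.2 * f q) :=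
    hg.tail h0 fun x y hy => by simp [cutD_eq_zero_left h0 hy]
  have := pd_add ((NN.cut_mul hf hs h0).differentiableAt p) (ht.differentiableAt p) none
  rw [show top s f = fun q => cut s q.2 * f q + tail (fun q => cutD s q.2 * f q) q from rfl, this,
    pd_none_tail hg (cutD_mul_zero h0 f), pd_mul (differentiableAt_cut_snd s p)
      (hf.differentiableAt hp), pd_none_cut]
  ring

theorem tail_congr {f g : Pt n → ℝ} {p : Pt n} (h : ∀ t, p.2 < t → f (p.1, t) = g (p.1, t)) :
    tail f p = tail g p :=
  setIntegral_congr_fun measurableSet_Ioi fun t ht => h t ht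

theorem pd_some_top {f : Pt n → ℝ} (hf : SmoothUp f) (hs : BddSupp f) {s : ℝ} (h0 : 0 < s)
    {p : Pt n} (hp : 0 < p.2) (i : Fin n) :
    pd (some i) (top s f) p = top s (pd (some i) f) p := by
  have hg := nn_cutD_mul hf hs h0
  have ht : NN (tail fun q : Pt n => cutD s q.2 * f q) :=
    hg.tail h0 fun x y hy => by simp [cutD_eq_zero_left h0 hy]
  have := pd_add ((NN.cut_mul hf hs h0).differentiableAt p) (ht.differentiableAt p) (some i)
  rw [show top s f = fun q => cut s q.2 * f q + tail (fun q => cutD s q.2 * f q) q from rfl, this,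
    pd_some_tail hg (cutD_mul_zero h0 f), pd_mul (differentiableAt_cut_snd s p)
      (hf.differentiableAt hp), pd_some_height]
  have : tail (pd (some i) fun q : Pt n => cutD s q.2 * f q) p
      = tail (fun q => cutD s q.2 * pd (some i) f q) p := by
    refine tail_congr fun t ht => ?_
    have h1 : DifferentiableAt ℝ f (p.1, t) := hf.differentiableAt (p := (p.1, t)) (hp.trans ht)
    rw [pd_mul (differentiableAt_cutD_snd s _) h1, pd_some_height]; simp
  rw [this]; simp [top]

theorem tail_cutD_int {f : Pt n → ℝ} (hf : SmoothUp f) (hs : BddSupp f) {s : ℝ} (h0 : 0 < s)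
    (x : EuclideanSpace ℝ (Fin n)) : Integrable fun t => cutD s t * f (x, t) :=
  (nn_cutD_mul hf hs h0).vert_integrable (cutD_mul_zero h0 f) x

theorem top_add {f g : Pt n → ℝ} (hf : SmoothUp f) (hs : BddSupp f) (hg : SmoothUp g)
    (hs' : BddSupp g) {s : ℝ} (h0 : 0 < s) (p : Pt n) :
    top s (fun q => f q + g q) p = top s f p + top s g p := by
  unfold top tail
  simp only [mul_add]
  rw [integral_add (tail_cutD_int hf hs h0 _).integrableOn (tail_cutD_int hg hs' h0 _).integrableOn]
  ring

theorem top_nonneg {f : Pt n → ℝ} {s : ℝ} (h0 : 0 < s) (h : ∀ p, 0 < p.2 → 0 ≤ f p) {p : Pt n}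
    (hp : 0 < p.2) : 0 ≤ top s f p :=
  add_nonneg (mul_nonneg (cut_nonneg _ _) (h p hp)) <|
    setIntegral_nonneg measurableSet_Ioi fun t ht =>
      mul_nonneg (cutD_nonneg h0 t) (h (p.1, t) (hp.trans ht))

theorem tail_cutD_eq_zero {f : Pt n → ℝ} {s : ℝ} (h0 : 0 < s) {p : Pt n} (hp : 2 * s ≤ p.2) :
    tail (fun q => cutD s q.2 * f q) p = 0 := by
  have : tail (fun q => cutD s q.2 * f q) p = tail (fun _ : Pt n => (0 : ℝ)) p :=
    tail_congr fun t ht => by simp [cutD_eq_zero_right h0 (hp.trans ht.le)]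
  rw [this]; simp [tail]

theorem top_eq_self {f : Pt n → ℝ} {s : ℝ} (h0 : 0 < s) {p : Pt n} (hp : 2 * s ≤ p.2) :
    top s f p = f p := by
  simp [top, tail_cutD_eq_zero h0 hp, cut_eq_one h0 hp]

theorem sub_top_eq {f : Pt n → ℝ} (hf : SmoothUp f) (hs : BddSupp f) {s : ℝ} (h0 : 0 < s)
    (x : EuclideanSpace ℝ (Fin n)) {y : ℝ} (hy : 0 < y) (hy2 : y ≤ 2 * s) :
    f (x, y) - top s f (x, y) = -∫ t in y..2 * s, (1 - cut s t) * pd none f (x, t) := by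
  have hT := NN.top hf hs h0
  have hd : ∀ t ∈ uIcc y (2 * s), HasDerivAt (fun t => f (x, t) - top s f (x, t))
      ((1 - cut s t) * pd none f (x, t)) t := by
    intro t ht
    rw [uIcc_of_le hy2] at ht
    have htp : 0 < t := hy.trans_le ht.1
    have h1 := hasDerivAt_vert (hf.differentiableAt (p := (x, t)) htp)
    have h2 := hasDerivAt_vert (hT.differentiableAt (x, t))
    rw [pd_none_top hf hs h0 (p := (x, t)) htp] at h2
    have h3 := h1.sub h2
    rwa [← one_sub_mul] at h3
  have hc : ContinuousOn (fun t => (1 - cut s t) * pd none f (x, t)) (uIcc y (2 * s)) := by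
    rw [uIcc_of_le hy2]
    refine ((continuous_const.sub (contDiff_cut s).continuous).continuousOn).mul ?_
    exact (hf.pd none).continuousOn.comp (by fun_prop) fun t ht => hy.trans_le ht.1
  rw [intervalIntegral.integral_eq_sub_of_hasDerivAt hd hc.intervalIntegrable,
    top_eq_self h0 (p := (x, 2 * s)) le_rfl]
  ring

/-- The vertical energy near the boundary. -/
def low_en (n : ℕ) (b s : ℝ) (f : Pt n → ℝ) : ℝ :=
  ∫ p, (1 - cut s p.2) * pd none f p ^ 2 ∂wt n b

theorem MemLp.of_le {f g : Pt n → ℝ} (hf : ContinuousOn f (upper n)) (hg : MemLp g 2 (wt n b))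
    (h : ∀ p, 0 < p.2 → |f p| ≤ |g p|) : MemLp f 2 (wt n b) :=
  hg.mono (aesm_of_continuousOn hf) (ae_wt_of_forall fun p hp => by simpa using h p hp)

theorem sub_top_sq_le (hb : -1 < b) (hb1 : b < 1) {f : Pt n → ℝ} (hf : SmoothUp f)
    (hs : BddSupp f) (h2 : MemLp (pd none f) 2 (wt n b)) {s : ℝ} (h0 : 0 < s) :
    MemLp (fun p => f p - top s f p) 2 (wt n b) ∧
      ∫ p, (f p - top s f p) ^ 2 ∂wt n b ≤ hardyC b * s ^ 2 * low_en n b s f := by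
  have hc : Continuous fun p : Pt n => √(1 - cut s p.2) :=
    (continuous_const.sub ((contDiff_cut s).continuous.comp continuous_snd)).sqrt
  have hgc : ContinuousOn (fun p => √(1 - cut s p.2) * pd none f p) (upper n) :=
    hc.continuousOn.mul (hf.pd none).continuousOn
  have hle : ∀ y, √(1 - cut s y) ≤ 1 := fun y => by
    rw [Real.sqrt_le_one]; linarith [cut_nonneg s y]
  have hg2 : MemLp (fun p => √(1 - cut s p.2) * pd none f p) 2 (wt n b) :=
    MemLp.of_le hgc h2 fun p _ => by
      rw [abs_mul, abs_of_nonneg (Real.sqrt_nonneg _)]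
      exact mul_le_of_le_one_left (abs_nonneg _) (hle _)
  have key := hardy hb hb1 h0 (F := fun p => f p - top s f p)
    (g := fun p => √(1 - cut s p.2) * pd none f p)
    (hf.continuousOn.sub (NN.top hf hs h0).continuous.continuousOn) hgc hg2 ?_ ?_
  · refine ⟨key.1, key.2.trans ?_⟩
    have e : ∀ p : Pt n, (√(1 - cut s p.2) * pd none f p) ^ 2
        = (1 - cut s p.2) * pd none f p ^ 2 := fun p => by
      rw [mul_pow, Real.sq_sqrt (sub_nonneg.2 (cut_le_one _ _))]
    have hi := hg2.integrable_sq
    simp only [e] at hi ⊢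
    refine mul_le_mul_of_nonneg_left ?_ (by have := hardyC_pos hb hb1; positivity)
    exact setIntegral_le_integral hi (ae_of_all _ fun p =>
      mul_nonneg (sub_nonneg.2 (cut_le_one _ _)) (sq_nonneg _))
  · intro x y hy hy2
    simp only
    rw [sub_top_eq hf hs h0 x hy hy2.le, enorm_neg, intervalIntegral.integral_of_le hy2.le]
    refine (enorm_integral_le_lintegral_enorm _).trans ?_
    have : Ioc y (2 * s) ⊆ Ioc 0 (2 * s) := Ioc_subset_Ioc_left hy.le
    refine (lintegral_mono_set this).trans ?_
    rw [← restrict_Ioo_eq_restrict_Ioc]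
    refine lintegral_mono fun t => ?_
    rw [enorm_mul, enorm_mul]
    refine mul_le_mul_left ?_ _
    have h1 : 0 ≤ 1 - cut s t := sub_nonneg.2 (cut_le_one _ _)
    rw [Real.enorm_of_nonneg h1, Real.enorm_of_nonneg (Real.sqrt_nonneg _)]
    refine ENNReal.ofReal_le_ofReal (Real.le_sqrt_of_sq_le ?_)
    nlinarith [cut_nonneg s t]
  · intro x y hy
    simp [top_eq_self h0 (p := (x, y)) hy]

theorem low_sq_integrable {f : Pt n → ℝ} (h2 : MemLp f 2 (wt n b)) (r : ℝ) :
    IntegrableOn (fun p => f p ^ 2) (low n r) (wt n b) := h2.integrable_sq.integrableOn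

theorem sub_top_sq_le_low (hb : -1 < b) (hb1 : b < 1) {f : Pt n → ℝ} (hf : SmoothUp f)
    (hs : BddSupp f) (h2 : MemLp f 2 (wt n b)) {s : ℝ} (h0 : 0 < s) :
    MemLp (fun p => f p - top s f p) 2 (wt n b) ∧
      ∫ p, (f p - top s f p) ^ 2 ∂wt n b
        ≤ 2 * (1 + hardyC b * stepC ^ 2) * ∫ p in low n (2 * s), f p ^ 2 ∂wt n b := by
  have hT : NN (tail fun q : Pt n => cutD s q.2 * f q) :=
    (nn_cutD_mul hf hs h0).tail h0 fun x y hy => by simp [cutD_eq_zero_left h0 hy]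
  have hgc : ContinuousOn (fun p => stepC / s * f p) (upper n) :=
    continuousOn_const.mul hf.continuousOn
  have hg2 : MemLp (fun p => stepC / s * f p) 2 (wt n b) := h2.const_mul _
  have key := hardy hb hb1 h0 (F := tail fun q : Pt n => cutD s q.2 * f q)
    (g := fun p => stepC / s * f p) hT.continuous.continuousOn hgc hg2 ?_ ?_
  · have e : ∫ p in low n (2 * s), (stepC / s * f p) ^ 2 ∂wt n b
        = (stepC / s) ^ 2 * ∫ p in low n (2 * s), f p ^ 2 ∂wt n b := by
      rw [← integral_const_mul]; simp only [mul_pow]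
    rw [e] at key
    have hd : (fun p => f p - top s f p) = fun p => (1 - cut s p.2) * f p -
        tail (fun q : Pt n => cutD s q.2 * f q) p := by
      funext p; simp only [top]; ring
    have hc1 : ContinuousOn (fun p : Pt n => (1 - cut s p.2) * f p) (upper n) :=
      (continuous_const.sub ((contDiff_cut s).continuous.comp continuous_snd)).continuousOn.mul
        hf.continuousOn
    have hle : ∀ p : Pt n, |(1 - cut s p.2) * f p| ≤ |f p| := fun p => by
      rw [abs_mul, abs_of_nonneg (sub_nonneg.2 (cut_le_one _ _))]
      exact mul_le_of_le_one_left (abs_nonneg _) (by linarith [cut_nonneg s p.2])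
    have hm1 : MemLp (fun p : Pt n => (1 - cut s p.2) * f p) 2 (wt n b) :=
      MemLp.of_le hc1 h2 fun p _ => hle p
    have hm : MemLp (fun p => f p - top s f p) 2 (wt n b) := by rw [hd]; exact hm1.sub key.1
    refine ⟨hm, ?_⟩
    have h1 : ∫ p, ((1 - cut s p.2) * f p) ^ 2 ∂wt n b
        ≤ ∫ p in low n (2 * s), f p ^ 2 ∂wt n b := by
      rw [← integral_indicator (measurableSet_low _)]
      refine integral_mono hm1.integrable_sq
        ((integrable_indicator_iff (measurableSet_low _)).2 (low_sq_integrable h2 _)) fun p => ?_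
      by_cases hp : p ∈ low n (2 * s)
      · simp only [indicator_of_mem hp]
        exact sq_le_sq.2 (hle p)
      · simp only [indicator_of_notMem hp]
        rw [cut_eq_one h0 (not_lt.1 hp)]; simp
    have h3 : ∫ p, (f p - top s f p) ^ 2 ∂wt n b ≤
        ∫ p, (2 * ((1 - cut s p.2) * f p) ^ 2 +
          2 * tail (fun q : Pt n => cutD s q.2 * f q) p ^ 2) ∂wt n b := by
      refine integral_mono hm.integrable_sq
        ((hm1.integrable_sq.const_mul 2).add (key.1.integrable_sq.const_mul 2)) fun p => ?_
      have := congrFun hd p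
      rw [this]
      nlinarith [sq_nonneg ((1 - cut s p.2) * f p + tail (fun q : Pt n => cutD s q.2 * f q) p)]
    rw [integral_add (hm1.integrable_sq.const_mul 2) (key.1.integrable_sq.const_mul 2),
      integral_const_mul, integral_const_mul] at h3
    have h4 : hardyC b * s ^ 2 * ((stepC / s) ^ 2 * ∫ p in low n (2 * s), f p ^ 2 ∂wt n b)
        = hardyC b * stepC ^ 2 * ∫ p in low n (2 * s), f p ^ 2 ∂wt n b := by
      field_simp
    rw [h4] at key
    linarith [key.2]
  · intro x y hy hy2
    refine (enorm_integral_le_lintegral_enorm _).trans ?_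
    rw [← lintegral_indicator measurableSet_Ioi, ← lintegral_indicator measurableSet_Ioo]
    refine lintegral_mono fun t => ?_
    change (Ioi y).indicator (fun t => ‖cutD s t * f (x, t)‖ₑ) t ≤ _
    by_cases ht : t ∈ Ioi y
    · rw [indicator_of_mem ht]
      by_cases ht2 : t < 2 * s
      · rw [indicator_of_mem (show t ∈ Ioo 0 (2 * s) from ⟨hy.trans ht, ht2⟩), enorm_mul, enorm_mul]
        refine mul_le_mul_left ?_ _
        rw [Real.enorm_of_nonneg (cutD_nonneg h0 t), Real.enorm_of_nonneg]
        · exact ENNReal.ofReal_le_ofReal (cutD_le h0 t)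
        · have := one_le_stepC; positivity
      · rw [cutD_eq_zero_right h0 (not_lt.1 ht2)]; simp
    · rw [indicator_of_notMem ht]; exact zero_le
  · intro x y hy
    exact tail_cutD_eq_zero h0 hy

theorem tendsto_low_sq {f : Pt n → ℝ} (h2 : MemLp f 2 (wt n b)) :
    Tendsto (fun r => ∫ p in low n r, f p ^ 2 ∂wt n b) (𝓝[>] 0) (𝓝 0) := by
  have : Tendsto (fun r => ∫ p, (low n r).indicator (fun p => f p ^ 2) p ∂wt n b) (𝓝[>] 0)
      (𝓝 (∫ _p, (0 : ℝ) ∂wt n b)) := by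
    refine tendsto_integral_filter_of_dominated_convergence (fun p => f p ^ 2) ?_ ?_
      h2.integrable_sq ?_
    · exact Eventually.of_forall fun r =>
        h2.integrable_sq.aestronglyMeasurable.indicator (measurableSet_low r)
    · exact Eventually.of_forall fun r => ae_of_all _ fun p => by
        rw [Real.norm_eq_abs]
        by_cases hp : p ∈ low n r
        · rw [indicator_of_mem hp, abs_of_nonneg (sq_nonneg _)]
        · rw [indicator_of_notMem hp]; simpa using sq_nonneg _
    · refine ae_wt_of_forall fun p hp => ?_
      refine tendsto_const_nhds.congr' ?_
      filter_upwards [Ioo_mem_nhdsGT hp] with r hr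
      rw [indicator_of_notMem]
      exact not_lt.2 hr.2.le
  simpa [integral_indicator (measurableSet_low _)] using this

theorem tendsto_l2_sub_top (hb : -1 < b) (hb1 : b < 1) {f : Pt n → ℝ} (hf : SmoothUp f)
    (hs : BddSupp f) (h2 : MemLp f 2 (wt n b)) :
    Tendsto (fun s => l2 n b (fun p => f p - top s f p)) (𝓝[>] 0) (𝓝 0) := by
  have h1 : Tendsto (fun s => √(2 * (1 + hardyC b * stepC ^ 2) *
      ∫ p in low n (2 * s), f p ^ 2 ∂wt n b)) (𝓝[>] 0) (𝓝 0) := by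
    have hm : Tendsto (fun s : ℝ => 2 * s) (𝓝[>] 0) (𝓝[>] 0) := by
      refine tendsto_nhdsWithin_iff.2 ⟨?_, eventually_mem_nhdsWithin.mono fun s hs => by
        simpa using hs⟩
      have : Tendsto (fun s : ℝ => 2 * s) (𝓝 0) (𝓝 (2 * 0)) := tendsto_id.const_mul 2
      simpa using this.mono_left nhdsWithin_le_nhds
    have := (((tendsto_low_sq h2).comp hm).const_mul (2 * (1 + hardyC b * stepC ^ 2))).sqrt
    simpa using this
  refine squeeze_zero' (Eventually.of_forall fun s => l2_nonneg _) ?_ h1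
  filter_upwards [self_mem_nhdsWithin] with s h0
  exact Real.sqrt_le_sqrt (sub_top_sq_le_low hb hb1 hf hs h2 h0).2

end

section

variable {n : ℕ} {b : ℝ}

theorem integral_tail_cutD (hb : -1 < b) {f : Pt n → ℝ} (hf : NN f) {s : ℝ} (h0 : 0 < s) :
    ∫ p, tail (fun q => cutD s q.2 * f q) p ∂wt n b
      = ∫ p, p.2 * cutD s p.2 / (1 + b) * f p ∂wt n b := by
  have hb' : 0 < 1 + b := by linarith
  have hg := nn_cutD_mul hf.smoothUp hf.supp h0
  have hT : NN (tail fun q : Pt n => cutD s q.2 * f q) :=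
    hg.tail h0 fun x y hy => by simp [cutD_eq_zero_left h0 hy]
  set t := tail fun q : Pt n => cutD s q.2 * f q with ht
  have hyc : ContDiff ℝ ∞ fun p : Pt n => p.2 / (1 + b) := contDiff_snd.div_const _
  have hyd : ∀ p : Pt n, DifferentiableAt ℝ (fun q : Pt n => q.2 / (1 + b)) p := fun p =>
    (hyc.differentiable (by simp)) p
  have hpy : ∀ p : Pt n, pd none (fun q : Pt n => q.2 / (1 + b)) p = 1 / (1 + b) := fun p => by
    rw [pd_none_height (g := fun y => y / (1 + b)) (by fun_prop)]; simp
  have hpt : ∀ p : Pt n, 0 < p.2 → pd none (fun q : Pt n => q.2 / (1 + b) * t q) p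
      + b / p.2 * (p.2 / (1 + b) * t p) = t p - p.2 * cutD s p.2 / (1 + b) * f p := by
    intro p hp
    rw [pd_mul (hyd p) (hT.differentiableAt p), hpy, ht, pd_none_tail hg (cutD_mul_zero h0 f)]
    field_simp
    ring
  have hi1 : Integrable t (wt n b) := hT.bc.integrable hb
  have hi2 : Integrable (fun p : Pt n => p.2 * cutD s p.2 / (1 + b) * f p) (wt n b) := by
    have : NN fun p : Pt n => (p.2 / (1 + b)) * (cutD s p.2 * f p) := by
      obtain ⟨r, hr, hv⟩ := hg.supp.exists_pos
      refine ⟨hyc.mul hg.smooth, BddSupp.mul_left hg.supp, s, h0, fun x y hy => ?_⟩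
      simp [cutD_eq_zero_left h0 hy]
    refine (this.bc.integrable hb).congr (ae_of_all _ fun p => ?_)
    simp only; ring
  have key := integral_vert (b := b) (H := fun q : Pt n => q.2 / (1 + b) * t q)
    (fun p _ => (hyd p).mul (hT.differentiableAt p))
    ((hi1.sub hi2).congr (ae_wt_of_forall fun p hp => (hpt p hp).symm))
    (BddSupp.mul_left hT.supp) ?_
  · rw [integral_congr_ae (ae_wt_of_forall hpt), integral_sub hi1 hi2] at key
    linarith
  · intro x
    obtain ⟨C, hC⟩ := hT.bdd
    have h1 : Tendsto (fun y : ℝ => y ^ (1 + b) * (C / (1 + b))) (𝓝[>] 0) (𝓝 0) := by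
      have := ((Real.continuousAt_rpow_const 0 (1 + b) (Or.inr hb'.le)).tendsto.mono_left
        (nhdsWithin_le_nhds (s := Ioi 0))).mul_const (C / (1 + b))
      simpa [Real.zero_rpow hb'.ne'] using this
    refine squeeze_zero_norm' ?_ h1
    filter_upwards [self_mem_nhdsWithin] with y hy
    have hy : 0 < y := hy
    rw [Real.norm_eq_abs, Real.rpow_add hy, Real.rpow_one, abs_mul, abs_mul,
      abs_of_pos (Real.rpow_pos_of_pos hy b), abs_of_pos (show 0 < y / (1 + b) by positivity)]
    have := mul_le_mul_of_nonneg_left (hC (x, y))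
      (show 0 ≤ y ^ b * (y / (1 + b)) by positivity)
    calc _ = y ^ b * (y / (1 + b)) * |t (x, y)| := by ring
      _ ≤ _ := this
      _ = _ := by ring

/-- Weight produced by comparing a function with its vertical average. -/
def avgW (b s y : ℝ) : ℝ := (1 - cut s y) - y * cutD s y / (1 + b)

theorem continuous_avgW (b s : ℝ) : Continuous (avgW b s) := by
  have := (contDiff_cut s).continuous
  have := (contDiff_cutD s).continuous
  unfold avgW; fun_prop

theorem integral_cutD_Ioi {s : ℝ} (h0 : 0 < s) {y : ℝ} :
    ∫ t in Ioi y, cutD s t = 1 - cut s y := by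
  refine integral_Ioi_of_hasDerivAt_of_nonneg' (fun t _ => hasDerivAt_cut s t)
    (fun t _ => cutD_nonneg h0 t) ?_
  refine tendsto_const_nhds.congr' ?_
  filter_upwards [eventually_ge_atTop (2 * s)] with t ht using (cut_eq_one h0 ht).symm

theorem mul_tail_le {f : Pt n → ℝ} (hf : NN f) {s : ℝ} (h0 : 0 < s) (p : Pt n) :
    2 * (f p * tail (fun q => cutD s q.2 * f q) p)
      ≤ (1 - cut s p.2) * f p ^ 2 + tail (fun q => cutD s q.2 * (f q * f q)) p := by
  have hk : IntegrableOn (fun t => cutD s t) (Ioi p.2) := by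
    by_contra h
    have h1 := integral_undef h
    have h2 := integral_cutD_Ioi h0 (y := p.2)
    rw [h1] at h2
    refine h (integrableOn_Ioi_deriv_of_nonneg' (fun t _ => hasDerivAt_cut s t)
      (fun t _ => cutD_nonneg h0 t) (l := 1) ?_)
    refine tendsto_const_nhds.congr' ?_
    filter_upwards [eventually_ge_atTop (2 * s)] with t ht using (cut_eq_one h0 ht).symm
  have h1 := (tail_cutD_int hf.smoothUp hf.supp h0 p.1).integrableOn (s := Ioi p.2)
  have h2 := (tail_cutD_int (hf.mul hf).smoothUp (hf.mul hf).supp h0 p.1).integrableOn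
    (s := Ioi p.2)
  have h3 : 0 ≤ ∫ t in Ioi p.2, (f p ^ 2 * cutD s t - 2 * f p * (cutD s t * f (p.1, t))
      + cutD s t * (f (p.1, t) * f (p.1, t))) := by
    refine integral_nonneg fun t => ?_
    have := mul_nonneg (cutD_nonneg h0 t) (sq_nonneg (f p - f (p.1, t)))
    simp only [Pi.zero_apply]
    nlinarith
  have e := integral_add ((hk.const_mul (f p ^ 2)).sub (h1.const_mul (2 * f p))) h2
  simp only [Pi.sub_apply] at e
  rw [e, integral_sub (hk.const_mul _) (h1.const_mul _), integral_const_mul, integral_const_mul,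
    integral_cutD_Ioi h0] at h3
  unfold tail
  simp only
  linarith

theorem integral_mul_sub_top_ge (hb : -1 < b) {f : Pt n → ℝ} (hf : NN f) {s : ℝ} (h0 : 0 < s) :
    1 / 2 * ∫ p, avgW b s p.2 * f p ^ 2 ∂wt n b ≤ ∫ p, f p * (f p - top s f p) ∂wt n b := by
  have hff := hf.mul hf
  have hg := nn_cutD_mul hff.smoothUp hff.supp h0
  have hT : NN (tail fun q : Pt n => cutD s q.2 * (f q * f q)) :=
    hg.tail h0 fun x y hy => by simp [cutD_eq_zero_left h0 hy]
  have hi1 := hT.bc.integrable hb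
  have hK : NN fun q : Pt n => cut s q.2 * (f q * f q) := NN.cut_mul hff.smoothUp hff.supp h0
  have hi2 : Integrable (fun p : Pt n => (1 - cut s p.2) * f p ^ 2) (wt n b) := by
    refine ((hff.sub hK).bc.integrable hb).congr (ae_of_all _ fun p => ?_)
    simp only; ring
  have hi3 : Integrable (fun p : Pt n => p.2 * cutD s p.2 / (1 + b) * (f p * f p)) (wt n b) := by
    have : NN fun p : Pt n => p.2 * (cutD s p.2 * (f p * f p)) := by
      refine ⟨contDiff_snd.mul hg.smooth, BddSupp.mul_left hg.supp, s, h0, fun x y hy => ?_⟩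
      simp [cutD_eq_zero_left h0 hy]
    refine ((this.bc.integrable hb).const_mul (1 / (1 + b))).congr (ae_of_all _ fun p => ?_)
    simp only; ring
  have hi4 := (hf.mul (hf.sub (NN.top hf.smoothUp hf.supp h0))).bc.integrable hb
  have e : ∫ p, avgW b s p.2 * f p ^ 2 ∂wt n b
      = ∫ p, ((1 - cut s p.2) * f p ^ 2 - tail (fun q => cutD s q.2 * (f q * f q)) p) ∂wt n b := by
    rw [integral_sub hi2 hi1, integral_tail_cutD hb hff h0, ← integral_sub hi2 hi3]
    refine integral_congr_ae (ae_of_all _ fun p => ?_)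
    simp only [avgW]; ring
  rw [e, ← integral_const_mul]
  refine integral_mono_ae ((hi2.sub hi1).const_mul _) hi4 (ae_of_all _ fun p => ?_)
  have := mul_tail_le hf h0 p
  simp only [top]
  nlinarith

instance : SFinite (wt n b) := by unfold wt; infer_instance

theorem shift_sub_sq_le {f : Pt n → ℝ} (hf : NN f) (i : Fin n) (h : ℝ) (p : Pt n) :
    (shift (EuclideanSpace.single i h) f p - f p) ^ 2 ≤
      h ^ 2 * ∫ t in Icc (0 : ℝ) 1,
        shift (EuclideanSpace.single i (t * h)) (pd (some i) f) p ^ 2 := by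
  have hq := hf.pd (some i)
  have hd : ∀ t : ℝ, HasDerivAt (fun t : ℝ => shift (EuclideanSpace.single i (t * h)) f p)
      (h * shift (EuclideanSpace.single i (t * h)) (pd (some i) f) p) t := by
    intro t
    have hl : HasDerivAt (fun t : ℝ => ((p.1 + EuclideanSpace.single i (t * h), p.2) : Pt n))
        (h • dir (some i)) t := by
      have h1 : HasDerivAt (fun t : ℝ => p + t • (h • (dir (some i) : Pt n)))
          (h • dir (some i)) t := by
        simpa using ((hasDerivAt_id t).smul_const (h • (dir (some i) : Pt n))).const_add p
      convert h1 using 2 with t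
      simp only [dir]
      ext j
      · simp
      · simp
    have := ((hf.differentiableAt
      (p.1 + EuclideanSpace.single i (t * h), p.2)).hasFDerivAt.comp_hasDerivAt t hl)
    simpa [shift, pd, Function.comp_def] using this
  have hc : Continuous fun t : ℝ => shift (EuclideanSpace.single i (t * h)) (pd (some i) f) p := by
    have hc' : Continuous fun t : ℝ => (EuclideanSpace.single i (t * h) :
        EuclideanSpace ℝ (Fin n)) := by
      have : (fun t : ℝ => (EuclideanSpace.single i (t * h) : EuclideanSpace ℝ (Fin n)))
        = fun t => t • EuclideanSpace.single i h := by
          funext t; ext j; simp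
      rw [this]; fun_prop
    unfold shift
    exact hq.continuous.comp (by fun_prop)
  have h1 := intervalIntegral.integral_eq_sub_of_hasDerivAt (a := 0) (b := 1)
    (fun t _ => hd t) ((hc.const_mul h).intervalIntegrable _ _)
  have h2 : shift (EuclideanSpace.single i h) f p - f p
      = h * ∫ t in (0:ℝ)..1, shift (EuclideanSpace.single i (t * h)) (pd (some i) f) p := by
    rw [← intervalIntegral.integral_const_mul, h1]
    have : (EuclideanSpace.single i 0 : EuclideanSpace ℝ (Fin n)) = 0 := by ext j; simp
    simp [shift, this]
  rw [h2, mul_pow, intervalIntegral.integral_of_le zero_le_one, ← integral_Icc_eq_integral_Ioc]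
  refine mul_le_mul_of_nonneg_left ?_ (sq_nonneg h)
  have : IsProbabilityMeasure ((volume : Measure ℝ).restrict (Icc 0 1)) := ⟨by simp⟩
  have := ConvexOn.map_integral_le (μ := (volume : Measure ℝ).restrict (Icc 0 1))
    (f := fun t => shift (EuclideanSpace.single i (t * h)) (pd (some i) f) p)
    (g := fun x : ℝ => x ^ 2) (s := univ) (even_two.convexOn_pow) (by fun_prop) isClosed_univ
    (by simp) hc.integrableOn_Icc (hc.pow 2).integrableOn_Icc
  exact this

theorem integrable_prod_shift_sq (hb : -1 < b) {q : Pt n → ℝ} (hq : NN q) (i : Fin n) (h : ℝ) :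
    Integrable (fun z : Pt n × ℝ => shift (EuclideanSpace.single i (z.2 * h)) q z.1 ^ 2)
      ((wt n b).prod (volume.restrict (Icc 0 1))) := by
  have hsc : Continuous fun z : Pt n × ℝ =>
      shift (EuclideanSpace.single i (z.2 * h)) q z.1 ^ 2 := by
    have : ∀ t : ℝ, (EuclideanSpace.single i (t * h) : EuclideanSpace ℝ (Fin n))
        = t • EuclideanSpace.single i h := fun t => by ext j; simp
    unfold shift
    simp only [this]
    exact (hq.continuous.comp (by fun_prop)).pow 2
  rw [integrable_prod_iff' hsc.aestronglyMeasurable]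
  refine ⟨ae_of_all _ fun t =>
    ((hq.shift (EuclideanSpace.single i (t * h))).memLp hb).integrable_sq, ?_⟩
  have : ∀ v, ∫ p, ‖shift v q p ^ 2‖ ∂wt n b = ∫ p, ‖q p ^ 2‖ ∂wt n b :=
    fun v => integral_shift v fun p => ‖q p ^ 2‖
  simp only [this]
  exact integrable_const _

theorem l2_shift_sub_le (hb : -1 < b) {f : Pt n → ℝ} (hf : NN f) (i : Fin n) (h : ℝ) :
    l2 n b (fun p => shift (EuclideanSpace.single i h) f p - f p)
      ≤ |h| * l2 n b (pd (some i) f) := by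
  have hq := hf.pd (some i)
  have hprod := integrable_prod_shift_sq hb hq i h
  have hsq : ∀ v, ∫ p, shift v (pd (some i) f) p ^ 2 ∂wt n b = ∫ p, pd (some i) f p ^ 2 ∂wt n b :=
    fun v => integral_shift v fun p => pd (some i) f p ^ 2
  have hle : ∫ p, (shift (EuclideanSpace.single i h) f p - f p) ^ 2 ∂wt n b ≤
      h ^ 2 * ∫ p, pd (some i) f p ^ 2 ∂wt n b := by
    refine (integral_mono ((((hf.shift _).sub hf).memLp hb).integrable_sq)
      (hprod.integral_prod_left.const_mul (h ^ 2)) (shift_sub_sq_le hf i h)).trans_eq ?_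
    rw [integral_const_mul, integral_integral_swap hprod]
    simp [hsq]
  calc _ ≤ √(h ^ 2 * ∫ p, pd (some i) f p ^ 2 ∂wt n b) := Real.sqrt_le_sqrt hle
    _ = _ := by rw [Real.sqrt_mul (sq_nonneg h), Real.sqrt_sq_eq_abs]; rfl

end

section

variable {n : ℕ} {b : ℝ}

/-- Vertical weight whose derivative is `y (1 - cut s y) (cut e y) / (1 + b)`. -/
def osc (b s e y : ℝ) : ℝ := ∫ t in (0 : ℝ)..y, t * (1 - cut s t) * cut e t / (1 + b)

theorem contDiff_osc_integrand (b s e : ℝ) :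
    ContDiff ℝ ∞ fun t => t * (1 - cut s t) * cut e t / (1 + b) :=
  ((contDiff_id.mul (contDiff_const.sub (contDiff_cut s))).mul (contDiff_cut e)).div_const _

theorem hasDerivAt_osc (b s e y : ℝ) :
    HasDerivAt (osc b s e) (y * (1 - cut s y) * cut e y / (1 + b)) y :=
  intervalIntegral.integral_hasDerivAt_right
    ((contDiff_osc_integrand b s e).continuous.intervalIntegrable _ _)
    ((contDiff_osc_integrand b s e).continuous.stronglyMeasurableAtFilter _ _)
    (contDiff_osc_integrand b s e).continuous.continuousAt

theorem contDiff_osc (b s e : ℝ) : ContDiff ℝ ∞ (osc b s e) := by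
  rw [contDiff_infty_iff_deriv]
  refine ⟨fun y => (hasDerivAt_osc b s e y).differentiableAt, ?_⟩
  rw [show deriv (osc b s e) = fun t => t * (1 - cut s t) * cut e t / (1 + b) from
    funext fun y => (hasDerivAt_osc b s e y).deriv]
  exact contDiff_osc_integrand b s e

theorem osc_eq_zero {s e y : ℝ} (he : 0 < e) (hy : y ≤ e) : osc b s e y = 0 := by
  unfold osc
  rw [intervalIntegral.integral_congr (g := fun _ => (0 : ℝ)), intervalIntegral.integral_zero]
  intro t ht
  have : t ≤ e := ht.2.trans (max_le he.le hy)
  simp [cut_eq_zero he this]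

theorem osc_integrand_nonneg (hb : -1 < b) {s e : ℝ} (he : 0 < e) (t : ℝ) :
    0 ≤ t * (1 - cut s t) * cut e t / (1 + b) := by
  have hb' : 0 < 1 + b := by linarith
  rcases le_or_gt t e with h | h
  · simp [cut_eq_zero he h]
  · have := sub_nonneg.2 (cut_le_one s t)
    have := cut_nonneg e t
    have := he.trans h
    positivity

theorem monotone_osc (hb : -1 < b) {s e : ℝ} (he : 0 < e) : Monotone (osc b s e) :=
  monotone_of_deriv_nonneg (fun y => (hasDerivAt_osc b s e y).differentiableAt) fun y => by
    rw [(hasDerivAt_osc b s e y).deriv]; exact osc_integrand_nonneg hb he y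

theorem osc_nonneg (hb : -1 < b) {s e : ℝ} (he : 0 < e) (y : ℝ) : 0 ≤ osc b s e y := by
  rcases le_or_gt y e with h | h
  · rw [osc_eq_zero he h]
  · rw [← osc_eq_zero (b := b) (s := s) he le_rfl]; exact monotone_osc hb he h.le

theorem osc_le (hb : -1 < b) {s e : ℝ} (hs : 0 < s) (he : 0 < e) (y : ℝ) :
    osc b s e y ≤ 4 * s ^ 2 / (1 + b) := by
  have hb' : 0 < 1 + b := by linarith
  have h1 : osc b s e (2 * s) ≤ 4 * s ^ 2 / (1 + b) := by
    have := intervalIntegral.norm_integral_le_of_norm_le_const (a := 0) (b := 2 * s)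
      (C := 2 * s / (1 + b)) (f := fun t => t * (1 - cut s t) * cut e t / (1 + b)) fun t ht => by
        rw [uIoc_of_le (by positivity)] at ht
        rw [Real.norm_of_nonneg (osc_integrand_nonneg hb he t)]
        have h1 := sub_nonneg.2 (cut_le_one s t)
        have h2 := cut_nonneg e t
        have h3 : (1 - cut s t) * cut e t ≤ 1 :=
          mul_le_one₀ (by linarith [cut_nonneg s t]) h2 (cut_le_one e t)
        refine div_le_div_of_nonneg_right ?_ hb'.le
        rw [mul_assoc]
        exact (mul_le_of_le_one_right ht.1.le h3).trans ht.2
    refine (le_abs_self _).trans (this.trans_eq ?_)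
    rw [sub_zero, abs_of_pos (by positivity)]; ring
  rcases le_total y (2 * s) with h | h
  · exact (monotone_osc hb he h).trans h1
  · refine le_trans (le_of_eq ?_) h1
    have hi := (contDiff_osc_integrand b s e).continuous.intervalIntegrable (μ := volume)
    have := intervalIntegral.integral_add_adjacent_intervals (hi 0 (2 * s)) (hi (2 * s) y)
    unfold osc
    rw [← this, intervalIntegral.integral_congr (a := 2 * s) (b := y) (g := fun _ => (0 : ℝ))]
    · simp
    · intro t ht
      rw [uIcc_of_le h] at ht
      simp [cut_eq_one hs ht.1]

/-- The zeroth order weight in the vertical integration by parts against `osc`. -/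
def oscB (b s e y : ℝ) : ℝ := avgW b s y * cut e y + y * (1 - cut s y) * cutD e y / (1 + b)

theorem continuous_oscB (b s e : ℝ) : Continuous (oscB b s e) := by
  have := (contDiff_cut s).continuous
  have := (contDiff_cut e).continuous
  have := (contDiff_cutD e).continuous
  have := continuous_avgW b s
  unfold oscB; fun_prop

def oscC (b : ℝ) : ℝ := 1 + 4 * stepC / (1 + b)

theorem mul_cutD_le {s y : ℝ} (hs : 0 < s) : y * cutD s y ≤ 2 * stepC := by
  have h1 := one_le_stepC
  rcases le_or_gt (2 * s) y with h | h
  · rw [cutD_eq_zero_right hs h]; linarith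
  · calc y * cutD s y ≤ (2 * s) * (stepC / s) :=
        mul_le_mul h.le (cutD_le hs y) (cutD_nonneg hs y) (by positivity)
      _ = _ := by field_simp

theorem abs_avgW_le (hb : -1 < b) {s y : ℝ} (hs : 0 < s) (hy : 0 < y) :
    |avgW b s y| ≤ 1 + 2 * stepC / (1 + b) := by
  have hb' : 0 < 1 + b := by linarith
  have h1 := mul_cutD_le (y := y) hs
  have h2 := mul_nonneg hy.le (cutD_nonneg hs y)
  have h3 : y * cutD s y / (1 + b) ≤ 2 * stepC / (1 + b) := by gcongr
  have h4 : 0 ≤ y * cutD s y / (1 + b) := by positivity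
  unfold avgW
  rw [abs_le]; constructor <;> linarith [cut_nonneg s y, cut_le_one s y]

theorem abs_oscB_le (hb : -1 < b) {s e y : ℝ} (hs : 0 < s) (he : 0 < e) (hy : 0 < y) :
    |oscB b s e y| ≤ oscC b := by
  have hb' : 0 < 1 + b := by linarith
  have h1 := mul_cutD_le (y := y) he
  have h2 := mul_nonneg hy.le (cutD_nonneg he y)
  have h0 := sub_nonneg.2 (cut_le_one s y)
  have h3 : |y * (1 - cut s y) * cutD e y / (1 + b)| ≤ 2 * stepC / (1 + b) := by
    rw [abs_div, abs_of_pos hb']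
    gcongr
    rw [show y * (1 - cut s y) * cutD e y = (1 - cut s y) * (y * cutD e y) by ring,
      abs_of_nonneg (by positivity)]
    exact (mul_le_of_le_one_left h2 (by linarith [cut_nonneg s y])).trans h1
  have h4 : |avgW b s y * cut e y| ≤ 1 + 2 * stepC / (1 + b) := by
    rw [abs_mul, abs_of_nonneg (cut_nonneg e y)]
    exact (mul_le_of_le_one_right (abs_nonneg _) (cut_le_one e y)).trans (abs_avgW_le hb hs hy)
  unfold oscB oscC
  refine (abs_add_le _ _).trans ((add_le_add h4 h3).trans_eq ?_)
  ring

theorem integral_osc_deriv (hb : -1 < b) {g : Pt n → ℝ} (hg : NN g) {s e : ℝ} (he : 0 < e) :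
    ∫ p, p.2 * (1 - cut s p.2) * cut e p.2 / (1 + b) * (g p * pd none g p) ∂wt n b
      = -(1 / 2) * ∫ p, oscB b s e p.2 * g p ^ 2 ∂wt n b := by
  have hb' : 1 + b ≠ 0 := by linarith
  set w : ℝ → ℝ := fun t => t * (1 - cut s t) * cut e t / (1 + b) with hw
  have hwc := contDiff_osc_integrand b s e
  have hwz : ∀ y, y ≤ e → w y = 0 := fun y hy => by simp [hw, cut_eq_zero he hy]
  have hws : ∀ y, y ≤ e → w y = w 0 := fun y hy => by rw [hwz y hy, hwz 0 he.le]
  have hwd : ∀ y, HasDerivAt w (((1 - cut s y) * cut e y - y * cutD s y * cut e y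
      + y * (1 - cut s y) * cutD e y) / (1 + b)) y := fun y => by
    have := (((hasDerivAt_id y).mul ((hasDerivAt_cut s y).const_sub 1)).mul
      (hasDerivAt_cut e y)).div_const (1 + b)
    refine this.congr_deriv ?_
    simp only [id, Pi.mul_apply]; ring
  have hH : NN fun p => w p.2 * (g p * g p) := (hg.mul hg).mul_height hwc he hws
  have h1 : NN fun p => w p.2 * (g p * pd none g p) := (hg.mul (hg.pd none)).mul_height hwc he hws
  have hpt : ∀ p : Pt n, 0 < p.2 → pd none (fun p : Pt n => w p.2 * (g p * g p)) p
      + b / p.2 * (w p.2 * (g p * g p))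
      = 2 * (w p.2 * (g p * pd none g p)) + oscB b s e p.2 * g p ^ 2 := by
    intro p hp
    have hd : DifferentiableAt ℝ (fun q : Pt n => w q.2) p :=
      ((hwc.comp contDiff_snd).differentiable (by simp)) p
    rw [pd_mul hd
      ((hg.mul hg).differentiableAt p), pd_mul (hg.differentiableAt p) (hg.differentiableAt p),
      pd_none_height (hwd p.2).differentiableAt, (hwd p.2).deriv]
    simp only [hw, oscB, avgW]
    field_simp
    ring
  have hi1 := (h1.bc.integrable hb).const_mul 2
  have hcB : BC fun p : Pt n => (g p * g p) * oscB b s e p.2 := by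
    refine BC.of_vanish ((hg.mul hg).continuous.mul
      ((continuous_oscB b s e).comp continuous_snd)).continuousOn
      (BddSupp.mul_right (hg.mul hg).supp) he fun x y _ hy => ?_
    simp [oscB, cut_eq_zero he hy.le, cutD_eq_zero_left he hy.le]
  have hi2 : Integrable (fun p : Pt n => oscB b s e p.2 * g p ^ 2) (wt n b) :=
    (hcB.integrable hb).congr (ae_of_all _ fun p => by simp only; ring)
  have key := integral_vert (b := b) (H := fun p : Pt n => w p.2 * (g p * g p))
    (fun p _ => hH.differentiableAt p)
    ((hi1.add hi2).congr (ae_wt_of_forall fun p hp => (hpt p hp).symm)) hH.supp fun x => ?_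
  · rw [integral_congr_ae (ae_wt_of_forall hpt), integral_add hi1 hi2, integral_const_mul] at key
    linarith
  · refine tendsto_const_nhds.congr' ?_
    filter_upwards [Ioo_mem_nhdsGT he] with y hy
    simp [hwz y hy.2.le]

theorem gd_shift (v : EuclideanSpace ℝ (Fin n)) (f g : Pt n → ℝ) :
    gd (shift v f) (shift v g) = shift v (gd f g) := by
  funext p; simp only [gd, pd_shift]; rfl

theorem shift_neg_shift (v : EuclideanSpace ℝ (Fin n)) (f : Pt n → ℝ) :
    shift (-v) (shift v f) = f := by
  funext p; simp [shift]

theorem integral_gd_shift_sub (hb : -1 < b) {f F : Pt n → ℝ} (hf : NN f) (hF : NN F)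
    (v : EuclideanSpace ℝ (Fin n)) :
    ∫ p, gd f (fun q => shift (-v) F q - F q) p ∂wt n b
      = ∫ p, gd (fun q => shift v f q - f q) F p ∂wt n b := by
  have h1 : ∀ p, gd f (fun q => shift (-v) F q - F q) p = gd f (shift (-v) F) p - gd f F p :=
    fun p => gd_sub_right ((hF.shift _).differentiableAt p) (hF.differentiableAt p)
  have h2 : ∀ p, gd (fun q => shift v f q - f q) F p = gd (shift v f) F p - gd f F p :=
    fun p => gd_sub_left ((hf.shift _).differentiableAt p) (hf.differentiableAt p)
  simp only [h1, h2]
  rw [integral_sub ((hf.gd_bc (hF.shift _)).integrable hb) ((hf.gd_bc hF).integrable hb),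
    integral_sub (((hf.shift _).gd_bc hF).integrable hb) ((hf.gd_bc hF).integrable hb)]
  congr 1
  rw [← integral_shift (-v) (gd (shift v f) F), ← gd_shift, shift_neg_shift]

theorem gd_height_mul {g : Pt n → ℝ} (hg : NN g) {w : ℝ → ℝ} (hw : Differentiable ℝ w) (p : Pt n) :
    gd g (fun q => w q.2 * g q) p = w p.2 * gd g g p + deriv w p.2 * (g p * pd none g p) := by
  have hd : DifferentiableAt ℝ (fun q : Pt n => w q.2) p :=
    (hw.comp differentiable_snd) p
  simp only [gd, Fintype.sum_option, pd_mul hd (hg.differentiableAt p), pd_none_height (hw p.2),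
    pd_some_height, mul_add, Finset.mul_sum]
  rw [Finset.sum_congr rfl fun i _ => show pd (some i) g p * (w p.2 * pd (some i) g p)
    + pd (some i) g p * (0 * g p) = w p.2 * (pd (some i) g p * pd (some i) g p) by ring]
  ring

theorem form_shift (lam : ℝ) (v : EuclideanSpace ℝ (Fin n)) (f : Pt n → ℝ) :
    form n b lam (shift v f) (shift v f) = form n b lam f f := by
  unfold form
  rw [gd_shift]
  exact integral_shift v fun p => gd f f p + lam * (f p * f p)

theorem form_sub_self_le (hb : -1 < b) {lam : ℝ} (hl : 0 ≤ lam) {f g : Pt n → ℝ} (hf : NN f)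
    (hg : NN g) : form n b lam (fun p => f p - g p) (fun p => f p - g p)
      ≤ 2 * form n b lam f f + 2 * form n b lam g g := by
  have h := form_self_nonneg (b := b) hl (fun p => f p + g p)
  rw [form_sub_left hb lam hf hg (hf.sub hg), form_comm lam f, form_comm lam g,
    form_sub_left hb lam hf hg hf, form_sub_left hb lam hf hg hg]
  rw [form_add_left hb lam hf hg (hf.add hg), form_comm lam f, form_comm lam g,
    form_add_left hb lam hf hg hf, form_add_left hb lam hf hg hg] at h
  rw [form_comm lam g f] at *
  linarith

theorem form_height_mul_le (hb : -1 < b) {lam : ℝ} (hl : 1 ≤ lam) {w : ℝ → ℝ}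
    (hw : ContDiff ℝ ∞ w) {r : ℝ} (hr : 0 < r) (hwr : ∀ y, y ≤ r → w y = w 0) {C D : ℝ}
    (hC : ∀ y, 0 < y → |w y| ≤ C) (hD : ∀ y, 0 < y → |deriv w y| ≤ D) {f : Pt n → ℝ} (hf : NN f) :
    form n b lam (fun p => w p.2 * f p) (fun p => w p.2 * f p)
      ≤ (2 * C ^ 2 + 2 * D ^ 2) * form n b lam f f := by
  have hwd : Differentiable ℝ w := hw.differentiable (by simp)
  have hwf := hf.mul_height hw hr hwr
  unfold form
  rw [← integral_const_mul]
  refine integral_mono_ae (form_int hb lam hwf hwf) ((form_int hb lam hf hf).const_mul _)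
    (ae_wt_of_forall fun p hp => ?_)
  have hd : DifferentiableAt ℝ (fun q : Pt n => w q.2) p := (hwd.comp differentiable_snd) p
  have h1 : w p.2 ^ 2 ≤ C ^ 2 := sq_le_sq' (by linarith [(abs_le.1 (hC _ hp)).1])
    (abs_le.1 (hC _ hp)).2
  have h2 : deriv w p.2 ^ 2 ≤ D ^ 2 := sq_le_sq' (by linarith [(abs_le.1 (hD _ hp)).1])
    (abs_le.1 (hD _ hp)).2
  simp only [gd, Fintype.sum_option, pd_mul hd (hf.differentiableAt p), pd_none_height (hwd p.2),
    pd_some_height]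
  have h3 : ∑ i, (w p.2 * pd (some i) f p + 0 * f p) * (w p.2 * pd (some i) f p + 0 * f p)
      = w p.2 ^ 2 * ∑ i, pd (some i) f p * pd (some i) f p := by
    rw [Finset.mul_sum]; exact Finset.sum_congr rfl fun i _ => by ring
  rw [h3]
  have h4 : 0 ≤ ∑ i, pd (some i) f p * pd (some i) f p :=
    Finset.sum_nonneg fun i _ => mul_self_nonneg _
  set S := ∑ i, pd (some i) f p * pd (some i) f p
  have h5 := mul_le_mul_of_nonneg_right h1 h4
  have h6 := mul_le_mul_of_nonneg_right h1 (sq_nonneg (pd none f p))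
  have h7 := mul_le_mul_of_nonneg_right h2 (sq_nonneg (f p))
  have h8 := mul_le_mul_of_nonneg_right h1 (sq_nonneg (f p))
  have h9 : (1:ℝ) * (D ^ 2 * f p ^ 2) ≤ lam * (D ^ 2 * f p ^ 2) := by gcongr
  have h10 := mul_le_mul_of_nonneg_left h8 (show 0 ≤ lam by linarith)
  have h11 : 0 ≤ lam * (D ^ 2 * f p ^ 2) := by positivity
  have h12 : 0 ≤ lam * (C ^ 2 * f p ^ 2) := by positivity
  have h13 : 0 ≤ C ^ 2 * S := by positivity
  have h14 : 0 ≤ D ^ 2 * S := by positivity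
  have h15 : 0 ≤ D ^ 2 * pd none f p ^ 2 := by positivity
  nlinarith [sq_nonneg (w p.2 * pd none f p - deriv w p.2 * f p)]

end

section

variable {n : ℕ} {b lam : ℝ}

/-- A Cauchy sequence of approximate solutions of `-div (y^b ∇p) = y^b R + μ`, where `μ` lives on
the boundary. -/
structure Approx (n : ℕ) (b lam : ℝ) (p R : ℕ → Pt n → ℝ) (M : ℝ) (μ : (Pt n → ℝ) → ℝ)
    (ε : ℕ → ℝ) : Prop where
  nn : ∀ k, NN (p k)
  memR : ∀ k, MemLp (R k) 2 (wt n b)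
  l2R : ∀ k, l2 n b (R k) ≤ M
  en_le : ∀ k, en n b lam (p k) ≤ M
  err : ∀ k φ, NN φ →
    |μ φ - (∫ q, gd (p k) φ q ∂wt n b - ∫ q, R k q * φ q ∂wt n b)| ≤ ε k * en n b lam φ
  cauchy : ∀ k j, k ≤ j → en n b lam (fun q => p j q - p k q) ≤ ε k
  eps_nonneg : ∀ k, 0 ≤ ε k
  tendsto : Tendsto ε atTop (𝓝 0)
  map_add : ∀ φ ψ, NN φ → NN ψ → μ (fun q => φ q + ψ q) = μ φ + μ ψ
  map_smul : ∀ (c : ℝ) φ, NN φ → μ (fun q => c * φ q) = c * μ φ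
  vanish : ∀ φ, NN φ → (∃ r, 0 < r ∧ ∀ x y, y ≤ r → φ (x, y) = 0) → μ φ = 0

theorem shift_diff_nn {f : Pt n → ℝ} (hf : NN f) (v : EuclideanSpace ℝ (Fin n)) :
    NN (fun q => shift v f q - f q) := (hf.shift v).sub hf

theorem osc_test (hb : -1 < b) {s e h : ℝ} (hs : 0 < s) (he : 0 < e) (i : Fin n) {f R : Pt n → ℝ}
    (hf : NN f) (hR : MemLp R 2 (wt n b)) {g φ : Pt n → ℝ}
    (hg : g = fun q => shift (EuclideanSpace.single i h) f q - f q)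
    (hφ : φ = fun q => shift (-EuclideanSpace.single i h) (fun q => osc b s e q.2 * g q) q
      - osc b s e q.2 * g q) :
    |∫ q, R q * φ q ∂wt n b| - ∫ q, gd f φ q ∂wt n b
      ≤ 1 / 2 * ∫ q, oscB b s e q.2 * g q ^ 2 ∂wt n b
        + 1 / 4 * (l2 n b R * |h|) ^ 2 * (4 * s ^ 2 / (1 + b)) := by
  set v : EuclideanSpace ℝ (Fin n) := EuclideanSpace.single i h with hv
  have hgn : NN g := hg ▸ shift_diff_nn hf v
  have hz : ∀ y, y ≤ e → osc b s e y = osc b s e 0 := fun y hy => by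
    rw [osc_eq_zero he hy, osc_eq_zero he he.le]
  have hF := hgn.mul_height (contDiff_osc b s e) he hz
  have hod : Differentiable ℝ (osc b s e) := (contDiff_osc b s e).differentiable (by simp)
  have hφn : NN φ := hφ ▸ shift_diff_nn hF (-v)
  have hgg : NN (fun p => osc b s e p.2 * gd g g p) := by
    have h1 : NN (gd g g) := by
      have : ∀ t : Finset (Option (Fin n)), NN (fun p => ∑ j ∈ t, pd j g p * pd j g p) := by
        intro t
        induction t using Finset.induction_on with
        | empty => simpa using NN.zero
        | insert a t ha ih =>
          simp only [Finset.sum_insert ha]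
          exact ((hgn.pd a).mul (hgn.pd a)).add ih
      exact this Finset.univ
    exact h1.mul_height (contDiff_osc b s e) he hz
  have hgy : NN (fun p : Pt n => p.2 * (1 - cut s p.2) * cut e p.2 / (1 + b)
      * (g p * pd none g p)) :=
    (hgn.mul (hgn.pd none)).mul_height (contDiff_osc_integrand b s e) he fun y hy => by
      simp [cut_eq_zero he hy]
  have h1 : ∫ q, gd f φ q ∂wt n b = ∫ q, osc b s e q.2 * gd g g q ∂wt n b
      - 1 / 2 * ∫ q, oscB b s e q.2 * g q ^ 2 ∂wt n b := by
    rw [hφ, integral_gd_shift_sub hb hf hF v, ← hg]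
    simp only [gd_height_mul hgn hod, (hasDerivAt_osc b s e _).deriv]
    rw [integral_add (hgg.bc.integrable hb) (hgy.bc.integrable hb), integral_osc_deriv hb hgn he]
    ring
  have h2 : l2 n b φ ≤ |h| * l2 n b (pd (some i) fun q => osc b s e q.2 * g q) := by
    have hn : -v = EuclideanSpace.single i (-h) := by
      rw [hv]
      ext j
      simp [PiLp.single_apply]
      split_ifs <;> simp
    have := l2_shift_sub_le hb hF i (-h)
    rw [abs_neg, ← hn] at this
    rw [hφ]; exact this
  have h3 : l2 n b (pd (some i) fun q => osc b s e q.2 * g q) ^ 2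
      ≤ 4 * s ^ 2 / (1 + b) * ∫ q, osc b s e q.2 * gd g g q ∂wt n b := by
    rw [l2_sq, ← integral_const_mul]
    refine integral_mono ((hF.pd (some i)).memLp hb).integrable_sq
      ((hgg.bc.integrable hb).const_mul _) fun p => ?_
    have hd : DifferentiableAt ℝ (fun q : Pt n => osc b s e q.2) p :=
      (hod.comp differentiable_snd) p
    simp only
    rw [pd_mul hd (hgn.differentiableAt p), pd_some_height]
    have h4 : pd (some i) g p ^ 2 ≤ gd g g p := by
      have := Finset.single_le_sum (f := fun j => pd j g p * pd j g p)
        (fun j _ => mul_self_nonneg _) (Finset.mem_univ (some i))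
      simpa [gd, sq] using this
    have h5 := osc_nonneg (s := s) hb he p.2
    have h6 := osc_le hb hs he p.2
    have hb' : 0 < 1 + b := by linarith
    calc (osc b s e p.2 * pd (some i) g p + 0 * g p) ^ 2
        = osc b s e p.2 * (osc b s e p.2 * pd (some i) g p ^ 2) := by ring
      _ ≤ _ := by
        refine mul_le_mul h6 (mul_le_mul_of_nonneg_left h4 h5)
          (mul_nonneg h5 (sq_nonneg _)) (by positivity)
  set A := ∫ q, osc b s e q.2 * gd g g q ∂wt n b
  set S := 4 * s ^ 2 / (1 + b)
  set L := l2 n b (pd (some i) fun q => osc b s e q.2 * g q)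
  have hS : 0 < S := by have : 0 < 1 + b := by linarith
                        positivity
  have h4 : |∫ q, R q * φ q ∂wt n b| ≤ l2 n b R * |h| * L := by
    refine (abs_integral_mul_le hR (hφn.memLp hb)).trans ?_
    rw [mul_assoc]
    exact mul_le_mul_of_nonneg_left h2 (l2_nonneg _)
  have h5 : l2 n b R * |h| * L ≤ 1 / 4 * (l2 n b R * |h|) ^ 2 * S + A := by
    have : L ^ 2 / S ≤ A := by rw [div_le_iff₀ hS]; linarith
    have h7 : 0 ≤ (l2 n b R * |h| / 2 * S - L) ^ 2 / S := by positivity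
    have h8 : (l2 n b R * |h| / 2 * S - L) ^ 2 / S
      = 1 / 4 * (l2 n b R * |h|) ^ 2 * S - l2 n b R * |h| * L + L ^ 2 / S := by field_simp; ring
    linarith
  rw [h1]
  linarith

theorem abs_integral_sq_sub_le (hb : -1 < b) {B : ℝ → ℝ} {C : ℝ} (hB : Continuous B)
    (hC : ∀ y, 0 < y → |B y| ≤ C) {f g : Pt n → ℝ} (hf : NN f) (hg : NN g) :
    |∫ p, B p.2 * f p ^ 2 ∂wt n b - ∫ p, B p.2 * g p ^ 2 ∂wt n b|
      ≤ C * (l2 n b (fun p => f p - g p) * (l2 n b f + l2 n b g)) := by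
  have hC0 : 0 ≤ C := (abs_nonneg _).trans (hC 1 one_pos)
  have hc : Continuous fun p : Pt n => B p.2 := hB.comp continuous_snd
  have hi : ∀ {f : Pt n → ℝ}, NN f → Integrable (fun p => B p.2 * f p ^ 2) (wt n b) := by
    intro f hf
    refine (((hf.mul hf).bc.mul_bdd hc.continuousOn fun p hp => hC p.2 hp).integrable hb).congr
      (ae_of_all _ fun p => ?_)
    simp only; ring
  have hd := hf.sub hg
  have hBd : MemLp (fun p => B p.2 * (f p - g p)) 2 (wt n b) := by
    have := (hd.bc.mul_bdd hc.continuousOn fun p hp => hC p.2 hp).memLp hb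
    simpa only [mul_comm] using this
  rw [← integral_sub (hi hf) (hi hg)]
  have e : ∀ p : Pt n, B p.2 * f p ^ 2 - B p.2 * g p ^ 2 = (B p.2 * (f p - g p)) * (f p + g p) :=
    fun p => by ring
  simp only [e]
  refine (abs_integral_mul_le hBd ((hf.add hg).memLp hb)).trans ?_
  rw [← mul_assoc]
  refine mul_le_mul ?_ (l2_add_le (hf.memLp hb) (hg.memLp hb)) (l2_nonneg _)
    (mul_nonneg hC0 (l2_nonneg _))
  have := l2_mono (f := fun p => B p.2 * (f p - g p)) (g := fun p => C * (f p - g p))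
    ((hd.memLp hb).const_mul C) fun p hp => by
      rw [abs_mul, abs_mul, abs_of_nonneg hC0]
      exact mul_le_mul_of_nonneg_right (hC _ hp) (abs_nonneg _)
  rwa [l2_const_mul, abs_of_nonneg hC0] at this

theorem Approx.M_nonneg {p R : ℕ → Pt n → ℝ} {M : ℝ} {μ : (Pt n → ℝ) → ℝ} {ε : ℕ → ℝ}
    (H : Approx n b lam p R M μ ε) : 0 ≤ M := (l2_nonneg _).trans (H.l2R 0)

theorem Approx.diff_quot_ge (hb : -1 < b) (hl : 1 ≤ lam) {p R : ℕ → Pt n → ℝ} {M : ℝ}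
    {μ : (Pt n → ℝ) → ℝ} {ε : ℕ → ℝ} (H : Approx n b lam p R M μ ε) {s e : ℝ} (hs : 0 < s)
    (he : 0 < e) (i : Fin n) (h : ℝ) (k₀ : ℕ) :
    -(h ^ 2 * (2 * (M ^ 2 * s ^ 2 / (1 + b)) + 2 * oscC b * ε k₀ * M)) ≤
      ∫ q, oscB b s e q.2 * (shift (EuclideanSpace.single i h) (p k₀) q - p k₀ q) ^ 2 ∂wt n b := by
  have hl0 : 0 ≤ lam := by linarith
  have hM := H.M_nonneg
  set v : EuclideanSpace ℝ (Fin n) := EuclideanSpace.single i h with hv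
  set g : ℕ → Pt n → ℝ := fun k q => shift v (p k) q - p k q with hg
  have hgn : ∀ k, NN (g k) := fun k => shift_diff_nn (H.nn k) v
  have hz : ∀ y, y ≤ e → osc b s e y = osc b s e 0 := fun y hy => by
    rw [osc_eq_zero he hy, osc_eq_zero he he.le]
  set F : ℕ → Pt n → ℝ := fun k q => osc b s e q.2 * g k q with hF
  have hFn : ∀ k, NN (F k) := fun k => (hgn k).mul_height (contDiff_osc b s e) he hz
  set φ : ℕ → Pt n → ℝ := fun k q => shift (-v) (F k) q - F k q with hφ
  have hφn : ∀ k, NN (φ k) := fun k => shift_diff_nn (hFn k) (-v)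
  set S := 4 * s ^ 2 / (1 + b) with hS
  obtain ⟨D, hD⟩ : ∃ D, ∀ y, 0 < y → |deriv (osc b s e) y| ≤ D := by
    have hc : Continuous fun y => y * (1 - cut s y) * cut e y / (1 + b) :=
      (contDiff_osc_integrand b s e).continuous
    obtain ⟨D, hD⟩ := isCompact_Icc.exists_bound_of_continuousOn
      (hc.continuousOn (s := Icc 0 (2 * s)))
    refine ⟨max D 0, fun y hy => ?_⟩
    rw [(hasDerivAt_osc b s e y).deriv]
    rcases le_or_gt y (2 * s) with hy2 | hy2
    · exact (hD y ⟨hy.le, hy2⟩).trans (le_max_left _ _)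
    · rw [cut_eq_one hs hy2.le]; simp
  obtain ⟨K, hK⟩ : ∃ K, ∀ k, en n b lam (φ k) ≤ K := by
    refine ⟨√(4 * ((2 * S ^ 2 + 2 * D ^ 2) * (4 * M ^ 2))), fun k => Real.sqrt_le_sqrt ?_⟩
    have h1 := form_sub_self_le hb hl0 ((hFn k).shift (-v)) (hFn k)
    rw [form_shift] at h1
    have h2 := form_height_mul_le hb hl (contDiff_osc b s e) he hz (C := S) (D := D)
      (fun y _ => by rw [abs_of_nonneg (osc_nonneg hb he y)]; exact osc_le hb hs he y) hD (hgn k)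
    have h3 := form_sub_self_le hb hl0 ((H.nn k).shift v) (H.nn k)
    rw [form_shift] at h3
    have h4 : form n b lam (p k) (p k) ≤ M ^ 2 := by
      rw [← en_sq hl0]; exact pow_le_pow_left₀ (en_nonneg _ _) (H.en_le k) 2
    have h5 : (2 * S ^ 2 + 2 * D ^ 2) * form n b lam (g k) (g k)
        ≤ (2 * S ^ 2 + 2 * D ^ 2) * (4 * M ^ 2) := by
      refine mul_le_mul_of_nonneg_left ?_ (by positivity)
      linarith
    linarith
  have hlow : ∀ k, - (h ^ 2 * (2 * (M ^ 2 * s ^ 2 / (1 + b)))) - 2 * (ε k * K) ≤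
      ∫ q, oscB b s e q.2 * g k q ^ 2 ∂wt n b := by
    intro k
    have h1 := osc_test hb hs he i (H.nn k) (H.memR k) (h := h) (g := g k) (φ := φ k) rfl rfl
    have h2 := H.err k (φ k) (hφn k)
    rw [H.vanish (φ k) (hφn k) ⟨e, he, fun x y hy => by
      simp [hφ, hF, shift, osc_eq_zero he hy]⟩, zero_sub, abs_neg] at h2
    have h3 := (abs_le.1 h2).2
    have h4 := mul_le_mul_of_nonneg_left (hK k) (H.eps_nonneg k)
    have h5 := le_abs_self (∫ q, R k q * φ k q ∂wt n b)
    have h5' := neg_abs_le (∫ q, R k q * φ k q ∂wt n b)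
    have h6 : (l2 n b (R k) * |h|) ^ 2 ≤ M ^ 2 * h ^ 2 := by
      rw [mul_pow, sq_abs]
      exact mul_le_mul_of_nonneg_right (pow_le_pow_left₀ (l2_nonneg _) (H.l2R k) 2) (sq_nonneg _)
    have h7 : 0 ≤ S := by have : 0 < 1 + b := by linarith
                          positivity
    have h8 := mul_le_mul_of_nonneg_right h6 h7
    have h9 : M ^ 2 * h ^ 2 * S = 4 * (h ^ 2 * (M ^ 2 * s ^ 2 / (1 + b))) := by rw [hS]; ring
    linarith
  have hcmp : ∀ k, k₀ ≤ k → ∫ q, oscB b s e q.2 * g k q ^ 2 ∂wt n b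
      - h ^ 2 * (2 * oscC b * ε k₀ * M) ≤ ∫ q, oscB b s e q.2 * g k₀ q ^ 2 ∂wt n b := by
    intro k hk
    have h1 := abs_integral_sq_sub_le hb (continuous_oscB b s e)
      (fun y hy => abs_oscB_le hb hs he hy) (hgn k) (hgn k₀)
    have h2 : ∀ k, l2 n b (g k) ≤ |h| * M := fun k =>
      (l2_shift_sub_le hb (H.nn k) i h).trans
        (mul_le_mul_of_nonneg_left ((l2_pd_le_en hb hl0 (H.nn k) _).trans (H.en_le k))
          (abs_nonneg _))
    have h3 : l2 n b (fun q => g k q - g k₀ q) ≤ |h| * ε k₀ := by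
      have e : (fun q => g k q - g k₀ q) =
          fun q => shift v (fun q => p k q - p k₀ q) q - (fun q => p k q - p k₀ q) q := by
        funext q; simp only [hg, shift]; ring
      rw [e]
      have hn := (H.nn k).sub (H.nn k₀)
      exact (l2_shift_sub_le hb hn i h).trans
        (mul_le_mul_of_nonneg_left ((l2_pd_le_en hb hl0 hn _).trans (H.cauchy _ _ hk))
          (abs_nonneg _))
    have hC0 : 0 ≤ oscC b := (abs_nonneg _).trans (abs_oscB_le hb hs he one_pos)
    have h4 : oscC b * (l2 n b (fun q => g k q - g k₀ q) * (l2 n b (g k) + l2 n b (g k₀)))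
        ≤ oscC b * ((|h| * ε k₀) * (|h| * M + |h| * M)) := by
      refine mul_le_mul_of_nonneg_left (mul_le_mul h3 (add_le_add (h2 _) (h2 _))
        (add_nonneg (l2_nonneg _) (l2_nonneg _))
        (mul_nonneg (abs_nonneg _) (H.eps_nonneg _))) hC0
    have h5 : oscC b * ((|h| * ε k₀) * (|h| * M + |h| * M)) = h ^ 2 * (2 * oscC b * ε k₀ * M) := by
      rw [← sq_abs h]; ring
    have := (abs_le.1 (h1.trans h4)).2
    linarith
  have hlim : Tendsto (fun k => - (h ^ 2 * (2 * (M ^ 2 * s ^ 2 / (1 + b)))) - 2 * (ε k * K)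
      - h ^ 2 * (2 * oscC b * ε k₀ * M)) atTop
      (𝓝 (- (h ^ 2 * (2 * (M ^ 2 * s ^ 2 / (1 + b)))) - 2 * (0 * K)
      - h ^ 2 * (2 * oscC b * ε k₀ * M))) :=
    ((((H.tendsto.mul_const K).const_mul 2).const_sub _).sub_const _)
  refine le_trans (le_of_eq (by ring)) (le_of_tendsto hlim ?_)
  filter_upwards [eventually_ge_atTop k₀] with k hk
  linarith [hlow k, hcmp k hk]

end

section

variable {n : ℕ} {b lam : ℝ}

theorem tendsto_diff_quot (hb : -1 < b) {f : Pt n → ℝ} (hf : NN f) (i : Fin n) {B : ℝ → ℝ} {C : ℝ}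
    (hB : Continuous B) (hC : ∀ y, 0 < y → |B y| ≤ C) :
    Tendsto (fun m : ℕ => ∫ q, B q.2 *
      ((shift (EuclideanSpace.single i (1 / ((m : ℝ) + 1))) f q - f q) / (1 / ((m : ℝ) + 1))) ^ 2
        ∂wt n b) atTop (𝓝 (∫ q, B q.2 * pd (some i) f q ^ 2 ∂wt n b)) := by
  have hC0 : 0 ≤ C := (abs_nonneg _).trans (hC 1 one_pos)
  obtain ⟨D, hD⟩ := (hf.pd (some i)).bdd
  obtain ⟨r, hr1, hr⟩ := hf.supp.exists_pos
  have hh : ∀ m : ℕ, 0 < 1 / ((m : ℝ) + 1) := fun m => Nat.one_div_pos_of_nat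
  have hh1 : ∀ m : ℕ, 1 / ((m : ℝ) + 1) ≤ 1 := fun m => by
    rw [div_le_one (by positivity)]; linarith [(Nat.cast_nonneg m : (0 : ℝ) ≤ m)]
  refine tendsto_integral_of_dominated_convergence
    ((closedBall (0 : EuclideanSpace ℝ (Fin n)) (r + 1) ×ˢ Iic (r + 1)).indicator
      fun _ => C * D ^ 2) ?_ ?_ ?_ ?_
  · intro m
    refine Continuous.aestronglyMeasurable ?_
    have := (shift_diff_nn hf (EuclideanSpace.single i (1 / ((m : ℝ) + 1)))).continuous
    exact (hB.comp continuous_snd).mul ((this.div_const _).pow 2)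
  · rw [integrable_indicator_iff (measurableSet_closedBall.prod measurableSet_Iic)]
    exact integrableOn_const (wt_box_lt_top hb _).ne
  · intro m
    refine ae_wt_of_forall fun q hq => ?_
    by_cases hqm : q ∈ closedBall (0 : EuclideanSpace ℝ (Fin n)) (r + 1) ×ˢ Iic (r + 1)
    · rw [indicator_of_mem hqm, Real.norm_eq_abs, abs_mul, abs_pow, sq_abs]
      refine mul_le_mul (hC _ hq) ?_ (sq_nonneg _) hC0
      rw [div_pow, div_le_iff₀ (by have := hh m; positivity), mul_comm]
      refine (shift_sub_sq_le hf i _ q).trans (mul_le_mul_of_nonneg_left ?_ (sq_nonneg _))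
      have h1 : ∀ t ∈ Icc (0 : ℝ) 1, shift (EuclideanSpace.single i (t * (1 / ((m : ℝ) + 1))))
          (pd (some i) f) q ^ 2 ≤ D ^ 2 := fun t _ => by
        rw [← sq_abs]
        exact pow_le_pow_left₀ (abs_nonneg _) (hD _) 2
      have h2 := norm_setIntegral_le_of_norm_le_const (μ := volume) (C := D ^ 2)
        (f := fun t : ℝ => shift (EuclideanSpace.single i (t * (1 / ((m : ℝ) + 1))))
          (pd (some i) f) q ^ 2) ((isCompact_Icc (a := (0 : ℝ)) (b := 1)).measure_lt_top)
        fun t ht => by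
          rw [Real.norm_eq_abs, abs_of_nonneg (sq_nonneg _)]; exact h1 t ht
      simp only [Real.volume_real_Icc, sub_zero, max_eq_left zero_le_one, mul_one] at h2
      exact (le_abs_self _).trans h2
    · rw [indicator_of_notMem hqm]
      have h0 : r + 1 < ‖q.1‖ ∨ r + 1 < q.2 := by
        by_contra hcon
        push Not at hcon
        exact hqm ⟨by simpa using hcon.1, hcon.2⟩
      have e1 : f q = 0 := hr q.1 q.2 (h0.imp (fun h => by linarith) fun h => by linarith)
      have e2 : shift (EuclideanSpace.single i (1 / ((m : ℝ) + 1))) f q = 0 := by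
        refine hr _ _ (h0.imp (fun h => ?_) fun h => by linarith)
        have := norm_sub_norm_le q.1 (-EuclideanSpace.single i (1 / ((m : ℝ) + 1)))
        rw [sub_neg_eq_add, norm_neg, PiLp.norm_single, Real.norm_eq_abs, abs_of_pos (hh m)] at this
        linarith [hh1 m]
      rw [e1, e2]; simp
  · refine ae_of_all _ fun q => (Tendsto.pow ?_ 2).const_mul _
    have h1 := (hasLineDerivAt_horiz (hf.differentiableAt (q.1, q.2)) i).tendsto_slope_zero
    have h2 : Tendsto (fun m : ℕ => 1 / ((m : ℝ) + 1)) atTop (𝓝[≠] 0) :=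
      tendsto_nhdsWithin_iff.2 ⟨tendsto_one_div_add_atTop_nhds_zero_nat,
        Eventually.of_forall fun m => (hh m).ne'⟩
    refine (h1.comp h2).congr fun m => ?_
    have e : (1 / ((m : ℝ) + 1)) • EuclideanSpace.single i (1 : ℝ)
        = EuclideanSpace.single i (1 / ((m : ℝ) + 1)) := by
      ext j; simp [PiLp.single_apply]
    rw [Function.comp, e, smul_eq_mul, ← div_eq_inv_mul]
    rfl

theorem Approx.osc_ge (hb : -1 < b) (hl : 1 ≤ lam) {p R : ℕ → Pt n → ℝ} {M : ℝ}
    {μ : (Pt n → ℝ) → ℝ} {ε : ℕ → ℝ} (H : Approx n b lam p R M μ ε) {s e : ℝ} (hs : 0 < s)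
    (he : 0 < e) (i : Fin n) (k : ℕ) :
    -(2 * (M ^ 2 * s ^ 2 / (1 + b)) + 2 * oscC b * ε k * M) ≤
      ∫ q, oscB b s e q.2 * pd (some i) (p k) q ^ 2 ∂wt n b := by
  refine ge_of_tendsto' (tendsto_diff_quot hb (H.nn k) i (continuous_oscB b s e)
    fun y hy => abs_oscB_le hb hs he hy) fun m => ?_
  have hh : 0 < 1 / ((m : ℝ) + 1) := Nat.one_div_pos_of_nat
  have h1 := H.diff_quot_ge hb hl hs he i (1 / ((m : ℝ) + 1)) k
  have h2 : ∀ q, oscB b s e q.2 * ((shift (EuclideanSpace.single i (1 / ((m : ℝ) + 1))) (p k) q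
      - p k q) / (1 / ((m : ℝ) + 1))) ^ 2 = oscB b s e q.2 *
      (shift (EuclideanSpace.single i (1 / ((m : ℝ) + 1))) (p k) q - p k q) ^ 2
        / (1 / ((m : ℝ) + 1)) ^ 2 := fun q => by rw [div_pow, mul_div_assoc]
  simp only [h2]
  rw [integral_div, le_div_iff₀ (by positivity)]
  linarith

theorem Approx.avg_ge (hb : -1 < b) (hl : 1 ≤ lam) {p R : ℕ → Pt n → ℝ} {M : ℝ}
    {μ : (Pt n → ℝ) → ℝ} {ε : ℕ → ℝ} (H : Approx n b lam p R M μ ε) {s : ℝ} (hs : 0 < s)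
    (i : Fin n) (k : ℕ) :
    -(2 * (M ^ 2 * s ^ 2 / (1 + b)) + 2 * oscC b * ε k * M) ≤
      ∫ q, avgW b s q.2 * pd (some i) (p k) q ^ 2 ∂wt n b := by
  have hq := (H.nn k).pd (some i)
  have hlim : Tendsto (fun m : ℕ => ∫ q, oscB b s (1 / ((m : ℝ) + 1)) q.2 * pd (some i) (p k) q ^ 2
      ∂wt n b) atTop (𝓝 (∫ q, avgW b s q.2 * pd (some i) (p k) q ^ 2 ∂wt n b)) := by
    refine tendsto_integral_of_dominated_convergence (fun q => oscC b * pd (some i) (p k) q ^ 2)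
      ?_ ?_ ?_ ?_
    · exact fun m => (((continuous_oscB b s _).comp continuous_snd).mul
        (hq.continuous.pow 2)).aestronglyMeasurable
    · exact (hq.memLp hb).integrable_sq.const_mul _
    · refine fun m => ae_wt_of_forall fun q hy => ?_
      rw [Real.norm_eq_abs, abs_mul, abs_of_nonneg (sq_nonneg (pd (some i) (p k) q))]
      exact mul_le_mul_of_nonneg_right (abs_oscB_le hb hs Nat.one_div_pos_of_nat hy) (sq_nonneg _)
    · refine ae_wt_of_forall fun q hy => ?_
      refine tendsto_const_nhds.congr' ?_
      have h1 : ∀ᶠ m : ℕ in atTop, 1 / ((m : ℝ) + 1) < q.2 / 2 :=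
        tendsto_one_div_add_atTop_nhds_zero_nat.eventually_lt_const (by linarith)
      filter_upwards [h1] with m hm
      have hh : 0 < 1 / ((m : ℝ) + 1) := Nat.one_div_pos_of_nat
      rw [oscB, cut_eq_one hh (by linarith), cutD_eq_zero_right hh (by linarith)]
      simp
  exact ge_of_tendsto' hlim fun m => H.osc_ge hb hl hs Nat.one_div_pos_of_nat i k

end

section

variable {n : ℕ} {b lam : ℝ}

theorem nn_sub_top {f : Pt n → ℝ} (hf : NN f) {s : ℝ} (h0 : 0 < s) :
    NN (fun p => f p - top s f p) := hf.sub (NN.top hf.smoothUp hf.supp h0)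

theorem pd_none_sub_top {f : Pt n → ℝ} (hf : NN f) {s : ℝ} (h0 : 0 < s) {p : Pt n}
    (hp : 0 < p.2) : pd none (fun p => f p - top s f p) p = (1 - cut s p.2) * pd none f p := by
  rw [pd_sub (hf.differentiableAt p) ((NN.top hf.smoothUp hf.supp h0).differentiableAt p),
    pd_none_top hf.smoothUp hf.supp h0 hp]
  ring

theorem pd_some_sub_top {f : Pt n → ℝ} (hf : NN f) {s : ℝ} (h0 : 0 < s) {p : Pt n}
    (hp : 0 < p.2) (i : Fin n) : pd (some i) (fun p => f p - top s f p) p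
      = pd (some i) f p - top s (pd (some i) f) p := by
  rw [pd_sub (hf.differentiableAt p) ((NN.top hf.smoothUp hf.supp h0).differentiableAt p),
    pd_some_top hf.smoothUp hf.supp h0 hp]

/-- The squared norm bound of `1 - top s`. -/
def topC (b : ℝ) : ℝ := 2 * (1 + hardyC b * stepC ^ 2)

theorem one_le_topC (hb : -1 < b) (hb1 : b < 1) : 1 ≤ topC b := by
  have := hardyC_pos hb hb1
  have h : 0 ≤ hardyC b * stepC ^ 2 := by positivity
  unfold topC; linarith

theorem l2_sub_top_sq_le (hb : -1 < b) (hb1 : b < 1) {f : Pt n → ℝ} (hf : NN f) {s : ℝ}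
    (h0 : 0 < s) : l2 n b (fun p => f p - top s f p) ^ 2 ≤ topC b * l2 n b f ^ 2 := by
  rw [l2_sq, l2_sq]
  refine (sub_top_sq_le_low hb hb1 hf.smoothUp hf.supp (hf.memLp hb) h0).2.trans ?_
  refine mul_le_mul_of_nonneg_left ?_ (zero_le_one.trans (one_le_topC hb hb1))
  exact setIntegral_le_integral (hf.memLp hb).integrable_sq (ae_of_all _ fun p => sq_nonneg _)

theorem form_sub_top_le (hb : -1 < b) (hb1 : b < 1) (hl : 0 ≤ lam) {f : Pt n → ℝ} (hf : NN f)
    {s : ℝ} (h0 : 0 < s) : form n b lam (fun p => f p - top s f p) (fun p => f p - top s f p)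
      ≤ topC b * form n b lam f f := by
  have hC := one_le_topC hb hb1
  rw [form_self_eq hb lam hf, form_self_eq hb lam (nn_sub_top hf h0), mul_add, Finset.mul_sum]
  refine add_le_add (Finset.sum_le_sum fun j _ => ?_) ?_
  · rcases j with _ | i
    · have h1 : l2 n b (pd none fun p => f p - top s f p) ≤ l2 n b (pd none f) :=
        l2_mono ((hf.pd none).memLp hb) fun p hp => by
          rw [pd_none_sub_top hf h0 hp, abs_mul]
          have h2 := cut_nonneg s p.2
          have h3 := cut_le_one s p.2
          rw [abs_of_nonneg (by linarith)]
          exact mul_le_of_le_one_left (abs_nonneg _) (by linarith)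
      have h2 := pow_le_pow_left₀ (l2_nonneg _) h1 2
      exact h2.trans (le_mul_of_one_le_left (sq_nonneg _) hC)
    · have h1 : l2 n b (pd (some i) fun p => f p - top s f p) ≤
          l2 n b (fun p => pd (some i) f p - top s (pd (some i) f) p) :=
        l2_mono ((nn_sub_top (hf.pd (some i)) h0).memLp hb) fun p hp => by
          rw [pd_some_sub_top hf h0 hp]
      exact (pow_le_pow_left₀ (l2_nonneg _) h1 2).trans
        (l2_sub_top_sq_le hb hb1 (hf.pd (some i)) h0)
  · have := mul_le_mul_of_nonneg_left (l2_sub_top_sq_le hb hb1 hf h0) hl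
    linarith

theorem en_sub_top_le (hb : -1 < b) (hb1 : b < 1) (hl : 0 ≤ lam) {f : Pt n → ℝ} (hf : NN f)
    {s : ℝ} (h0 : 0 < s) : en n b lam (fun p => f p - top s f p) ≤ √(topC b) * en n b lam f := by
  unfold en
  rw [← Real.sqrt_mul (zero_le_one.trans (one_le_topC hb hb1))]
  exact Real.sqrt_le_sqrt (form_sub_top_le hb hb1 hl hf h0)

/-- The constant in `Approx.low_en_le`. -/
def lowC (n : ℕ) (b : ℝ) : ℝ :=
  hardyC b + 2 * n * (1 / (1 + b)) + 2 * n * oscC b + 2 * √(topC b)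

theorem Approx.low_en_le (hb : -1 < b) (hb1 : b < 1) (hl : 1 ≤ lam) {p R : ℕ → Pt n → ℝ} {M : ℝ}
    {μ : (Pt n → ℝ) → ℝ} {ε : ℕ → ℝ} (H : Approx n b lam p R M μ ε) {s : ℝ} (hs : 0 < s) (k : ℕ) :
    low_en n b s (p k) ≤ 2 * μ (fun q => p k q - top s (p k) q) + lowC n b * (M ^ 2 * s ^ 2)
      + lowC n b * (ε k * M) := by
  have hb' : 0 < 1 + b := by linarith
  have hM := H.M_nonneg
  have hf := H.nn k
  set f := p k with hfk
  set F : Pt n → ℝ := fun q => f q - top s f q with hF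
  have hFn : NN F := nn_sub_top hf hs
  set E := low_en n b s f with hE
  have hH := hardyC_pos hb hb1
  have h1 := (abs_le.1 (H.err k F hFn)).1
  have h2 : en n b lam F ≤ √(topC b) * M :=
    (en_sub_top_le hb hb1 (by linarith) hf hs).trans
      (mul_le_mul_of_nonneg_left (H.en_le k) (Real.sqrt_nonneg _))
  have h3 := mul_le_mul_of_nonneg_left h2 (H.eps_nonneg k)
  have h4 : ∫ q, R k q * F q ∂wt n b ≤ 1 / 2 * E + 1 / 2 * (hardyC b * (M ^ 2 * s ^ 2)) := by
    have h5 : ∫ q, R k q * F q ∂wt n b ≤ M * l2 n b F :=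
      (le_abs_self _).trans ((abs_integral_mul_le (H.memR k) (hFn.memLp hb)).trans
        (mul_le_mul_of_nonneg_right (H.l2R k) (l2_nonneg _)))
    have h6 : l2 n b F ^ 2 ≤ hardyC b * s ^ 2 * E := by
      rw [l2_sq]
      exact (sub_top_sq_le hb hb1 hf.smoothUp hf.supp ((hf.pd none).memLp hb) hs).2
    set G := hardyC b * s ^ 2
    have hG : 0 < G := by positivity
    have h7 : l2 n b F ^ 2 / G ≤ E := by rw [div_le_iff₀ hG]; linarith
    have h8 : 0 ≤ (M * G - l2 n b F) ^ 2 / G := by positivity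
    have h9 : (M * G - l2 n b F) ^ 2 / G = M ^ 2 * G - 2 * (M * l2 n b F) + l2 n b F ^ 2 / G := by
      field_simp
      ring
    have h10 : M ^ 2 * G = hardyC b * (M ^ 2 * s ^ 2) := by simp only [G]; ring
    linarith
  have h5 : E - n * (M ^ 2 * s ^ 2 / (1 + b) + oscC b * ε k * M) ≤ ∫ q, gd f F q ∂wt n b := by
    have e1 : ∫ q, gd f F q ∂wt n b = ∑ j, ∫ q, pd j f q * pd j F q ∂wt n b :=
      integral_finsetSum _ fun j _ => (((hf.pd j).mul (hFn.pd j)).bc.integrable hb)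
    rw [e1, Fintype.sum_option]
    have e2 : ∫ q, pd none f q * pd none F q ∂wt n b = E := by
      refine integral_congr_ae (ae_wt_of_forall fun q hq => ?_)
      simp only [hF]
      rw [pd_none_sub_top hf hs hq]
      ring
    have e3 : ∀ i : Fin n, -(M ^ 2 * s ^ 2 / (1 + b) + oscC b * ε k * M) ≤
        ∫ q, pd (some i) f q * pd (some i) F q ∂wt n b := fun i => by
      have e4 : ∫ q, pd (some i) f q * pd (some i) F q ∂wt n b =
          ∫ q, pd (some i) f q * (pd (some i) f q - top s (pd (some i) f) q) ∂wt n b := by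
        refine integral_congr_ae (ae_wt_of_forall fun q hq => ?_)
        simp only [hF]
        rw [pd_some_sub_top hf hs hq]
      rw [e4]
      have e5 := integral_mul_sub_top_ge hb (hf.pd (some i)) hs
      have e6 := H.avg_ge hb hl hs i k
      linarith
    have e7 := Finset.sum_le_sum fun i (_ : i ∈ Finset.univ) => e3 i
    rw [Finset.sum_const, Finset.card_univ, Fintype.card_fin, nsmul_eq_mul] at e7
    rw [e2]
    linarith
  have hoc : 0 ≤ oscC b := (abs_nonneg _).trans (abs_oscB_le hb hs hs one_pos)
  have hx : 0 ≤ M ^ 2 * s ^ 2 := by positivity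
  have hy : 0 ≤ ε k * M := mul_nonneg (H.eps_nonneg k) hM
  have hn0 : (0 : ℝ) ≤ n := Nat.cast_nonneg n
  have h6 : hardyC b * (M ^ 2 * s ^ 2) + 2 * n * (1 / (1 + b)) * (M ^ 2 * s ^ 2)
      ≤ lowC n b * (M ^ 2 * s ^ 2) := by
    rw [← add_mul]
    refine mul_le_mul_of_nonneg_right ?_ hx
    have : 0 ≤ 2 * n * oscC b + 2 * √(topC b) := by positivity
    unfold lowC; linarith
  have h7 : 2 * n * oscC b * (ε k * M) + 2 * √(topC b) * (ε k * M) ≤ lowC n b * (ε k * M) := by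
    rw [← add_mul]
    refine mul_le_mul_of_nonneg_right ?_ hy
    have : 0 ≤ hardyC b + 2 * n * (1 / (1 + b)) := by positivity
    unfold lowC; linarith
  have h8 : M ^ 2 * s ^ 2 / (1 + b) = 1 / (1 + b) * (M ^ 2 * s ^ 2) := by ring
  rw [h8] at h5
  linarith

end

section

variable {n : ℕ} {b lam : ℝ}

theorem Approx.map_sub {p R : ℕ → Pt n → ℝ} {M : ℝ}
    {μ : (Pt n → ℝ) → ℝ} {ε : ℕ → ℝ} (H : Approx n b lam p R M μ ε) {φ ψ : Pt n → ℝ}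
    (hφ : NN φ) (hψ : NN ψ) : μ (fun q => φ q - ψ q) = μ φ - μ ψ := by
  have h := H.map_add φ (fun q => -1 * ψ q) hφ (hψ.const_mul _)
  rw [H.map_smul _ _ hψ] at h
  simp only [neg_one_mul, ← sub_eq_add_neg] at h
  exact h

/-- The `L²` norm on `{y < r}`. -/
def l2low (n : ℕ) (b r : ℝ) (f : Pt n → ℝ) : ℝ := √(∫ p in low n r, f p ^ 2 ∂wt n b)

theorem l2low_nonneg (r : ℝ) (f : Pt n → ℝ) : 0 ≤ l2low n b r f := Real.sqrt_nonneg _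

theorem tendsto_l2low {f : Pt n → ℝ} (h2 : MemLp f 2 (wt n b)) :
    Tendsto (fun r => l2low n b r f) (𝓝[>] 0) (𝓝 0) := by
  have := (tendsto_low_sq h2).sqrt
  rwa [Real.sqrt_zero] at this

theorem l2_le_l2low {h g : Pt n → ℝ} (hg : MemLp g 2 (wt n b)) {r : ℝ}
    (hc : ContinuousOn h (upper n)) (hle : ∀ p, 0 < p.2 → |h p| ≤ |g p|)
    (h0 : ∀ p : Pt n, r ≤ p.2 → h p = 0) : l2 n b h ≤ l2low n b r g := by
  refine Real.sqrt_le_sqrt ?_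
  rw [← setIntegral_eq_integral_of_forall_compl_eq_zero (s := low n r) fun p hp => by
    rw [h0 p (not_lt.1 hp)]; simp]
  refine integral_mono_ae (MemLp.of_le hc hg hle).integrable_sq.integrableOn
    hg.integrable_sq.integrableOn ?_
  refine ae_restrict_of_ae (ae_wt_of_forall fun p hp => ?_)
  simpa only [sq_abs] using pow_le_pow_left₀ (abs_nonneg _) (hle p hp) 2

theorem abs_integral_mul_low_le {f h g : Pt n → ℝ} (hf : MemLp f 2 (wt n b))
    (hg : MemLp g 2 (wt n b)) {r : ℝ} (hc : ContinuousOn h (upper n))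
    (hle : ∀ p, 0 < p.2 → |h p| ≤ |g p|) (h0 : ∀ p : Pt n, r ≤ p.2 → h p = 0) :
    |∫ p, f p * h p ∂wt n b| ≤ l2 n b f * l2low n b r g :=
  (abs_integral_mul_le hf (MemLp.of_le hc hg hle)).trans
    (mul_le_mul_of_nonneg_left (l2_le_l2low hg hc hle h0) (l2_nonneg _))

theorem abs_one_sub_cut_mul_le (s : ℝ) (y a : ℝ) : |(1 - cut s y) * a| ≤ |a| := by
  have h2 := cut_nonneg s y
  have h3 := cut_le_one s y
  rw [abs_mul, abs_of_nonneg (by linarith)]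
  exact mul_le_of_le_one_left (abs_nonneg _) (by linarith)

theorem abs_integral_cutD_le (hb : -1 < b) {f φ : Pt n → ℝ} (hf : NN f) (hφ : NN φ) {s : ℝ}
    (hs : 0 < s) : |∫ p, pd none f p * (cutD s p.2 * φ p) ∂wt n b|
      ≤ stepC / s * (√(low_en n b (2 * s) f) * l2low n b (2 * s) φ) := by
  have hst : 0 ≤ stepC / s := by have := one_le_stepC; positivity
  set g : Pt n → ℝ := fun p => √(1 - cut (2 * s) p.2) * pd none f p with hg
  have hc : Continuous g := by
    refine (Real.continuous_sqrt.comp (continuous_const.sub ?_)).mul (hf.pd none).continuous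
    exact (contDiff_cut _).continuous.comp continuous_snd
  have hg2 : MemLp g 2 (wt n b) := by
    refine MemLp.of_le hc.continuousOn ((hf.pd none).memLp hb) fun p _ => ?_
    rw [hg, abs_mul, abs_of_nonneg (Real.sqrt_nonneg _)]
    refine mul_le_of_le_one_left (abs_nonneg _) (Real.sqrt_le_one.2 ?_)
    linarith [cut_nonneg (2 * s) p.2]
  have e1 : l2 n b g = √(low_en n b (2 * s) f) := by
    unfold l2 low_en
    congr 2
    funext p
    rw [hg, mul_pow, Real.sq_sqrt (sub_nonneg.2 (cut_le_one _ _))]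
  have e2 : ∀ p : Pt n, pd none f p * (cutD s p.2 * φ p) = g p * (cutD s p.2 * φ p) := fun p => by
    rcases le_or_gt (2 * s) p.2 with hp | hp
    · rw [cutD_eq_zero_right hs hp]; simp
    · rw [hg]; simp only; rw [cut_eq_zero (by positivity) hp.le]; simp
  simp only [e2]
  have h1 := abs_integral_mul_low_le (h := fun p => cutD s p.2 * φ p)
    (g := fun p => stepC / s * φ p) (r := 2 * s) hg2 ((hφ.memLp hb).const_mul _)
    (((contDiff_cutD s).continuous.comp continuous_snd).mul hφ.continuous).continuousOn
    (fun p _ => by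
      rw [abs_mul, abs_mul, abs_of_nonneg (cutD_nonneg hs _), abs_of_nonneg hst]
      exact mul_le_mul_of_nonneg_right (cutD_le hs _) (abs_nonneg _))
    (fun p hp => by rw [cutD_eq_zero_right hs hp, zero_mul])
  have e3 : l2low n b (2 * s) (fun p => stepC / s * φ p) = stepC / s * l2low n b (2 * s) φ := by
    unfold l2low
    simp only [mul_pow]
    rw [integral_const_mul, Real.sqrt_mul (sq_nonneg _), Real.sqrt_sq hst]
  rw [e3, e1] at h1
  linarith

theorem Approx.abs_le_low_en (hb : -1 < b) (hl : 1 ≤ lam) {p R : ℕ → Pt n → ℝ} {M : ℝ}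
    {μ : (Pt n → ℝ) → ℝ} {ε : ℕ → ℝ} (H : Approx n b lam p R M μ ε) {φ : Pt n → ℝ} (hφ : NN φ)
    {s : ℝ} (hs : 0 < s) (k : ℕ) :
    |μ φ| ≤ stepC / s * (√(low_en n b (2 * s) (p k)) * l2low n b (2 * s) φ)
      + M * (∑ j, l2low n b (2 * s) (pd j φ) + l2low n b (2 * s) φ)
      + ε k * en n b lam (fun q => φ q - cut s q.2 * φ q) := by
  have hM := H.M_nonneg
  have hcn : NN (fun q => cut s q.2 * φ q) := NN.cut_mul hφ.smoothUp hφ.supp hs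
  set χ : Pt n → ℝ := fun q => φ q - cut s q.2 * φ q with hχ
  have hχn : NN χ := hφ.sub hcn
  have h1 : μ φ = μ χ := by
    rw [H.map_sub hφ hcn, H.vanish _ hcn ⟨s, hs, fun x y hy => by simp [cut_eq_zero hs hy]⟩,
      sub_zero]
  have h2 := H.err k χ hχn
  have hc : Continuous fun q : Pt n => 1 - cut s q.2 :=
    continuous_const.sub ((contDiff_cut _).continuous.comp continuous_snd)
  have hlow : ∀ {f g : Pt n → ℝ}, MemLp f 2 (wt n b) → l2 n b f ≤ M → NN g →
      |∫ q, f q * ((1 - cut s q.2) * g q) ∂wt n b| ≤ M * l2low n b (2 * s) g := by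
    intro f g hf hfM hg
    refine (abs_integral_mul_low_le (h := fun q => (1 - cut s q.2) * g q) hf (hg.memLp hb)
      (hc.mul hg.continuous).continuousOn
      (fun q _ => abs_one_sub_cut_mul_le _ _ _) (r := 2 * s) fun q hq => ?_).trans
      (mul_le_mul_of_nonneg_right hfM (l2low_nonneg _ _))
    rw [cut_eq_one hs hq]; simp
  have hR : |∫ q, R k q * χ q ∂wt n b| ≤ M * l2low n b (2 * s) φ := by
    have := hlow (H.memR k) (H.l2R k) hφ
    refine le_of_eq_of_le ?_ this
    congr 2; funext q; simp only [hχ]; ring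
  have hpj : ∀ j, l2 n b (pd j (p k)) ≤ M := fun j =>
    (l2_pd_le_en hb (by linarith) (H.nn k) j).trans (H.en_le k)
  have hd : ∀ q : Pt n, DifferentiableAt ℝ (fun q : Pt n => cut s q.2) q :=
    fun q => differentiableAt_cut_snd s q
  have hpn : ∀ q, pd none χ q = (1 - cut s q.2) * pd none φ q - cutD s q.2 * φ q := fun q => by
    rw [hχ, pd_sub (hφ.differentiableAt q) (hcn.differentiableAt q),
      pd_mul (hd q) (hφ.differentiableAt q), pd_none_cut]
    ring
  have hps : ∀ i q, pd (some i) χ q = (1 - cut s q.2) * pd (some i) φ q := fun i q => by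
    rw [hχ, pd_sub (hφ.differentiableAt q) (hcn.differentiableAt q),
      pd_mul (hd q) (hφ.differentiableAt q), pd_some_height]
    ring
  have hG : |∫ q, gd (p k) χ q ∂wt n b| ≤
      stepC / s * (√(low_en n b (2 * s) (p k)) * l2low n b (2 * s) φ)
      + M * ∑ j, l2low n b (2 * s) (pd j φ) := by
    have e1 : ∫ q, gd (p k) χ q ∂wt n b = ∑ j, ∫ q, pd j (p k) q * pd j χ q ∂wt n b :=
      integral_finsetSum _ fun j _ => ((((H.nn k).pd j).mul (hχn.pd j)).bc.integrable hb)
    rw [e1, Fintype.sum_option, Fintype.sum_option, mul_add, ← add_assoc, Finset.mul_sum]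
    refine (abs_add_le _ _).trans (add_le_add ?_ ((Finset.abs_sum_le_sum_abs _ _).trans
      (Finset.sum_le_sum fun i _ => ?_)))
    · have e2 : ∀ q, pd none (p k) q * pd none χ q = pd none (p k) q *
          ((1 - cut s q.2) * pd none φ q) - pd none (p k) q * (cutD s q.2 * φ q) := fun q => by
        rw [hpn]; ring
      simp only [e2]
      have hi : Integrable (fun q => pd none (p k) q * (cutD s q.2 * φ q)) (wt n b) :=
        (((H.nn k).pd none).mul (nn_cutD_mul hφ.smoothUp hφ.supp hs)).bc.integrable hb
      have hi2 : Integrable (fun q => pd none (p k) q * ((1 - cut s q.2) * pd none φ q))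
          (wt n b) := by
        have h := (((H.nn k).pd none).mul (hχn.pd none)).bc.integrable hb |>.add hi
        refine h.congr (ae_of_all _ fun q => ?_)
        simp only [Pi.add_apply, hpn]; ring
      rw [integral_sub hi2 hi]
      have h3 := hlow (((H.nn k).pd none).memLp hb) (hpj none) (hφ.pd none)
      have h4 := abs_integral_cutD_le hb (H.nn k) hφ hs
      refine (abs_sub _ _).trans ?_
      linarith
    · simp only [hps]
      exact hlow (((H.nn k).pd _).memLp hb) (hpj _) (hφ.pd _)
  rw [h1]
  have h5 : |μ χ| ≤ |μ χ - (∫ q, gd (p k) χ q ∂wt n b - ∫ q, R k q * χ q ∂wt n b)|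
      + (|∫ q, gd (p k) χ q ∂wt n b| + |∫ q, R k q * χ q ∂wt n b|) := by
    have h6 := abs_add_le (μ χ - (∫ q, gd (p k) χ q ∂wt n b - ∫ q, R k q * χ q ∂wt n b))
      (∫ q, gd (p k) χ q ∂wt n b - ∫ q, R k q * χ q ∂wt n b)
    rw [sub_add_cancel] at h6
    exact h6.trans (add_le_add_right (abs_sub _ _) _)
  linarith

/-- The `L²` norm of the boundary values. -/
def trace (n : ℕ) (φ : Pt n → ℝ) : ℝ := √(∫ x : EuclideanSpace ℝ (Fin n), φ (x, 0) ^ 2)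

theorem l2low_eq_trace (hb : -1 < b) {φ : Pt n → ℝ} {r : ℝ} (hr : 0 < r)
    (hflat : ∀ x y, y ≤ r → φ (x, y) = φ (x, 0)) :
    l2low n b r φ = √(r ^ (1 + b) / (1 + b)) * trace n φ := by
  have hb' : 0 < 1 + b := by linarith
  have h0 : 0 ≤ r ^ (1 + b) / (1 + b) := by positivity
  unfold l2low trace
  rw [← Real.sqrt_mul h0, wt_restrict_low]
  congr 1
  have e : ∫ p, φ p ^ 2 ∂(volume : Measure (EuclideanSpace ℝ (Fin n))).prod
      ((nu b).restrict (Iio r)) = ∫ p : Pt n, φ (p.1, 0) ^ 2 * 1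
        ∂(volume : Measure (EuclideanSpace ℝ (Fin n))).prod ((nu b).restrict (Iio r)) := by
    rw [← wt_restrict_low]
    refine setIntegral_congr_fun (measurableSet_low r) fun p hp => ?_
    simp only [mul_one]
    rw [← hflat p.1 p.2 (le_of_lt hp)]
  rw [e, integral_prod_mul (fun x : EuclideanSpace ℝ (Fin n) => φ (x, 0) ^ 2) fun _ : ℝ => (1 : ℝ)]
  rw [integral_const, smul_eq_mul, mul_one, mul_comm, measureReal_restrict_apply_univ,
    measureReal_def, nu_Iio hb hr, ENNReal.toReal_ofReal h0]

theorem Approx.trace_bound (hb : -1 < b) (hl : 1 ≤ lam) {p R : ℕ → Pt n → ℝ} {M : ℝ}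
    {μ : (Pt n → ℝ) → ℝ} {ε : ℕ → ℝ} (H : Approx n b lam p R M μ ε) {Q s₀ : ℝ} (hQ : 0 ≤ Q)
    (hs₀ : 0 < s₀) (hE : ∀ s, 0 < s → s < s₀ → ∀ᶠ k in atTop, low_en n b s (p k) ≤ Q * s ^ (1 - b))
    {φ : Pt n → ℝ} (hφ : NN φ) : |μ φ| ≤ 2 * stepC * √(Q / (1 + b)) * trace n φ := by
  have hb' : 0 < 1 + b := by linarith
  have hst := one_le_stepC
  obtain ⟨r, hr, hflat⟩ := hφ.flat
  have hrest : Tendsto (fun s => 2 * stepC * √(Q / (1 + b)) * trace n φ +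
      M * (∑ j, l2low n b s (pd j φ) + l2low n b s φ)) (𝓝[>] 0)
      (𝓝 (2 * stepC * √(Q / (1 + b)) * trace n φ + M * (∑ _j : Option (Fin n), 0 + 0))) :=
    (((tendsto_finsetSum _ fun j _ => tendsto_l2low ((hφ.pd j).memLp hb)).add
      (tendsto_l2low (hφ.memLp hb))).const_mul M).const_add _
  rw [Finset.sum_const_zero, add_zero, mul_zero, add_zero] at hrest
  refine ge_of_tendsto hrest ?_
  filter_upwards [Ioo_mem_nhdsGT (lt_min hs₀ hr)] with t ht
  obtain ⟨ht0, ht1⟩ := ht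
  have hts : t < s₀ := ht1.trans_le (min_le_left _ _)
  have htr : t < r := ht1.trans_le (min_le_right _ _)
  have hs : 0 < t / 2 := by positivity
  have e2 : 2 * (t / 2) = t := by ring
  have hlim : Tendsto (fun k => stepC / (t / 2) * (√(Q * t ^ (1 - b)) * l2low n b t φ)
      + M * (∑ j, l2low n b t (pd j φ) + l2low n b t φ)
      + ε k * en n b lam (fun q => φ q - cut (t / 2) q.2 * φ q)) atTop
      (𝓝 (stepC / (t / 2) * (√(Q * t ^ (1 - b)) * l2low n b t φ)
      + M * (∑ j, l2low n b t (pd j φ) + l2low n b t φ)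
      + 0 * en n b lam (fun q => φ q - cut (t / 2) q.2 * φ q))) :=
    (H.tendsto.mul_const _).const_add _
  have h1 : |μ φ| ≤ stepC / (t / 2) * (√(Q * t ^ (1 - b)) * l2low n b t φ)
      + M * (∑ j, l2low n b t (pd j φ) + l2low n b t φ)
      + 0 * en n b lam (fun q => φ q - cut (t / 2) q.2 * φ q) := by
    refine ge_of_tendsto hlim ?_
    filter_upwards [hE t ht0 hts] with k hk
    have h2 := H.abs_le_low_en hb hl hφ hs k
    rw [e2] at h2
    have h3 := mul_le_mul_of_nonneg_right (Real.sqrt_le_sqrt hk) (l2low_nonneg (b := b) t φ)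
    have h4 : 0 ≤ stepC / (t / 2) := by positivity
    have h5 := mul_le_mul_of_nonneg_left h3 h4
    linarith
  have e3 : stepC / (t / 2) * (√(Q * t ^ (1 - b)) * l2low n b t φ)
      = 2 * stepC * √(Q / (1 + b)) * trace n φ := by
    rw [l2low_eq_trace hb ht0 fun x y hy => hflat x y (hy.trans htr.le), ← mul_assoc (√_),
      ← Real.sqrt_mul (by positivity)]
    have e4 : Q * t ^ (1 - b) * (t ^ (1 + b) / (1 + b)) = Q / (1 + b) * t ^ 2 := by
      have : t ^ (1 - b) * t ^ (1 + b) = t ^ 2 := by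
        rw [← Real.rpow_add ht0, ← Real.rpow_natCast]; norm_num
      rw [← this]; ring
    rw [e4, Real.sqrt_mul (by positivity), Real.sqrt_sq ht0.le]
    field_simp
  linarith

end

section

variable {n : ℕ} {b lam : ℝ}

theorem NN.nonneg {f : Pt n → ℝ} (hf : NN f) (h : ∀ p, 0 < p.2 → 0 ≤ f p) (p : Pt n) : 0 ≤ f p := by
  obtain ⟨r, hr, hfl⟩ := hf.flat'
  rcases lt_or_ge 0 p.2 with hp | hp
  · exact h p hp
  · rw [show p = (p.1, p.2) from rfl, hfl p.1 p.2 r (by linarith) le_rfl]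
    exact h _ hr

/-- A cutoff function equal to one for `‖x‖ ≤ ρ` and `y ≤ ρ`. -/
def bump (n : ℕ) (ρ : ℝ) (p : Pt n) : ℝ :=
  Real.smoothTransition (ρ + 2 - √(1 + ‖p.1‖ ^ 2)) * (1 - cut ρ p.2)

theorem nn_bump {ρ : ℝ} (hρ : 0 < ρ) : NN (bump n ρ) := by
  refine ⟨?_, ⟨2 * ρ + 2, fun x y h => ?_⟩, ρ, hρ, fun x y hy => ?_⟩
  · refine (Real.smoothTransition.contDiff.comp (contDiff_const.sub ?_)).mul
      (contDiff_const.sub ((contDiff_cut ρ).comp contDiff_snd))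
    exact ContDiff.sqrt (contDiff_const.add (contDiff_fst.norm_sq ℝ)) fun p => by positivity
  · rcases h with h | h
    · have h1 : ‖x‖ ≤ √(1 + ‖x‖ ^ 2) := Real.le_sqrt_of_sq_le (by linarith)
      simp only [bump]
      rw [Real.smoothTransition.zero_of_nonpos (by linarith), zero_mul]
    · simp only [bump]
      rw [cut_eq_one hρ (by linarith), sub_self, mul_zero]
  · simp only [bump]
    rw [cut_eq_zero hρ hy, cut_eq_zero hρ hρ.le]

theorem bump_nonneg (ρ : ℝ) (p : Pt n) : 0 ≤ bump n ρ p :=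
  mul_nonneg (Real.smoothTransition.nonneg _) (sub_nonneg.2 (cut_le_one _ _))

theorem bump_eq_one {ρ : ℝ} (hρ : 0 < ρ) {p : Pt n} (h1 : ‖p.1‖ ≤ ρ) (h2 : p.2 ≤ ρ) :
    bump n ρ p = 1 := by
  have h3 : √(1 + ‖p.1‖ ^ 2) ≤ 1 + ρ :=
    Real.sqrt_le_iff.2 ⟨by linarith, by nlinarith [norm_nonneg p.1]⟩
  rw [bump, cut_eq_zero hρ h2, Real.smoothTransition.one_of_one_le (by linarith)]
  ring

theorem NN.exists_le_bump {f : Pt n → ℝ} (hf : NN f) :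
    ∃ C ρ : ℝ, 0 ≤ C ∧ 0 < ρ ∧ ∀ p, |f p| ≤ C * bump n ρ p := by
  obtain ⟨C, hC⟩ := hf.bdd
  obtain ⟨r, hr1, hr⟩ := hf.supp.exists_pos
  have hC0 : 0 ≤ C := (abs_nonneg _).trans (hC 0)
  refine ⟨C, r, hC0, by linarith, fun p => ?_⟩
  by_cases h : r < ‖p.1‖ ∨ r < p.2
  · rw [show p = (p.1, p.2) from rfl, hr _ _ h, abs_zero]
    exact mul_nonneg hC0 (bump_nonneg _ _)
  · push Not at h
    rw [bump_eq_one (by linarith) h.1 h.2, mul_one]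
    exact hC p

theorem sqrt_lam_l2_le_en (hb : -1 < b) (hl : 0 ≤ lam) {f : Pt n → ℝ} (hf : NN f) :
    √lam * l2 n b f ≤ en n b lam f := by
  refine Real.le_sqrt_of_sq_le ?_
  rw [mul_pow, Real.sq_sqrt hl, form_self_eq hb lam hf]
  have : 0 ≤ ∑ j, l2 n b (pd j f) ^ 2 := Finset.sum_nonneg fun _ _ => sq_nonneg _
  linarith

theorem abs_form_le (hb : -1 < b) (hl : 0 ≤ lam) {f g : Pt n → ℝ} (hf : NN f) (hg : NN g) :
    |form n b lam f g| ≤ (n + 2) * (en n b lam f * en n b lam g) := by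
  rw [form_eq hb lam hf hg]
  have h1 : ∀ j, |∫ p, pd j f p * pd j g p ∂wt n b| ≤ en n b lam f * en n b lam g := fun j =>
    (abs_integral_mul_le ((hf.pd j).memLp hb) ((hg.pd j).memLp hb)).trans
      (mul_le_mul (l2_pd_le_en hb hl hf j) (l2_pd_le_en hb hl hg j) (l2_nonneg _) (en_nonneg _ _))
  have h2 : |lam * ∫ p, f p * g p ∂wt n b| ≤ en n b lam f * en n b lam g := by
    rw [abs_mul, abs_of_nonneg hl]
    calc lam * |∫ p, f p * g p ∂wt n b| ≤ lam * (l2 n b f * l2 n b g) :=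
          mul_le_mul_of_nonneg_left (abs_integral_mul_le (hf.memLp hb) (hg.memLp hb)) hl
      _ = (√lam * l2 n b f) * (√lam * l2 n b g) := by
          nth_rewrite 1 [← Real.mul_self_sqrt hl]; ring
      _ ≤ _ := mul_le_mul (sqrt_lam_l2_le_en hb hl hf) (sqrt_lam_l2_le_en hb hl hg)
          (mul_nonneg (Real.sqrt_nonneg _) (l2_nonneg _)) (en_nonneg _ _)
  refine (abs_add_le _ _).trans ?_
  have h3 := (Finset.abs_sum_le_sum_abs (fun j => ∫ p, pd j f p * pd j g p ∂wt n b)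
    Finset.univ).trans (Finset.sum_le_sum fun j _ => h1 j)
  rw [Finset.sum_const, Finset.card_univ, Fintype.card_option, Fintype.card_fin, nsmul_eq_mul] at h3
  push_cast at h3
  linarith

/-- A minimizing sequence `ψ` for the obstacle problem `a(ψ,ψ)/2 + ℓ(ψ) → min`, `ψ ≥ 0`,
together with the limiting residual `μ`. -/
structure Obst (n : ℕ) (b lam : ℝ) (ℓ : (Pt n → ℝ) → ℝ) (C : ℝ) (ψ : ℕ → Pt n → ℝ)
    (μ : (Pt n → ℝ) → ℝ) (ε : ℕ → ℝ) : Prop where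
  nn : ∀ k, NN (ψ k)
  psi_nonneg : ∀ k p, 0 ≤ ψ k p
  err : ∀ k φ, NN φ → |μ φ - (form n b lam (ψ k) φ + ℓ φ)| ≤ ε k * en n b lam φ
  ell_le : ∀ φ, NN φ → |ℓ φ| ≤ C * en n b lam φ
  cauchy : ∀ k j, k ≤ j → en n b lam (fun q => ψ j q - ψ k q) ≤ ε k
  eps_nonneg : ∀ k, 0 ≤ ε k
  tendsto : Tendsto ε atTop (𝓝 0)
  map_add : ∀ φ χ, NN φ → NN χ → μ (fun q => φ q + χ q) = μ φ + μ χ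
  map_smul : ∀ (c : ℝ) φ, NN φ → μ (fun q => c * φ q) = c * μ φ
  nonneg : ∀ φ, NN φ → (∀ p, 0 ≤ φ p) → 0 ≤ μ φ
  mu_psi : Tendsto (fun k => μ (ψ k)) atTop (𝓝 0)
  form_le : ∀ k, form n b lam (ψ k) (ψ k) ≤ 4 * C ^ 2 + 4

theorem nn_ppart {f : Pt n → ℝ} (hf : NN f) {e : ℝ} (he : 0 < e) : NN (fun p => ppart e (f p)) :=
  hf.comp (contDiff_ppart e) (ppart_eq_zero he (by positivity))

theorem pd_ppart {f : Pt n → ℝ} (hf : NN f) (e : ℝ) (j : Option (Fin n)) (p : Pt n) :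
    pd j (fun q => ppart e (f q)) p = cut (e / 2) (f p) * pd j f p := by
  rw [pd_comp (hasDerivAt_ppart e _).differentiableAt (hf.differentiableAt p),
    (hasDerivAt_ppart e _).deriv]

theorem ppart_sq_le {e : ℝ} (he : 0 < e) (t : ℝ) : ppart e t * ppart e t ≤ t * ppart e t := by
  rcases le_or_gt t (e / 2) with h | h
  · simp [ppart_eq_zero he h]
  · have h1 := ppart_le he t
    rw [max_eq_left (by linarith)] at h1
    exact mul_le_mul_of_nonneg_right h1 (ppart_nonneg he t)

theorem pd_eq_zero_of_nonneg {f : Pt n → ℝ} (hp : ∀ p, 0 ≤ f p) {p : Pt n} (h0 : f p = 0)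
    (j : Option (Fin n)) : pd j f p = 0 := by
  have : IsLocalMin f p := Eventually.of_forall fun q => by rw [h0]; exact hp q
  rw [pd, this.fderiv_eq_zero]
  rfl

theorem tendsto_form_sub_ppart (hb : -1 < b) (hl : 0 ≤ lam) {φ : Pt n → ℝ} (hφ : NN φ)
    (hφ0 : ∀ p, 0 ≤ φ p) : Tendsto (fun m : ℕ =>
      en n b lam (fun p => φ p - ppart (1 / ((m : ℝ) + 1)) (φ p))) atTop (𝓝 0) := by
  have hh : ∀ m : ℕ, 0 < 1 / ((m : ℝ) + 1) := fun m => Nat.one_div_pos_of_nat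
  set χ : ℕ → Pt n → ℝ := fun m p => φ p - ppart (1 / ((m : ℝ) + 1)) (φ p) with hχ
  have hχn : ∀ m, NN (χ m) := fun m => hφ.sub (nn_ppart hφ (hh m))
  have hpd : ∀ m j p, pd j (χ m) p = (1 - cut (1 / ((m : ℝ) + 1) / 2) (φ p)) * pd j φ p :=
    fun m j p => by
      rw [hχ, pd_sub (hφ.differentiableAt p) ((nn_ppart hφ (hh m)).differentiableAt p),
        pd_ppart hφ]
      ring
  have hlim : Tendsto (fun m => form n b lam (χ m) (χ m)) atTop
      (𝓝 (∫ _p, (0 : ℝ) ∂wt n b)) := by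
    refine tendsto_integral_of_dominated_convergence (fun p => gd φ φ p + lam * (φ p * φ p))
      (fun m => (form_int hb lam (hχn m) (hχn m)).aestronglyMeasurable) (form_int hb lam hφ hφ)
      (fun m => ae_of_all _ fun p => ?_) (ae_of_all _ fun p => ?_)
    · rw [Real.norm_eq_abs, abs_of_nonneg (add_nonneg (gd_self_nonneg _ _)
        (mul_nonneg hl (mul_self_nonneg _)))]
      refine add_le_add (Finset.sum_le_sum fun j _ => ?_) (mul_le_mul_of_nonneg_left ?_ hl)
      · rw [hpd, ← abs_mul_abs_self, ← abs_mul_abs_self (pd j φ p)]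
        exact mul_self_le_mul_self (abs_nonneg _) (abs_one_sub_cut_mul_le _ _ _)
      · have h1 := ppart_nonneg (hh m) (φ p)
        have h2 := ppart_le (hh m) (φ p)
        rw [max_eq_left (hφ0 p)] at h2
        exact mul_self_le_mul_self (by simp only [hχ]; linarith) (by simp only [hχ]; linarith)
    · rcases (hφ0 p).eq_or_lt with h0 | h0
      · refine tendsto_const_nhds.congr fun m => ?_
        have h1 : ∀ j, pd j (χ m) p = 0 := fun j => by
          rw [hpd, pd_eq_zero_of_nonneg hφ0 h0.symm, mul_zero]
        have h2 : χ m p = 0 := by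
          simp only [hχ]
          rw [← h0, ppart_eq_zero (hh m) (by have := hh m; positivity), sub_zero]
        simp [gd, h1, h2]
      · have h1 : ∀ᶠ m : ℕ in atTop, 1 / ((m : ℝ) + 1) < φ p :=
          tendsto_one_div_add_atTop_nhds_zero_nat.eventually_lt_const h0
        have h2 : Tendsto (fun m => χ m p) atTop (𝓝 0) := by
          refine squeeze_zero (fun m => ?_) (fun m => ?_)
            tendsto_one_div_add_atTop_nhds_zero_nat
          · have h2 := ppart_le (hh m) (φ p)
            rw [max_eq_left (hφ0 p)] at h2
            simp only [hχ]; linarith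
          · have := sub_le_ppart (hh m) (φ p)
            simp only [hχ]; linarith
        have h3 := (h2.mul h2).const_mul lam
        rw [mul_zero, mul_zero] at h3
        refine h3.congr' ?_
        filter_upwards [h1] with m hm
        have h4 : ∀ j, pd j (χ m) p = 0 := fun j => by
          have := hh m
          rw [hpd, cut_eq_one (by positivity) (by linarith), sub_self, zero_mul]
        simp [gd, h4]
  rw [integral_zero] at hlim
  have := hlim.sqrt
  rwa [Real.sqrt_zero] at this

end

section

variable {n : ℕ} {b lam : ℝ}

theorem ppart_sub_le (e : ℝ) {t u : ℝ} (h : u ≤ t) : ppart e t - ppart e u ≤ t - u := by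
  have hd : ∀ x, HasDerivAt (fun x => x - ppart e x) (1 - cut (e / 2) x) x := fun x =>
    (hasDerivAt_id' x).sub (hasDerivAt_ppart e x)
  have hm : Monotone fun x => x - ppart e x :=
    monotone_of_deriv_nonneg (fun x => (hd x).differentiableAt) fun x => by
      rw [(hd x).deriv]; exact sub_nonneg.2 (cut_le_one _ _)
  have := hm h
  simp only at this
  linarith

theorem form_ppart_le (hb : -1 < b) (hl : 0 ≤ lam) {f : Pt n → ℝ} (hf : NN f) {e : ℝ} (he : 0 < e) :
    form n b lam (fun p => ppart e (f p)) (fun p => ppart e (f p)) ≤ form n b lam f f := by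
  have hg := nn_ppart hf he
  refine integral_mono (form_int hb lam hg hg) (form_int hb lam hf hf) fun p => ?_
  refine add_le_add (Finset.sum_le_sum fun j _ => ?_) (mul_le_mul_of_nonneg_left ?_ hl)
  · rw [pd_ppart hf]
    have h1 := cut_nonneg (e / 2) (f p)
    have h2 := cut_le_one (e / 2) (f p)
    have h3 : cut (e / 2) (f p) * cut (e / 2) (f p) ≤ 1 := by nlinarith
    nlinarith [mul_self_nonneg (pd j f p)]
  · have h1 := ppart_sq_le he (f p)
    nlinarith [mul_self_nonneg (f p - ppart e (f p))]

theorem mul_form_ppart_le (hb : -1 < b) (hl : 0 ≤ lam) {φ ψ : Pt n → ℝ} (hφ : NN φ) (hψ : NN ψ)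
    {e : ℝ} (he : 0 < e) (N : ℝ) :
    N * form n b lam ψ (fun p => ppart e (φ p - N * ψ p)) ≤ form n b lam φ φ / 4 := by
  have hu : NN fun p => φ p - N * ψ p := hφ.sub (hψ.const_mul N)
  have hg := nn_ppart hu he
  rw [form, ← integral_const_mul, div_eq_mul_inv, form, ← integral_mul_const]
  refine integral_mono ((form_int hb lam hψ hg).const_mul N) ((form_int hb lam hφ hφ).mul_const _)
    fun p => ?_
  simp only [gd, mul_add, add_mul, Finset.mul_sum, Finset.sum_mul]
  refine add_le_add (Finset.sum_le_sum fun j _ => ?_) ?_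
  · have hN : N * pd j ψ p = pd j φ p - pd j (fun p => φ p - N * ψ p) p := by
      rw [pd_sub (hφ.differentiableAt p) ((hψ.const_mul N).differentiableAt p),
        pd_const_mul (hψ.differentiableAt p)]
      ring
    rw [pd_ppart hu]
    have h1 := cut_nonneg (e / 2) (φ p - N * ψ p)
    have h2 := cut_le_one (e / 2) (φ p - N * ψ p)
    set c := cut (e / 2) (φ p - N * ψ p)
    set u := pd j (fun p => φ p - N * ψ p) p
    rw [← mul_assoc, hN]
    have h3 : c * c ≤ c := by nlinarith
    nlinarith [mul_self_nonneg u, mul_self_nonneg (pd j φ p / 2 - c * u)]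
  · have h1 := ppart_sq_le he (φ p - N * ψ p)
    set c := ppart e (φ p - N * ψ p)
    have : N * (ψ p * c) ≤ φ p * φ p * 4⁻¹ := by
      nlinarith [mul_self_nonneg (φ p / 2 - c)]
    nlinarith

variable {ℓ μ : (Pt n → ℝ) → ℝ} {C : ℝ} {ψ : ℕ → Pt n → ℝ} {ε : ℕ → ℝ}

theorem Obst.map_sub (H : Obst n b lam ℓ C ψ μ ε) {φ χ : Pt n → ℝ} (hφ : NN φ) (hχ : NN χ) :
    μ (fun q => φ q - χ q) = μ φ - μ χ := by
  have h1 := H.map_add φ (fun q => (-1) * χ q) hφ (hχ.const_mul _)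
  rw [H.map_smul _ _ hχ] at h1
  rw [show (fun q => φ q - χ q) = fun q => φ q + (-1) * χ q by ext; ring, h1]
  ring

theorem Obst.mono (H : Obst n b lam ℓ C ψ μ ε) {φ χ : Pt n → ℝ} (hφ : NN φ) (hχ : NN χ)
    (h : ∀ p, φ p ≤ χ p) : μ φ ≤ μ χ := by
  have h1 := H.nonneg _ (hχ.sub hφ) fun p => sub_nonneg.2 (h p)
  rw [H.map_sub hχ hφ] at h1
  linarith

theorem Obst.abs_mu_le (H : Obst n b lam ℓ C ψ μ ε) (hb : -1 < b) (hl : 0 ≤ lam) {f : Pt n → ℝ}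
    (hf : NN f) : |μ f| ≤ ((n + 2) * en n b lam (ψ 0) + C + ε 0) * en n b lam f := by
  have h1 := H.err 0 f hf
  have h2 := H.ell_le f hf
  have h3 := abs_form_le hb hl (H.nn 0) hf
  rw [abs_le] at h1 h2 h3 ⊢
  constructor <;> nlinarith

/-- The residual `μ` does not charge regions where `ℓ` is nonpositive. -/
theorem Obst.eq_zero (H : Obst n b lam ℓ C ψ μ ε) (hb : -1 < b) (hl : 0 ≤ lam) {φ : Pt n → ℝ}
    (hφ : NN φ) (hφ0 : ∀ p, 0 ≤ φ p)
    (hℓ : ∀ χ, NN χ → (∀ p, 0 ≤ χ p) → (∀ p, φ p = 0 → χ p = 0) → ℓ χ ≤ 0) : μ φ = 0 := by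
  refine le_antisymm ?_ (H.nonneg φ hφ hφ0)
  have key : ∀ e > 0, ∀ N > 0, μ φ ≤ form n b lam φ φ / 4 / N
      + μ (fun p => φ p - ppart e (φ p)) := by
    intro e he N hN
    set B := √(2 * form n b lam φ φ + 2 * (N ^ 2 * (4 * C ^ 2 + 4)))
    have hχ : ∀ k, NN fun p => ppart e (φ p - N * ψ k p) := fun k =>
      nn_ppart (hφ.sub ((H.nn k).const_mul N)) he
    have hle : ∀ k, μ φ ≤ N * μ (ψ k) + (form n b lam φ φ / 4 / N + ε k * B)
        + μ (fun p => φ p - ppart e (φ p)) := by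
      intro k
      have hψk := (H.nn k).const_mul N
      have hd := hφ.sub (nn_ppart hφ he)
      have h1 : μ φ ≤ μ (fun p => (N * ψ k p + ppart e (φ p - N * ψ k p))
          + (φ p - ppart e (φ p))) := by
        refine H.mono hφ ((hψk.add (hχ k)).add hd) fun p => ?_
        have := ppart_sub_le e (t := φ p) (u := φ p - N * ψ k p)
          (by have := mul_nonneg hN.le (H.psi_nonneg k p); linarith)
        linarith
      rw [H.map_add _ _ (hψk.add (hχ k)) hd, H.map_add _ _ hψk (hχ k),
        H.map_smul _ _ (H.nn k)] at h1
      have h2 := H.err k _ (hχ k)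
      have h3 := mul_form_ppart_le hb hl hφ (H.nn k) he N
      rw [mul_comm, ← le_div_iff₀ hN] at h3
      have h4 : ℓ (fun p => ppart e (φ p - N * ψ k p)) ≤ 0 := by
        refine hℓ _ (hχ k) (fun p => ppart_nonneg he _) fun p hp => ppart_eq_zero he ?_
        have := mul_nonneg hN.le (H.psi_nonneg k p)
        rw [hp]; linarith
      have h5 : en n b lam (fun p => ppart e (φ p - N * ψ k p)) ≤ B := by
        refine Real.sqrt_le_sqrt ((form_ppart_le hb hl (hφ.sub hψk) he).trans ?_)
        refine (form_sub_self_le hb hl hφ hψk).trans ?_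
        rw [form_const_mul_left lam N (H.nn k), form_comm lam (ψ k),
          form_const_mul_left lam N (H.nn k)]
        have := mul_le_mul_of_nonneg_left (H.form_le k) (sq_nonneg N)
        nlinarith
      have h6 := mul_le_mul_of_nonneg_left h5 (H.eps_nonneg k)
      have h7 := (abs_le.1 h2).2
      linarith
    have hlim : Tendsto (fun k => N * μ (ψ k) + (form n b lam φ φ / 4 / N + ε k * B)
        + μ (fun p => φ p - ppart e (φ p))) atTop (𝓝 (N * 0 + (form n b lam φ φ / 4 / N + 0 * B)
        + μ (fun p => φ p - ppart e (φ p)))) :=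
      ((H.mu_psi.const_mul N).add (tendsto_const_nhds.add (H.tendsto.mul_const B))).add_const _
    have := ge_of_tendsto' hlim hle
    simpa using this
  have key2 : ∀ e > 0, μ φ ≤ μ (fun p => φ p - ppart e (φ p)) := by
    intro e he
    have hlim : Tendsto (fun m : ℕ => form n b lam φ φ / 4 / ((m : ℝ) + 1)
        + μ (fun p => φ p - ppart e (φ p))) atTop (𝓝 (0 + μ (fun p => φ p - ppart e (φ p)))) := by
      refine Tendsto.add_const _ ?_
      have := tendsto_one_div_add_atTop_nhds_zero_nat (𝕜 := ℝ).const_mul (form n b lam φ φ / 4)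
      simpa [div_eq_mul_inv] using this
    rw [zero_add] at hlim
    exact ge_of_tendsto' hlim fun m => key e he _ (by positivity)
  have hlim := (tendsto_form_sub_ppart hb hl hφ hφ0).const_mul
    ((n + 2) * en n b lam (ψ 0) + C + ε 0)
  rw [mul_zero] at hlim
  refine ge_of_tendsto' hlim fun m => ?_
  have hm : 0 < 1 / ((m : ℝ) + 1) := Nat.one_div_pos_of_nat
  exact (key2 _ hm).trans ((le_abs_self _).trans (H.abs_mu_le hb hl (hφ.sub (nn_ppart hφ hm))))

theorem Obst.vanish (H : Obst n b lam ℓ C ψ μ ε) (hb : -1 < b) (hl : 0 ≤ lam)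
    (hℓ : ∀ χ, NN χ → (∀ p, 0 ≤ χ p) → (∃ r > 0, ∀ x y, y ≤ r → χ (x, y) = 0) → ℓ χ ≤ 0)
    {φ : Pt n → ℝ} (hφ : NN φ) (h0 : ∃ r > 0, ∀ x y, y ≤ r → φ (x, y) = 0) : μ φ = 0 := by
  obtain ⟨r, hr, h0⟩ := h0
  obtain ⟨D, ρ, hD, hρ, hle⟩ := hφ.exists_le_bump
  have hr2 : 0 < r / 2 := by positivity
  set ϑ : Pt n → ℝ := fun p => D * (cut (r / 2) p.2 * bump n ρ p)
  have hϑ : NN ϑ := (NN.cut_mul (nn_bump hρ).smoothUp (nn_bump hρ).supp hr2).const_mul D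
  have hϑ0 : ∀ p, 0 ≤ ϑ p := fun p => mul_nonneg hD (mul_nonneg (cut_nonneg _ _) (bump_nonneg _ _))
  have hμ : μ ϑ = 0 := H.eq_zero hb hl hϑ hϑ0 fun χ hχ hχ0 hz => hℓ χ hχ hχ0
    ⟨r / 2, hr2, fun x y hy => hz _ (by simp [ϑ, cut_eq_zero hr2 hy])⟩
  have hab : ∀ p, |φ p| ≤ ϑ p := fun p => by
    rcases le_or_gt p.2 r with h | h
    · rw [show p = (p.1, p.2) from rfl, h0 _ _ h, abs_zero]; exact hϑ0 _
    · simp only [ϑ]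
      rw [cut_eq_one hr2 (by linarith), one_mul]; exact hle p
  have h1 := H.mono hφ hϑ fun p => (le_abs_self _).trans (hab p)
  have h2 := H.mono (hϑ.const_mul (-1)) hφ fun p => by
    have := neg_le_of_abs_le (hab p); linarith
  rw [H.map_smul _ _ hϑ, hμ, mul_zero] at h2
  rw [hμ] at h1
  exact le_antisymm h1 h2

end

section

variable {n : ℕ} {b lam : ℝ}

/-- A function smooth in the upper half space with bounded support and finite energy, and a square
integrable right-hand side. -/
structure Datum (n : ℕ) (b : ℝ) (w R : Pt n → ℝ) : Prop where
  smooth : SmoothUp w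
  supp : BddSupp w
  mem : MemLp w 2 (wt n b)
  mem_pd : ∀ j, MemLp (pd j w) 2 (wt n b)
  memR : MemLp R 2 (wt n b)

/-- The functional `φ ↦ ∫ (∇w·∇φ - R φ)`. -/
def ell (n : ℕ) (b : ℝ) (w R φ : Pt n → ℝ) : ℝ :=
  ∫ p, gd w φ p ∂wt n b - ∫ p, R p * φ p ∂wt n b

theorem MemLp.mul_int {f g : Pt n → ℝ} (hf : MemLp f 2 (wt n b)) (hg : MemLp g 2 (wt n b)) :
    Integrable (fun p => f p * g p) (wt n b) := hf.integrable_mul hg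

theorem MemLp.gd_int (hb : -1 < b) {w φ : Pt n → ℝ} (h : ∀ j, MemLp (pd j w) 2 (wt n b))
    (hφ : NN φ) : Integrable (gd w φ) (wt n b) :=
  integrable_finsetSum _ fun j _ => (h j).integrable_mul ((hφ.pd j).memLp hb)

variable {w R : Pt n → ℝ}

theorem Datum.ell_add (D : Datum n b w R) (hb : -1 < b) {φ χ : Pt n → ℝ} (hφ : NN φ) (hχ : NN χ) :
    ell n b w R (fun p => φ p + χ p) = ell n b w R φ + ell n b w R χ := by
  have h1 : ∫ p, gd w (fun p => φ p + χ p) p ∂wt n b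
      = ∫ p, gd w φ p ∂wt n b + ∫ p, gd w χ p ∂wt n b := by
    rw [← integral_add (MemLp.gd_int hb D.mem_pd hφ) (MemLp.gd_int hb D.mem_pd hχ)]
    simp only [gd_add_right (hφ.differentiableAt _) (hχ.differentiableAt _)]
  have h2 : ∫ p, R p * (φ p + χ p) ∂wt n b
      = ∫ p, R p * φ p ∂wt n b + ∫ p, R p * χ p ∂wt n b := by
    rw [← integral_add (MemLp.mul_int D.memR (hφ.memLp hb))
      (MemLp.mul_int D.memR (hχ.memLp hb))]
    simp only [mul_add]
  rw [ell, ell, ell, h1, h2]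
  ring

theorem ell_smul (w R : Pt n → ℝ) {φ : Pt n → ℝ} (hφ : NN φ) (c : ℝ) :
    ell n b w R (fun p => c * φ p) = c * ell n b w R φ := by
  have h2 : ∀ p, R p * (c * φ p) = c * (R p * φ p) := fun p => by ring
  simp only [ell, gd_const_mul_right (hφ.differentiableAt _), h2, integral_const_mul]
  ring

/-- The bound of `ell` in the energy norm. -/
def ellC (n : ℕ) (b : ℝ) (w R : Pt n → ℝ) : ℝ := ∑ j, l2 n b (pd j w) + l2 n b R

theorem abs_integral_gd_le (hb : -1 < b) (hl : 0 ≤ lam) {w φ : Pt n → ℝ}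
    (h : ∀ j, MemLp (pd j w) 2 (wt n b)) (hφ : NN φ) :
    |∫ p, gd w φ p ∂wt n b| ≤ (∑ j, l2 n b (pd j w)) * en n b lam φ := by
  unfold gd
  rw [integral_finsetSum _ fun j _ => MemLp.mul_int (h j) ((hφ.pd j).memLp hb), Finset.sum_mul]
  refine (Finset.abs_sum_le_sum_abs _ _).trans (Finset.sum_le_sum fun j _ => ?_)
  exact (abs_integral_mul_le (h j) ((hφ.pd j).memLp hb)).trans
    (mul_le_mul_of_nonneg_left (l2_pd_le_en hb hl hφ j) (l2_nonneg _))

theorem Datum.ell_le (D : Datum n b w R) (hb : -1 < b) (hl : 1 ≤ lam) {φ : Pt n → ℝ} (hφ : NN φ) :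
    |ell n b w R φ| ≤ ellC n b w R * en n b lam φ := by
  have h1 := abs_integral_gd_le hb (zero_le_one.trans hl) D.mem_pd hφ
  have h2 := (abs_integral_mul_le D.memR (hφ.memLp hb)).trans
    (mul_le_mul_of_nonneg_left (l2_le_en hb hl hφ) (l2_nonneg _))
  rw [ellC, add_mul]
  exact (abs_sub _ _).trans (add_le_add h1 h2)

theorem exists_obst (hb : -1 < b) (hl : 0 ≤ lam) {ℓ : (Pt n → ℝ) → ℝ} {C : ℝ}
    (hadd : ∀ φ χ, NN φ → NN χ → ℓ (fun p => φ p + χ p) = ℓ φ + ℓ χ)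
    (hsmul : ∀ (c : ℝ) φ, NN φ → ℓ (fun p => c * φ p) = c * ℓ φ)
    (hle : ∀ φ, NN φ → |ℓ φ| ≤ C * en n b lam φ) :
    ∃ ψ μ ε, Obst n b lam ℓ C ψ μ ε := by
  classical
  obtain ⟨ψ, μ, ε, h1, h2, h3, h4, h5, h6, h7, h8⟩ := exists_minimizing_sequence (formL n hb lam)
    (fun u v => form_comm lam u.1 v.1) (fun v => form_self_nonneg hl v.1)
    { toFun := fun v => ℓ v.1
      map_add' := fun u v => hadd u.1 v.1 u.2 v.2
      map_smul' := fun c v => hsmul c v.1 v.2 } C (fun v => hle v.1 v.2)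
    {v : NNs n | ∀ p, 0 ≤ v.1 p} (fun p => le_rfl) (fun u hu v hv p => add_nonneg (hu p) (hv p))
    (fun t ht v hv p => mul_nonneg ht (hv p))
  refine ⟨fun k => (ψ k).1, fun φ => if h : NN φ then μ ⟨φ, h⟩ else 0, ε, fun k => (ψ k).2,
    h3, fun k φ hφ => ?_, hle, h7, h2, h1, fun φ χ hφ hχ => ?_, fun c φ hφ => ?_,
    fun φ hφ h => ?_, ?_, h8⟩
  · simp only [dif_pos hφ]
    exact h4 k ⟨φ, hφ⟩
  · simp only [dif_pos hφ, dif_pos hχ, dif_pos (hφ.add hχ)]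
    exact μ.map_add ⟨φ, hφ⟩ ⟨χ, hχ⟩
  · simp only [dif_pos hφ, dif_pos (hφ.const_mul c)]
    exact μ.map_smul c ⟨φ, hφ⟩
  · simp only [dif_pos hφ]
    exact h5 ⟨φ, hφ⟩ h
  · refine h6.congr fun k => ?_
    rw [dif_pos (show NN (ψ k).1 from (ψ k).2)]

theorem pd_sub_top (hs : SmoothUp w) (hw : BddSupp w) {δ : ℝ} (hδ : 0 < δ) {p : Pt n}
    (hp : 0 < p.2) (j : Option (Fin n)) :
    pd j w p - pd j (top δ w) p = match j with
      | none => (1 - cut δ p.2) * pd none w p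
      | some i => pd (some i) w p - top δ (pd (some i) w) p := by
  cases j with
  | none => simp only [pd_none_top hs hw hδ hp]; ring
  | some i => simp only [pd_some_top hs hw hδ hp]

theorem Datum.tendsto_top (D : Datum n b w R) (hb : -1 < b) (hb1 : b < 1) :
    Tendsto (fun δ => ∑ j, l2 n b (fun p => pd j w p - pd j (top δ w) p)
      + √lam * l2 n b (fun p => w p - top δ w p)) (𝓝[>] 0) (𝓝 0) := by
  have h1 : ∀ j, Tendsto (fun δ => l2 n b (fun p => pd j w p - pd j (top δ w) p)) (𝓝[>] 0)
      (𝓝 0) := by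
    intro j
    cases j with
    | none =>
      have h2 : Tendsto (fun r : ℝ => 2 * r) (𝓝[>] 0) (𝓝[>] 0) := by
        refine tendsto_nhdsWithin_iff.2 ⟨?_, eventually_mem_nhdsWithin.mono fun s hs => by
          simpa using hs⟩
        have : Tendsto (fun r : ℝ => 2 * r) (𝓝 0) (𝓝 (2 * 0)) := tendsto_id.const_mul 2
        rw [mul_zero] at this
        exact this.mono_left nhdsWithin_le_nhds
      refine squeeze_zero' (Eventually.of_forall fun _ => l2_nonneg _) ?_
        ((tendsto_l2low (D.mem_pd none)).comp h2)
      filter_upwards [self_mem_nhdsWithin] with δ hδ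
      have hδ' : 0 < δ := hδ
      refine l2_le_l2low (D.mem_pd none) ?_ (fun p hp => ?_) fun p hp => ?_
      · exact ((D.smooth.pd none).sub
          ((NN.top D.smooth D.supp hδ').pd none).smoothUp).continuousOn
      · rw [pd_sub_top D.smooth D.supp hδ' hp]
        exact abs_one_sub_cut_mul_le _ _ _
      · rw [pd_sub_top D.smooth D.supp hδ' (by linarith), cut_eq_one hδ' hp]
        simp
    | some i =>
      refine (tendsto_l2_sub_top hb hb1 (D.smooth.pd (some i)) (D.supp.pd (some i))
        (D.mem_pd _)).congr' ?_
      filter_upwards [self_mem_nhdsWithin] with δ hδ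
      unfold l2
      congr 1
      refine integral_congr_ae (ae_wt_of_forall fun p hp => ?_)
      simp only
      rw [pd_sub_top D.smooth D.supp hδ hp]
  have h3 := (tendsto_l2_sub_top hb hb1 D.smooth D.supp D.mem).const_mul (√lam)
  rw [mul_zero] at h3
  have h4 := (tendsto_finsetSum Finset.univ fun j _ => h1 j).add h3
  simpa using h4

theorem en_le_sum (hb : -1 < b) (hl : 0 ≤ lam) {f : Pt n → ℝ} (hf : NN f) :
    en n b lam f ≤ ∑ j, l2 n b (pd j f) + √lam * l2 n b f := by
  have h0 : 0 ≤ ∑ j, l2 n b (pd j f) := Finset.sum_nonneg fun _ _ => l2_nonneg _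
  have h1 : 0 ≤ √lam * l2 n b f := mul_nonneg (Real.sqrt_nonneg _) (l2_nonneg _)
  refine Real.sqrt_le_iff.2 ⟨add_nonneg h0 h1, ?_⟩
  rw [form_self_eq hb lam hf]
  have h2 : ∑ j, l2 n b (pd j f) ^ 2 ≤ (∑ j, l2 n b (pd j f)) ^ 2 :=
    Finset.sum_sq_le_sq_sum_of_nonneg fun _ _ => l2_nonneg _
  have h3 : (√lam * l2 n b f) ^ 2 = lam * l2 n b f ^ 2 := by rw [mul_pow, Real.sq_sqrt hl]
  nlinarith

theorem en_add_le (hb : -1 < b) (hl : 0 ≤ lam) {f g : Pt n → ℝ} (hf : NN f) (hg : NN g) :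
    en n b lam (fun p => f p + g p) ≤ 2 * (en n b lam f + en n b lam g) := by
  have h := form_sub_self_le hb hl hf (hg.const_mul (-1))
  rw [form_const_mul_left lam (-1) hg, form_comm lam g, form_const_mul_left lam (-1) hg,
    show (fun p => f p - -1 * g p) = fun p => f p + g p by ext; ring,
    ← en_sq hl f, ← en_sq hl g] at h
  have h1 := en_nonneg (b := b) lam f
  have h2 := en_nonneg (b := b) lam g
  exact Real.sqrt_le_iff.2 ⟨by positivity, h.trans (by nlinarith [mul_nonneg h1 h2])⟩

end

section

variable {n : ℕ} {b lam : ℝ}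

variable {w R : Pt n → ℝ}

/-- The distance in energy between `w` and its regularization. -/
def topDist (n : ℕ) (b lam δ : ℝ) (w : Pt n → ℝ) : ℝ :=
  ∑ j, l2 n b (fun p => pd j w p - pd j (top δ w) p) + √lam * l2 n b (fun p => w p - top δ w p)

theorem Datum.exists_topDist_le (D : Datum n b w R) (hb : -1 < b) (hb1 : b < 1) (lam : ℝ) {η : ℝ}
    (hη : 0 < η) : ∃ δ, 0 < δ ∧ topDist n b lam δ w ≤ η := by
  have h := (D.tendsto_top (lam := lam) hb hb1).eventually_lt_const hη
  obtain ⟨δ, h1, h2⟩ := (h.and self_mem_nhdsWithin).exists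
  exact ⟨δ, h2, h1.le⟩

theorem l2_sub_le {f g : Pt n → ℝ} (hf : MemLp f 2 (wt n b)) (hg : MemLp g 2 (wt n b)) :
    l2 n b (fun p => f p - g p) ≤ l2 n b f + l2 n b g := by
  have h := l2_add_le hf (hg.const_mul (-1))
  rw [l2_const_mul, abs_neg, abs_one, one_mul] at h
  simpa [← sub_eq_add_neg] using h

theorem Datum.en_top_sub_le (D : Datum n b w R) (hb : -1 < b) (hl : 0 ≤ lam) {δ δ' : ℝ}
    (hδ : 0 < δ) (hδ' : 0 < δ') : en n b lam (fun p => top δ' w p - top δ w p)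
      ≤ topDist n b lam δ w + topDist n b lam δ' w := by
  have hT := NN.top D.smooth D.supp hδ
  have hT' := NN.top D.smooth D.supp hδ'
  refine (en_le_sum hb hl (hT'.sub hT)).trans ?_
  have h1 : ∀ j, l2 n b (pd j (fun p => top δ' w p - top δ w p))
      ≤ l2 n b (fun p => pd j w p - pd j (top δ w) p)
        + l2 n b (fun p => pd j w p - pd j (top δ' w) p) := fun j => by
    rw [show pd j (fun p => top δ' w p - top δ w p) = fun p => (pd j w p - pd j (top δ w) p)
      - (pd j w p - pd j (top δ' w) p) by
        ext p; rw [pd_sub (hT'.differentiableAt p) (hT.differentiableAt p)]; ring]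
    exact l2_sub_le ((D.mem_pd j).sub ((hT.pd j).memLp hb))
      ((D.mem_pd j).sub ((hT'.pd j).memLp hb))
  have h2 : l2 n b (fun p => top δ' w p - top δ w p)
      ≤ l2 n b (fun p => w p - top δ w p) + l2 n b (fun p => w p - top δ' w p) := by
    rw [show (fun p => top δ' w p - top δ w p) = fun p => (w p - top δ w p)
      - (w p - top δ' w p) by ext p; ring]
    exact l2_sub_le (D.mem.sub (hT.memLp hb)) (D.mem.sub (hT'.memLp hb))
  have h3 := Finset.sum_le_sum fun j (_ : j ∈ Finset.univ) => h1 j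
  rw [Finset.sum_add_distrib] at h3
  have h4 := mul_le_mul_of_nonneg_left h2 (Real.sqrt_nonneg lam)
  unfold topDist
  linarith

theorem Datum.en_top_le (D : Datum n b w R) (hb : -1 < b) (hl : 0 ≤ lam) {δ : ℝ} (hδ : 0 < δ) :
    en n b lam (top δ w) ≤ topDist n b lam δ w + (∑ j, l2 n b (pd j w) + √lam * l2 n b w) := by
  have hT := NN.top D.smooth D.supp hδ
  refine (en_le_sum hb hl hT).trans ?_
  have h1 : ∀ j, l2 n b (pd j (top δ w))
      ≤ l2 n b (pd j w) + l2 n b (fun p => pd j w p - pd j (top δ w) p) := fun j => by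
    have := l2_sub_le (g := fun p => pd j w p - pd j (top δ w) p) (D.mem_pd j)
      ((D.mem_pd j).sub ((hT.pd j).memLp hb))
    simpa only [sub_sub_cancel] using this
  have h2 : l2 n b (top δ w) ≤ l2 n b w + l2 n b (fun p => w p - top δ w p) := by
    have := l2_sub_le (g := fun p => w p - top δ w p) D.mem (D.mem.sub (hT.memLp hb))
    simpa only [sub_sub_cancel] using this
  have h3 := Finset.sum_le_sum fun j (_ : j ∈ Finset.univ) => h1 j
  rw [Finset.sum_add_distrib] at h3
  have h4 := mul_le_mul_of_nonneg_left h2 (Real.sqrt_nonneg lam)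
  unfold topDist
  linarith

theorem Datum.gd_top_sub_le (D : Datum n b w R) (hb : -1 < b) (hl : 0 ≤ lam) {δ : ℝ} (hδ : 0 < δ)
    {φ : Pt n → ℝ} (hφ : NN φ) :
    |∫ p, gd w φ p ∂wt n b - ∫ p, gd (top δ w) φ p ∂wt n b|
      ≤ topDist n b lam δ w * en n b lam φ := by
  have hT := NN.top D.smooth D.supp hδ
  have hTm : ∀ j, MemLp (pd j (top δ w)) 2 (wt n b) := fun j => (hT.pd j).memLp hb
  have hm : ∀ j, MemLp (pd j (fun p => w p - top δ w p)) 2 (wt n b) := fun j => by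
    refine ((D.mem_pd j).sub (hTm j)).ae_eq (ae_wt_of_forall fun p hp => ?_)
    rw [pd_sub (D.smooth.differentiableAt hp) (hT.differentiableAt p)]; rfl
  have hl2 : ∀ j, l2 n b (pd j (fun p => w p - top δ w p))
      = l2 n b (fun p => pd j w p - pd j (top δ w) p) := fun j => by
    unfold l2
    congr 1
    refine integral_congr_ae (ae_wt_of_forall fun p hp => ?_)
    simp only [pd_sub (D.smooth.differentiableAt hp) (hT.differentiableAt p)]
  rw [← integral_sub (MemLp.gd_int hb D.mem_pd hφ) (MemLp.gd_int hb hTm hφ)]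
  have h1 := abs_integral_gd_le hb hl hm hφ
  simp only [hl2] at h1
  rw [integral_congr_ae (ae_wt_of_forall fun p hp =>
    (gd_sub_left (h := φ) (D.smooth.differentiableAt hp) (hT.differentiableAt p)).symm)]
  refine h1.trans (mul_le_mul_of_nonneg_right ?_ (en_nonneg _ _))
  exact le_add_of_nonneg_right (mul_nonneg (Real.sqrt_nonneg _) (l2_nonneg _))

theorem Obst.en_psi_le {ℓ μ : (Pt n → ℝ) → ℝ} {C : ℝ} {ψ : ℕ → Pt n → ℝ} {ε : ℕ → ℝ}
    (H : Obst n b lam ℓ C ψ μ ε) (k : ℕ) : en n b lam (ψ k) ≤ √(4 * C ^ 2 + 4) :=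
  Real.sqrt_le_sqrt (H.form_le k)

theorem Obst.exists_approx {C : ℝ} {ψ : ℕ → Pt n → ℝ} {μ : (Pt n → ℝ) → ℝ} {ε : ℕ → ℝ}
    (H : Obst n b lam (ell n b w R) C ψ μ ε) (D : Datum n b w R) (hb : -1 < b) (hb1 : b < 1)
    (hl : 1 ≤ lam) (hℓ : ∀ χ, NN χ → (∀ p, 0 ≤ χ p) →
      (∃ r > 0, ∀ x y, y ≤ r → χ (x, y) = 0) → ell n b w R χ ≤ 0) :
    ∃ δ : ℕ → ℝ, (∀ k, 0 < δ k) ∧ ∃ M ε', Approx n b lam (fun k q => ψ k q + top (δ k) w q)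
      (fun k q => R q - lam * ψ k q) M μ ε' := by
  have hl0 : 0 ≤ lam := zero_le_one.trans hl
  have hex : ∀ k : ℕ, ∃ δ, 0 < δ ∧ topDist n b lam δ w ≤ 1 / ((k : ℝ) + 1) := fun k =>
    D.exists_topDist_le hb hb1 lam Nat.one_div_pos_of_nat
  choose δ hδ hdist using hex
  have hT : ∀ k, NN (top (δ k) w) := fun k => NN.top D.smooth D.supp (hδ k)
  set S := √(4 * C ^ 2 + 4)
  have hS : 0 ≤ S := Real.sqrt_nonneg _
  set W := ∑ j, l2 n b (pd j w) + √lam * l2 n b w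
  have hW : 0 ≤ W := add_nonneg (Finset.sum_nonneg fun _ _ => l2_nonneg _)
    (mul_nonneg (Real.sqrt_nonneg _) (l2_nonneg _))
  have hk1 : ∀ k : ℕ, 1 / ((k : ℝ) + 1) ≤ 1 := fun k => by
    rw [div_le_one (by positivity)]; linarith [Nat.cast_nonneg (α := ℝ) k]
  have hRS : 0 ≤ l2 n b R + lam * S := by have := l2_nonneg (b := b) R; positivity
  have hψm : ∀ k, MemLp (fun q => lam * ψ k q) 2 (wt n b) := fun k =>
    ((H.nn k).memLp hb).const_mul lam
  refine ⟨δ, hδ, 2 * (S + (1 + W)) + (l2 n b R + lam * S),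
    fun k => 2 * (ε k + 2 * (1 / ((k : ℝ) + 1))), fun k => (H.nn k).add (hT k),
    fun k => D.memR.sub (hψm k), fun k => ?_, fun k => ?_, fun k φ hφ => ?_, fun k j hkj => ?_,
    fun k => ?_, ?_, H.map_add, H.map_smul, fun φ hφ h0 => H.vanish hb hl0 hℓ hφ h0⟩
  · refine (l2_sub_le D.memR (hψm k)).trans ?_
    rw [l2_const_mul, abs_of_nonneg hl0]
    have := mul_le_mul_of_nonneg_left ((l2_le_en hb hl (H.nn k)).trans (H.en_psi_le k)) hl0
    linarith
  · have h1 := en_add_le hb hl0 (H.nn k) (hT k)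
    have h2 := D.en_top_le hb hl0 (hδ k)
    have h3 := H.en_psi_le k
    have h4 := hdist k
    have h5 := hk1 k
    linarith
  · have hTm : ∀ j, MemLp (pd j (top (δ k) w)) 2 (wt n b) := fun j => ((hT k).pd j).memLp hb
    have e1 : ∫ q, gd (fun q => ψ k q + top (δ k) w q) φ q ∂wt n b
        = ∫ q, gd (ψ k) φ q ∂wt n b + ∫ q, gd (top (δ k) w) φ q ∂wt n b := by
      rw [← integral_add (((H.nn k).gd_bc hφ).integrable hb) (((hT k).gd_bc hφ).integrable hb)]
      simp only [gd_add_left ((H.nn k).differentiableAt _) ((hT k).differentiableAt _)]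
    have e2 : ∫ q, (R q - lam * ψ k q) * φ q ∂wt n b
        = ∫ q, R q * φ q ∂wt n b - ∫ q, lam * (ψ k q * φ q) ∂wt n b := by
      rw [← integral_sub (MemLp.mul_int D.memR (hφ.memLp hb))
        ((((H.nn k).bc.mul hφ.bc).integrable hb).const_mul lam)]
      congr 1; ext q; ring
    have e3 : form n b lam (ψ k) φ = ∫ q, gd (ψ k) φ q ∂wt n b
        + ∫ q, lam * (ψ k q * φ q) ∂wt n b :=
      integral_add (((H.nn k).gd_bc hφ).integrable hb)
        ((((H.nn k).bc.mul hφ.bc).integrable hb).const_mul lam)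
    have h1 := H.err k φ hφ
    have h2 := D.gd_top_sub_le hb hl0 (hδ k) hφ
    have h3 := mul_le_mul_of_nonneg_right (hdist k) (en_nonneg (b := b) lam φ)
    have h4 : 0 ≤ 1 / ((k : ℝ) + 1) * en n b lam φ := mul_nonneg (by positivity) (en_nonneg _ _)
    have h5 := mul_nonneg (H.eps_nonneg k) (en_nonneg (b := b) lam φ)
    rw [e3, ell] at h1
    rw [e1, e2]
    rw [abs_le] at h1 h2 ⊢
    constructor <;> nlinarith
  · have h1 := en_add_le hb hl0 ((H.nn j).sub (H.nn k)) ((hT j).sub (hT k))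
    have h2 := H.cauchy k j hkj
    have h3 := D.en_top_sub_le hb hl0 (hδ k) (hδ j)
    have h4 : 1 / ((j : ℝ) + 1) ≤ 1 / ((k : ℝ) + 1) := by
      have : (k : ℝ) ≤ j := by exact_mod_cast hkj
      gcongr
    rw [show (fun q => ψ j q + top (δ j) w q - (ψ k q + top (δ k) w q))
      = fun q => (ψ j q - ψ k q) + (top (δ j) w q - top (δ k) w q) by ext; ring]
    have h5 := hdist k
    have h6 := hdist j
    linarith
  · have := H.eps_nonneg k
    positivity
  · have := (H.tendsto.add
      ((tendsto_one_div_add_atTop_nhds_zero_nat (𝕜 := ℝ)).const_mul 2)).const_mul 2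
    simpa using this

end

section

variable {n : ℕ} {b lam : ℝ}

variable {w R : Pt n → ℝ}

/-- `φ` vanishes in a neighbourhood of `K × {0}`. -/
def VanishNear (K : Set (EuclideanSpace ℝ (Fin n))) (φ : Pt n → ℝ) : Prop :=
  ∃ V, IsOpen V ∧ K ⊆ V ∧ ∃ r > 0, ∀ x ∈ V, ∀ y, y ≤ r → φ (x, y) = 0

section clip

variable {K : Set (EuclideanSpace ℝ (Fin n))} {C : ℝ} {ℓ μ : (Pt n → ℝ) → ℝ} {ψ : ℕ → Pt n → ℝ}
  {ε : ℕ → ℝ}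

theorem Obst.excess_eq_zero (H : Obst n b lam ℓ C ψ μ ε) (hb : -1 < b) (hl : 0 ≤ lam)
    (hℓ : ∀ χ, NN χ → (∀ p, 0 ≤ χ p) → VanishNear K χ → ℓ χ ≤ 0) {f : Pt n → ℝ} (hf : NN f)
    (hK : ∀ x ∈ K, f (x, 0) ≤ 0) {e : ℝ} (he : 0 < e) : μ (fun p => ppart e (f p)) = 0 := by
  refine H.eq_zero hb hl (nn_ppart hf he) (fun p => ppart_nonneg he _) fun χ hχ hχ0 hz =>
    hℓ χ hχ hχ0 ?_
  obtain ⟨r, hr, hfl⟩ := hf.flat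
  refine ⟨{x | f (x, 0) < e / 2}, ?_, fun x hx => (hK x hx).trans_lt (by positivity), r, hr,
    fun x hx y hy => hz _ ?_⟩
  · exact isOpen_lt (hf.continuous.comp (by fun_prop)) continuous_const
  · rw [hfl x y hy]
    exact ppart_eq_zero he (le_of_lt hx)

theorem Obst.exists_clip (H : Obst n b lam ℓ C ψ μ ε) (hb : -1 < b) (hl : 0 ≤ lam)
    (hℓ : ∀ χ, NN χ → (∀ p, 0 ≤ χ p) → VanishNear K χ → ℓ χ ≤ 0) {f : Pt n → ℝ} (hf : NN f)
    {c : ℝ} (hc : 0 < c) (hK : ∀ x ∈ K, |f (x, 0)| ≤ c) :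
    ∃ g, NN g ∧ μ g = μ f ∧ ∀ p, |g p| ≤ |f p| ∧ |g p| ≤ 2 * c := by
  obtain ⟨ρ, hρ1, hρ⟩ := hf.supp.exists_pos
  have hρ0 : 0 < ρ := by linarith
  set ϑ := bump n ρ
  have hϑ : NN ϑ := nn_bump hρ0
  have hϑ0 : ∀ p, 0 ≤ ϑ p := bump_nonneg ρ
  have hϑ1 : ∀ p, f p = 0 ∨ ϑ p = 1 := fun p => by
    by_cases h : ρ < ‖p.1‖ ∨ ρ < p.2
    · exact Or.inl (hρ p.1 p.2 h)
    · push Not at h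
      exact Or.inr (bump_eq_one hρ0 h.1 h.2)
  set P : Pt n → ℝ := fun p => f p - c * ϑ p
  set N : Pt n → ℝ := fun p => -1 * f p - c * ϑ p
  have hP : NN P := hf.sub (hϑ.const_mul c)
  have hN : NN N := (hf.const_mul (-1)).sub (hϑ.const_mul c)
  have hG1 := nn_ppart hP hc
  have hG2 := nn_ppart hN hc
  have hsgn : ∀ x ∈ K, P (x, 0) ≤ 0 ∧ N (x, 0) ≤ 0 := fun x hx => by
    have h1 := abs_le.1 (hK x hx)
    have h2 := mul_nonneg hc.le (hϑ0 (x, 0))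
    rcases hϑ1 (x, 0) with h | h
    · simp only [P, N, h]
      constructor <;> linarith
    · simp only [P, N, h]
      constructor <;> linarith
  refine ⟨fun p => (f p - ppart c (P p)) + ppart c (N p), (hf.sub hG1).add hG2, ?_, fun p => ?_⟩
  · rw [H.map_add _ _ (hf.sub hG1) hG2, H.map_sub hf hG1,
      H.excess_eq_zero hb hl hℓ hP (fun x hx => (hsgn x hx).1) hc,
      H.excess_eq_zero hb hl hℓ hN (fun x hx => (hsgn x hx).2) hc]
    ring
  · have h0 := hϑ0 p
    have hcϑ := mul_nonneg hc.le h0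
    have hle : c * ϑ p ≤ c := by
      rcases hϑ1 p with h | h
      · have : ϑ p ≤ 1 := by
          refine mul_le_one₀ (Real.smoothTransition.le_one _) (sub_nonneg.2 (cut_le_one _ _)) ?_
          linarith [cut_nonneg ρ p.2]
        nlinarith
      · rw [h, mul_one]
    have a1 := ppart_nonneg hc (P p)
    have a2 := ppart_nonneg hc (N p)
    have b1 := ppart_le hc (P p)
    have b2 := ppart_le hc (N p)
    have c1 := sub_le_ppart hc (P p)
    have c2 := sub_le_ppart hc (N p)
    rcases le_total 0 (f p) with h | h
    · have h2 : ppart c (N p) = 0 := ppart_eq_zero hc (by simp only [N]; linarith)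
      have h3 : max (P p) 0 ≤ f p := max_le (by simp only [P]; linarith) h
      simp only [P, N] at *
      rw [h2, add_zero, abs_of_nonneg h, abs_of_nonneg (by linarith)]
      constructor <;> linarith
    · have h2 : ppart c (P p) = 0 := ppart_eq_zero hc (by simp only [P]; linarith)
      have h3 : max (N p) 0 ≤ -f p := max_le (by simp only [N]; linarith) (by linarith)
      simp only [P, N] at *
      rw [h2, sub_zero, abs_of_nonpos h, abs_of_nonpos (by linarith)]
      constructor <;> linarith

end clip

/-- The size of `w - top s w` on the boundary where `|y^b ∂_y w| ≤ 1`. -/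
def fluxC (b s : ℝ) : ℝ := (2 * s) ^ (1 - b) / (1 - b)

theorem abs_top_sub_top_le (hb1 : b < 1) (hs : SmoothUp w) (hw : BddSupp w) {δ s : ℝ} (hδ : 0 < δ)
    (h0 : 0 < s) {x : EuclideanSpace ℝ (Fin n)} {Q : ℝ} (hQ : 0 ≤ Q)
    (h : ∀ t, 0 < t → t < 2 * s → |t ^ b * pd none w (x, t)| ≤ Q) :
    |top δ w (x, 0) - top s (top δ w) (x, 0)| ≤ Q * fluxC b s := by
  have hT := NN.top hs hw hδ
  obtain ⟨r, hr, hfl⟩ := (nn_sub_top hT h0).flat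
  set y := min r s
  have hy : 0 < y := lt_min hr h0
  have hys : y ≤ 2 * s := (min_le_right _ _).trans (by linarith)
  have e1 : top δ w (x, y) - top s (top δ w) (x, y) = top δ w (x, 0) - top s (top δ w) (x, 0) :=
    hfl x y (min_le_left _ _)
  rw [← e1, sub_top_eq hT.smoothUp hT.supp h0 x hy hys, abs_neg]
  have hi : IntervalIntegrable (fun t : ℝ => Q * t ^ (-b)) volume 0 (2 * s) :=
    (intervalIntegral.intervalIntegrable_rpow' (by linarith)).const_mul Q
  have hi2 : IntervalIntegrable (fun t : ℝ => Q * t ^ (-b)) volume y (2 * s) :=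
    hi.mono_set (by
      rw [uIcc_of_le hys, uIcc_of_le (by linarith)]
      exact Icc_subset_Icc_left hy.le)
  have h1 : |∫ t in y..2 * s, (1 - cut s t) * pd none (top δ w) (x, t)|
      ≤ ∫ t in y..2 * s, Q * t ^ (-b) := by
    have hne : ∀ᵐ t : ℝ, t ≠ 2 * s := by simp [ae_iff, measure_singleton]
    rw [← Real.norm_eq_abs]
    refine intervalIntegral.norm_integral_le_of_norm_le hys ?_ hi2
    filter_upwards [hne] with t htne ht
    have ht0 : 0 < t := hy.trans ht.1
    have hp : (0 : ℝ) < ((x, t) : Pt n).2 := ht0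
    rw [Real.norm_eq_abs, pd_none_top hs hw hδ hp]
    refine (abs_one_sub_cut_mul_le _ _ _).trans ?_
    rw [abs_mul, abs_of_nonneg (cut_nonneg _ _)]
    refine (mul_le_of_le_one_left (abs_nonneg _) (cut_le_one _ _)).trans ?_
    have h2 := h t ht0 (lt_of_le_of_ne ht.2 htne)
    have h3 : 0 < t ^ b := Real.rpow_pos_of_pos ht0 _
    rw [abs_mul, abs_of_pos h3] at h2
    rw [Real.rpow_neg ht0.le, ← div_eq_mul_inv, le_div_iff₀ h3]
    linarith
  refine h1.trans ?_
  have h2 : ∫ t in y..2 * s, Q * t ^ (-b) ≤ ∫ t in (0 : ℝ)..2 * s, Q * t ^ (-b) := by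
    rw [← intervalIntegral.integral_add_adjacent_intervals (a := 0) (b := y) (c := 2 * s)
      (hi.mono_set (by
        rw [uIcc_of_le hy.le, uIcc_of_le (by linarith)]
        exact Icc_subset_Icc_right hys)) hi2]
    have : 0 ≤ ∫ t in (0 : ℝ)..y, Q * t ^ (-b) :=
      intervalIntegral.integral_nonneg hy.le fun t ht =>
        mul_nonneg hQ (Real.rpow_nonneg ht.1 _)
    linarith
  refine h2.trans_eq ?_
  rw [intervalIntegral.integral_const_mul, integral_rpow (Or.inl (by linarith)), fluxC,
    Real.zero_rpow (by linarith), sub_zero]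
  ring_nf

end

section

variable {n : ℕ} {b lam : ℝ}

variable {w R : Pt n → ℝ}

theorem top_eq_zero (s : ℝ) {f : Pt n → ℝ} {x : EuclideanSpace ℝ (Fin n)}
    (h : ∀ y, f (x, y) = 0) (y : ℝ) : top s f (x, y) = 0 := by
  simp [top, tail, h]

theorem sub_top_top_eq_zero {ρ δ s : ℝ} (hw : ∀ x y, ρ < ‖x‖ ∨ ρ < y → w (x, y) = 0) (h0 : 0 < s)
    {x : EuclideanSpace ℝ (Fin n)} {y : ℝ} (h : ρ < ‖x‖ ∨ 2 * s ≤ y) :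
    top δ w (x, y) - top s (top δ w) (x, y) = 0 := by
  rcases h with h | h
  · have h1 : ∀ y, top δ w (x, y) = 0 := top_eq_zero δ fun y => hw x y (Or.inl h)
    rw [h1, top_eq_zero s h1, sub_zero]
  · rw [top_eq_self h0 h, sub_self]

theorem fluxC_pos (hb1 : b < 1) {s : ℝ} (hs : 0 < s) : 0 < fluxC b s :=
  div_pos (Real.rpow_pos_of_pos (by linarith) _) (by linarith)

theorem fluxC_eq {s : ℝ} (hs : 0 < s) : fluxC b s = 2 ^ (1 - b) / (1 - b) * s ^ (1 - b) := by
  rw [fluxC, Real.mul_rpow zero_le_two hs.le]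
  ring

/-- The points of the boundary where the flux exceeds `η` somewhere below height `r`. -/
def fluxSet (n : ℕ) (b : ℝ) (w : Pt n → ℝ) (η r : ℝ) : Set (EuclideanSpace ℝ (Fin n)) :=
  {x | ∃ t, 0 < t ∧ t < r ∧ η < |t ^ b * pd none w (x, t)|}

theorem isOpen_fluxSet (hw : SmoothUp w) (η r : ℝ) : IsOpen (fluxSet n b w η r) := by
  have e : fluxSet n b w η r
      = ⋃ t ∈ Ioo (0 : ℝ) r, {x | η < |t ^ b * pd none w (x, t)|} := by
    ext x
    simp only [fluxSet, mem_ofPred_eq, mem_iUnion, mem_Ioo, exists_prop, and_assoc]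
  rw [e]
  refine isOpen_biUnion fun t ht => ?_
  have hc : Continuous fun x : EuclideanSpace ℝ (Fin n) => pd none w (x, t) :=
    (hw.pd none).continuousOn.comp_continuous (by fun_prop) fun x => ht.1
  exact isOpen_lt continuous_const (by fun_prop)

theorem fluxSet_mono (η : ℝ) {r r' : ℝ} (h : r ≤ r') : fluxSet n b w η r ⊆ fluxSet n b w η r' :=
  fun _ ⟨t, h1, h2, h3⟩ => ⟨t, h1, h2.trans_le h, h3⟩

theorem exists_volume_fluxSet_lt (hw : SmoothUp w)
    (hu : ∀ x, Tendsto (fun y => y ^ b * pd none w (x, y)) (𝓝[>] 0) (𝓝 0)) {η e : ℝ} (hη : 0 < η)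
    (he : 0 < e) (ρ : ℝ) :
    ∃ r > 0, volume.real (fluxSet n b w η r ∩ closedBall 0 ρ) < e := by
  have hfin : volume (closedBall (0 : EuclideanSpace ℝ (Fin n)) ρ) ≠ ⊤ :=
    measure_closedBall_lt_top.ne
  have hlim := tendsto_measure_iInter_atTop (μ := volume)
    (s := fun k : ℕ => fluxSet n b w η (1 / ((k : ℝ) + 1)) ∩ closedBall 0 ρ)
    (fun k => ((isOpen_fluxSet hw _ _).measurableSet.inter
      measurableSet_closedBall).nullMeasurableSet)
    (fun i j hij => inter_subset_inter_left _
      (fluxSet_mono η (Nat.one_div_le_one_div hij)))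
    ⟨0, (measure_mono inter_subset_right).trans_lt measure_closedBall_lt_top |>.ne⟩
  have hempty : ⋂ k : ℕ, fluxSet n b w η (1 / ((k : ℝ) + 1)) ∩ closedBall 0 ρ = ∅ := by
    refine eq_empty_of_forall_notMem fun x hx => ?_
    have h1 := ((tendsto_order.1 (hu x).abs).2 η (by simpa using hη))
    obtain ⟨ε, hε, h2⟩ := mem_nhdsGT_iff_exists_Ioo_subset.1 h1
    obtain ⟨k, hk⟩ := exists_nat_one_div_lt (show (0 : ℝ) < ε from hε)
    obtain ⟨t, ht0, ht1, ht2⟩ := (mem_iInter.1 hx k).1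
    have h3 : |t ^ b * pd none w (x, t)| < η := h2 ⟨ht0, ht1.trans hk⟩
    linarith
  rw [hempty, measure_empty] at hlim
  obtain ⟨k, hk⟩ := (hlim.eventually_lt_const (ENNReal.ofReal_pos.2 he)).exists
  refine ⟨_, Nat.one_div_pos_of_nat (n := k), ?_⟩
  exact ENNReal.toReal_lt_of_lt_ofReal hk

theorem trace_sq_le {φ : Pt n → ℝ} {ρ c c' : ℝ} {A : Set (EuclideanSpace ℝ (Fin n))}
    (hA : MeasurableSet A) (h0 : ∀ x, ρ < ‖x‖ → φ (x, 0) = 0)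
    (h1 : ∀ x, x ∉ A → |φ (x, 0)| ≤ c) (h2 : ∀ x, |φ (x, 0)| ≤ c') :
    trace n φ ^ 2 ≤ c ^ 2 * volume.real (closedBall (0 : EuclideanSpace ℝ (Fin n)) ρ)
      + c' ^ 2 * volume.real (A ∩ closedBall 0 ρ) := by
  set B := closedBall (0 : EuclideanSpace ℝ (Fin n)) ρ
  have hB : MeasurableSet B := measurableSet_closedBall
  have hBf : volume B ≠ ⊤ := measure_closedBall_lt_top.ne
  have hABf : volume (A ∩ B) ≠ ⊤ := measure_ne_top_of_subset inter_subset_right hBf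
  rw [trace, Real.sq_sqrt (integral_nonneg fun x => sq_nonneg _)]
  have hi1 : Integrable (B.indicator fun _ => c ^ 2) :=
    (integrable_indicator_iff hB).2 (integrableOn_const hBf)
  have hi2 : Integrable ((A ∩ B).indicator fun _ => c' ^ 2) :=
    (integrable_indicator_iff (hA.inter hB)).2 (integrableOn_const hABf)
  have h3 : ∫ x : EuclideanSpace ℝ (Fin n), φ (x, 0) ^ 2
      ≤ ∫ x, (B.indicator (fun _ => c ^ 2) x + (A ∩ B).indicator (fun _ => c' ^ 2) x) := by
    refine integral_mono_of_nonneg (ae_of_all _ fun x => sq_nonneg _) (hi1.add hi2)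
      (ae_of_all _ fun x => ?_)
    have hs1 : 0 ≤ c ^ 2 := sq_nonneg c
    have hs2 : 0 ≤ c' ^ 2 := sq_nonneg c'
    by_cases hx : x ∈ B
    · by_cases hxA : x ∈ A
      · have : φ (x, 0) ^ 2 ≤ c' ^ 2 := sq_le_sq' (abs_le.1 (h2 x)).1 (abs_le.1 (h2 x)).2
        simp [hx, hxA]
        linarith
      · have : φ (x, 0) ^ 2 ≤ c ^ 2 := sq_le_sq' (abs_le.1 (h1 x hxA)).1 (abs_le.1 (h1 x hxA)).2
        simp [hx, hxA]
        linarith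
    · have : φ (x, 0) = 0 := h0 x (by simpa [B] using hx)
      simp [hx, this]
  refine h3.trans_eq ?_
  rw [integral_add hi1 hi2, integral_indicator_const _ hB, integral_indicator_const _ (hA.inter hB)]
  simp only [smul_eq_mul]
  ring

end

section

variable {n : ℕ} {b lam : ℝ}

variable {w R : Pt n → ℝ} {K : Set (EuclideanSpace ℝ (Fin n))} {C M : ℝ} {ψ : ℕ → Pt n → ℝ}
  {μ : (Pt n → ℝ) → ℝ} {ε ε' δ : ℕ → ℝ}

section residual

variable {ℓ : (Pt n → ℝ) → ℝ}

theorem Obst.sub_top_le (H : Obst n b lam ℓ C ψ μ ε) (hs : SmoothUp w) (hw : BddSupp w)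
    {d s : ℝ} (hd : 0 < d) (h0 : 0 < s) (k : ℕ) :
    μ (fun q => (ψ k q + top d w q) - top s (fun q => ψ k q + top d w q) q)
      ≤ μ (ψ k) + μ (fun q => top d w q - top s (top d w) q) := by
  have hψ := H.nn k
  have hT := NN.top hs hw hd
  have hTψ := NN.top hψ.smoothUp hψ.supp h0
  have e : (fun q => (ψ k q + top d w q) - top s (fun q => ψ k q + top d w q) q)
      = fun q => (ψ k q - top s (ψ k) q) + (top d w q - top s (top d w) q) := by
    funext q
    rw [top_add hψ.smoothUp hψ.supp hT.smoothUp hT.supp h0]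
    ring
  rw [e, H.map_add _ _ (nn_sub_top hψ h0) (nn_sub_top hT h0), H.map_sub hψ hTψ]
  have := H.nonneg _ hTψ (hTψ.nonneg fun p hp => top_nonneg h0 (fun q _ => H.psi_nonneg k q) hp)
  linarith

theorem Obst.low_en_eventually (H : Obst n b lam ℓ C ψ μ ε) (hs : SmoothUp w) (hw : BddSupp w)
    (hδ : ∀ k, 0 < δ k) (hb : -1 < b) (hb1 : b < 1) (hl : 1 ≤ lam) {R : ℕ → Pt n → ℝ}
    (A : Approx n b lam (fun k q => ψ k q + top (δ k) w q) R M μ ε') {s m η : ℝ} (h0 : 0 < s)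
    (hη : 0 < η) (hm : ∀ k, μ (fun q => top (δ k) w q - top s (top (δ k) w) q) ≤ m) :
    ∀ᶠ k in atTop, low_en n b s (fun q => ψ k q + top (δ k) w q)
      ≤ 2 * m + lowC n b * M ^ 2 * s ^ 2 + η := by
  have hlim : Tendsto (fun k => 2 * μ (ψ k) + lowC n b * (ε' k * M)) atTop (𝓝 0) := by
    simpa using (H.mu_psi.const_mul 2).add ((A.tendsto.mul_const M).const_mul (lowC n b))
  filter_upwards [hlim.eventually_lt_const hη] with k hk
  have h1 := A.low_en_le hb hb1 hl h0 k
  have h2 := H.sub_top_le hs hw (hδ k) h0 k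
  have h3 := hm k
  linarith

end residual

/-- The hypotheses on a datum under which the obstacle argument applies: the flux tends to zero
pointwise, is bounded on `K`, and the functional is nonpositive off `K`. -/
structure Tame (n : ℕ) (b : ℝ) (w R : Pt n → ℝ) (K : Set (EuclideanSpace ℝ (Fin n)))
    (κ t₀ : ℝ) : Prop extends Datum n b w R where
  flux : ∀ x, Tendsto (fun y => y ^ b * pd none w (x, y)) (𝓝[>] 0) (𝓝 0)
  kappa_pos : 0 < κ
  t_pos : 0 < t₀
  bound : ∀ x ∈ K, ∀ t, 0 < t → t < t₀ → |t ^ b * pd none w (x, t)| ≤ κ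
  off : ∀ φ, NN φ → (∀ p, 0 ≤ φ p) → VanishNear K φ → ell n b w R φ ≤ 0

variable {κ t₀ : ℝ}

theorem Tame.exists_clip (T : Tame n b w R K κ t₀) (hb : -1 < b) (hb1 : b < 1) (hl : 0 ≤ lam)
    (H : Obst n b lam (ell n b w R) C ψ μ ε) {s d : ℝ} (hd : 0 < d) (h0 : 0 < s)
    (hs : 2 * s < t₀) :
    ∃ g, NN g ∧ μ g = μ (fun q => top d w q - top s (top d w) q) ∧
      ∀ p, |g p| ≤ |top d w p - top s (top d w) p| ∧ |g p| ≤ 2 * (κ * fluxC b s) :=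
  H.exists_clip hb hl T.off (nn_sub_top (NN.top T.smooth T.supp hd) h0)
    (mul_pos T.kappa_pos (fluxC_pos hb1 h0)) fun x hx =>
      abs_top_sub_top_le hb1 T.smooth T.supp hd h0 T.kappa_pos.le fun t ht ht2 =>
        T.bound x hx t ht (ht2.trans hs)

theorem Tame.exists_trace_bound (T : Tame n b w R K κ t₀) (hb : -1 < b) (hb1 : b < 1)
    (hl : 1 ≤ lam) (H : Obst n b lam (ell n b w R) C ψ μ ε) (hδ : ∀ k, 0 < δ k)
    {R' : ℕ → Pt n → ℝ}
    (A : Approx n b lam (fun k q => ψ k q + top (δ k) w q) R' M μ ε') :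
    ∃ B, 0 ≤ B ∧ ∀ φ, NN φ → |μ φ| ≤ B * trace n φ := by
  have hl0 : 0 ≤ lam := zero_le_one.trans hl
  have hb' : 0 < 1 - b := by linarith
  have hb'' : 0 < 1 + b := by linarith
  have hκ := T.kappa_pos
  have ht₀ := T.t_pos
  obtain ⟨ρ, hρ1, hρ⟩ := T.supp.exists_pos
  have hρ0 : 0 < ρ := by linarith
  have hϑ : NN (bump n ρ) := nn_bump hρ0
  have hϑ0 := H.nonneg _ hϑ (bump_nonneg ρ)
  have hlowC : 0 ≤ lowC n b := by
    have h1 := hardyC_pos hb hb1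
    have h2 : 0 ≤ oscC b := by
      have h3 := one_le_stepC
      unfold oscC
      positivity
    unfold lowC
    positivity
  set Q := 4 * κ * (2 ^ (1 - b) / (1 - b)) * μ (bump n ρ) + lowC n b * M ^ 2 + 1
  have hQ : 0 ≤ Q := by positivity
  refine ⟨2 * stepC * √(Q / (1 + b)), ?_, fun φ hφ => A.trace_bound hb hl hQ
    (s₀ := min (t₀ / 2) (1 / 2)) (lt_min (by positivity) (by norm_num)) (fun s h0 hs => ?_) hφ⟩
  · have := one_le_stepC
    positivity
  have hs1 : 2 * s < t₀ := by linarith [hs.trans_le (min_le_left _ _)]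
  have hs2 : 2 * s < 1 := by linarith [hs.trans_le (min_le_right _ _)]
  have hpow : s ^ 2 ≤ s ^ (1 - b) := by
    rw [← Real.rpow_natCast]
    exact Real.rpow_le_rpow_of_exponent_ge h0 (by linarith) (by push_cast; linarith)
  have hspos : 0 < s ^ (1 - b) := Real.rpow_pos_of_pos h0 _
  have hm : ∀ k, μ (fun q => top (δ k) w q - top s (top (δ k) w) q)
      ≤ 2 * (κ * fluxC b s) * μ (bump n ρ) := fun k => by
    obtain ⟨g, hg, hμ, hgle⟩ := T.exists_clip hb hb1 hl0 H (hδ k) h0 hs1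
    rw [← hμ, ← H.map_smul _ _ hϑ]
    refine H.mono hg (hϑ.const_mul _) fun p => ?_
    by_cases hp : ρ < ‖p.1‖ ∨ 2 * s ≤ p.2
    · have h1 := (hgle p).1
      have h2 := sub_top_top_eq_zero (δ := δ k) hρ h0 (x := p.1) (y := p.2) hp
      rw [Prod.mk.eta] at h2
      rw [h2, abs_zero] at h1
      have h3 := bump_nonneg ρ p
      have h4 := fluxC_pos hb1 h0
      refine (le_abs_self _).trans (h1.trans ?_)
      positivity
    · push Not at hp
      rw [bump_eq_one hρ0 hp.1 (by linarith [hp.2]), mul_one]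
      exact (le_abs_self _).trans (hgle p).2
  filter_upwards [H.low_en_eventually T.smooth T.supp hδ hb hb1 hl A h0 hspos hm] with k hk
  refine hk.trans ?_
  rw [fluxC_eq h0]
  have : lowC n b * M ^ 2 * s ^ 2 ≤ lowC n b * M ^ 2 * s ^ (1 - b) :=
    mul_le_mul_of_nonneg_left hpow (by positivity)
  simp only [Q]
  linarith

theorem Tame.mu_eq_zero (T : Tame n b w R K κ t₀) (hb : -1 < b) (hb1 : b < 1)
    (hl : 1 ≤ lam) (H : Obst n b lam (ell n b w R) C ψ μ ε) (hδ : ∀ k, 0 < δ k)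
    {R' : ℕ → Pt n → ℝ}
    (A : Approx n b lam (fun k q => ψ k q + top (δ k) w q) R' M μ ε') {φ : Pt n → ℝ}
    (hφ : NN φ) : μ φ = 0 := by
  have hl0 : 0 ≤ lam := zero_le_one.trans hl
  have hb' : 0 < 1 - b := by linarith
  have hb'' : 0 < 1 + b := by linarith
  have hκ := T.kappa_pos
  have ht₀ := T.t_pos
  obtain ⟨ρ, hρ1, hρ⟩ := T.supp.exists_pos
  obtain ⟨B, hB, hBle⟩ := T.exists_trace_bound hb hb1 hl H hδ A
  set V := volume.real (closedBall (0 : EuclideanSpace ℝ (Fin n)) ρ)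
  have hV : 0 ≤ V := measureReal_nonneg
  set F : ℝ := 2 ^ (1 - b) / (1 - b)
  have hF : 0 < F := by positivity
  have key : ∀ η, 0 < η → |μ φ| ≤ 2 * stepC * √(((2 * B + 2) * η) / (1 + b)) * trace n φ := by
    intro η hη
    -- choice of the threshold `e` and of the height `r`
    obtain ⟨e, he, hee⟩ : ∃ e, 0 < e ∧ (e * F) ^ 2 * V ≤ η ^ 2 / 2 := by
      refine ⟨η / (2 * F * √(V + 1)), by positivity, ?_⟩
      have h1 : (η / (2 * F * √(V + 1)) * F) ^ 2 = η ^ 2 / (4 * (V + 1)) := by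
        rw [← Real.sq_sqrt (show 0 ≤ V + 1 by linarith)]
        rw [Real.sqrt_sq (Real.sqrt_nonneg _)]
        field_simp
        norm_num
      rw [h1, div_mul_eq_mul_div, div_le_div_iff₀ (by positivity) (by norm_num)]
      nlinarith [sq_nonneg η]
    obtain ⟨r, hr, hrV⟩ := exists_volume_fluxSet_lt T.smooth T.flux he
      (show 0 < η ^ 2 / (2 * (2 * κ * F) ^ 2) by positivity) ρ
    have hlim : Tendsto (fun s : ℝ => lowC n b * M ^ 2 * s ^ (1 + b)) (𝓝[>] 0) (𝓝 0) := by
      have h1 : Tendsto (fun s : ℝ => s ^ (1 + b)) (𝓝[>] 0) (𝓝 0) := by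
        have := (Real.continuousAt_rpow_const 0 (1 + b) (Or.inr hb''.le)).tendsto
        rw [Real.zero_rpow hb''.ne'] at this
        exact this.mono_left nhdsWithin_le_nhds
      simpa using h1.const_mul (lowC n b * M ^ 2)
    obtain ⟨s₁, hs₁, hsub⟩ := mem_nhdsGT_iff_exists_Ioo_subset.1 (hlim.eventually_lt_const hη)
    have hs₁' : (0 : ℝ) < s₁ := hs₁
    refine A.trace_bound hb hl (by positivity) (s₀ := min (min (t₀ / 2) (r / 2)) s₁)
      (lt_min (lt_min (by positivity) (by positivity)) hs₁) (fun s h0 hs => ?_) hφ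
    have hs1 : 2 * s < t₀ := by
      linarith [hs.trans_le ((min_le_left _ _).trans (min_le_left _ _))]
    have hs2 : 2 * s < r := by
      linarith [hs.trans_le ((min_le_left _ _).trans (min_le_right _ _))]
    have hs3 : lowC n b * M ^ 2 * s ^ (1 + b) < η := hsub ⟨h0, hs.trans_le (min_le_right _ _)⟩
    have hspos : 0 < s ^ (1 - b) := Real.rpow_pos_of_pos h0 _
    have hm : ∀ k, μ (fun q => top (δ k) w q - top s (top (δ k) w) q)
        ≤ B * (η * s ^ (1 - b)) := fun k => by
      obtain ⟨g, hg, hμ, hgle⟩ := T.exists_clip hb hb1 hl0 H (hδ k) h0 hs1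
      rw [← hμ]
      refine (le_abs_self _).trans ((hBle g hg).trans (mul_le_mul_of_nonneg_left ?_ hB))
      refine le_of_sq_le_sq ?_ (by positivity)
      have h1 := trace_sq_le (φ := g) (ρ := ρ) (c := e * fluxC b s) (c' := 2 * (κ * fluxC b s))
        (isOpen_fluxSet (b := b) T.smooth e r).measurableSet (fun x hx => ?_) (fun x hx => ?_)
        fun x => (hgle (x, 0)).2
      · refine h1.trans ?_
        have h2 : (2 * (κ * fluxC b s)) ^ 2 * volume.real (fluxSet n b w e r ∩ closedBall 0 ρ)
            ≤ (2 * (κ * fluxC b s)) ^ 2 * (η ^ 2 / (2 * (2 * κ * F) ^ 2)) :=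
          mul_le_mul_of_nonneg_left hrV.le (sq_nonneg _)
        have h3 : (2 * (κ * fluxC b s)) ^ 2 * (η ^ 2 / (2 * (2 * κ * F) ^ 2))
            = η ^ 2 / 2 * (s ^ (1 - b)) ^ 2 := by
          rw [fluxC_eq h0]
          change (2 * (κ * (F * s ^ (1 - b)))) ^ 2 * _ = _
          field_simp
        have h4 : (e * fluxC b s) ^ 2 * V ≤ η ^ 2 / 2 * (s ^ (1 - b)) ^ 2 := by
          rw [fluxC_eq h0]
          calc (e * (F * s ^ (1 - b))) ^ 2 * V = (e * F) ^ 2 * V * (s ^ (1 - b)) ^ 2 := by ring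
            _ ≤ _ := mul_le_mul_of_nonneg_right hee (sq_nonneg _)
        calc _ ≤ η ^ 2 / 2 * (s ^ (1 - b)) ^ 2 + η ^ 2 / 2 * (s ^ (1 - b)) ^ 2 :=
              add_le_add h4 (h2.trans_eq h3)
          _ = _ := by ring
      · have h2 := (hgle (x, 0)).1
        rw [sub_top_top_eq_zero hρ h0 (Or.inl hx), abs_zero] at h2
        exact abs_nonpos_iff.1 h2
      · refine (hgle (x, 0)).1.trans (abs_top_sub_top_le hb1 T.smooth T.supp (hδ k) h0 he.le
          fun t ht ht2 => ?_)
        by_contra hlt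
        exact hx ⟨t, ht, ht2.trans hs2, not_le.1 hlt⟩
    filter_upwards [H.low_en_eventually T.smooth T.supp hδ hb hb1 hl A h0
      (mul_pos hη hspos) hm] with k hk
    refine hk.trans ?_
    have h5 : lowC n b * M ^ 2 * s ^ 2 ≤ η * s ^ (1 - b) := by
      have : s ^ 2 = s ^ (1 + b) * s ^ (1 - b) := by
        rw [← Real.rpow_add h0, ← Real.rpow_natCast]
        norm_num
      rw [this, ← mul_assoc]
      exact mul_le_mul_of_nonneg_right hs3.le hspos.le
    linarith
  have hlim : Tendsto (fun η : ℝ => 2 * stepC * √(((2 * B + 2) * η) / (1 + b)) * trace n φ)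
      (𝓝[>] 0) (𝓝 0) := by
    have hc : Continuous fun η : ℝ => 2 * stepC * √(((2 * B + 2) * η) / (1 + b)) * trace n φ := by
      fun_prop
    simpa using (hc.tendsto 0).mono_left nhdsWithin_le_nhds
  have h0 : |μ φ| ≤ 0 := ge_of_tendsto hlim (by
    filter_upwards [self_mem_nhdsWithin] with η hη using key η hη)
  exact abs_nonpos_iff.1 h0

theorem NN.lap_bc {φ : Pt n → ℝ} (hφ : NN φ) : BC (lap b φ) := by
  obtain ⟨r, hr, h⟩ := hφ.pd_none_flat
  refine (BC.sum Finset.univ fun j _ => ((hφ.pd j).pd j).bc).add (BC.of_vanish (r := r) ?_ ?_ hr ?_)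
  · refine ContinuousOn.mul (continuousOn_const.div continuous_snd.continuousOn fun p hp => ?_)
      (hφ.pd none).continuous.continuousOn
    exact (show (0 : ℝ) < p.2 from hp).ne'
  · exact (hφ.pd none).supp.mul_left
  · intro x y _ hy
    rw [h x y hy, mul_zero]

theorem NN.green (hb : -1 < b) {f φ : Pt n → ℝ} (hf : NN f) (hφ : NN φ) :
    ∫ p, gd φ f p ∂wt n b = -∫ p, f p * lap b φ p ∂wt n b := by
  obtain ⟨r, hr, h⟩ := hφ.pd_none_flat
  exact WeightedHalfSpace.green hb hφ.smoothUp hf.smoothUp (fun j => hf.bc.mul (hφ.pd j).bc)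
    (fun j => (hf.pd j).bc.mul (hφ.pd j).bc) (fun j => hf.bc.mul ((hφ.pd j).pd j).bc) hr
    fun x y _ hy => by rw [h x y hy, mul_zero]

theorem Tame.ell_nonpos (T : Tame n b w R K κ t₀) (hb : -1 < b) (hb1 : b < 1) {φ : Pt n → ℝ}
    (hφ : NN φ) (hφ0 : ∀ p, 0 ≤ φ p) : ell n b w R φ ≤ 0 := by
  set S := √(4 * ellC n b w R ^ 2 + 4)
  set L := l2 n b (lap b φ)
  have key : ∀ lam, 1 ≤ lam → ell n b w R φ ≤ S / √lam * L := by
    intro lam hl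
    have hl0 : 0 < lam := by linarith
    obtain ⟨ψ, μ, ε, H⟩ := exists_obst hb hl0.le (fun φ χ h1 h2 => T.ell_add hb h1 h2)
      (fun c φ h => ell_smul w R h c) (fun φ h => T.ell_le hb hl h)
    obtain ⟨δ, hδ, M, ε', A⟩ := H.exists_approx T.toDatum hb hb1 hl fun χ h1 h2 ⟨r, hr, h3⟩ =>
      T.off χ h1 h2 ⟨univ, isOpen_univ, subset_univ _, r, hr, fun x _ => h3 x⟩
    have hμ := T.mu_eq_zero hb hb1 hl H hδ A hφ
    have hk : ∀ k, ell n b w R φ ≤ S / √lam * L + ε k * en n b lam φ := fun k => by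
      have h1 := (abs_le.1 (H.err k φ hφ)).1
      rw [hμ] at h1
      have h2 : form n b lam (ψ k) φ
          = ∫ p, gd (ψ k) φ p ∂wt n b + lam * ∫ p, ψ k p * φ p ∂wt n b := by
        rw [form, integral_add (((H.nn k).gd_bc hφ).integrable hb)
          ((((H.nn k).bc.mul hφ.bc).const_mul lam).integrable hb), integral_const_mul]
      have h3 : 0 ≤ lam * ∫ p, ψ k p * φ p ∂wt n b :=
        mul_nonneg hl0.le (integral_nonneg fun p => mul_nonneg (H.psi_nonneg k p) (hφ0 p))
      have h4 := NN.green hb (H.nn k) hφ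
      rw [gd_comm] at h4
      have h5 := le_trans (le_abs_self _)
        (abs_integral_mul_le (g := lap b φ) ((H.nn k).memLp hb) (hφ.lap_bc.memLp hb))
      have h6 : l2 n b (ψ k) ≤ S / √lam := by
        rw [le_div_iff₀ (Real.sqrt_pos.2 hl0), mul_comm]
        exact (sqrt_lam_l2_le_en hb hl0.le (H.nn k)).trans (H.en_psi_le k)
      have h7 := mul_le_mul_of_nonneg_right h6 (l2_nonneg (b := b) (lap b φ))
      simp only [L]
      linarith
    have hlim : Tendsto (fun k => S / √lam * L + ε k * en n b lam φ) atTop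
        (𝓝 (S / √lam * L + 0 * en n b lam φ)) := (H.tendsto.mul_const _).const_add _
    rw [zero_mul, add_zero] at hlim
    exact ge_of_tendsto' hlim hk
  have hlim : Tendsto (fun lam => S / √lam * L) atTop (𝓝 (0 * L)) :=
    (Real.tendsto_sqrt_atTop.const_div_atTop S).mul_const L
  rw [zero_mul] at hlim
  exact ge_of_tendsto hlim (eventually_atTop.2 ⟨1, key⟩)

end

section

variable {n : ℕ} {b lam : ℝ}

variable {w R : Pt n → ℝ}

theorem SmoothUp.continuousOn_lap {f : Pt n → ℝ} (hf : SmoothUp f) :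
    ContinuousOn (lap b f) (upper n) := by
  refine (continuousOn_finsetSum _ fun j _ => ((hf.pd j).pd j).continuousOn).add
    (ContinuousOn.mul ?_ (hf.pd none).continuousOn)
  exact continuousOn_const.div continuous_snd.continuousOn fun p hp =>
    (show (0 : ℝ) < p.2 from hp).ne'

/-- A datum with pointwise vanishing flux and `-Δ_b w ≤ R`. -/
structure FluxDatum (n : ℕ) (b : ℝ) (w R : Pt n → ℝ) : Prop extends Datum n b w R where
  flux : ∀ x, Tendsto (fun y => y ^ b * pd none w (x, y)) (𝓝[>] 0) (𝓝 0)
  lap_ge : ∀ p, 0 < p.2 → -lap b w p ≤ R p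

theorem integral_gd_eq_of_vanish (hw : SmoothUp w) (hb : -1 < b) {φ : Pt n → ℝ}
    (hφ : NN φ) (hφ0 : ∀ p, 0 ≤ φ p) (hz : ∃ r > 0, ∀ x y, y ≤ r → φ (x, y) = 0) :
    BC (fun p => φ p * lap b w p) ∧
      ∫ p, gd w φ p ∂wt n b = -∫ p, φ p * lap b w p ∂wt n b := by
  obtain ⟨r, hr, hz⟩ := hz
  have hc := hφ.continuous.continuousOn (s := upper n)
  have hz' : ∀ x y, y < r → φ (x, y) = 0 := fun x y hy => hz x y hy.le
  have hpz : ∀ j x y, y < r → pd j φ (x, y) = 0 := fun j x y hy =>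
    pd_eq_zero_of_nonneg hφ0 (hz' x y hy) j
  refine ⟨BC.of_vanish (hc.mul hw.continuousOn_lap) hφ.supp.mul_right hr
      fun x y _ hy => by rw [hz' x y hy, zero_mul], ?_⟩
  exact green hb hw hφ.smoothUp
    (fun j => BC.of_vanish (hc.mul (hw.pd j).continuousOn) hφ.supp.mul_right hr
      fun x y _ hy => by rw [hz' x y hy, zero_mul])
    (fun j => BC.of_vanish ((hφ.pd j).continuous.continuousOn.mul (hw.pd j).continuousOn)
      (hφ.pd j).supp.mul_right hr fun x y _ hy => by rw [hpz j x y hy, zero_mul])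
    (fun j => BC.of_vanish (hc.mul ((hw.pd j).pd j).continuousOn) hφ.supp.mul_right hr
      fun x y _ hy => by rw [hz' x y hy, zero_mul]) hr
    (fun x y _ hy => by rw [hz' x y hy, zero_mul])

theorem FluxDatum.ell_nonpos_of_vanish (D : FluxDatum n b w R) (hb : -1 < b) {φ : Pt n → ℝ}
    (hφ : NN φ) (hφ0 : ∀ p, 0 ≤ φ p) (hz : ∃ r > 0, ∀ x y, y ≤ r → φ (x, y) = 0) :
    ell n b w R φ ≤ 0 := by
  obtain ⟨hi, hg⟩ := integral_gd_eq_of_vanish D.smooth hb hφ hφ0 hz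
  have h1 : ∫ p, -(φ p * lap b w p) ∂wt n b ≤ ∫ p, R p * φ p ∂wt n b := by
    refine integral_mono_ae (hi.integrable hb).neg (MemLp.mul_int D.memR (hφ.memLp hb))
      (ae_wt_of_forall fun p hp => ?_)
    nlinarith [D.lap_ge p hp, hφ0 p]
  rw [integral_neg] at h1
  rw [ell, hg]
  linarith

/-- Boundary points near which the functional is nonpositive. -/
def GoodPt (n : ℕ) (b : ℝ) (w R : Pt n → ℝ) (x : EuclideanSpace ℝ (Fin n)) : Prop :=
  ∃ r > 0, ∀ φ, NN φ → (∀ p, 0 ≤ φ p) → (∀ x' y, r ≤ dist x' x → φ (x', y) = 0) →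
    ell n b w R φ ≤ 0

theorem isClosed_not_goodPt : IsClosed {x | ¬ GoodPt n b w R x} := by
  rw [← isOpen_compl_iff, Metric.isOpen_iff]
  intro x hx
  obtain ⟨r, hr, h⟩ := not_not.1 hx
  refine ⟨r / 2, by positivity, fun x' hx' => ?_⟩
  rw [mem_compl_iff, mem_ofPred_eq, not_not]
  refine ⟨r / 2, by positivity, fun φ h1 h2 h3 => h φ h1 h2 fun z y hz => h3 z y ?_⟩
  have := dist_triangle z x' x
  rw [mem_ball] at hx'
  linarith

theorem Datum.ell_sum (D : Datum n b w R) (hb : -1 < b) {ι : Type*} (s : Finset ι)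
    {f : ι → Pt n → ℝ} (hf : ∀ i, NN (f i)) :
    NN (fun p => ∑ i ∈ s, f i p) ∧
      ell n b w R (fun p => ∑ i ∈ s, f i p) = ∑ i ∈ s, ell n b w R (f i) := by
  classical
  induction s using Finset.induction_on with
  | empty =>
    have h := ell_smul (b := b) w R NN.zero 0
    simp only [zero_mul] at h
    simpa using ⟨NN.zero, h⟩
  | insert i s hi ih =>
    simp only [Finset.sum_insert hi]
    exact ⟨(hf i).add ih.1, by rw [D.ell_add hb (hf i) ih.1, ih.2]⟩

theorem FluxDatum.ell_nonpos_of_vanishNear (D : FluxDatum n b w R) (hb : -1 < b) {φ : Pt n → ℝ}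
    (hφ : NN φ) (hφ0 : ∀ p, 0 ≤ φ p) (hv : VanishNear {x | ¬ GoodPt n b w R x} φ) :
    ell n b w R φ ≤ 0 := by
  obtain ⟨V, hV, hKV, r, hr, hz⟩ := hv
  obtain ⟨ρ, hρ⟩ := hφ.supp
  set Z := closedBall (0 : EuclideanSpace ℝ (Fin n)) ρ \ V
  have hZ : IsCompact Z := (isCompact_closedBall _ _).diff hV
  have hgood : ∀ x : Z, GoodPt n b w R x := fun x => by
    by_contra h
    exact x.2.2 (hKV h)
  choose rad hrad hell using hgood
  obtain ⟨t, ht⟩ := hZ.elim_finite_subcover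
    (fun x : Z => ball (x : EuclideanSpace ℝ (Fin n)) (rad x))
    (fun x => isOpen_ball) fun x hx => mem_iUnion.2 ⟨⟨x, hx⟩, mem_ball_self (hrad _)⟩
  obtain ⟨f, hf⟩ := SmoothPartitionOfUnity.exists_isSubordinate
    𝓘(ℝ, EuclideanSpace ℝ (Fin n)) hZ.isClosed
    (fun x : t => ball (x.1 : EuclideanSpace ℝ (Fin n)) (rad x.1)) (fun x => isOpen_ball)
    (fun x hx => by
      obtain ⟨i, hi, h⟩ := mem_iUnion₂.1 (ht hx)
      exact mem_iUnion.2 ⟨⟨i, hi⟩, h⟩)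
  have hfs : ∀ i, ContDiff ℝ ∞ (f i) := fun i => (f i).contMDiff.contDiff
  set g : t → Pt n → ℝ := fun i p => f i p.1 * φ p
  have hg : ∀ i, NN (g i) := fun i => hφ.mul_horiz (hfs i)
  have hg0 : ∀ i p, 0 ≤ g i p := fun i p => mul_nonneg (f.nonneg i p.1) (hφ0 p)
  have hsum : ∀ p, ∑ i, g i p = (∑ᶠ i, f i p.1) * φ p := fun p => by
    rw [finsum_eq_sum_of_fintype, Finset.sum_mul]
  have hS := D.ell_sum hb Finset.univ hg
  have hrest : NN (fun p => φ p - ∑ i, g i p) := hφ.sub hS.1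
  have h1 : ell n b w R (fun p => φ p - ∑ i, g i p) ≤ 0 := by
    refine D.ell_nonpos_of_vanish hb hrest (fun p => ?_) ⟨r, hr, fun x y hy => ?_⟩
    · rw [hsum, sub_nonneg]
      exact mul_le_of_le_one_left (hφ0 p) (f.sum_le_one p.1)
    · simp only [hsum]
      by_cases hx : x ∈ Z
      · rw [f.sum_eq_one hx, one_mul, sub_self]
      · have : φ (x, y) = 0 := by
          by_cases hxV : x ∈ V
          · exact hz x hxV y hy
          · refine hρ x y (Or.inl ?_)
            by_contra hle
            exact hx ⟨by simpa using hle, hxV⟩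
        rw [this, mul_zero, sub_self]
  have h2 : ∀ i, ell n b w R (g i) ≤ 0 := fun i =>
    hell i.1 (g i) (hg i) (hg0 i) fun x' y hx' => by
      have : f i x' = 0 := by
        by_contra hne
        have := hf i (subset_tsupport _ hne)
        rw [mem_ball] at this
        linarith
      simp only [g, this, zero_mul]
  have e : φ = fun p => (φ p - ∑ i, g i p) + ∑ i, g i p := by
    funext p; ring
  rw [e, D.ell_add hb hrest hS.1, hS.2]
  have := Finset.sum_nonpos (s := Finset.univ) fun i _ => h2 i
  linarith

end

section

variable {n : ℕ} {b lam : ℝ}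

variable {w R : Pt n → ℝ}

/-- Smooth compactly supported functions of the horizontal variable. -/
def HorizCut (χ : Pt n → ℝ) : Prop :=
  ∃ η : EuclideanSpace ℝ (Fin n) → ℝ, ContDiff ℝ ∞ η ∧ HasCompactSupport η ∧ χ = fun p => η p.1

variable {χ : Pt n → ℝ}

theorem HorizCut.contDiff (h : HorizCut χ) : ContDiff ℝ ∞ χ := by
  obtain ⟨η, h1, _, rfl⟩ := h
  exact h1.comp contDiff_fst

theorem HorizCut.differentiableAt (h : HorizCut χ) (p : Pt n) : DifferentiableAt ℝ χ p :=
  h.contDiff.differentiable (by simp) p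

theorem HorizCut.exists_bound (h : HorizCut χ) : ∃ C, ∀ p, |χ p| ≤ C := by
  obtain ⟨η, h1, h2, rfl⟩ := h
  obtain ⟨C, hC⟩ := h2.exists_bound_of_continuous h1.continuous
  exact ⟨C, fun p => hC p.1⟩

theorem HorizCut.pd_none (h : HorizCut χ) (p : Pt n) : pd none χ p = 0 := by
  obtain ⟨η, h1, _, rfl⟩ := h
  have h2 : HasFDerivAt (fun q : Pt n => η q.1)
      ((fderiv ℝ η p.1).comp (ContinuousLinearMap.fst ℝ _ ℝ)) p :=
    (h1.differentiable (by simp) p.1).hasFDerivAt.comp p hasFDerivAt_fst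
  rw [pd, h2.fderiv]
  simp [dir]

theorem HorizCut.zero : HorizCut (fun _ : Pt n => 0) :=
  ⟨fun _ => 0, contDiff_const, HasCompactSupport.zero, rfl⟩

theorem HorizCut.partial_deriv (h : HorizCut χ) (j : Option (Fin n)) : HorizCut (pd j χ) := by
  cases j with
  | none =>
    rw [show pd none χ = fun _ => 0 from funext h.pd_none]
    exact HorizCut.zero
  | some i =>
    obtain ⟨η, h1, h2, rfl⟩ := h
    refine ⟨fun x => fderiv ℝ η x (EuclideanSpace.single i 1),
      (h1.fderiv_right (m := ∞) (by simp)).clm_apply contDiff_const,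
      h2.fderiv_apply (𝕜 := ℝ) (EuclideanSpace.single i 1), ?_⟩
    funext p
    have h3 : HasFDerivAt (fun q : Pt n => η q.1)
        ((fderiv ℝ η p.1).comp (ContinuousLinearMap.fst ℝ _ ℝ)) p :=
      (h1.differentiable (by simp) p.1).hasFDerivAt.comp p hasFDerivAt_fst
    rw [pd, h3.fderiv]
    simp [dir]

theorem HorizCut.mul_memLp (h : HorizCut χ) {f : Pt n → ℝ} (hf : MemLp f 2 (wt n b)) :
    MemLp (fun p => χ p * f p) 2 (wt n b) := by
  obtain ⟨C, hC⟩ := h.exists_bound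
  refine (hf.const_mul C).mono ((aesm_of_continuousOn h.contDiff.continuous.continuousOn).mul hf.1)
    (ae_of_all _ fun p => ?_)
  rw [norm_mul, norm_mul, Real.norm_eq_abs, Real.norm_eq_abs C]
  exact mul_le_mul_of_nonneg_right ((hC p).trans (le_abs_self C)) (norm_nonneg _)

theorem HorizCut.mul_nn (h : HorizCut χ) {f : Pt n → ℝ} (hf : NN f) : NN (fun p => χ p * f p) := by
  obtain ⟨η, h1, _, rfl⟩ := h
  exact hf.mul_horiz h1

theorem HorizCut.lap_eq (h : HorizCut χ) (p : Pt n) : lap b χ p = ∑ j, pd j (pd j χ) p := by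
  rw [lap, h.pd_none, mul_zero, add_zero]

theorem HorizCut.integral_pd (h : HorizCut χ) (D : Datum n b w R) (hb : -1 < b) {φ : Pt n → ℝ}
    (hφ : NN φ) (j : Option (Fin n)) :
    ∫ p, (pd j χ p * w p) * pd j φ p ∂wt n b
      = -∫ p, (pd j (pd j χ) p * w p
        + pd j χ p * pd j w p) * φ p ∂wt n b := by
  cases j with
  | none => simp [h.pd_none, (h.partial_deriv none).pd_none]
  | some i =>
    set j : Option (Fin n) := some i
    set c := pd j χ
    have hc : HorizCut c := h.partial_deriv j
    have hφ2 := hφ.memLp hb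
    have hs : MemLp (fun p => pd j c p * w p
        + c p * pd j w p) 2 (wt n b) :=
      ((hc.partial_deriv j).mul_memLp D.mem).add (hc.mul_memLp (D.mem_pd j))
    have i1 := MemLp.mul_int (hc.mul_memLp D.mem) ((hφ.pd j).memLp hb)
    have i2 := MemLp.mul_int hs hφ2
    have hd : ∀ p : Pt n, 0 < p.2 → pd j (fun p => (c p * w p) * φ p) p
        = (c p * w p) * pd j φ p + (pd j c p * w p
        + c p * pd j w p) * φ p := fun p hp => by
      have h1 := D.smooth.differentiableAt hp
      have h2 : DifferentiableAt ℝ (fun p => c p * w p) p := (hc.differentiableAt p).mul h1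
      rw [pd_mul h2 (hφ.differentiableAt p), pd_mul (hc.differentiableAt p) h1]
      ring
    have hae : pd j (fun p => (c p * w p) * φ p) =ᵐ[wt n b]
        fun p => (c p * w p) * pd j φ p + (pd j c p * w p
          + c p * pd j w p) * φ p := ae_wt_of_forall hd
    have h0 := integral_pd_some (b := b) (G := fun p => (c p * w p) * φ p) i (fun p hp =>
      ((hc.differentiableAt p).mul (D.smooth.differentiableAt hp)).mul (hφ.differentiableAt p))
      (MemLp.mul_int (hc.mul_memLp D.mem) hφ2) ((i1.add i2).congr hae.symm)
    rw [integral_congr_ae hae, integral_add i1 i2] at h0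
    linarith

/-- The commutator of `Δ_b` with multiplication by `χ`, applied to `w`. -/
def commLap (b : ℝ) (χ w : Pt n → ℝ) (p : Pt n) : ℝ := 2 * gd χ w p + lap b χ p * w p

theorem HorizCut.memLp_commLap (h : HorizCut χ) (D : Datum n b w R) :
    MemLp (commLap b χ w) 2 (wt n b) := by
  have h1 : MemLp (gd χ w) 2 (wt n b) :=
    memLp_finsetSum _ fun j _ => (h.partial_deriv j).mul_memLp (D.mem_pd j)
  have h2 : MemLp (fun p => ∑ j, (pd j (pd j χ) p * w p)) 2
      (wt n b) := memLp_finsetSum _ fun j _ => ((h.partial_deriv j).partial_deriv j).mul_memLp D.mem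
  have e : commLap b χ w = fun p => 2 * gd χ w p
      + ∑ j, (pd j (pd j χ) p * w p) := by
    funext p
    rw [commLap, h.lap_eq, Finset.sum_mul]
  rw [e]
  exact (h1.const_mul 2).add h2

theorem HorizCut.pd_mul_eq (h : HorizCut χ) (D : Datum n b w R) (j : Option (Fin n)) {p : Pt n}
    (hp : 0 < p.2) : pd j (fun q => χ q * w q) p
      = χ p * pd j w p + pd j χ p * w p :=
  pd_mul (h.differentiableAt p) (D.smooth.differentiableAt hp) j

theorem HorizCut.datum (h : HorizCut χ) (D : Datum n b w R) :
    Datum n b (fun p => χ p * w p) (fun p => χ p * R p + |commLap b χ w p|) where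
  smooth := (ContDiff.smoothUp h.contDiff).mul D.smooth
  supp := D.supp.mul_left
  mem := h.mul_memLp D.mem
  mem_pd j := ((h.mul_memLp (D.mem_pd j)).add ((h.partial_deriv j).mul_memLp D.mem)).ae_eq
    (ae_wt_of_forall fun _ hp => (h.pd_mul_eq D j hp).symm)
  memR := (h.mul_memLp D.memR).add (h.memLp_commLap D).abs

theorem HorizCut.ell_le (h : HorizCut χ) (D : Datum n b w R) (hb : -1 < b) {φ : Pt n → ℝ}
    (hφ : NN φ) (hφ0 : ∀ p, 0 ≤ φ p) :
    ell n b (fun p => χ p * w p) (fun p => χ p * R p + |commLap b χ w p|) φ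
      ≤ ell n b w R (fun p => χ p * φ p) := by
  have hχφ := h.mul_nn hφ
  have hφ2 := hφ.memLp hb
  have hc := h.memLp_commLap D
  have i1 : Integrable (gd w fun p => χ p * φ p) (wt n b) := MemLp.gd_int hb D.mem_pd hχφ
  have j1 : ∀ j, Integrable (fun p => (pd j χ p * w p) * pd j φ p) (wt n b) := fun j =>
    MemLp.mul_int ((h.partial_deriv j).mul_memLp D.mem) ((hφ.pd j).memLp hb)
  have j2 : ∀ j, Integrable (fun p => (pd j χ p * pd j w p) * φ p) (wt n b) := fun j =>
    MemLp.mul_int ((h.partial_deriv j).mul_memLp (D.mem_pd j)) hφ2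
  have j3 : ∀ j, Integrable (fun p => (pd j (pd j χ) p * w p + pd j χ p * pd j w p) * φ p)
      (wt n b) := fun j =>
    MemLp.mul_int (((h.partial_deriv j).partial_deriv j |>.mul_memLp D.mem).add
      ((h.partial_deriv j).mul_memLp (D.mem_pd j))) hφ2
  have i2 : Integrable (fun p => ∑ j, (pd j χ p * w p) * pd j φ p) (wt n b) :=
    integrable_finsetSum _ fun j _ => j1 j
  have i3 : Integrable (fun p => ∑ j, (pd j χ p * pd j w p) * φ p) (wt n b) :=
    integrable_finsetSum _ fun j _ => j2 j
  have e1 : ∫ p, gd (fun p => χ p * w p) φ p ∂wt n b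
      = ∫ p, gd w (fun p => χ p * φ p) p ∂wt n b + ∫ p, (∑ j, (pd j χ p * w p) * pd j φ p) ∂wt n b
        - ∫ p, (∑ j, (pd j χ p * pd j w p) * φ p) ∂wt n b := by
    have i12 : Integrable (fun p => gd w (fun p => χ p * φ p) p
        + ∑ j, (pd j χ p * w p) * pd j φ p) (wt n b) := i1.add i2
    rw [← integral_add i1 i2, ← integral_sub i12 i3]
    refine integral_congr_ae (ae_wt_of_forall fun p hp => ?_)
    simp only [gd]
    rw [← Finset.sum_add_distrib, ← Finset.sum_sub_distrib]
    refine Finset.sum_congr rfl fun j _ => ?_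
    rw [h.pd_mul_eq D j hp, pd_mul (h.differentiableAt p) (hφ.differentiableAt p)]
    ring
  have e2 : ∫ p, (∑ j, (pd j χ p * w p) * pd j φ p) ∂wt n b
      - ∫ p, (∑ j, (pd j χ p * pd j w p) * φ p) ∂wt n b
      = -∫ p, commLap b χ w p * φ p ∂wt n b := by
    rw [integral_finsetSum _ fun j _ => j1 j,
      Finset.sum_congr rfl fun j _ => h.integral_pd D hb hφ j, Finset.sum_neg_distrib,
      ← integral_finsetSum _ fun j _ => j3 j, ← neg_add',
      ← integral_add (integrable_finsetSum _ fun j _ => j3 j) i3]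
    congr 1
    refine integral_congr_ae (ae_of_all _ fun p => ?_)
    simp only [commLap, gd, h.lap_eq, Finset.mul_sum, Finset.sum_mul, add_mul,
      Finset.sum_add_distrib]
    simp only [← Finset.sum_add_distrib]
    refine Finset.sum_congr rfl fun j _ => ?_
    ring
  have e3 : ∫ p, (χ p * R p + |commLap b χ w p|) * φ p ∂wt n b
      = ∫ p, R p * (χ p * φ p) ∂wt n b + ∫ p, |commLap b χ w p| * φ p ∂wt n b := by
    have k1 : Integrable (fun p => R p * (χ p * φ p)) (wt n b) :=
      MemLp.mul_int D.memR (hχφ.memLp hb)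
    have k2 : Integrable (fun p => |commLap b χ w p| * φ p) (wt n b) := MemLp.mul_int hc.abs hφ2
    rw [← integral_add k1 k2]
    refine integral_congr_ae (ae_of_all _ fun p => ?_)
    simp only []
    ring
  have h4 : -∫ p, commLap b χ w p * φ p ∂wt n b ≤ ∫ p, |commLap b χ w p| * φ p ∂wt n b := by
    rw [← integral_neg]
    refine integral_mono (MemLp.mul_int hc hφ2).neg (MemLp.mul_int hc.abs hφ2) fun p => ?_
    simp only []
    nlinarith [neg_abs_le (commLap b χ w p), hφ0 p]
  rw [ell, ell, e1, e3]
  linarith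

end

section

variable {n : ℕ} {b lam : ℝ}
variable {w R χ : Pt n → ℝ}

/-- On a nonempty closed set, pointwise vanishing flux is uniformly bounded on some portion. -/
theorem FluxDatum.exists_portion (D : FluxDatum n b w R) {K : Set (EuclideanSpace ℝ (Fin n))}
    (hK : IsClosed K) (hne : K.Nonempty) :
    ∃ x₀ ∈ K, ∃ r > 0, ∃ t₀ > 0, ∀ x ∈ K, dist x x₀ < r → ∀ t, 0 < t → t < t₀ →
      |t ^ b * pd none w (x, t)| ≤ 1 := by
  have : Nonempty K := hne.to_subtype
  have : CompleteSpace K := hK.completeSpace_coe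
  set F : ℕ → Set K := fun j =>
    {x | ∀ t, 0 < t → t < 1 / ((j : ℝ) + 1) → |t ^ b * pd none w (x.1, t)| ≤ 1}
  have hF : ∀ j, IsClosed (F j) := fun j => by
    simp only [F, ofPred_forall]
    refine isClosed_iInter fun t => isClosed_iInter fun ht => isClosed_iInter fun _ => ?_
    refine isClosed_le (Continuous.abs (continuous_const.mul ?_)) continuous_const
    exact (D.smooth.pd none).continuousOn.comp_continuous
      (continuous_subtype_val.prodMk continuous_const) fun _ => ht
  have hU : ⋃ j, F j = univ := by
    refine eq_univ_of_forall fun x => mem_iUnion.2 ?_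
    have h1 : ∀ᶠ y in 𝓝[>] (0 : ℝ), |y ^ b * pd none w (x.1, y)| ≤ 1 := by
      have := (D.flux x.1).eventually (Metric.closedBall_mem_nhds 0 one_pos)
      filter_upwards [this] with y hy
      simpa [mem_closedBall, Real.dist_eq] using hy
    obtain ⟨u, hu, h2⟩ := mem_nhdsGT_iff_exists_Ioo_subset.1 h1
    obtain ⟨j, hj⟩ := exists_nat_one_div_lt (show (0 : ℝ) < u from hu)
    exact ⟨j, fun t h3 h4 => h2 ⟨h3, h4.trans hj⟩⟩
  obtain ⟨j, x₀, hx⟩ := nonempty_interior_of_iUnion_of_closed hF hU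
  obtain ⟨r, hr, hb⟩ := Metric.isOpen_iff.1 isOpen_interior x₀ hx
  exact ⟨x₀.1, x₀.2, r, hr, 1 / ((j : ℝ) + 1), by positivity, fun x hx hd =>
    interior_subset (hb (show (⟨x, hx⟩ : K) ∈ ball x₀ r from hd))⟩

/-- Localisation does not change the functional on functions supported where the cutoff is one. -/
theorem HorizCut.ell_eq (h : HorizCut χ) {U : Set (Pt n)} (hU : IsOpen U) (h1 : ∀ p ∈ U, χ p = 1)
    {φ : Pt n → ℝ} (hφ0 : ∀ p, 0 ≤ φ p) (hφ : ∀ p, p ∉ U → φ p = 0) :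
    ell n b (fun p => χ p * w p) (fun p => χ p * R p + |commLap b χ w p|) φ = ell n b w R φ := by
  have hpd : ∀ p ∈ U, ∀ j, pd j χ p = 0 := fun p hp j => by
    rw [pd, Filter.EventuallyEq.fderiv_eq (f := fun _ => (1 : ℝ))
      (eventually_of_mem (hU.mem_nhds hp) h1)]
    simp
  have hpd2 : ∀ p ∈ U, ∀ j, pd j (pd j χ) p = 0 := fun p hp j => by
    rw [pd, Filter.EventuallyEq.fderiv_eq (f := fun _ => (0 : ℝ))
      (eventually_of_mem (hU.mem_nhds hp) fun q hq => hpd q hq j)]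
    simp
  have e1 : ∀ p, gd (fun p => χ p * w p) φ p = gd w φ p := fun p => by
    refine Finset.sum_congr rfl fun j _ => ?_
    by_cases hp : p ∈ U
    · rw [pd, Filter.EventuallyEq.fderiv_eq (f := w)
        (eventually_of_mem (hU.mem_nhds hp) fun q hq => by simp [h1 q hq])]
      rfl
    · rw [pd_eq_zero_of_nonneg hφ0 (hφ p hp) j, mul_zero, mul_zero]
  have e2 : ∀ p, (χ p * R p + |commLap b χ w p|) * φ p = R p * φ p := fun p => by
    by_cases hp : p ∈ U
    · simp [h1 p hp, commLap, gd, h.lap_eq, hpd p hp, hpd2 p hp]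
    · rw [hφ p hp, mul_zero, mul_zero]
  simp only [ell, e1, e2]

theorem FluxDatum.goodPt (D : FluxDatum n b w R) (hb : -1 < b) (hb1 : b < 1)
    (x : EuclideanSpace ℝ (Fin n)) : GoodPt n b w R x := by
  by_contra hx
  obtain ⟨x₀, hx₀, r, hr, t₀, ht₀, hbd⟩ := D.exists_portion isClosed_not_goodPt ⟨x, hx⟩
  let η : ContDiffBump x₀ := ⟨r / 2, r, by positivity, by linarith⟩
  have hχ : HorizCut fun p : Pt n => η p.1 := ⟨η, η.contDiff, η.hasCompactSupport, rfl⟩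
  set χ : Pt n → ℝ := fun p => η p.1
  have T : Tame n b (fun p => χ p * w p) (fun p => χ p * R p + |commLap b χ w p|)
      {x | ¬ GoodPt n b w R x} 1 t₀ :=
    { hχ.datum D.toDatum with
      flux := fun x => by
        have := (D.flux x).const_mul (η x)
        rw [mul_zero] at this
        refine this.congr' ?_
        filter_upwards [self_mem_nhdsWithin] with y hy
        rw [hχ.pd_mul_eq D.toDatum none (p := (x, y)) hy, hχ.pd_none]
        simp only [χ]
        ring
      kappa_pos := one_pos
      t_pos := ht₀
      bound := fun x hx t h1 h2 => by
        rw [hχ.pd_mul_eq D.toDatum none (p := (x, t)) h1, hχ.pd_none, zero_mul, add_zero,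
          mul_left_comm, abs_mul]
        have h3 : |χ (x, t)| ≤ 1 := by
          rw [abs_of_nonneg η.nonneg]
          exact η.le_one
        by_cases hd : dist x x₀ < r
        · exact mul_le_one₀ h3 (abs_nonneg _) (hbd x hx hd t h1 h2)
        · rw [show χ (x, t) = 0 from η.zero_of_le_dist (not_lt.1 hd), abs_zero, zero_mul]
          exact zero_le_one
      off := fun φ hφ hφ0 hv => by
        refine (hχ.ell_le D.toDatum hb hφ hφ0).trans
          (D.ell_nonpos_of_vanishNear hb (hχ.mul_nn hφ) (fun p => mul_nonneg η.nonneg (hφ0 p)) ?_)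
        obtain ⟨V, hV, hKV, r', hr', hz⟩ := hv
        exact ⟨V, hV, hKV, r', hr', fun x hx y hy =>
          mul_eq_zero_of_right _ (hz x hx y hy)⟩ }
  refine hx₀ ⟨r / 2, by positivity, fun φ hφ hφ0 hz => ?_⟩
  rw [← hχ.ell_eq (U := {p | dist p.1 x₀ < r / 2})
    (isOpen_lt (continuous_fst.dist continuous_const) continuous_const)
    (fun p hp => η.one_of_mem_closedBall (mem_closedBall.2 (le_of_lt (mem_ofPred_eq.mp hp)))) hφ0
      fun p hp => hz p.1 p.2 (not_lt.1 hp)]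
  exact T.ell_nonpos hb hb1 hφ hφ0

/-- Pointwise vanishing flux implies the weak Neumann inequality. -/
theorem FluxDatum.ell_nonpos (D : FluxDatum n b w R) (hb : -1 < b) (hb1 : b < 1) {φ : Pt n → ℝ}
    (hφ : NN φ) (hφ0 : ∀ p, 0 ≤ φ p) : ell n b w R φ ≤ 0 := by
  refine D.ell_nonpos_of_vanishNear hb hφ hφ0 ⟨∅, isOpen_empty, fun x hx => ?_, 1, one_pos,
    fun x hx => absurd hx (notMem_empty x)⟩
  exact absurd (D.goodPt hb hb1 x) hx

end

section

variable {n : ℕ} {b lam : ℝ}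
variable {w R : Pt n → ℝ}

theorem tendsto_cut {s : ℕ → ℝ} (hs : ∀ k, 0 < s k) (hl : Tendsto s atTop (𝓝 0)) {y : ℝ}
    (hy : 0 < y) : ∀ᶠ k in atTop, cut (s k) y = 1 := by
  filter_upwards [hl.eventually_lt_const (half_pos hy)] with k hk
  exact cut_eq_one (hs k) (by linarith)

theorem MemLp.integrable_of_bddSupp (hb : -1 < b) {f : Pt n → ℝ} (hf : MemLp f 2 (wt n b))
    (hs : BddSupp f) : Integrable f (wt n b) := by
  obtain ⟨r, hr⟩ := hs
  have : IsFiniteMeasure ((wt n b).restrict (closedBall 0 r ×ˢ Iic r)) :=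
    ⟨by rw [Measure.restrict_apply_univ]; exact wt_box_lt_top hb r⟩
  have h1 : IntegrableOn f (closedBall 0 r ×ˢ Iic r) (wt n b) :=
    (hf.restrict _).integrable one_le_two
  refine h1.integrable_of_forall_notMem_eq_zero fun p hp => hr p.1 p.2 ?_
  rw [mem_prod, mem_closedBall_zero_iff, mem_Iic, not_and_or, not_le, not_le] at hp
  exact hp

theorem FluxDatum.integral_gd_nn_le (D : FluxDatum n b w R) (hb : -1 < b) (hb1 : b < 1)
    (hi : Integrable (lap b w) (wt n b)) {φ : Pt n → ℝ} (hφ : NN φ) (hφ0 : ∀ p, 0 ≤ φ p) :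
    ∫ p, gd w φ p ∂wt n b ≤ -∫ p, φ p * lap b w p ∂wt n b := by
  obtain ⟨C, hC⟩ := hφ.bdd
  have hs : ∀ k : ℕ, 0 < 1 / ((k : ℝ) + 1) := fun k => Nat.one_div_pos_of_nat
  have hl : Tendsto (fun k : ℕ => 1 / ((k : ℝ) + 1)) atTop (𝓝 0) :=
    tendsto_one_div_add_atTop_nhds_zero_nat
  set c : ℕ → Pt n → ℝ := fun k p => cut (1 / ((k : ℝ) + 1)) p.2
  have hc0 : ∀ k p, 0 ≤ c k p := fun k p => cut_nonneg _ _
  have hc1 : ∀ k p, c k p ≤ 1 := fun k p => cut_le_one _ _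
  have hcont : ∀ k, Continuous (c k) := fun k => (contDiff_cut _).continuous.comp continuous_snd
  have hcl : ∀ p : Pt n, 0 < p.2 → Tendsto (fun k => c k p) atTop (𝓝 1) := fun p hp =>
    tendsto_const_nhds.congr' ((tendsto_cut hs hl hp).mono fun k hk => hk.symm)
  have hR := MemLp.mul_int D.memR (hφ.memLp hb)
  have hlap : Integrable (fun p => φ p * lap b w p) (wt n b) :=
    hi.bdd_mul hφ.continuous.aestronglyMeasurable (ae_of_all _ fun p => hC p)
  have key : ∀ k, ∫ p, gd w φ p ∂wt n b
      ≤ ∫ p, (1 - c k p) * (R p * φ p) ∂wt n b - ∫ p, c k p * (φ p * lap b w p) ∂wt n b := by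
    intro k
    have h1 : NN fun p => c k p * φ p := NN.cut_mul hφ.smoothUp hφ.supp (hs k)
    have h2 : NN fun p => φ p - c k p * φ p := hφ.sub h1
    have h3 := D.ell_nonpos hb hb1 h2 fun p => by
      nlinarith [hc1 k p, hφ0 p]
    have h4 := (integral_gd_eq_of_vanish D.smooth hb h1 (fun p => mul_nonneg (hc0 k p) (hφ0 p))
      ⟨_, hs k, fun x y hy => mul_eq_zero_of_left (cut_eq_zero (hs k) hy) _⟩).2
    have h5 : ∫ p, gd w (fun p => φ p - c k p * φ p) p ∂wt n b
        = ∫ p, gd w φ p ∂wt n b - ∫ p, gd w (fun p => c k p * φ p) p ∂wt n b := by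
      rw [← integral_sub (MemLp.gd_int hb D.mem_pd hφ) (MemLp.gd_int hb D.mem_pd h1)]
      exact integral_congr_ae (ae_of_all _ fun p =>
        gd_sub_right (hφ.differentiableAt p) (h1.differentiableAt p))
    rw [ell, h5, h4] at h3
    have e1 : ∀ p, (1 - c k p) * (R p * φ p) = R p * (φ p - c k p * φ p) := fun p => by ring
    have e2 : ∀ p, c k p * (φ p * lap b w p) = c k p * φ p * lap b w p := fun p => by ring
    simp only [e1, e2]
    linarith
  have t1 : Tendsto (fun k => ∫ p, (1 - c k p) * (R p * φ p) ∂wt n b) atTop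
      (𝓝 (∫ _p, (0 : ℝ) ∂wt n b)) := by
    refine tendsto_integral_of_dominated_convergence (fun p => |R p * φ p|)
      (fun k => (continuous_const.sub (hcont k)).aestronglyMeasurable.mul hR.1) hR.abs
      (fun k => ae_of_all _ fun p => ?_) (ae_wt_of_forall fun p hp => ?_)
    · rw [Real.norm_eq_abs, abs_mul, abs_of_nonneg (sub_nonneg.2 (hc1 k p))]
      nlinarith [hc0 k p, abs_nonneg (R p * φ p)]
    · simpa using ((hcl p hp).const_sub 1).mul_const (R p * φ p)
  have t2 : Tendsto (fun k => ∫ p, c k p * (φ p * lap b w p) ∂wt n b) atTop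
      (𝓝 (∫ p, φ p * lap b w p ∂wt n b)) := by
    refine tendsto_integral_of_dominated_convergence (fun p => |φ p * lap b w p|)
      (fun k => (hcont k).aestronglyMeasurable.mul hlap.1) hlap.abs
      (fun k => ae_of_all _ fun p => ?_) (ae_wt_of_forall fun p hp => ?_)
    · rw [Real.norm_eq_abs, abs_mul, abs_of_nonneg (hc0 k p)]
      nlinarith [hc1 k p, abs_nonneg (φ p * lap b w p)]
    · simpa using (hcl p hp).mul_const (φ p * lap b w p)
  have := ge_of_tendsto' (t1.sub t2) key
  simpa using this

/-- The function `y ↦ y` made constant near `y ≤ 0`. -/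
def lift₀ (r y : ℝ) : ℝ := y * cut r y

theorem contDiff_lift₀ (r : ℝ) : ContDiff ℝ ∞ (lift₀ r) := contDiff_id.mul (contDiff_cut r)

theorem hasDerivAt_lift₀ (r y : ℝ) : HasDerivAt (lift₀ r) (cut r y + y * cutD r y) y := by
  have := (hasDerivAt_id y).mul (hasDerivAt_cut r y)
  rw [id, one_mul] at this
  exact this

theorem lift₀_eq_zero {r y : ℝ} (hr : 0 < r) (hy : y ≤ r) : lift₀ r y = 0 := by
  rw [lift₀, cut_eq_zero hr hy, mul_zero]

theorem lift₀_eq_self {r y : ℝ} (hr : 0 < r) (hy : 2 * r ≤ y) : lift₀ r y = y := by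
  rw [lift₀, cut_eq_one hr hy, mul_one]

theorem abs_lift₀_sub_le {r y : ℝ} (hr : 0 < r) (hy : 0 < y) : |lift₀ r y - y| ≤ 2 * r := by
  rcases le_total (2 * r) y with h | h
  · rw [lift₀_eq_self hr h, sub_self, abs_zero]
    positivity
  · have h1 := cut_nonneg r y
    have h2 := cut_le_one r y
    rw [lift₀, abs_le]
    constructor <;> nlinarith

theorem abs_deriv_lift₀_le {r y : ℝ} (hr : 0 < r) (hy : 0 < y) :
    |cut r y + y * cutD r y| ≤ 1 + 2 * stepC := by
  have h1 := cut_nonneg r y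
  have h2 := cut_le_one r y
  have h3 := cutD_nonneg hr y
  have h5 := one_le_stepC
  rw [abs_of_nonneg (by positivity)]
  rcases le_total (2 * r) y with h | h
  · rw [cutD_eq_zero_right hr h]
    linarith
  · have h4 := cutD_le hr y
    have : y * cutD r y ≤ 2 * r * (stepC / r) := by gcongr
    rw [show 2 * r * (stepC / r) = 2 * stepC by field_simp] at this
    linarith

/-- Make a function constant in the height near the boundary. -/
def flatten (r : ℝ) (Φ : Pt n → ℝ) (p : Pt n) : ℝ := Φ (p.1, lift₀ r p.2)

variable {Φ : Pt n → ℝ} {r : ℝ}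

theorem nn_flatten (h1 : ContDiff ℝ ∞ Φ) (h2 : HasCompactSupport Φ) (hr : 0 < r) :
    NN (flatten r Φ) := by
  obtain ⟨ρ, hρ⟩ := h2.isCompact.isBounded.subset_closedBall 0
  have hz : ∀ p : Pt n, ρ < ‖p‖ → Φ p = 0 := fun p hp => by
    by_contra h
    have := hρ (subset_tsupport _ h)
    rw [mem_closedBall_zero_iff] at this
    linarith
  refine ⟨h1.comp (contDiff_fst.prodMk ((contDiff_lift₀ r).comp contDiff_snd)),
    ⟨max ρ (2 * r), fun x y h => hz _ ?_⟩, ⟨r, hr, fun x y hy => ?_⟩⟩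
  · rw [Prod.norm_def]
    rcases h with h | h
    · exact lt_max_of_lt_left ((le_max_left _ _).trans_lt h)
    · refine lt_max_of_lt_right ?_
      simp only []
      rw [lift₀_eq_self hr ((le_max_right _ _).trans h.le)]
      exact ((le_max_left _ _).trans_lt h).trans_le (le_abs_self y)
  · simp [flatten, lift₀_eq_zero hr hy, lift₀_eq_zero hr hr.le]

theorem flatten_eq (hr : 0 < r) {p : Pt n} (hp : 2 * r ≤ p.2) : flatten r Φ p = Φ p := by
  rw [flatten, lift₀_eq_self hr hp]

theorem pd_flatten_eq (hr : 0 < r) {p : Pt n} (hp : 2 * r < p.2) (j : Option (Fin n)) :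
    pd j (flatten r Φ) p = pd j Φ p := by
  have : flatten r Φ =ᶠ[𝓝 p] Φ := by
    filter_upwards [(isOpen_lt continuous_const continuous_snd).mem_nhds hp] with q hq
    exact flatten_eq hr (le_of_lt hq)
  rw [pd, this.fderiv_eq, pd]

/-- Bounds for a test function and its derivatives pass to the flattened function. -/
theorem exists_pd_flatten_le (h1 : ContDiff ℝ ∞ Φ) (h2 : HasCompactSupport Φ) :
    ∃ C, ∀ r, 0 < r → ∀ p : Pt n, 0 < p.2 → ∀ j, |pd j (flatten r Φ) p| ≤ C := by
  obtain ⟨C, hC⟩ := (h2.fderiv (𝕜 := ℝ)).exists_bound_of_continuous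
    (h1.continuous_fderiv (by simp))
  have hC0 : 0 ≤ C := (norm_nonneg _).trans (hC 0)
  refine ⟨C * (1 + 2 * stepC), fun r hr p hp j => ?_⟩
  have h3 : HasFDerivAt (fun q : Pt n => (q.1, lift₀ r q.2)) ((ContinuousLinearMap.fst ℝ _ ℝ).prod
      ((cut r p.2 + p.2 * cutD r p.2) • ContinuousLinearMap.snd ℝ _ ℝ)) p :=
    hasFDerivAt_fst.prodMk ((hasDerivAt_lift₀ r p.2).comp_hasFDerivAt p hasFDerivAt_snd)
  have h4 : HasFDerivAt (flatten r Φ) _ p :=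
    (h1.differentiable (by simp) _).hasFDerivAt.comp p h3
  rw [pd, h4.fderiv]
  refine (ContinuousLinearMap.le_opNorm (fderiv ℝ Φ _) _).trans
    (mul_le_mul (hC _) ?_ (norm_nonneg _) hC0)
  have h5 := one_le_stepC
  cases j with
  | none =>
    simpa [dir, Prod.norm_def] using abs_deriv_lift₀_le hr hp
  | some i =>
    simp [dir, Prod.norm_def]
    linarith

/-- Uniform closeness of the flattened function. -/
theorem exists_flatten_sub_le (h1 : ContDiff ℝ ∞ Φ) (h2 : HasCompactSupport Φ) {ε : ℝ}
    (hε : 0 < ε) : ∃ r, 0 < r ∧ ∀ p : Pt n, 0 < p.2 → |flatten r Φ p - Φ p| < ε := by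
  obtain ⟨δ, hδ, h⟩ := Metric.uniformContinuous_iff.1
    (h2.uniformContinuous_of_continuous h1.continuous) ε hε
  refine ⟨δ / 4, by positivity, fun p hp => h (a := (p.1, lift₀ _ p.2)) (b := p) ?_⟩
  have := abs_lift₀_sub_le (r := δ / 4) (by positivity) hp
  rw [Prod.dist_eq, dist_self, Real.dist_eq]
  exact max_lt hδ (by linarith)

/-- The weak Neumann inequality for test functions smooth up to the boundary. -/
theorem FluxDatum.integral_gd_le (D : FluxDatum n b w R) (hb : -1 < b) (hb1 : b < 1)
    (hi : Integrable (lap b w) (wt n b)) (h1 : ContDiff ℝ ∞ Φ) (h2 : HasCompactSupport Φ)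
    (h0 : ∀ p, 0 ≤ Φ p) :
    ∫ p, gd w Φ p ∂wt n b ≤ -∫ p, Φ p * lap b w p ∂wt n b := by
  obtain ⟨C, hC⟩ := exists_pd_flatten_le h1 h2
  obtain ⟨B, hB⟩ := h2.exists_bound_of_continuous h1.continuous
  have hs : ∀ k : ℕ, 0 < 1 / ((k : ℝ) + 1) := fun k => Nat.one_div_pos_of_nat
  have hl : Tendsto (fun k : ℕ => 1 / ((k : ℝ) + 1)) atTop (𝓝 0) :=
    tendsto_one_div_add_atTop_nhds_zero_nat
  have hev : ∀ p : Pt n, 0 < p.2 → ∀ᶠ k : ℕ in atTop, 2 * (1 / ((k : ℝ) + 1)) < p.2 :=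
    fun p hp => (hl.const_mul 2).eventually_lt_const (by simpa using hp)
  set f : ℕ → Pt n → ℝ := fun k => flatten (1 / ((k : ℝ) + 1)) Φ
  have hf : ∀ k, NN (f k) := fun k => nn_flatten h1 h2 (hs k)
  have hpi : ∀ j, Integrable (pd j w) (wt n b) := fun j => by
    exact MemLp.integrable_of_bddSupp hb (D.mem_pd j) (D.supp.pd j)
  have t1 : Tendsto (fun k => ∫ p, gd w (f k) p ∂wt n b) atTop (𝓝 (∫ p, gd w Φ p ∂wt n b)) := by
    refine tendsto_integral_of_dominated_convergence (fun p => ∑ j, |pd j w p| * C)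
      (fun k => (MemLp.gd_int hb D.mem_pd (hf k)).1)
      (integrable_finsetSum _ fun j _ => (hpi j).abs.mul_const C)
      (fun k => ae_wt_of_forall fun p hp => ?_) (ae_wt_of_forall fun p hp => ?_)
    · refine (Finset.abs_sum_le_sum_abs _ _).trans (Finset.sum_le_sum fun j _ => ?_)
      rw [abs_mul]
      exact mul_le_mul_of_nonneg_left (hC _ (hs k) p hp j) (abs_nonneg _)
    · refine tendsto_const_nhds.congr' ?_
      filter_upwards [hev p hp] with k hk
      exact Finset.sum_congr rfl fun j _ => by rw [pd_flatten_eq (hs k) hk]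
  have t2 : Tendsto (fun k => ∫ p, f k p * lap b w p ∂wt n b) atTop
      (𝓝 (∫ p, Φ p * lap b w p ∂wt n b)) := by
    refine tendsto_integral_of_dominated_convergence (fun p => B * |lap b w p|)
      (fun k => (hf k).continuous.aestronglyMeasurable.mul hi.1) (hi.abs.const_mul B)
      (fun k => ae_of_all _ fun p => ?_) (ae_wt_of_forall fun p hp => ?_)
    · rw [norm_mul]
      exact mul_le_mul_of_nonneg_right (hB _) (norm_nonneg _)
    · refine tendsto_const_nhds.congr' ?_
      filter_upwards [hev p hp] with k hk
      rw [show f k p = Φ p from flatten_eq (hs k) hk.le]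
  exact le_of_tendsto_of_tendsto' t1 t2.neg fun k =>
    D.integral_gd_nn_le hb hb1 hi (hf k) fun p => h0 _

end

section

variable {n : ℕ} {b lam : ℝ}

theorem lap_mul {f g : Pt n → ℝ} (hf : SmoothUp f) (hg : SmoothUp g) {p : Pt n} (hp : 0 < p.2) :
    lap b (fun q => f q * g q) p = f p * lap b g p + 2 * gd f g p + g p * lap b f p := by
  have h1 : ∀ j, pd j (pd j fun q => f q * g q) p
      = f p * pd j (pd j g) p + 2 * (pd j f p * pd j g p) + g p * pd j (pd j f) p := fun j => by
    have e : pd j (fun q => f q * g q) =ᶠ[𝓝 p] fun q => f q * pd j g q + pd j f q * g q := by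
      filter_upwards [upper_mem_nhds hp] with q hq
      exact pd_mul (hf.differentiableAt hq) (hg.differentiableAt hq) j
    have d1 := hf.differentiableAt hp
    have d2 := hg.differentiableAt hp
    have d3 := (hf.pd j).differentiableAt hp
    have d4 := (hg.pd j).differentiableAt hp
    rw [pd, e.fderiv_eq]
    change pd j (fun q => f q * pd j g q + pd j f q * g q) p = _
    rw [pd_add (f := fun q => f q * pd j g q) (g := fun q => pd j f q * g q) (d1.mul d4)
      (d3.mul d2), pd_mul d1 d4, pd_mul d3 d2]
    ring
  simp only [lap, h1, pd_mul (hf.differentiableAt hp) (hg.differentiableAt hp), gd,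
    Finset.sum_add_distrib, Finset.mul_sum, mul_add]
  ring

theorem lap_comp {f : Pt n → ℝ} (hf : SmoothUp f) {γ γ' γ'' : ℝ → ℝ}
    (h1 : ∀ t, HasDerivAt γ (γ' t) t) (h2 : ∀ t, HasDerivAt γ' (γ'' t) t) {p : Pt n}
    (hp : 0 < p.2) :
    lap b (fun q => γ (f q)) p = γ' (f p) * lap b f p + γ'' (f p) * gd f f p := by
  have e0 : ∀ j q, 0 < q.2 → pd j (fun q => γ (f q)) q = γ' (f q) * pd j f q := fun j q hq => by
    rw [pd_comp (h1 _).differentiableAt (hf.differentiableAt hq), (h1 _).deriv]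
  have h3 : ∀ j, pd j (pd j fun q => γ (f q)) p
      = γ' (f p) * pd j (pd j f) p + γ'' (f p) * (pd j f p * pd j f p) := fun j => by
    have e : pd j (fun q => γ (f q)) =ᶠ[𝓝 p] fun q => γ' (f q) * pd j f q := by
      filter_upwards [upper_mem_nhds hp] with q hq
      exact e0 j q hq
    have d1 := hf.differentiableAt hp
    have d3 := (hf.pd j).differentiableAt hp
    rw [pd, e.fderiv_eq]
    change pd j (fun q => γ' (f q) * pd j f q) p = _
    rw [pd_mul (f := fun q => γ' (f q)) ((h2 _).differentiableAt.comp p d1) d3,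
      pd_comp (h2 _).differentiableAt d1, (h2 _).deriv]
    ring
  simp only [lap, h3, e0 none p hp, gd, Finset.sum_add_distrib, Finset.mul_sum, mul_add]
  ring

/-- The factor `(1 + (t / N)²)^{-1/2}`. -/
def rho (N t : ℝ) : ℝ := (√(1 + (t / N) ^ 2))⁻¹

/-- A convex approximation of `t² / 2` with linear growth. -/
def gam (N t : ℝ) : ℝ := N ^ 2 * (√(1 + (t / N) ^ 2) - 1)

theorem one_add_sq_pos (t : ℝ) : 0 < 1 + t ^ 2 := by positivity

theorem rho_pos (N t : ℝ) : 0 < rho N t := inv_pos.2 (Real.sqrt_pos.2 (one_add_sq_pos _))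

theorem rho_le_one (N t : ℝ) : rho N t ≤ 1 :=
  inv_le_one_of_one_le₀ (Real.one_le_sqrt.2 (by nlinarith [sq_nonneg (t / N)]))

theorem hasDerivAt_sqrt_sq (N t : ℝ) : HasDerivAt (fun t => √(1 + (t / N) ^ 2))
    (t / N ^ 2 * rho N t) t := by
  have h1 : HasDerivAt (fun t : ℝ => 1 + (t / N) ^ 2) (2 * (t / N) * (1 / N)) t := by
    simpa using (((hasDerivAt_id t).div_const N).pow 2).const_add 1
  refine (h1.sqrt (one_add_sq_pos _).ne').congr_deriv ?_
  rw [rho, div_eq_mul_inv, mul_inv]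
  ring

theorem hasDerivAt_gam {N : ℝ} (hN : 0 < N) (t : ℝ) : HasDerivAt (gam N) (t * rho N t) t := by
  refine (((hasDerivAt_sqrt_sq N t).sub_const 1).const_mul (N ^ 2)).congr_deriv ?_
  field_simp

theorem hasDerivAt_mul_rho {N : ℝ} (hN : 0 < N) (t : ℝ) :
    HasDerivAt (fun t => t * rho N t) (rho N t ^ 3) t := by
  have h0 := Real.sqrt_pos.2 (one_add_sq_pos (t / N))
  have hs := Real.sq_sqrt (one_add_sq_pos (t / N)).le
  refine ((hasDerivAt_id t).mul ((hasDerivAt_sqrt_sq N t).inv h0.ne')).congr_deriv ?_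
  simp only [rho, id, Pi.inv_apply]
  set q := √(1 + (t / N) ^ 2)
  have : t ^ 2 = N ^ 2 * (q ^ 2 - 1) := by
    rw [hs]
    field_simp
    ring
  field_simp
  linear_combination (-1 : ℝ) * this

theorem contDiff_gam (N : ℝ) : ContDiff ℝ ∞ (gam N) :=
  contDiff_const.mul (((contDiff_const.add ((contDiff_id.div_const N).pow 2)).sqrt
    fun _ => (one_add_sq_pos _).ne').sub contDiff_const)

theorem abs_mul_rho_le' {N : ℝ} (hN : 0 < N) (t : ℝ) : |t * rho N t| ≤ N := by
  rw [abs_mul, abs_of_pos (rho_pos N t), rho, ← div_eq_mul_inv,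
    div_le_iff₀ (Real.sqrt_pos.2 (one_add_sq_pos _))]
  have h : |t / N| ≤ √(1 + (t / N) ^ 2) := Real.abs_le_sqrt (by linarith)
  rw [abs_div, abs_of_pos hN, div_le_iff₀ hN] at h
  linarith

theorem abs_gam_le {N : ℝ} (hN : 0 < N) (t : ℝ) : |gam N t| ≤ N * |t| := by
  have h1 : 1 ≤ √(1 + (t / N) ^ 2) := Real.one_le_sqrt.2 (by nlinarith [sq_nonneg (t / N)])
  have h2 : √(1 + (t / N) ^ 2) ≤ 1 + |t / N| := by
    rw [Real.sqrt_le_left (by positivity)]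
    nlinarith [sq_abs (t / N), abs_nonneg (t / N)]
  rw [gam, abs_of_nonneg (mul_nonneg (sq_nonneg N) (by linarith))]
  calc N ^ 2 * (√(1 + (t / N) ^ 2) - 1) ≤ N ^ 2 * |t / N| := by gcongr; linarith
    _ = N * |t| := by rw [abs_div, abs_of_pos hN]; field_simp

theorem tendsto_rho (t : ℝ) : Tendsto (fun k : ℕ => rho ((k : ℝ) + 1) t) atTop (𝓝 1) := by
  have h : Tendsto (fun k : ℕ => t / ((k : ℝ) + 1)) atTop (𝓝 0) := by
    simpa [div_eq_mul_inv] using (tendsto_one_div_add_atTop_nhds_zero_nat (𝕜 := ℝ)).const_mul t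
  have h2 := ((((h.pow 2).const_add 1).sqrt).inv₀ (by simp))
  simpa [rho] using h2

end

section

variable {n : ℕ} {b : ℝ}

theorem pd_eventuallyEq {f g : Pt n → ℝ} {p : Pt n} (h : f =ᶠ[𝓝 p] g) (j : Option (Fin n)) :
    pd j f =ᶠ[𝓝 p] pd j g := by
  filter_upwards [h.eventuallyEq_nhds] with q hq
  rw [pd, pd, hq.fderiv_eq]

theorem lap_congr {f g : Pt n → ℝ} {p : Pt n} (h : f =ᶠ[𝓝 p] g) : lap b f p = lap b g p := by
  simp only [lap]
  rw [(pd_eventuallyEq h none).eq_of_nhds]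
  congr 1
  exact Finset.sum_congr rfl fun j _ => (pd_eventuallyEq (pd_eventuallyEq h j) j).eq_of_nhds

theorem pd_zero (j : Option (Fin n)) : pd j (fun _ : Pt n => (0 : ℝ)) = fun _ => 0 := by
  funext p
  simp [pd]

theorem lap_zero (p : Pt n) : lap b (fun _ : Pt n => (0 : ℝ)) p = 0 := by
  simp [lap, pd_zero]

/-- A cutoff that is one where `Φ` is large and zero where it is small. -/
theorem exists_cutoff {Φ : Pt n → ℝ} (h1 : ContDiff ℝ ∞ Φ) (h2 : HasCompactSupport Φ) {ε : ℝ}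
    (hε : 0 < ε) : ∃ η, NN η ∧ (∀ p, 0 ≤ η p) ∧ (∀ p, η p ≤ 1) ∧
      (∀ p, 0 < p.2 → |Φ p| < ε / 4 → η =ᶠ[𝓝 p] fun _ => 0) ∧
      (∀ p, 0 < p.2 → ε < |Φ p| → η =ᶠ[𝓝 p] fun _ => 1) := by
  obtain ⟨r, hr, h⟩ := exists_flatten_sub_le h1 h2 (ε := ε / 4) (by positivity)
  have hf := nn_flatten h1 h2 hr
  have he : 0 < ε ^ 2 / 4 := by positivity
  refine ⟨fun p => cut (ε ^ 2 / 4) (flatten r Φ p ^ 2),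
    hf.comp (β := fun t => cut (ε ^ 2 / 4) (t ^ 2)) ((contDiff_cut _).comp (contDiff_id.pow 2))
      (cut_eq_zero he (by simpa using he.le)),
    fun p => cut_nonneg _ _, fun p => cut_le_one _ _, fun p hp hΦ => ?_, fun p hp hΦ => ?_⟩
  · have h3 : |flatten r Φ p| < ε / 2 := by
      have := abs_sub_abs_le_abs_sub (flatten r Φ p) (Φ p)
      linarith [h p hp]
    filter_upwards [hf.continuous.abs.continuousAt.eventually_lt_const h3] with q hq
    refine cut_eq_zero he ?_
    rw [← sq_abs (flatten r Φ q)]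
    nlinarith [abs_nonneg (flatten r Φ q)]
  · have h3 : 3 / 4 * ε < |flatten r Φ p| := by
      have := abs_sub_abs_le_abs_sub (Φ p) (flatten r Φ p)
      rw [abs_sub_comm] at this
      linarith [h p hp]
    filter_upwards [hf.continuous.abs.continuousAt.eventually_const_lt h3] with q hq
    refine cut_eq_one he ?_
    rw [← sq_abs (flatten r Φ q)]
    nlinarith [abs_nonneg (flatten r Φ q)]

theorem BC.exists_le_mul {g Φ : Pt n → ℝ} (hg : BC g) {δ : ℝ} (hδ : 0 < δ)
    (h : ∀ p, 0 < p.2 → |Φ p| < δ → g p = 0) :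
    ∃ C, 0 ≤ C ∧ ∀ p, 0 < p.2 → |g p| ≤ C * |Φ p| ∧ |g p| ≤ C * Φ p ^ 2 := by
  obtain ⟨B, hB⟩ := hg.bdd
  have hB0 : 0 ≤ max B 0 := le_max_right _ _
  refine ⟨max B 0 / δ + max B 0 / δ ^ 2, by positivity, fun p hp => ?_⟩
  by_cases hs : |Φ p| < δ
  · rw [h p hp hs, abs_zero]
    constructor <;> positivity
  · push Not at hs
    have h1 : |g p| ≤ max B 0 := (hB p hp).trans (le_max_left _ _)
    have h2 : max B 0 ≤ max B 0 / δ * |Φ p| := by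
      rw [div_mul_eq_mul_div, le_div_iff₀ hδ]
      gcongr
    have h3 : max B 0 ≤ max B 0 / δ ^ 2 * Φ p ^ 2 := by
      rw [div_mul_eq_mul_div, le_div_iff₀ (by positivity), ← sq_abs (Φ p)]
      gcongr
    have h4 : 0 ≤ max B 0 / δ * Φ p ^ 2 := by positivity
    have h5 : 0 ≤ max B 0 / δ ^ 2 * |Φ p| := by positivity
    constructor <;> linarith

/-- A smooth function with finite energies relative to a test function. -/
structure Energy (n : ℕ) (b : ℝ) (V Φ : Pt n → ℝ) : Prop where
  smooth : SmoothUp V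
  test : ContDiff ℝ ∞ Φ
  supp : HasCompactSupport Φ
  flux : ∀ x, Tendsto (fun y => y ^ b * (V (x, y) * pd none V (x, y))) (𝓝[>] 0) (𝓝 0)
  mem : MemLp (fun p => Φ p * V p) 2 (wt n b)
  mem_pd : ∀ j, MemLp (fun p => Φ p * pd j V p) 2 (wt n b)
  mem_lap : MemLp (fun p => Φ p * lap b V p) 2 (wt n b)
  mem_test : ∀ j, MemLp (fun p => V p * pd j Φ p) 2 (wt n b)

variable {V Φ : Pt n → ℝ}

theorem Energy.memLp_mul {w : Pt n → ℝ} (hΦ : ∃ C, 0 ≤ C ∧ ∀ p : Pt n, 0 < p.2 → |w p| ≤ C * |Φ p|)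
    {F : Pt n → ℝ} (hw : ContinuousOn w (upper n)) (hF : ContinuousOn F (upper n))
    (h : MemLp (fun p => Φ p * F p) 2 (wt n b)) : MemLp (fun p => w p * F p) 2 (wt n b) := by
  obtain ⟨C, hC0, hC⟩ := hΦ
  refine MemLp.of_le (hw.mul hF) (h.const_mul C) fun p hp => ?_
  rw [abs_mul, abs_mul, abs_mul, abs_of_nonneg hC0, ← mul_assoc]
  exact mul_le_mul_of_nonneg_right (hC p hp) (abs_nonneg _)

theorem gd_bddSupp {f g : Pt n → ℝ} (hf : BddSupp f) : BddSupp (gd f g) := by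
  choose r hr using fun j => hf.pd j
  refine ⟨∑ j, |r j|, fun x y h => Finset.sum_eq_zero fun j _ => mul_eq_zero_of_left
    (hr j x y ?_) _⟩
  have h1 : r j ≤ ∑ j, |r j| := (le_abs_self _).trans
    (Finset.single_le_sum (f := fun j => |r j|) (fun _ _ => abs_nonneg _) (Finset.mem_univ j))
  exact h.imp h1.trans_lt h1.trans_lt

theorem continuous_rho (N : ℝ) : Continuous (rho N) :=
  Continuous.inv₀ (by fun_prop) fun _ => (Real.sqrt_pos.2 (one_add_sq_pos _)).ne'

theorem smoothUp_gam (hV : SmoothUp V) (N : ℝ) : SmoothUp fun p => gam N (V p) :=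
  (contDiff_gam N).comp_contDiffOn hV

theorem continuousOn_mul_rho {N : ℝ} (hN : 0 < N) (hV : SmoothUp V) :
    ContinuousOn (fun p => V p * rho N (V p)) (upper n) :=
  (show Continuous fun t => t * rho N t from continuous_iff_continuousAt.2 fun t =>
    (hasDerivAt_mul_rho hN t).continuousAt).comp_continuousOn hV.continuousOn

theorem pd_gam {N : ℝ} (hN : 0 < N) (hV : SmoothUp V) {p : Pt n} (hp : 0 < p.2)
    (j : Option (Fin n)) :
    pd j (fun p => gam N (V p)) p = V p * rho N (V p) * pd j V p := by
  rw [pd_comp (hasDerivAt_gam hN _).differentiableAt (hV.differentiableAt hp),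
    (hasDerivAt_gam hN _).deriv]

/-- The truncated and localized function satisfies the hypotheses of the weak Neumann
inequality. -/
theorem Energy.fluxDatum (E : Energy n b V Φ) (hb : -1 < b) {N δ : ℝ} (hN : 0 < N) (hδ : 0 < δ)
    {η : Pt n → ℝ} (hη : NN η) (h0 : ∀ p, 0 ≤ η p) (h1 : ∀ p, η p ≤ 1)
    (hz : ∀ p, 0 < p.2 → |Φ p| < δ → η =ᶠ[𝓝 p] fun _ => 0) :
    (∃ R, FluxDatum n b (fun p => η p * gam N (V p)) R) ∧
      Integrable (lap b fun p => η p * gam N (V p)) (wt n b) := by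
  have hW := smoothUp_gam E.smooth N
  have cη := hη.continuous.continuousOn (s := upper n)
  have cρ := continuousOn_mul_rho hN E.smooth
  have cV := E.smooth.continuousOn
  have bη := hη.bc.exists_le_mul hδ fun p hp h => (hz p hp h).eq_of_nhds
  have bp : ∀ j, ∃ C, 0 ≤ C ∧ ∀ p : Pt n, 0 < p.2 → |pd j η p| ≤ C * |Φ p| := fun j => by
    obtain ⟨C, hC0, hC⟩ := (hη.pd j).bc.exists_le_mul (Φ := Φ) hδ fun p hp h => by
      rw [(pd_eventuallyEq (hz p hp h) j).eq_of_nhds, pd_zero]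
    exact ⟨C, hC0, fun p hp => (hC p hp).1⟩
  have bl : ∃ C, 0 ≤ C ∧ ∀ p : Pt n, 0 < p.2 → |lap b η p| ≤ C * |Φ p| := by
    obtain ⟨C, hC0, hC⟩ := (hη.lap_bc (b := b)).exists_le_mul (Φ := Φ) hδ fun p hp h => by
      rw [lap_congr (hz p hp h), lap_zero]
    exact ⟨C, hC0, fun p hp => (hC p hp).1⟩
  obtain ⟨C, hC0, hC⟩ := bη
  have bη : ∃ C, 0 ≤ C ∧ ∀ p : Pt n, 0 < p.2 → |η p| ≤ C * |Φ p| :=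
    ⟨C, hC0, fun p hp => (hC p hp).1⟩
  have mul_gam : ∀ {g : Pt n → ℝ}, ContinuousOn g (upper n) →
      (∃ C, 0 ≤ C ∧ ∀ p : Pt n, 0 < p.2 → |g p| ≤ C * |Φ p|) →
      MemLp (fun p => g p * gam N (V p)) 2 (wt n b) := fun {g} hg hb' => by
    refine MemLp.of_le (hg.mul hW.continuousOn) ((Energy.memLp_mul hb' hg cV E.mem).const_mul N)
      fun p _ => ?_
    rw [abs_mul, abs_mul, abs_mul, abs_of_pos hN, mul_left_comm]
    exact mul_le_mul_of_nonneg_left (abs_gam_le hN _) (abs_nonneg _)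
  have mul_rho : ∀ {g F : Pt n → ℝ}, ContinuousOn g (upper n) → ContinuousOn F (upper n) →
      (∃ C, 0 ≤ C ∧ ∀ p : Pt n, 0 < p.2 → |g p| ≤ C * |Φ p|) →
      MemLp (fun p => Φ p * F p) 2 (wt n b) →
      MemLp (fun p => g p * (V p * rho N (V p) * F p)) 2 (wt n b) := fun {g F} hg hF hb' hm => by
    refine MemLp.of_le (hg.mul (cρ.mul hF)) ((Energy.memLp_mul hb' hg hF hm).const_mul N)
      fun p _ => ?_
    rw [abs_mul, abs_mul _ (F p), abs_mul N, abs_of_pos hN, mul_left_comm, abs_mul (g p)]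
    exact mul_le_mul_of_nonneg_right (abs_mul_rho_le' hN _)
      (mul_nonneg (abs_nonneg _) (abs_nonneg _))
  have hpw : ∀ j p, 0 < p.2 → pd j (fun p => η p * gam N (V p)) p
      = η p * (V p * rho N (V p) * pd j V p) + pd j η p * gam N (V p) := fun j p hp => by
    rw [pd_mul (hη.differentiableAt p) (hW.differentiableAt hp), pd_gam hN E.smooth hp]
  have hg : MemLp (gd η fun p => gam N (V p)) 2 (wt n b) := by
    have h3 : MemLp (fun p => ∑ j, pd j η p * (V p * rho N (V p) * pd j V p)) 2 (wt n b) :=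
      memLp_finsetSum _ fun j _ => mul_rho (hη.pd j).continuous.continuousOn
        (E.smooth.pd j).continuousOn (bp j) (E.mem_pd j)
    refine h3.congr_norm ?_ ?_
    · exact aesm_of_continuousOn (continuousOn_finsetSum _ fun j _ =>
        (hη.pd j).continuous.continuousOn.mul (hW.pd j).continuousOn)
    · refine ae_wt_of_forall fun p hp => ?_
      simp only [gd, pd_gam hN E.smooth hp]
  have hl : MemLp (fun p => lap b η p * gam N (V p)) 2 (wt n b) := mul_gam hη.lap_bc.cont bl
  have hlap : ∀ p, 0 < p.2 → lap b (fun p => η p * gam N (V p)) p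
      = η p * (V p * rho N (V p) * lap b V p) + η p * (rho N (V p) ^ 3 * gd V V p)
        + 2 * gd η (fun p => gam N (V p)) p + lap b η p * gam N (V p) := fun p hp => by
    rw [lap_mul hη.smoothUp hW hp, lap_comp E.smooth (hasDerivAt_gam hN) (hasDerivAt_mul_rho hN) hp]
    ring
  have sw : SmoothUp fun p => η p * gam N (V p) := hη.smoothUp.mul hW
  have cl := E.smooth.continuousOn_lap (b := b)
  refine ⟨⟨fun p => N * (η p * |lap b V p|) - 2 * gd η (fun p => gam N (V p)) p
      - lap b η p * gam N (V p), ⟨sw, hη.supp.mul_right, mul_gam cη bη, fun j => ?_, ?_⟩,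
      fun x => ?_, fun p hp => ?_⟩, ?_⟩
  · refine ((mul_rho cη (E.smooth.pd j).continuousOn bη (E.mem_pd j)).add
      (mul_gam (hη.pd j).continuous.continuousOn (bp j))).congr_norm
      (aesm_of_continuousOn (sw.pd j).continuousOn) (ae_wt_of_forall fun p hp => ?_)
    rw [hpw j p hp]
    rfl
  · refine (MemLp.sub ?_ (hg.const_mul 2)).sub hl
    refine (MemLp.of_le (cη.mul cl.abs) (Energy.memLp_mul bη cη cl E.mem_lap)
      fun p _ => ?_).const_mul N
    change abs (η p * abs (lap b V p)) ≤ _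
    rw [abs_mul, abs_mul, abs_abs]
  · obtain ⟨r, hr, h3⟩ := hη.pd_none_flat
    refine squeeze_zero_norm' ?_ (tendsto_zero_iff_norm_tendsto_zero.1 (E.flux x))
    filter_upwards [Ioo_mem_nhdsGT hr] with y hy
    rw [hpw none (x, y) hy.1, h3 x y hy.2, zero_mul, add_zero,
      show y ^ b * (η (x, y) * (V (x, y) * rho N (V (x, y)) * pd none V (x, y)))
        = η (x, y) * rho N (V (x, y)) * (y ^ b * (V (x, y) * pd none V (x, y))) by ring, norm_mul,
      Real.norm_of_nonneg (mul_nonneg (h0 _) (rho_pos _ _).le)]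
    exact mul_le_of_le_one_left (norm_nonneg _)
      (mul_le_one₀ (h1 _) (rho_pos _ _).le (rho_le_one _ _))
  · have a1 := abs_mul_rho_le' hN (V p)
    have a2 : -(η p * (V p * rho N (V p) * lap b V p)) ≤ N * (η p * |lap b V p|) := by
      have := neg_abs_le (V p * rho N (V p) * lap b V p)
      rw [abs_mul] at this
      have a3 := mul_le_mul_of_nonneg_right a1 (abs_nonneg (lap b V p))
      have a4 : -(V p * rho N (V p) * lap b V p) ≤ N * |lap b V p| := by linarith
      nlinarith [mul_le_mul_of_nonneg_left a4 (h0 p)]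
    have a5 : 0 ≤ η p * (rho N (V p) ^ 3 * gd V V p) :=
      mul_nonneg (h0 p) (mul_nonneg (pow_nonneg (rho_pos _ _).le _) (gd_self_nonneg _ _))
    rw [hlap p hp]
    linarith
  · have i1 : Integrable (fun p => η p * (V p * rho N (V p) * lap b V p)) (wt n b) :=
      MemLp.integrable_of_bddSupp hb (mul_rho cη cl bη E.mem_lap) hη.supp.mul_right
    have i3 : Integrable (gd η fun p => gam N (V p)) (wt n b) := by
      exact MemLp.integrable_of_bddSupp hb hg (gd_bddSupp hη.supp)
    have i4 : Integrable (fun p => lap b η p * gam N (V p)) (wt n b) :=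
      MemLp.integrable_of_bddSupp hb hl hη.lap_bc.supp.mul_right
    have i2 : Integrable (fun p => η p * (rho N (V p) ^ 3 * gd V V p)) (wt n b) := by
      have i5 : Integrable (fun p => ∑ j, Φ p * pd j V p * (Φ p * pd j V p)) (wt n b) :=
        integrable_finsetSum _ fun j _ => MemLp.mul_int (E.mem_pd j) (E.mem_pd j)
      refine (i5.const_mul C).mono' ?_ (ae_wt_of_forall fun p hp => ?_)
      · exact aesm_of_continuousOn (cη.mul (((continuous_rho N).comp_continuousOn cV).pow 3 |>.mul
          (continuousOn_finsetSum _ fun j _ =>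
            (E.smooth.pd j).continuousOn.mul (E.smooth.pd j).continuousOn)))
      · have h3 := gd_self_nonneg V p
        have h4 : rho N (V p) ^ 3 ≤ 1 := pow_le_one₀ (rho_pos _ _).le (rho_le_one _ _)
        have h5 : ∑ j, Φ p * pd j V p * (Φ p * pd j V p) = Φ p ^ 2 * gd V V p := by
          rw [gd, Finset.mul_sum]
          exact Finset.sum_congr rfl fun j _ => by ring
        have h6 := (hC p hp).2
        rw [abs_of_nonneg (h0 p)] at h6
        have h7 : 0 ≤ rho N (V p) ^ 3 * gd V V p := mul_nonneg (pow_nonneg (rho_pos _ _).le _) h3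
        rw [Real.norm_of_nonneg (mul_nonneg (h0 p) h7), h5, ← mul_assoc C]
        exact mul_le_mul h6 (mul_le_of_le_one_left h3 h4) h7
          (mul_nonneg hC0 (sq_nonneg _))
    refine (((i1.add i2).add (i3.const_mul 2)).add i4).congr
      (ae_wt_of_forall fun p hp => (hlap p hp).symm)

end

section

variable {n : ℕ} {b : ℝ} {V Φ : Pt n → ℝ}

/-- The square `t²`, cut off where `t² ≤ e`. -/
def sqCut (e t : ℝ) : ℝ := lift₀ e (t ^ 2)

/-- The derivative of `sqCut`. -/
def sqCutD (e t : ℝ) : ℝ := (cut e (t ^ 2) + t ^ 2 * cutD e (t ^ 2)) * (2 * t)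

theorem contDiff_sqCut (e : ℝ) : ContDiff ℝ ∞ (sqCut e) :=
  (contDiff_lift₀ e).comp (contDiff_id.pow 2)

theorem hasDerivAt_sqCut (e t : ℝ) : HasDerivAt (sqCut e) (sqCutD e t) t := by
  have h : HasDerivAt (fun t : ℝ => t ^ 2) (2 * t) t := by simpa using hasDerivAt_pow 2 t
  exact (hasDerivAt_lift₀ e (t ^ 2)).comp t h

theorem sqCut_nonneg (e t : ℝ) : 0 ≤ sqCut e t := mul_nonneg (sq_nonneg t) (cut_nonneg _ _)

theorem sqCut_le (e t : ℝ) : sqCut e t ≤ t ^ 2 :=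
  mul_le_of_le_one_right (sq_nonneg t) (cut_le_one _ _)

theorem continuous_sqCutD (e : ℝ) : Continuous (sqCutD e) := by
  have h1 := (contDiff_cut e).continuous
  have h2 := (contDiff_cutD e).continuous
  unfold sqCutD
  fun_prop

theorem abs_sqCutD_le {e : ℝ} (he : 0 < e) (t : ℝ) :
    |sqCutD e t| ≤ (1 + 2 * stepC) * 2 * |t| := by
  rw [sqCutD, abs_mul, abs_mul, abs_two, mul_assoc]
  rcases eq_or_ne t 0 with rfl | h
  · simp
  · exact mul_le_mul_of_nonneg_right (abs_deriv_lift₀_le he (by positivity)) (by positivity)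

theorem eventually_sqCut {e : ℕ → ℝ} (he : ∀ k, 0 < e k) (hl : Tendsto e atTop (𝓝 0)) (t : ℝ) :
    ∀ᶠ k in atTop, sqCut (e k) t = t ^ 2 ∧ sqCutD (e k) t = 2 * t := by
  rcases eq_or_ne t 0 with rfl | h
  · simp [sqCut, sqCutD, lift₀]
  · filter_upwards [hl.eventually_lt_const (show (0 : ℝ) < t ^ 2 / 2 by positivity)] with k hk
    have hk' : 2 * e k ≤ t ^ 2 := by linarith
    rw [sqCut, sqCutD, lift₀_eq_self (he k) hk', cut_eq_one (he k) hk',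
      cutD_eq_zero_right (he k) hk', mul_zero, add_zero, one_mul]
    exact ⟨rfl, rfl⟩

/-- The inequality with truncation and cutoff. -/
theorem Energy.integral_trunc_le (E : Energy n b V Φ) (hb : -1 < b) (hb1 : b < 1) {N e : ℝ}
    (hN : 0 < N) (he : 0 < e) :
    ∫ p, (rho N (V p) * (sqCutD e (Φ p) * (V p * gd V Φ p))
      + rho N (V p) * (sqCut e (Φ p) * (V p * lap b V p))
      + rho N (V p) ^ 3 * (sqCut e (Φ p) * gd V V p)) ∂wt n b ≤ 0 := by
  obtain ⟨η, hη, h0, h1, hz, ho⟩ := exists_cutoff E.test E.supp (Real.sqrt_pos.2 he)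
  obtain ⟨⟨R, D⟩, hi⟩ := E.fluxDatum hb hN (by positivity) hη h0 h1 hz
  have hθ : ContDiff ℝ ∞ fun p => sqCut e (Φ p) := (contDiff_sqCut e).comp E.test
  have hs : HasCompactSupport fun p => sqCut e (Φ p) :=
    E.supp.comp_left (g := sqCut e) (by simp [sqCut, lift₀])
  have hθ0 : ∀ p, 0 ≤ sqCut e (Φ p) := fun p => sqCut_nonneg _ _
  have key := D.integral_gd_le hb hb1 hi hθ hs hθ0
  obtain ⟨B, hB⟩ := hs.exists_bound_of_continuous hθ.continuous
  have i1 : Integrable (gd (fun p => η p * gam N (V p)) fun p => sqCut e (Φ p)) (wt n b) := by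
    obtain ⟨C, hC⟩ := (hs.fderiv (𝕜 := ℝ)).exists_bound_of_continuous
      (hθ.continuous_fderiv (by simp))
    refine integrable_finsetSum _ fun j _ => ?_
    have h3 : Integrable (pd j fun p => η p * gam N (V p)) (wt n b) :=
      MemLp.integrable_of_bddSupp hb (D.mem_pd j) (D.supp.pd j)
    refine h3.mul_bdd (c := C * ‖(dir j : Pt n)‖) ?_ (ae_of_all _ fun p => ?_)
    · exact ((hθ.continuous_fderiv (by simp)).clm_apply continuous_const).aestronglyMeasurable
    · exact (ContinuousLinearMap.le_opNorm (fderiv ℝ _ p) _).trans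
        (mul_le_mul_of_nonneg_right (hC p) (norm_nonneg _))
  have i2 : Integrable (fun p => sqCut e (Φ p) * lap b (fun p => η p * gam N (V p)) p) (wt n b) :=
    hi.bdd_mul hθ.continuous.aestronglyMeasurable (ae_of_all _ hB)
  have h2 := integral_add i1 i2
  have h4 : ∀ p, 0 < p.2 →
      rho N (V p) * (sqCutD e (Φ p) * (V p * gd V Φ p))
      + rho N (V p) * (sqCut e (Φ p) * (V p * lap b V p))
      + rho N (V p) ^ 3 * (sqCut e (Φ p) * gd V V p)
      = gd (fun p => η p * gam N (V p)) (fun p => sqCut e (Φ p)) p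
        + sqCut e (Φ p) * lap b (fun p => η p * gam N (V p)) p := by
    intro p hp
    have hpd : ∀ j, pd j (fun p => sqCut e (Φ p)) p = sqCutD e (Φ p) * pd j Φ p := fun j => by
      rw [pd_comp (hasDerivAt_sqCut _ _).differentiableAt
        (E.test.differentiable (by simp) p), (hasDerivAt_sqCut _ _).deriv]
    by_cases h5 : sqCut e (Φ p) = 0
    · have h6 : ∀ j, pd j (fun p => sqCut e (Φ p)) p = 0 := pd_eq_zero_of_nonneg hθ0 h5
      have h7 : sqCutD e (Φ p) * gd V Φ p = 0 := by
        rw [gd, Finset.mul_sum]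
        refine Finset.sum_eq_zero fun j _ => ?_
        rw [mul_left_comm, ← hpd, h6, mul_zero]
      have h8 : gd (fun p => η p * gam N (V p)) (fun p => sqCut e (Φ p)) p = 0 :=
        Finset.sum_eq_zero fun j _ => by rw [h6, mul_zero]
      rw [h8, h5]
      linear_combination (rho N (V p) * V p) * h7
    · have h6 : √e < |Φ p| := by
        rw [← Real.sqrt_sq_eq_abs]
        refine Real.sqrt_lt_sqrt he.le ?_
        by_contra h
        exact h5 (lift₀_eq_zero he (not_lt.1 h))
      have h7 : (fun p => η p * gam N (V p)) =ᶠ[𝓝 p] fun p => gam N (V p) := by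
        filter_upwards [ho p hp h6] with q hq
        rw [hq, one_mul]
      have h8 : gd (fun p => η p * gam N (V p)) (fun p => sqCut e (Φ p)) p
          = V p * rho N (V p) * (sqCutD e (Φ p) * gd V Φ p) := by
        simp only [gd, Finset.mul_sum]
        refine Finset.sum_congr rfl fun j _ => ?_
        rw [(pd_eventuallyEq h7 j).eq_of_nhds, pd_gam hN E.smooth hp, hpd]
        ring
      rw [h8, lap_congr h7, lap_comp E.smooth (hasDerivAt_gam hN) (hasDerivAt_mul_rho hN) hp]
      ring
  rw [integral_congr_ae (ae_wt_of_forall h4)]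
  linarith

theorem Energy.integrable_gd_test (E : Energy n b V Φ) :
    Integrable (fun p => Φ p * V p * gd V Φ p) (wt n b) := by
  have : Integrable (fun p => ∑ j, Φ p * pd j V p * (V p * pd j Φ p)) (wt n b) :=
    integrable_finsetSum _ fun j _ => MemLp.mul_int (E.mem_pd j) (E.mem_test j)
  refine this.congr (ae_of_all _ fun p => ?_)
  simp only [gd, Finset.mul_sum]
  exact Finset.sum_congr rfl fun j _ => by ring

theorem Energy.integrable_lap (E : Energy n b V Φ) :
    Integrable (fun p => Φ p ^ 2 * (V p * lap b V p)) (wt n b) :=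
  (MemLp.mul_int E.mem E.mem_lap).congr (ae_of_all _ fun p => by ring)

theorem Energy.integrable_gd (E : Energy n b V Φ) :
    Integrable (fun p => Φ p ^ 2 * gd V V p) (wt n b) := by
  have : Integrable (fun p => ∑ j, Φ p * pd j V p * (Φ p * pd j V p)) (wt n b) :=
    integrable_finsetSum _ fun j _ => MemLp.mul_int (E.mem_pd j) (E.mem_pd j)
  refine this.congr (ae_of_all _ fun p => ?_)
  simp only [gd, Finset.mul_sum]
  exact Finset.sum_congr rfl fun j _ => by ring

/-- The integration by parts inequality for `V Φ²`. -/
theorem Energy.integral_le (E : Energy n b V Φ) (hb : -1 < b) (hb1 : b < 1) :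
    ∫ p, (2 * (Φ p * V p * gd V Φ p) + Φ p ^ 2 * (V p * lap b V p) + Φ p ^ 2 * gd V V p) ∂wt n b
      ≤ 0 := by
  have hs : ∀ k : ℕ, 0 < 1 / ((k : ℝ) + 1) := fun k => Nat.one_div_pos_of_nat
  have hl : Tendsto (fun k : ℕ => 1 / ((k : ℝ) + 1)) atTop (𝓝 0) :=
    tendsto_one_div_add_atTop_nhds_zero_nat
  have cV := E.smooth.continuousOn
  have cΦ := E.test.continuous.continuousOn (s := upper n)
  have cg : ContinuousOn (gd V Φ) (upper n) := continuousOn_finsetSum _ fun j _ =>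
    (E.smooth.pd j).continuousOn.mul ((ContDiff.smoothUp E.test).pd j).continuousOn
  have cgV : ContinuousOn (gd V V) (upper n) := continuousOn_finsetSum _ fun j _ =>
    (E.smooth.pd j).continuousOn.mul (E.smooth.pd j).continuousOn
  have cl := E.smooth.continuousOn_lap (b := b)
  refine le_of_tendsto' (tendsto_integral_of_dominated_convergence
    (F := fun (k : ℕ) p => rho ((k : ℝ) + 1) (V p)
        * (sqCutD (1 / ((k : ℝ) + 1)) (Φ p) * (V p * gd V Φ p))
      + rho ((k : ℝ) + 1) (V p) * (sqCut (1 / ((k : ℝ) + 1)) (Φ p) * (V p * lap b V p))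
      + rho ((k : ℝ) + 1) (V p) ^ 3 * (sqCut (1 / ((k : ℝ) + 1)) (Φ p) * gd V V p))
    (fun p => (1 + 2 * stepC) * 2 * |Φ p * V p * gd V Φ p| + |Φ p ^ 2 * (V p * lap b V p)|
      + Φ p ^ 2 * gd V V p)
    (fun k => ?_) (((E.integrable_gd_test.abs.const_mul _).add E.integrable_lap.abs).add
      E.integrable_gd) (fun k => ae_of_all _ fun p => ?_) (ae_of_all _ fun p => ?_))
    fun k => E.integral_trunc_le hb hb1 (by positivity) (hs k)
  · have c1 := (continuous_rho ((k : ℝ) + 1)).comp_continuousOn cV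
    have c2 := (continuous_sqCutD (1 / ((k : ℝ) + 1))).comp_continuousOn cΦ
    have c3 := (contDiff_sqCut (1 / ((k : ℝ) + 1))).continuous.comp_continuousOn cΦ
    exact aesm_of_continuousOn (((c1.mul (c2.mul (cV.mul cg))).add
      (c1.mul (c3.mul (cV.mul cl)))).add ((c1.pow 3).mul (c3.mul cgV)))
  · have r0 := (rho_pos ((k : ℝ) + 1) (V p)).le
    have r1 := rho_le_one ((k : ℝ) + 1) (V p)
    have g0 := gd_self_nonneg V p
    have q0 := sqCut_nonneg (1 / ((k : ℝ) + 1)) (Φ p)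
    have q1 := sqCut_le (1 / ((k : ℝ) + 1)) (Φ p)
    refine (norm_add_le _ _).trans (add_le_add ((norm_add_le _ _).trans (add_le_add ?_ ?_)) ?_)
    · rw [norm_mul, Real.norm_of_nonneg r0, norm_mul, Real.norm_eq_abs, Real.norm_eq_abs,
        mul_assoc (Φ p), abs_mul (Φ p), ← mul_assoc _ |Φ p|]
      refine (mul_le_of_le_one_left (by positivity) r1).trans ?_
      exact mul_le_mul_of_nonneg_right (abs_sqCutD_le (hs k) _) (abs_nonneg _)
    · rw [norm_mul, Real.norm_of_nonneg r0, norm_mul, Real.norm_of_nonneg q0, abs_mul,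
        abs_of_nonneg (sq_nonneg (Φ p)), Real.norm_eq_abs]
      refine (mul_le_of_le_one_left (by positivity) r1).trans ?_
      exact mul_le_mul_of_nonneg_right q1 (abs_nonneg _)
    · rw [Real.norm_of_nonneg (by positivity)]
      refine (mul_le_of_le_one_left (by positivity) (pow_le_one₀ r0 r1)).trans ?_
      exact mul_le_mul_of_nonneg_right q1 g0
  · have hρ := tendsto_rho (V p)
    have ev := eventually_sqCut hs hl (Φ p)
    have t1 : Tendsto (fun k : ℕ => sqCut (1 / ((k : ℝ) + 1)) (Φ p)) atTop (𝓝 (Φ p ^ 2)) :=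
      tendsto_const_nhds.congr' (ev.mono fun k hk => hk.1.symm)
    have t2 : Tendsto (fun k : ℕ => sqCutD (1 / ((k : ℝ) + 1)) (Φ p)) atTop (𝓝 (2 * Φ p)) :=
      tendsto_const_nhds.congr' (ev.mono fun k hk => hk.2.symm)
    have := ((hρ.mul (t2.mul_const (V p * gd V Φ p))).add
      (hρ.mul (t1.mul_const (V p * lap b V p)))).add ((hρ.pow 3).mul (t1.mul_const (gd V V p)))
    convert this using 2
    ring

end

section

variable {n : ℕ} {b : ℝ} {V Φ : Pt n → ℝ}

theorem norm_dir (j : Option (Fin n)) : ‖(dir j : Pt n)‖ = 1 := by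
  cases j <;> simp [dir, Prod.norm_def]

theorem abs_pd_le (f : Pt n → ℝ) (p : Pt n) (j : Option (Fin n)) : |pd j f p| ≤ ‖fderiv ℝ f p‖ := by
  simpa [norm_dir, pd] using (fderiv ℝ f p).le_opNorm (dir j)

theorem apply_eq (L : Pt n →L[ℝ] ℝ) (p : Pt n) :
    L p = ∑ i, p.1 i * L (dir (some i)) + p.2 * L (dir none) := by
  have h1 : p = ∑ i, p.1 i • (dir (some i) : Pt n) + p.2 • dir none := by
    refine Prod.ext ?_ ?_
    · ext i
      simp [dir, Prod.fst_sum, Pi.single_apply]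
    · simp [dir, Prod.snd_sum]
  conv_lhs => rw [h1]
  simp

theorem norm_sq_le_gd (f : Pt n → ℝ) (p : Pt n) : ‖fderiv ℝ f p‖ ^ 2 ≤ 2 * gd f f p := by
  have h0 := gd_self_nonneg f p
  have key : ‖fderiv ℝ f p‖ ≤ √(2 * gd f f p) := by
    refine ContinuousLinearMap.opNorm_le_bound _ (Real.sqrt_nonneg _) fun q => ?_
    have h1 : ‖q.1‖ ≤ ‖q‖ := norm_fst_le q
    have h2 : |q.2| ≤ ‖q‖ := norm_snd_le q
    have h3 : ∑ i, q.1 i ^ 2 = ‖q.1‖ ^ 2 := (EuclideanSpace.real_norm_sq_eq q.1).symm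
    have h4 := Finset.sum_mul_sq_le_sq_mul_sq Finset.univ (fun i => q.1 i)
      fun i => pd (some i) f p
    have h5 : gd f f p = pd none f p ^ 2 + ∑ i, pd (some i) f p ^ 2 := by
      rw [gd, Fintype.sum_option]
      simp only [sq]
    have h6 : 0 ≤ ∑ i, pd (some i) f p ^ 2 := Finset.sum_nonneg fun i _ => sq_nonneg _
    have h7 : ‖q.1‖ ^ 2 ≤ ‖q‖ ^ 2 := by gcongr
    have h8 : q.2 ^ 2 ≤ ‖q‖ ^ 2 := sq_le_sq' (by linarith [abs_le.1 h2]) (abs_le.1 h2).2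
    rw [Real.norm_eq_abs, ← Real.sqrt_sq (norm_nonneg q), ← Real.sqrt_mul (by positivity)]
    refine Real.abs_le_sqrt ?_
    rw [apply_eq]
    change (∑ i, q.1 i * pd (some i) f p + q.2 * pd none f p) ^ 2 ≤ _
    rw [h3] at h4
    have h9 := mul_le_mul_of_nonneg_right h7 h6
    have h10 := mul_le_mul_of_nonneg_right h8 (sq_nonneg (pd none f p))
    rw [h5]
    nlinarith [sq_nonneg (∑ i, q.1 i * pd (some i) f p - q.2 * pd none f p)]
  have := pow_le_pow_left₀ (norm_nonneg _) key 2
  rwa [Real.sq_sqrt (by positivity)] at this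

theorem gd_le_norm_sq (f : Pt n → ℝ) (p : Pt n) : gd f f p ≤ 2 * ‖fderiv ℝ f p‖ ^ 2 := by
  have h1 : gd f f p = pd none f p ^ 2 + ∑ i, pd (some i) f p ^ 2 := by
    rw [gd, Fintype.sum_option]
    simp only [sq]
  have h2 : pd none f p ^ 2 ≤ ‖fderiv ℝ f p‖ ^ 2 := by
    rw [← sq_abs]
    exact pow_le_pow_left₀ (abs_nonneg _) (abs_pd_le f p none) 2
  set S := ∑ i, pd (some i) f p ^ 2
  have hS : 0 ≤ S := Finset.sum_nonneg fun i _ => sq_nonneg _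
  set g : EuclideanSpace ℝ (Fin n) := WithLp.toLp 2 fun i => pd (some i) f p
  have h3 : ‖g‖ ^ 2 = S := EuclideanSpace.real_norm_sq_eq g
  have h4 : fderiv ℝ f p (g, 0) = S := by
    rw [apply_eq]
    simp [g, S, pd, sq]
  have h5 := (fderiv ℝ f p).le_opNorm (g, 0)
  rw [h4, Prod.norm_def, norm_zero, max_eq_left (norm_nonneg g), Real.norm_of_nonneg hS,
    ← h3] at h5
  have h6 : ‖g‖ ≤ ‖fderiv ℝ f p‖ := by
    by_contra h
    push Not at h
    nlinarith [norm_nonneg (fderiv ℝ f p)]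
  have h7 := pow_le_pow_left₀ (norm_nonneg _) h6 2
  rw [h1]
  linarith

theorem Energy.integrable_gd_test_sq (E : Energy n b V Φ) :
    Integrable (fun p => V p ^ 2 * gd Φ Φ p) (wt n b) := by
  have : Integrable (fun p => ∑ j, V p * pd j Φ p * (V p * pd j Φ p)) (wt n b) :=
    integrable_finsetSum _ fun j _ => MemLp.mul_int (E.mem_test j) (E.mem_test j)
  refine this.congr (ae_of_all _ fun p => ?_)
  simp only [gd, Finset.mul_sum]
  exact Finset.sum_congr rfl fun j _ => by ring

theorem Energy.integral_gd_le (E : Energy n b V Φ) (hb : -1 < b) (hb1 : b < 1) {ε : ℝ}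
    (hε : 0 < ε) :
    ∫ p, Φ p ^ 2 * gd V V p ∂wt n b ≤ ε / 2 * ∫ p, (Φ p * lap b V p) ^ 2 ∂wt n b
      + (2 / ε * ∫ p, (Φ p * V p) ^ 2 ∂wt n b + 4 * ∫ p, V p ^ 2 * gd Φ Φ p ∂wt n b) := by
  have i0 := E.integrable_gd
  have i1 : Integrable (fun p => (Φ p * lap b V p) ^ 2) (wt n b) := E.mem_lap.integrable_sq
  have i2 : Integrable (fun p => (Φ p * V p) ^ 2) (wt n b) := E.mem.integrable_sq
  have i3 := E.integrable_gd_test_sq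
  have k1 : Integrable (fun p => 2 / ε * (Φ p * V p) ^ 2 + 4 * (V p ^ 2 * gd Φ Φ p)) (wt n b) :=
    (i2.const_mul _).add (i3.const_mul _)
  have k2 : Integrable (fun p => 2 * (Φ p * V p * gd V Φ p) + Φ p ^ 2 * (V p * lap b V p)
      + Φ p ^ 2 * gd V V p) (wt n b) :=
    ((E.integrable_gd_test.const_mul 2).add E.integrable_lap).add i0
  have k3 : Integrable (fun p => ε / 2 * (Φ p * lap b V p) ^ 2
      + (2 / ε * (Φ p * V p) ^ 2 + 4 * (V p ^ 2 * gd Φ Φ p))) (wt n b) :=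
    (i1.const_mul _).add k1
  have k4 : Integrable (fun p => 2 * (2 * (Φ p * V p * gd V Φ p) + Φ p ^ 2 * (V p * lap b V p)
      + Φ p ^ 2 * gd V V p)) (wt n b) := k2.const_mul 2
  have k5 : Integrable (fun p => ε / 2 * (Φ p * lap b V p) ^ 2) (wt n b) := i1.const_mul _
  have hle : ∫ p, Φ p ^ 2 * gd V V p ∂wt n b ≤ ∫ p, (2 * (2 * (Φ p * V p * gd V Φ p)
      + Φ p ^ 2 * (V p * lap b V p) + Φ p ^ 2 * gd V V p)
      + (ε / 2 * (Φ p * lap b V p) ^ 2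
      + (2 / ε * (Φ p * V p) ^ 2 + 4 * (V p ^ 2 * gd Φ Φ p)))) ∂wt n b := by
    refine integral_mono i0 (k4.add k3) fun p => ?_
    have h1 : -(4 * (Φ p * V p * gd V Φ p)) ≤ Φ p ^ 2 * gd V V p + 4 * (V p ^ 2 * gd Φ Φ p) := by
      have : 0 ≤ ∑ j, (Φ p * pd j V p + 2 * (V p * pd j Φ p)) ^ 2 :=
        Finset.sum_nonneg fun j _ => sq_nonneg _
      have e : ∑ j, (Φ p * pd j V p + 2 * (V p * pd j Φ p)) ^ 2
          = Φ p ^ 2 * gd V V p + 4 * (Φ p * V p * gd V Φ p) + 4 * (V p ^ 2 * gd Φ Φ p) := by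
        simp only [gd, Finset.mul_sum, ← Finset.sum_add_distrib]
        exact Finset.sum_congr rfl fun j _ => by ring
      linarith
    have h2 : -(2 * (Φ p ^ 2 * (V p * lap b V p)))
        ≤ ε / 2 * (Φ p * lap b V p) ^ 2 + 2 / ε * (Φ p * V p) ^ 2 := by
      have h3 : 0 ≤ (ε * (Φ p * lap b V p) + 2 * (Φ p * V p)) ^ 2 / (2 * ε) := by positivity
      have e : (ε * (Φ p * lap b V p) + 2 * (Φ p * V p)) ^ 2 / (2 * ε)
          = ε / 2 * (Φ p * lap b V p) ^ 2 + 2 * (Φ p ^ 2 * (V p * lap b V p))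
            + 2 / ε * (Φ p * V p) ^ 2 := by
        field_simp
        ring
      linarith
    simp only []
    linarith
  rw [integral_add k4 k3, integral_const_mul, integral_add k5 k1, integral_add
    (i2.const_mul _) (i3.const_mul _), integral_const_mul, integral_const_mul,
    integral_const_mul] at hle
  linarith [E.integral_le hb hb1]

theorem lapb_eq_lap (s : ℝ) (V : Pt n → ℝ) : lapb n s V = lap (3 - 2 * s) V := by
  funext p
  rw [lap, Fintype.sum_option, add_comm (pd none (pd none V) p)]
  rfl

end

end WeightedHalfSpace

open WeightedHalfSpace

/-- interpolation inequality, Lemma 3.3 of Colombo–De Lellis–Massaccesi.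
Let `s ∈ (1,2)`, `b = 3-2s`.  There is `C = C(n,s) > 0` such that for every function `V` on the
upper half space which is smooth there, satisfies the boundary vanishing of the extension
(`y^b V ∂_y V → 0` as `y → 0⁺`), and has the three weighted energies finite, every
`Φ ∈ C_c^∞(ℝ^{n+1})` and every `ε ∈ (0,1)`:
`∫ y^b |∇̄V|² Φ² ≤ ε ∫ y^b |Δ̄_b V|² Φ² + (C/ε) ∫ y^b |V|² (Φ² + |∇̄Φ|²)`. -/
theorem stmt_17 (n : ℕ) (hn : 1 ≤ n) (s : ℝ) (hs1 : 1 < s) (hs2 : s < 2) :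
    ∃ C : ℝ, 0 < C ∧
      ∀ (V Φ : EuclideanSpace ℝ (Fin n) × ℝ → ℝ) (ε : ℝ), 0 < ε → ε < 1 →
        ContDiffOn ℝ (⊤ : ℕ∞) V {p : EuclideanSpace ℝ (Fin n) × ℝ | 0 < p.2} →
        ContDiff ℝ (⊤ : ℕ∞) Φ → HasCompactSupport Φ →
        (∀ x : EuclideanSpace ℝ (Fin n),
          Tendsto (fun y : ℝ => y ^ (3 - 2 * s) * V (x, y) * fderiv ℝ V (x, y) (0, 1))
            (𝓝[>] (0 : ℝ)) (𝓝 0)) →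
        IntegrableOn (fun p => p.2 ^ (3 - 2 * s) * ‖fderiv ℝ V p‖ ^ 2 * (Φ p) ^ 2)
          {p : EuclideanSpace ℝ (Fin n) × ℝ | 0 < p.2} →
        IntegrableOn (fun p => p.2 ^ (3 - 2 * s) * (lapb n s V p) ^ 2 * (Φ p) ^ 2)
          {p : EuclideanSpace ℝ (Fin n) × ℝ | 0 < p.2} →
        IntegrableOn
          (fun p => p.2 ^ (3 - 2 * s) * (V p) ^ 2 * ((Φ p) ^ 2 + ‖fderiv ℝ Φ p‖ ^ 2))
          {p : EuclideanSpace ℝ (Fin n) × ℝ | 0 < p.2} →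
        (∫ p in {p : EuclideanSpace ℝ (Fin n) × ℝ | 0 < p.2},
            p.2 ^ (3 - 2 * s) * ‖fderiv ℝ V p‖ ^ 2 * (Φ p) ^ 2)
          ≤ ε * (∫ p in {p : EuclideanSpace ℝ (Fin n) × ℝ | 0 < p.2},
                p.2 ^ (3 - 2 * s) * (lapb n s V p) ^ 2 * (Φ p) ^ 2)
            + (C / ε) * ∫ p in {p : EuclideanSpace ℝ (Fin n) × ℝ | 0 < p.2},
                p.2 ^ (3 - 2 * s) * (V p) ^ 2 * ((Φ p) ^ 2 + ‖fderiv ℝ Φ p‖ ^ 2) := by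
  refine ⟨16, by norm_num, fun V Φ ε hε hε1 hV hΦ hc hf i1 i2 i3 => ?_⟩
  simp only [lapb_eq_lap, mul_assoc (_ ^ (3 - 2 * s))] at hf i1 i2 i3 ⊢
  set b := 3 - 2 * s with hb
  change IntegrableOn _ (upper n) at i1 i2 i3
  change ∫ p in upper n, _ ≤ ε * (∫ p in upper n, _) + 16 / ε * ∫ p in upper n, _
  rw [← integral_wt fun p => ‖fderiv ℝ V p‖ ^ 2 * Φ p ^ 2,
    ← integral_wt fun p => lap b V p ^ 2 * Φ p ^ 2,
    ← integral_wt fun p => V p ^ 2 * (Φ p ^ 2 + ‖fderiv ℝ Φ p‖ ^ 2)]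
  have j1 := (integrable_wt_iff (F := fun p => ‖fderiv ℝ V p‖ ^ 2 * Φ p ^ 2)).2 i1
  have j2 := (integrable_wt_iff (F := fun p => lap b V p ^ 2 * Φ p ^ 2)).2 i2
  have j3 := (integrable_wt_iff
    (F := fun p => V p ^ 2 * (Φ p ^ 2 + ‖fderiv ℝ Φ p‖ ^ 2))).2 i3
  have hV' : SmoothUp V := hV
  have cV := hV'.continuousOn
  have cΦ := hΦ.continuous.continuousOn (s := upper n)
  have mem_of : ∀ {f g : Pt n → ℝ}, ContinuousOn f (upper n) → Integrable g (wt n b) →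
      (∀ p, f p ^ 2 ≤ g p) → MemLp f 2 (wt n b) := fun {f g} hf hg h => by
    rw [memLp_two_iff_integrable_sq (aesm_of_continuousOn hf)]
    refine hg.mono' (aesm_of_continuousOn (hf.pow 2)) (ae_of_all _ fun p => ?_)
    rw [Real.norm_of_nonneg (sq_nonneg _)]
    exact h p
  have pd_sq : ∀ (f : Pt n → ℝ) j p, pd j f p ^ 2 ≤ ‖fderiv ℝ f p‖ ^ 2 := fun f j p => by
    rw [← sq_abs]
    exact pow_le_pow_left₀ (abs_nonneg _) (abs_pd_le f p j) 2
  have E : Energy n b V Φ :=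
    { smooth := hV
      test := hΦ
      supp := hc
      flux := hf
      mem := mem_of (cΦ.mul cV) j3 fun p => by
        nlinarith [mul_nonneg (sq_nonneg (V p)) (sq_nonneg ‖fderiv ℝ Φ p‖)]
      mem_pd := fun j => mem_of (cΦ.mul (hV'.pd j).continuousOn) j1 fun p => by
        nlinarith [mul_le_mul_of_nonneg_right (pd_sq V j p) (sq_nonneg (Φ p))]
      mem_lap := mem_of (cΦ.mul hV'.continuousOn_lap) j2 fun p => by
        rw [mul_pow, mul_comm]
      mem_test := fun j => mem_of (cV.mul ((ContDiff.smoothUp hΦ).pd j).continuousOn) j3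
        fun p => by
          nlinarith [mul_le_mul_of_nonneg_left (pd_sq Φ j p) (sq_nonneg (V p)),
            mul_nonneg (sq_nonneg (V p)) (sq_nonneg (Φ p))] }
  have key := E.integral_gd_le (by linarith) (by linarith) hε
  have l1 : ∫ p, ‖fderiv ℝ V p‖ ^ 2 * Φ p ^ 2 ∂wt n b
      ≤ 2 * ∫ p, Φ p ^ 2 * gd V V p ∂wt n b := by
    rw [← integral_const_mul]
    refine integral_mono j1 (E.integrable_gd.const_mul 2) fun p => ?_
    simp only []
    nlinarith [mul_le_mul_of_nonneg_right (norm_sq_le_gd V p) (sq_nonneg (Φ p))]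
  have l2 : ∫ p, (Φ p * lap b V p) ^ 2 ∂wt n b = ∫ p, lap b V p ^ 2 * Φ p ^ 2 ∂wt n b := by
    simp only [mul_pow, mul_comm]
  have k2 := E.mem.integrable_sq
  have l3 : 4 / ε * ∫ p, (Φ p * V p) ^ 2 ∂wt n b + 8 * ∫ p, V p ^ 2 * gd Φ Φ p ∂wt n b
      ≤ 16 / ε * ∫ p, V p ^ 2 * (Φ p ^ 2 + ‖fderiv ℝ Φ p‖ ^ 2) ∂wt n b := by
    have k3 : Integrable (fun p => V p ^ 2 * gd Φ Φ p) (wt n b) := E.integrable_gd_test_sq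
    rw [← integral_const_mul, ← integral_const_mul, ← integral_const_mul,
      ← integral_add (k2.const_mul _) (k3.const_mul _)]
    refine integral_mono ((k2.const_mul _).add (k3.const_mul _)) (j3.const_mul _) fun p => ?_
    have h1 := mul_le_mul_of_nonneg_left (gd_le_norm_sq Φ p) (sq_nonneg (V p))
    have h2 : 0 ≤ V p ^ 2 * ‖fderiv ℝ Φ p‖ ^ 2 := by positivity
    have h3 : 0 ≤ V p ^ 2 * Φ p ^ 2 := by positivity
    have h4 : 16 ≤ 16 / ε := by rw [le_div_iff₀ hε]; linarith
    have h5 : 4 / ε ≤ 16 / ε := by gcongr; norm_num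
    change 4 / ε * (Φ p * V p) ^ 2 + 8 * (V p ^ 2 * gd Φ Φ p) ≤ 16 / ε * _
    nlinarith [mul_le_mul_of_nonneg_right h4 h2, mul_le_mul_of_nonneg_right h5 h3]
  rw [l2] at key
  have e : 4 / ε = 2 * (2 / ε) := by ring
  rw [e] at l3
  linarith
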